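/- Let Ω be a bounded open connected subset of ℝ², let f ∈ BV_loc(Ω) ∩ C⁰(Ω) satisfy |f(x)| > 0 for every x ∈ Ω, and let u ∈ C⁰(Ω) be a viscosity solution of -Δ_∞ u = f in Ω. Then for every α > 3/2 the function |Du|^α belongs to W^{1,2}_loc(Ω), and there is a constant C(α) depending only on α such that for every ball B = B(x,R) with B(x,2R) ⋐ Ω one has ∫_B |D|Du|^α|² dx ≤ C(α) R^{-2} ∫_{B(x,2R)} |Du|^{2α} dx + C(α) ‖f‖_{BV(B(x,2R))} [ R^{-1} sup_{closure of B(x,2R)} |u| + ( R · sup_{closure of B(x,2R)} |f| )^{1/3} ]^{2α-3}. -/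

import Mathlib

open MeasureTheory Metric
open scoped ENNReal RealInnerProductSpace BigOperators

noncomputable section

abbrev E2 : Type := EuclideanSpace ℝ (Fin 2)

/-- Partial derivative in the `i`-th coordinate direction. -/
def pd (i : Fin 2) (φ : E2 → ℝ) (x : E2) : ℝ :=
  fderiv ℝ φ x (EuclideanSpace.single i 1)

/-- Second partial derivative. -/
def pd2 (i j : Fin 2) (φ : E2 → ℝ) (x : E2) : ℝ :=
  pd i (pd j φ) x

/-- The ∞-Laplacian `Δ_∞ φ = Σ_{i,j} φ_i φ_j φ_{ij}`. -/
def infLap (φ : E2 → ℝ) (x : E2) : ℝ :=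
  ∑ i : Fin 2, ∑ j : Fin 2, pd i φ x * pd j φ x * pd2 i j φ x

/-- The ordinary Laplacian. -/
def lap (φ : E2 → ℝ) (x : E2) : ℝ := pd2 0 0 φ x + pd2 1 1 φ x

/-- `|Dφ|²`. -/
def gradSq (φ : E2 → ℝ) (x : E2) : ℝ := ∑ i : Fin 2, (pd i φ x) ^ 2

/-- `|D²φ Dφ|²`. -/
def hessGradSq (φ : E2 → ℝ) (x : E2) : ℝ :=
  ∑ i : Fin 2, (∑ j : Fin 2, pd2 i j φ x * pd j φ x) ^ 2

/-- Viscosity solution of `-Δ_∞ u = f` on `Ω`. -/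
def IsViscositySol (Ω : Set E2) (f u : E2 → ℝ) : Prop :=
  ∀ φ : E2 → ℝ, ContDiff ℝ 2 φ →
    (∀ x₀ ∈ Ω, IsLocalMaxOn (fun y => u y - φ y) Ω x₀ → -infLap φ x₀ ≤ f x₀) ∧
    (∀ x₀ ∈ Ω, IsLocalMinOn (fun y => u y - φ y) Ω x₀ → f x₀ ≤ -infLap φ x₀)

/-- `G` is a weak gradient of `v` on `Ω`. -/
def HasWeakGradOn (v : E2 → ℝ) (G : E2 → E2) (Ω : Set E2) : Prop :=
  LocallyIntegrableOn v Ω volume ∧ LocallyIntegrableOn (fun x => ‖G x‖) Ω volume ∧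
    ∀ φ : E2 → ℝ, ContDiff ℝ (⊤ : ℕ∞) φ → HasCompactSupport φ → tsupport φ ⊆ Ω →
      ∀ i : Fin 2, ∫ x in Ω, v x * pd i φ x = - ∫ x in Ω, G x i * φ x

/-- `G ∈ L^p_loc(Ω; ℝ²)`. -/
def MemLpLocOn (G : E2 → E2) (p : ℝ) (Ω : Set E2) : Prop :=
  ∀ K : Set E2, K ⊆ Ω → IsCompact K → IntegrableOn (fun x => ‖G x‖ ^ p) K volume

/-- `v ∈ W^{1,p}_loc(Ω)`: there is a weak gradient of `v` lying in `L^p_loc(Ω;ℝ²)`. -/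
def MemW1pLoc (v : E2 → ℝ) (p : ℝ) (Ω : Set E2) : Prop :=
  ∃ G : E2 → E2, HasWeakGradOn v G Ω ∧ MemLpLocOn G p Ω

/-- Divergence of a vector field. -/
def divg (Φ : E2 → E2) (x : E2) : ℝ := ∑ i : Fin 2, pd i (fun y => Φ y i) x

/-- The admissible pairings defining the BV norm of `f` on `U`. -/
def bvPairings (f : E2 → ℝ) (U : Set E2) : Set ℝ :=
  { r | ∃ Φ : E2 → E2, ContDiff ℝ 1 Φ ∧ HasCompactSupport Φ ∧ tsupport Φ ⊆ U ∧
      (∀ x, ‖Φ x‖ ≤ 1) ∧ r = ∫ x in U, f x * divg Φ x }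

/-- `‖f‖_{BV(U)}`. -/
def bvNorm (f : E2 → ℝ) (U : Set E2) : ℝ := sSup (bvPairings f U)

/-- `f ∈ BV_loc(Ω)`. -/
def BVloc (f : E2 → ℝ) (Ω : Set E2) : Prop :=
  ∀ U : Set E2, IsOpen U → IsCompact (closure U) → closure U ⊆ Ω →
    BddAbove (bvPairings f U)

/-- `sup_s |h|`. -/
def supAbsOn (h : E2 → ℝ) (s : Set E2) : ℝ := sSup ((fun y => |h y|) '' s)

section

open Set Filter Topology
open scoped Gradient NNReal

/-- Viscosity subsolution of `-Δ_∞ u ≤ g` on `U`. -/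
def ViscSub (U : Set E2) (g u : E2 → ℝ) : Prop :=
  ∀ x ∈ U, ∀ φ : E2 → ℝ, ContDiff ℝ 2 φ → IsLocalMax (fun y => u y - φ y) x →
    -infLap φ x ≤ g x

/-- Viscosity supersolution of `-Δ_∞ u ≥ g` on `U`. -/
def ViscSup (U : Set E2) (g u : E2 → ℝ) : Prop :=
  ∀ x ∈ U, ∀ φ : E2 → ℝ, ContDiff ℝ 2 φ → IsLocalMin (fun y => u y - φ y) x →
    g x ≤ -infLap φ x

lemma pd_congr {φ ψ : E2 → ℝ} {x : E2} (h : φ =ᶠ[𝓝 x] ψ) (i : Fin 2) : pd i φ x = pd i ψ x := by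
  unfold pd; rw [h.fderiv_eq]

lemma pd_congr_ev {φ ψ : E2 → ℝ} {x : E2} (h : φ =ᶠ[𝓝 x] ψ) (i : Fin 2) :
    pd i φ =ᶠ[𝓝 x] pd i ψ := by
  filter_upwards [h.eventuallyEq_nhds] with y hy using pd_congr hy i

lemma infLap_congr {φ ψ : E2 → ℝ} {x : E2} (h : φ =ᶠ[𝓝 x] ψ) : infLap φ x = infLap ψ x := by
  unfold infLap pd2
  simp only [pd_congr h, pd_congr (pd_congr_ev h _)]

lemma pd_neg (φ : E2 → ℝ) (x : E2) (i : Fin 2) : pd i (fun y => -φ y) x = -pd i φ x := by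
  unfold pd
  have : (fun y => -φ y) = -φ := rfl
  rw [this, fderiv_neg]; rfl

lemma infLap_neg (φ : E2 → ℝ) (x : E2) : infLap (fun y => -φ y) x = -infLap φ x := by
  unfold infLap pd2
  simp only [fun j => funext fun y => pd_neg φ y j, pd_neg, Fin.sum_univ_two]
  ring

lemma ViscSup.neg {U : Set E2} {g u : E2 → ℝ} (h : ViscSup U g u) :
    ViscSub U (fun x => -g x) (fun x => -u x) := by
  intro x hx φ hφ hm
  have := h x hx (fun y => -φ y) hφ.neg ?_
  · rw [infLap_neg] at this; linarith
  · refine hm.neg.congr (Eventually.of_forall fun y => ?_) 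
    simp; ring

lemma ViscSub.neg {U : Set E2} {g u : E2 → ℝ} (h : ViscSub U g u) :
    ViscSup U (fun x => -g x) (fun x => -u x) := by
  intro x hx φ hφ hm
  have := h x hx (fun y => -φ y) hφ.neg ?_
  · rw [infLap_neg] at this; linarith
  · refine hm.neg.congr (Eventually.of_forall fun y => ?_) 
    simp; ring

lemma ViscSub.mono {U U' : Set E2} {g g' u : E2 → ℝ} (h : ViscSub U g u) (hU : U' ⊆ U)
    (hg : ∀ x ∈ U', g x ≤ g' x) : ViscSub U' g' u :=
  fun x hx φ hφ hm => (h x (hU hx) φ hφ hm).trans (hg x hx)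

lemma ViscSup.mono {U U' : Set E2} {g g' u : E2 → ℝ} (h : ViscSup U g u) (hU : U' ⊆ U)
    (hg : ∀ x ∈ U', g' x ≤ g x) : ViscSup U' g' u :=
  fun x hx φ hφ hm => (hg x hx).trans (h x (hU hx) φ hφ hm)

lemma ViscSub.congr {U : Set E2} {g u u' : E2 → ℝ} (h : ViscSub U g u) (hU : IsOpen U)
    (hu : ∀ x ∈ U, u x = u' x) : ViscSub U g u' := by
  intro x hx φ hφ hm
  refine h x hx φ hφ (hm.congr ?_)
  filter_upwards [hU.mem_nhds hx] with y hy
  simp [hu y hy]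

lemma ViscSup.congr {U : Set E2} {g u u' : E2 → ℝ} (h : ViscSup U g u) (hU : IsOpen U)
    (hu : ∀ x ∈ U, u x = u' x) : ViscSup U g u' := by
  intro x hx φ hφ hm
  refine h x hx φ hφ (hm.congr ?_)
  filter_upwards [hU.mem_nhds hx] with y hy
  simp [hu y hy]

lemma IsViscositySol.vsub {Ω : Set E2} {f u : E2 → ℝ} (h : IsViscositySol Ω f u) : ViscSub Ω f u :=
  fun x hx φ hφ hm => (h φ hφ).1 x hx (hm.filter_mono nhdsWithin_le_nhds)

lemma IsViscositySol.vsup {Ω : Set E2} {f u : E2 → ℝ} (h : IsViscositySol Ω f u) : ViscSup Ω f u :=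
  fun x hx φ hφ hm => (h φ hφ).2 x hx (hm.filter_mono nhdsWithin_le_nhds)

/-- A function that is `C^n` near `x` agrees near `x` with a global compactly supported one. -/
lemma exists_contDiff_cutoff {φ : E2 → ℝ} {x : E2} (hφ : ContDiffAt ℝ 2 φ x) :
    ∃ ψ : E2 → ℝ, ContDiff ℝ 2 ψ ∧ HasCompactSupport ψ ∧ ψ =ᶠ[𝓝 x] φ := by
  obtain ⟨δ, hδ, hb⟩ := Metric.eventually_nhds_iff_ball.1 (hφ.eventually (by simp))
  let χ : ContDiffBump x := ⟨δ / 4, δ / 2, by linarith, by linarith⟩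
  refine ⟨fun y => χ y * φ y, ?_, ?_, ?_⟩
  · rw [contDiff_iff_contDiffAt]
    intro y
    by_cases hy : y ∈ ball x δ
    · exact χ.contDiff.contDiffAt.mul (hb y hy)
    · have : y ∉ tsupport χ := by
        rw [χ.tsupport_eq]
        intro h
        apply hy
        have h2 : dist y x ≤ δ / 2 := h
        exact mem_ball.2 (by linarith)
      have h0 : (fun y => χ y * φ y) =ᶠ[𝓝 y] fun _ => 0 := by
        filter_upwards [notMem_tsupport_iff_eventuallyEq.1 this] with z hz
        simp [hz]
      exact contDiffAt_const.congr_of_eventuallyEq h0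
  · exact χ.hasCompactSupport.mul_right
  · filter_upwards [χ.eventuallyEq_one] with y hy
    simp [hy]

lemma ViscSub.local {U : Set E2} {g u : E2 → ℝ} (h : ViscSub U g u) {x : E2}
    (hx : x ∈ U) {φ : E2 → ℝ}
    (hφ : ContDiffAt ℝ 2 φ x) (hm : IsLocalMax (fun y => u y - φ y) x) : -infLap φ x ≤ g x := by
  obtain ⟨ψ, hψ, -, he⟩ := exists_contDiff_cutoff hφ
  rw [← infLap_congr he]
  refine h x hx ψ hψ (hm.congr ?_)
  filter_upwards [he] with y hy
  rw [hy]

lemma pd_contDiffAt {φ : E2 → ℝ} {x : E2} (hφ : ContDiffAt ℝ 2 φ x) (i : Fin 2) :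
    ContDiffAt ℝ 1 (pd i φ) x := by
  unfold pd
  exact (hφ.fderiv_right (by norm_num)).clm_apply contDiffAt_const

lemma infLap_eq_grad {φ : E2 → ℝ} {x : E2} (hφ : ContDiffAt ℝ 2 φ x) :
    infLap φ x = ∑ i : Fin 2, pd i φ x * pd i (fun y => gradSq φ y / 2) x := by
  have hd := fun j =>
    (pd_contDiffAt hφ j).differentiableAt (by norm_num)
  have : ∀ i, pd i (fun y => gradSq φ y / 2) x = ∑ j : Fin 2, pd j φ x * pd2 i j φ x := by
    intro i
    unfold gradSq pd2
    simp only [Fin.sum_univ_two]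
    have h1 : HasFDerivAt (fun y => (pd 0 φ y ^ 2 + pd 1 φ y ^ 2) / 2)
        ((pd 0 φ x) • fderiv ℝ (pd 0 φ) x + (pd 1 φ x) • fderiv ℝ (pd 1 φ) x) x := by
      have := (((hd 0).hasFDerivAt.pow 2).add ((hd 1).hasFDerivAt.pow 2)).mul_const (1/2 : ℝ)
      refine (this.congr_fderiv ?_).congr_of_eventuallyEq ?_
      · ext v; simp; ring
      · exact Eventually.of_forall fun y => by simp; ring
    change fderiv ℝ (fun y => (pd 0 φ y ^ 2 + pd 1 φ y ^ 2) / 2) x (EuclideanSpace.single i 1) = _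
    rw [h1.fderiv]
    simp [pd]
  simp only [this]
  unfold infLap
  refine Finset.sum_congr rfl fun i _ => ?_
  rw [Finset.mul_sum]
  exact Finset.sum_congr rfl fun j _ => by ring

lemma hasFDerivAt_radial {G : ℝ → ℝ} {x0 y : E2} (hy : y ≠ x0) {G' : ℝ}
    (hG : HasDerivAt G G' ‖y - x0‖) :
    HasFDerivAt (fun z => G ‖z - x0‖) ((G' / ‖y - x0‖) • innerSL ℝ (y - x0)) y := by
  have hn := sub_ne_zero.2 hy
  have h2 : HasFDerivAt (fun z => ‖z - x0‖ ^ 2) (2 • innerSL ℝ (y - x0)) y := by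
    have := ((hasFDerivAt_id (𝕜 := ℝ) y).sub_const x0).norm_sq
    simpa using this
  have h3 : HasFDerivAt (fun z => ‖z - x0‖) ((1 / ‖y - x0‖) • innerSL ℝ (y - x0)) y := by
    have := h2.sqrt (by positivity)
    simp only [Real.sqrt_sq (norm_nonneg _)] at this
    refine this.congr_fderiv ?_
    ext v
    simp
    field_simp
  refine (hG.comp_hasFDerivAt y h3).congr_fderiv ?_
  rw [smul_smul]
  congr 1
  field_simp

lemma pd_radial {G : ℝ → ℝ} {x0 y : E2} (hy : y ≠ x0) {G' : ℝ}
    (hG : HasDerivAt G G' ‖y - x0‖) (i : Fin 2) :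
    pd i (fun z => G ‖z - x0‖) y = G' / ‖y - x0‖ * (y - x0) i := by
  unfold pd
  rw [(hasFDerivAt_radial hy hG).fderiv]
  simp [EuclideanSpace.inner_single_right]

lemma contDiffAt_radial {G : ℝ → ℝ} {x0 y : E2} (hy : y ≠ x0)
    (hG : ContDiffAt ℝ 2 G ‖y - x0‖) : ContDiffAt ℝ 2 (fun z => G ‖z - x0‖) y := by
  exact hG.comp y ((contDiffAt_id.sub contDiffAt_const).norm ℝ (sub_ne_zero.2 hy))

lemma e2_norm_sq (v : E2) : v 0 ^ 2 + v 1 ^ 2 = ‖v‖ ^ 2 := by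
  rw [EuclideanSpace.norm_sq_eq]; simp

lemma infLap_radial {G G1 : ℝ → ℝ} {G2 : ℝ} {x0 x : E2} (hx : x ≠ x0)
    (hG : ContDiffAt ℝ 2 G ‖x - x0‖)
    (h1 : ∀ᶠ ρ in 𝓝 ‖x - x0‖, HasDerivAt G (G1 ρ) ρ) (h2 : HasDerivAt G1 G2 ‖x - x0‖) :
    infLap (fun z => G ‖z - x0‖) x = G1 ‖x - x0‖ ^ 2 * G2 := by
  rw [infLap_eq_grad (contDiffAt_radial hx hG)]
  have hc : Tendsto (fun z => ‖z - x0‖) (𝓝 x) (𝓝 ‖x - x0‖) :=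
    (continuous_id.sub continuous_const).norm.continuousAt
  have hev : (fun y => gradSq (fun z => G ‖z - x0‖) y / 2) =ᶠ[𝓝 x]
      fun y => (fun ρ => G1 ρ ^ 2 / 2) ‖y - x0‖ := by
    filter_upwards [hc.eventually h1, isOpen_ne.mem_nhds hx] with y hy1 hy2
    unfold gradSq
    have hn := norm_ne_zero_iff.2 (sub_ne_zero.2 hy2)
    simp only [pd_radial hy2 hy1, Fin.sum_univ_two]
    have := e2_norm_sq (y - x0)
    field_simp
    rw [← this]
  have h3 : HasDerivAt (fun ρ => G1 ρ ^ 2 / 2) (G1 ‖x - x0‖ * G2) ‖x - x0‖ := by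
    have := (h2.pow 2).div_const 2
    refine this.congr_deriv ?_
    simp; ring
  have hn := norm_ne_zero_iff.2 (sub_ne_zero.2 hx)
  simp only [pd_congr hev, pd_radial hx h3, pd_radial hx h1.self_of_nhds, Fin.sum_univ_two]
  field_simp
  rw [← e2_norm_sq (x - x0)]; ring

/-- Radial test functions. -/
lemma ViscSub.radial {U : Set E2} {g u : E2 → ℝ} (h : ViscSub U g u) {x x0 : E2} (hx : x ∈ U)
    (hne : x ≠ x0) {G G1 : ℝ → ℝ} {G2 : ℝ} (hG : ContDiffAt ℝ 2 G ‖x - x0‖)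
    (h1 : ∀ᶠ ρ in 𝓝 ‖x - x0‖, HasDerivAt G (G1 ρ) ρ) (h2 : HasDerivAt G1 G2 ‖x - x0‖)
    (hm : IsLocalMax (fun y => u y - G ‖y - x0‖) x) : -(G1 ‖x - x0‖ ^ 2 * G2) ≤ g x := by
  rw [← infLap_radial hne hG h1 h2]
  exact h.local hx (contDiffAt_radial hne hG) hm

/-- Comparison of a subsolution with a radial function on a punctured disc. -/
lemma ViscSub.punctured {g u : E2 → ℝ} {x0 : E2} {ρ0 c S : ℝ}
    (hu : ContinuousOn u (closedBall x0 ρ0)) (h : ViscSub (ball x0 ρ0) g u)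
    (hg : ∀ x ∈ ball x0 ρ0, g x < c) {G G1 G2 : ℝ → ℝ} (hGc : ContinuousOn G (Icc 0 ρ0))
    (hG0 : G 0 = 0) (hGs : ∀ ρ ∈ Ioo 0 ρ0, ContDiffAt ℝ 2 G ρ)
    (h1 : ∀ ρ ∈ Ioo 0 ρ0, HasDerivAt G (G1 ρ) ρ) (h2 : ∀ ρ ∈ Ioo 0 ρ0, HasDerivAt G1 (G2 ρ) ρ)
    (hc : ∀ ρ ∈ Ioo 0 ρ0, c ≤ -(G1 ρ ^ 2 * G2 ρ))
    (hS : ∀ y, ‖y - x0‖ = ρ0 → u y - u x0 ≤ S) {x : E2} (hx : x ∈ closedBall x0 ρ0) :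
    u x - u x0 ≤ max 0 (S - G ρ0) + G ‖x - x0‖ := by
  have hcont : ContinuousOn (fun y => u y - G ‖y - x0‖) (closedBall x0 ρ0) := by
    refine hu.sub (hGc.comp (by fun_prop) ?_)
    intro y hy
    exact ⟨norm_nonneg _, by simpa [dist_eq_norm] using hy⟩
  obtain ⟨z, hz, hmax⟩ := (isCompact_closedBall x0 ρ0).exists_isMaxOn ⟨x, hx⟩ hcont
  have hzx : u x - G ‖x - x0‖ ≤ u z - G ‖z - x0‖ := hmax hx
  by_cases hz0 : z = x0
  · subst hz0
    simp only [sub_self, norm_zero, hG0] at hzx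
    linarith [le_max_left 0 (S - G ρ0)]
  have hz' : ‖z - x0‖ ≤ ρ0 := by simpa [dist_eq_norm] using hz
  rcases hz'.lt_or_eq with hlt | heq
  · exfalso
    have hzb : z ∈ ball x0 ρ0 := by simpa [dist_eq_norm] using hlt
    have hI : ‖z - x0‖ ∈ Ioo 0 ρ0 := ⟨norm_pos_iff.2 (sub_ne_zero.2 hz0), hlt⟩
    have := h.radial hzb hz0 (hGs _ hI)
      (by filter_upwards [Ioo_mem_nhds hI.1 hI.2] with ρ hρ using h1 ρ hρ) (h2 _ hI)
        (hmax.isLocalMax (closedBall_mem_nhds_of_mem hzb))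
    have := hg z hzb
    linarith [hc _ hI]
  · have := hS z heq
    rw [heq] at hzx
    linarith [le_max_right 0 (S - G ρ0)]

/-- One-sided interior Lipschitz estimate. -/
lemma ViscSub.sub_le_mul {U : Set E2} {g u : E2 → ℝ} {m F ρ0 : ℝ} (h : ViscSub U g u)
    (hu : ContinuousOn u U) (hF : 0 < F) (hρ0 : 0 < ρ0) (hm : ∀ x ∈ U, |u x| ≤ m)
    (hg : ∀ x ∈ U, g x ≤ F) {x y : E2} (hy : closedBall y ρ0 ⊆ U) (hx : x ∈ U) :
    u x - u y ≤ (4 * m / ρ0 + 2 * (2 * ρ0 * F) ^ ((1 : ℝ) / 3)) * ‖x - y‖ := by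
  set r := (2 * ρ0 * F) ^ ((1 : ℝ) / 3) with hr
  set A := 4 * m / ρ0 + 2 * r
  have hm0 := (abs_nonneg _).trans (hm x hx)
  have hr0 : 0 < r := by positivity
  have hr3 : r ^ 3 = 2 * ρ0 * F := by
    rw [hr, ← Real.rpow_natCast, ← Real.rpow_mul (by positivity)]; norm_num
  have hA0 : 0 < A := by positivity
  have hAr : 2 * r ≤ A := by have : 0 ≤ 4 * m / ρ0 := by positivity
                             linarith
  have hAm : 4 * m ≤ A * ρ0 := by
    have : 4 * m / ρ0 ≤ A := by linarith
    rwa [div_le_iff₀ hρ0] at this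
  have hosc : u x - u y ≤ 2 * m := by
    have h1 := abs_le.1 (hm x hx)
    linarith [abs_le.1 (hm y (hy (mem_closedBall_self hρ0.le)))]
  by_cases hxy : ‖x - y‖ ≤ ρ0
  · have hA3 : 16 * ρ0 * F ≤ A ^ 3 := by
      nlinarith [pow_le_pow_left₀ (by positivity) hAr 3]
    have key := ViscSub.punctured (g := g) (u := u) (x0 := y) (ρ0 := ρ0) (c := 2 * F) (S := 2 * m)
      (G := fun ρ => A * ρ - A / (4 * ρ0) * ρ ^ 2) (G1 := fun ρ => A - A / (2 * ρ0) * ρ)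
      (G2 := fun ρ => - (A / (2 * ρ0))) (hu.mono hy)
      (h.mono (ball_subset_closedBall.trans hy) fun x _ => le_rfl)
      (fun z hz => by have := hg z (hy (ball_subset_closedBall hz)); linarith)
      (by fun_prop) (by simp) (fun ρ _ => by fun_prop) ?_ ?_ ?_ ?_
      (x := x) (by simpa [dist_eq_norm] using hxy)
    · have h0 : max 0 (2 * m - (A * ρ0 - A / (4 * ρ0) * ρ0 ^ 2)) = 0 := by
        apply max_eq_left
        field_simp
        linarith
      rw [h0] at key
      have : 0 ≤ A / (4 * ρ0) * ‖x - y‖ ^ 2 := by positivity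
      linarith
    · intro ρ _
      refine (((hasDerivAt_id ρ).const_mul A).sub
        (((hasDerivAt_id ρ).pow 2).const_mul (A / (4 * ρ0)))).congr_deriv ?_
      simp; field_simp; ring
    · intro ρ _
      refine (((hasDerivAt_id ρ).const_mul (A / (2 * ρ0))).const_sub A).congr_deriv ?_
      simp
    · intro ρ hρ
      have h1 : A / 2 ≤ A - A / (2 * ρ0) * ρ := by
        have : A / (2 * ρ0) * ρ ≤ A / (2 * ρ0) * ρ0 := by
          have := hρ.2.le
          gcongr
        have h3 : A / (2 * ρ0) * ρ0 = A / 2 := by field_simp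
        linarith
      have h2 : (A / 2) ^ 2 ≤ (A - A / (2 * ρ0) * ρ) ^ 2 := by gcongr
      have h3 : (A / 2) ^ 2 * (A / (2 * ρ0)) ≤ (A - A / (2 * ρ0) * ρ) ^ 2 * (A / (2 * ρ0)) := by
        gcongr
      have h4 : (A / 2) ^ 2 * (A / (2 * ρ0)) = A ^ 3 / (8 * ρ0) := by field_simp; norm_num
      have h5 : 2 * F ≤ A ^ 3 / (8 * ρ0) := by
        rw [le_div_iff₀ (by positivity)]; linarith
      simp only [mul_neg, neg_neg]
      linarith
    · intro z hz
      have h1 := abs_le.1 (hm z (hy (by simp [dist_eq_norm, hz])))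
      linarith [abs_le.1 (hm y (hy (mem_closedBall_self hρ0.le)))]
  · push Not at hxy
    have : A * ρ0 ≤ A * ‖x - y‖ := by gcongr
    linarith

lemma hasDerivAt_rpow43 {κ q ρ : ℝ} (h : 0 < q + ρ) :
    HasDerivAt (fun ρ => κ * ((q + ρ) ^ ((4 : ℝ) / 3) - q ^ ((4 : ℝ) / 3)))
      (κ * (4 / 3) * (q + ρ) ^ ((1 : ℝ) / 3)) ρ := by
  refine (((((hasDerivAt_id ρ).const_add q).rpow_const (p := 4 / 3) (Or.inl h.ne')).sub_const
    _).const_mul κ).congr_deriv ?_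
  norm_num
  ring

lemma hasDerivAt_rpow13 {κ q ρ : ℝ} (h : 0 < q + ρ) :
    HasDerivAt (fun ρ => κ * (4 / 3) * (q + ρ) ^ ((1 : ℝ) / 3))
      (κ * (4 / 9) * (q + ρ) ^ (-(2 : ℝ) / 3)) ρ := by
  refine ((((hasDerivAt_id ρ).const_add q).rpow_const (p := 1 / 3) (Or.inl h.ne')).const_mul
    (κ * (4 / 3))).congr_deriv ?_
  norm_num
  ring

lemma rpow43_eq {κ s : ℝ} (h : 0 < s) :
    (κ * (4 / 3) * s ^ ((1 : ℝ) / 3)) ^ 2 * (κ * (4 / 9) * s ^ (-(2 : ℝ) / 3)) =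
      κ ^ 3 * (64 / 81) := by
  have h1 : (s ^ ((1 : ℝ) / 3)) ^ 2 * s ^ (-(2 : ℝ) / 3) = 1 := by
    rw [← Real.rpow_natCast, ← Real.rpow_mul h.le, ← Real.rpow_add h]; norm_num
  calc _ = κ ^ 3 * (64 / 81) * ((s ^ ((1 : ℝ) / 3)) ^ 2 * s ^ (-(2 : ℝ) / 3)) := by ring
    _ = _ := by rw [h1, mul_one]

/-- Comparison of an `∞`-convex function with a convex `4/3`-profile. -/
lemma ViscSub.convex_profile {g w : E2 → ℝ} {x0 : E2} {ρ0 c κ q S : ℝ}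
    (hw : ContinuousOn w (closedBall x0 ρ0)) (h : ViscSub (ball x0 ρ0) g w)
    (hg : ∀ x ∈ ball x0 ρ0, g x < -c) (hκ : κ ^ 3 * (64 / 81) ≤ c) (hq : 0 ≤ q)
    (hS : ∀ y, ‖y - x0‖ = ρ0 → w y - w x0 ≤ S) {x : E2} (hx : x ∈ closedBall x0 ρ0) :
    w x - w x0 ≤ max 0 (S - κ * ((q + ρ0) ^ ((4 : ℝ) / 3) - q ^ ((4 : ℝ) / 3))) +
      κ * ((q + ‖x - x0‖) ^ ((4 : ℝ) / 3) - q ^ ((4 : ℝ) / 3)) := by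
  refine ViscSub.punctured (G := fun ρ => κ * ((q + ρ) ^ ((4 : ℝ) / 3) - q ^ ((4 : ℝ) / 3)))
    hw h hg ?_ (by simp) ?_ (fun ρ hρ => hasDerivAt_rpow43 (by linarith [hρ.1]))
    (fun ρ hρ => hasDerivAt_rpow13 (by linarith [hρ.1])) ?_ hS hx
  · refine (continuousOn_const.mul (ContinuousOn.sub ?_ continuousOn_const))
    exact (continuousOn_const.add continuousOn_id).rpow_const fun _ _ => Or.inr (by norm_num)
  · intro ρ hρ
    have : 0 < q + ρ := by linarith [hρ.1]
    exact contDiffAt_const.mul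
      (((contDiffAt_const.add contDiffAt_id).rpow_const_of_ne this.ne').sub contDiffAt_const)
  · intro ρ hρ
    rw [rpow43_eq (by linarith [hρ.1])]
    linarith

/-- Comparison of an `∞`-almost concave function with a concave `4/3`-profile. -/
lemma ViscSub.concave_profile {g w : E2 → ℝ} {x0 : E2} {ρ0 c κ Q τ S : ℝ}
    (hw : ContinuousOn w (closedBall x0 ρ0)) (h : ViscSub (ball x0 ρ0) g w)
    (hg : ∀ x ∈ ball x0 ρ0, g x < c) (hκ : c ≤ κ ^ 3 * (64 / 81)) (hκ0 : 0 ≤ κ) (hQ : ρ0 ≤ Q)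
    (hτ : 0 ≤ τ) (hS : ∀ y, ‖y - x0‖ = ρ0 → w y - w x0 ≤ S) {x : E2}
    (hx : x ∈ closedBall x0 ρ0) :
    w x - w x0 ≤ max 0 (S - (κ * (Q ^ ((4 : ℝ) / 3) - (Q - ρ0) ^ ((4 : ℝ) / 3)) + τ * ρ0)) +
      (κ * (Q ^ ((4 : ℝ) / 3) - (Q - ‖x - x0‖) ^ ((4 : ℝ) / 3)) + τ * ‖x - x0‖) := by
  refine ViscSub.punctured
    (G := fun ρ => κ * (Q ^ ((4 : ℝ) / 3) - (Q - ρ) ^ ((4 : ℝ) / 3)) + τ * ρ)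
    (G1 := fun ρ => κ * (4 / 3) * (Q - ρ) ^ ((1 : ℝ) / 3) + τ)
    (G2 := fun ρ => -(κ * (4 / 9) * (Q - ρ) ^ (-(2 : ℝ) / 3))) hw h hg ?_
      (by simp) ?_ ?_ ?_ ?_ hS hx
  · refine (continuousOn_const.mul (continuousOn_const.sub ?_)).add (by fun_prop)
    exact (continuousOn_const.sub continuousOn_id).rpow_const fun _ _ => Or.inr (by norm_num)
  · intro ρ hρ
    have : 0 < Q - ρ := by linarith [hρ.2]
    exact (contDiffAt_const.mul (contDiffAt_const.sub
      ((contDiffAt_const.sub contDiffAt_id).rpow_const_of_ne this.ne'))).add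
        (contDiffAt_const.mul contDiffAt_id)
  · intro ρ hρ
    have h0 : 0 < Q - ρ := by linarith [hρ.2]
    have := (((hasDerivAt_id ρ).const_sub Q).rpow_const (p := (4 : ℝ) / 3) (Or.inl h0.ne'))
    refine (((this.const_sub _).const_mul κ).add ((hasDerivAt_id ρ).const_mul τ)).congr_deriv ?_
    norm_num
    ring
  · intro ρ hρ
    have h0 : 0 < Q - ρ := by linarith [hρ.2]
    refine (((((hasDerivAt_id ρ).const_sub Q).rpow_const (p := (1 : ℝ) / 3)
      (Or.inl h0.ne')).const_mul (κ * (4 / 3))).add_const τ).congr_deriv ?_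
    norm_num
    ring
  · intro ρ hρ
    have h0 : 0 < Q - ρ := by linarith [hρ.2]
    have h1 := rpow43_eq (κ := κ) h0
    have h2 : (κ * (4 / 3) * (Q - ρ) ^ ((1 : ℝ) / 3)) ^ 2 ≤
        (κ * (4 / 3) * (Q - ρ) ^ ((1 : ℝ) / 3) + τ) ^ 2 := by
      gcongr; linarith
    have h3 : 0 ≤ κ * (4 / 9) * (Q - ρ) ^ (-(2 : ℝ) / 3) := by positivity
    have h4 := mul_le_mul_of_nonneg_right h2 h3
    rw [mul_neg, neg_neg]
    linarith

lemma eq_of_holder43 {w : E2 → ℝ} {x0 : E2} {η κ : ℝ}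
    (h : ∀ x ∈ ball x0 η, ∀ z ∈ ball x0 η, w x - w z ≤ κ * ‖x - z‖ ^ ((4 : ℝ) / 3)) :
    ∀ x ∈ ball x0 η, w x = w x0 := by
  have hd : ∀ z ∈ ball x0 η, HasFDerivAt w (0 : E2 →L[ℝ] ℝ) z := by
    intro z hz
    rw [hasFDerivAt_iff_isLittleO]
    have hO : (fun x => w x - w z - (0 : E2 →L[ℝ] ℝ) (x - z)) =O[𝓝 z]
        fun x => ‖x - z‖ ^ ((4 : ℝ) / 3) := by
      refine Asymptotics.IsBigO.of_bound κ ?_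
      filter_upwards [isOpen_ball.mem_nhds hz] with x hx
      have h1 := h x hx z hz
      have h2 := h z hz x hx
      rw [norm_sub_rev] at h2
      rw [Real.norm_of_nonneg (by positivity : 0 ≤ ‖x - z‖ ^ ((4 : ℝ) / 3))]
      simp only [zero_apply, sub_zero, Real.norm_eq_abs, abs_le]
      constructor <;> linarith
    refine hO.trans_isLittleO ?_
    have hlim : Tendsto (fun x => ‖x - z‖ ^ ((1 : ℝ) / 3)) (𝓝 z) (𝓝 0) := by
      have : ContinuousAt (fun x => ‖x - z‖ ^ ((1 : ℝ) / 3)) z :=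
        ContinuousAt.rpow_const (by fun_prop) (Or.inr (by norm_num))
      simpa [ContinuousAt] using this
    rw [Asymptotics.isLittleO_iff]
    intro ε hε
    filter_upwards [hlim.eventually (gt_mem_nhds hε)] with x hx
    rw [Real.norm_of_nonneg (by positivity)]
    have : ‖x - z‖ ^ ((4 : ℝ) / 3) = ‖x - z‖ ^ ((1 : ℝ) / 3) * ‖x - z‖ := by
      rcases (norm_nonneg (x - z)).eq_or_lt with h0 | h0
      · rw [← h0]; norm_num
      · conv_rhs => rw [← Real.rpow_one ‖x - z‖, ← Real.rpow_mul h0.le, ← Real.rpow_add h0]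
        norm_num
    rw [this]
    gcongr
  intro x hx
  refine (convex_ball x0 η).is_const_of_fderivWithin_eq_zero (𝕜 := ℝ)
    (fun z hz => (hd z hz).differentiableAt.differentiableWithinAt) (fun z hz => ?_) hx
      (mem_ball_self (dist_nonneg.trans_lt hx))
  rw [fderivWithin_of_isOpen isOpen_ball hz, (hd z hz).fderiv]

/-- `∞`-strictly convex functions grow at least like the `4/3`-power. -/
lemma ViscSub.growth {g w : E2 → ℝ} {x0 : E2} {ρ0 c κ S : ℝ} (hρ0 : 0 < ρ0) (hc : 0 < c)
    (hw : ContinuousOn w (closedBall x0 ρ0)) (h : ViscSub (ball x0 ρ0) g w)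
    (hg : ∀ x ∈ ball x0 ρ0, g x < -c) (hκ : κ ^ 3 * (64 / 81) ≤ c)
    (hS : ∀ y ∈ closedBall x0 ρ0, w y - w x0 ≤ S) : κ * ρ0 ^ ((4 : ℝ) / 3) ≤ S := by
  by_contra! hlt
  have hcont : ContinuousAt
      (fun z => S + w x0 - w z - κ * (ρ0 - ‖z - x0‖) ^ ((4 : ℝ) / 3)) x0 := by
    refine (continuousAt_const.sub (hw.continuousAt (closedBall_mem_nhds x0 hρ0))).sub
      (continuousAt_const.mul ?_)
    exact ContinuousAt.rpow_const (by fun_prop) (Or.inr (by norm_num))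
  have hev : ∀ᶠ z in 𝓝 x0, S + w x0 - w z - κ * (ρ0 - ‖z - x0‖) ^ ((4 : ℝ) / 3) < 0 := by
    refine hcont.eventually_lt continuousAt_const ?_
    simp; linarith
  obtain ⟨η0, hη0, hb⟩ := Metric.eventually_nhds_iff_ball.1 hev
  set η := min η0 (ρ0 / 3)
  have hηpos : 0 < η := by positivity
  have hηρ : η ≤ ρ0 / 3 := min_le_right _ _
  have key : ∀ x ∈ ball x0 η, w x = w x0 := by
    refine eq_of_holder43 (κ := κ) fun x hx z hz => ?_
    have hx' : ‖x - x0‖ < η := by simpa [dist_eq_norm] using hx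
    have hz' : ‖z - x0‖ < η := by simpa [dist_eq_norm] using hz
    have hsub : closedBall z (ρ0 - ‖z - x0‖) ⊆ closedBall x0 ρ0 := by
      apply closedBall_subset_closedBall'; rw [dist_eq_norm]; linarith
    have hsub' : ball z (ρ0 - ‖z - x0‖) ⊆ ball x0 ρ0 := by
      apply ball_subset_ball'; rw [dist_eq_norm]; linarith
    have hxz : ‖x - z‖ ≤ ρ0 - ‖z - x0‖ := by
      have : ‖x - z‖ ≤ ‖x - x0‖ + ‖x0 - z‖ := norm_sub_le_norm_sub_add_norm_sub _ _ _
      rw [norm_sub_rev x0 z] at this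
      linarith
    have := ViscSub.convex_profile (q := 0) (S := S + w x0 - w z) (κ := κ) (hw.mono hsub)
      (h.mono hsub' fun _ _ => le_rfl) (fun y hy => hg y (hsub' hy)) hκ le_rfl
      (fun y hy => by
        have := hS y (hsub (by simp [dist_eq_norm, hy]))
        linarith) (x := x) (by simpa [dist_eq_norm] using hxz)
    have hneg := hb z (ball_subset_ball (min_le_left _ _) hz)
    rw [max_eq_left] at this
    · simpa using this
    · simp only [zero_add, Real.zero_rpow (by norm_num : (4 : ℝ) / 3 ≠ 0), sub_zero]
      linarith
  have := h x0 (mem_ball_self hρ0) (fun _ => 0) contDiff_const ?_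
  · have h2 := hg x0 (mem_ball_self hρ0)
    have h3 : infLap (fun _ : E2 => (0 : ℝ)) x0 = 0 := by
      simp [infLap, pd]
    linarith
  · filter_upwards [ball_mem_nhds x0 hηpos] with y hy
    simp [key y hy]

lemma exists_cube_profile {c : ℝ} (hc : 0 < c) : ∃ κ : ℝ, 0 < κ ∧ κ ^ 3 * (64 / 81) = c := by
  refine ⟨(c * (81 / 64)) ^ ((1 : ℝ) / 3), by positivity, ?_⟩
  rw [← Real.rpow_natCast, ← Real.rpow_mul (by positivity)]
  norm_num
  ring

lemma exists_midpoint_balls {x0 y : E2} {r : ℝ} (h : y ∈ closedBall x0 (2 * r)) :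
    ∃ x ∈ closedBall x0 r, y ∈ closedBall x r ∧ x0 ∈ closedBall x r := by
  refine ⟨midpoint ℝ x0 y, ?_, ?_, ?_⟩
  · rw [mem_closedBall, dist_midpoint_left]
    rw [mem_closedBall, dist_comm] at h
    norm_num; linarith
  · rw [mem_closedBall, dist_comm, dist_midpoint_right]
    rw [mem_closedBall, dist_comm] at h
    norm_num; linarith
  · rw [mem_closedBall, dist_comm, dist_midpoint_left]
    rw [mem_closedBall, dist_comm] at h
    norm_num; linarith

/-- The local step of the comparison principle. -/
lemma comparison_local {t w g1 g2 : E2 → ℝ} {x0 y0 y0' : E2} {r c1 c2 : ℝ} (hr : 0 < r)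
    (ht : ContinuousOn t (closedBall x0 (2 * r))) (hw : ContinuousOn w (closedBall x0 (2 * r)))
    (h1 : ViscSub (ball x0 (2 * r)) g1 t) (h2 : ViscSub (ball x0 (2 * r)) g2 w)
    (hg1 : ∀ x ∈ ball x0 (2 * r), g1 x < c1) (hg2 : ∀ x ∈ ball x0 (2 * r), g2 x < -c2)
    (hc1 : 0 < c1) (hc : c1 < c2) (hy0 : y0 ∈ closedBall x0 r) (hy0' : y0' ∈ closedBall x0 r)
    (hmax : ∀ x ∈ closedBall x0 r, ∀ y ∈ closedBall x r, ∀ y' ∈ closedBall x r,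
      t y + w y' ≤ t y0 + w y0') : False := by
  obtain ⟨κ1, hκ1, hκ1c⟩ := exists_cube_profile hc1
  obtain ⟨κ2, hκ2, hκ2c⟩ := exists_cube_profile (hc1.trans hc)
  have hκ : κ1 < κ2 := by
    refine lt_of_pow_lt_pow_left₀ 3 hκ2.le ?_
    linarith
  have hx02 : x0 ∈ closedBall x0 (2 * r) := mem_closedBall_self (by linarith)
  have hsub : closedBall x0 r ⊆ closedBall x0 (2 * r) := closedBall_subset_closedBall (by linarith)
  have hsub' : ball x0 r ⊆ ball x0 (2 * r) := ball_subset_ball (by linarith)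
  obtain ⟨y2, hy2, hy2m⟩ := (isCompact_closedBall x0 (2 * r)).exists_isMaxOn ⟨x0, hx02⟩ ht
  obtain ⟨y2', hy2', hy2m'⟩ := (isCompact_closedBall x0 (2 * r)).exists_isMaxOn ⟨x0, hx02⟩ hw
  have ht2 : ∀ y ∈ closedBall x0 (2 * r), t y ≤ t y2 := fun y hy => hy2m hy
  have hw2 : ∀ y ∈ closedBall x0 (2 * r), w y ≤ w y2' := fun y hy => hy2m' hy
  have hw1 : ∀ y ∈ closedBall x0 r, w y ≤ w y0' := fun y hy => by
    have := hmax x0 (mem_closedBall_self hr.le) y0 hy0 y hy; linarith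
  -- the two exchange inequalities
  have hb : t y2 - t y0 ≤ w y0' - w x0 := by
    obtain ⟨x, hx, hxy, hxx⟩ := exists_midpoint_balls hy2
    have := hmax x hx y2 hxy x0 hxx; linarith
  have hb' : w y2' - w y0' ≤ t y0 - t x0 := by
    obtain ⟨x, hx, hxy, hxx⟩ := exists_midpoint_balls hy2'
    have := hmax x hx x0 hxx y2' hxy; linarith
  have hp0 : (0 : ℝ) ≤ 4 / 3 := by norm_num
  -- choose the parameter of the profile
  have hgr : κ2 * r ^ ((4 : ℝ) / 3) ≤ w y0' - w x0 :=
    ViscSub.growth hr (hc1.trans hc) (hw.mono hsub) (h2.mono hsub' fun _ _ => le_rfl)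
      (fun x hx => hg2 x (hsub' hx)) hκ2c.le (fun y hy => by have := hw1 y hy; linarith)
  set a' := w y0' - w x0
  have ha'0 := le_trans (by positivity) hgr
  obtain ⟨q, hq, hqe⟩ : ∃ q : ℝ, 0 ≤ q ∧
      κ2 * ((q + r) ^ ((4 : ℝ) / 3) - q ^ ((4 : ℝ) / 3)) = a' := by
    have hcont : Continuous fun q : ℝ => κ2 * ((q + r) ^ ((4 : ℝ) / 3) - q ^ ((4 : ℝ) / 3)) :=
      continuous_const.mul (((continuous_id.add continuous_const).rpow_const
        fun _ => Or.inr hp0).sub (continuous_id.rpow_const fun _ => Or.inr hp0))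
    set Q := (a' / (κ2 * r)) ^ 3 with hQ
    have hQ0 : 0 ≤ Q := by positivity
    have hQ3 : Q ^ ((1 : ℝ) / 3) = a' / (κ2 * r) := by
      rw [hQ, ← Real.rpow_natCast, ← Real.rpow_mul (by positivity)]; norm_num
    have hsplit : ∀ s : ℝ, 0 ≤ s → s ^ ((4 : ℝ) / 3) = s * s ^ ((1 : ℝ) / 3) := by
      intro s hs
      have : (4 : ℝ) / 3 = 1 + 1 / 3 := by norm_num
      rw [this, Real.rpow_add' hs (by norm_num), Real.rpow_one]
    have hbig : a' ≤ κ2 * ((Q + r) ^ ((4 : ℝ) / 3) - Q ^ ((4 : ℝ) / 3)) := by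
      rw [hsplit _ (by positivity), hsplit _ hQ0]
      have : Q ^ ((1 : ℝ) / 3) ≤ (Q + r) ^ ((1 : ℝ) / 3) := by gcongr; linarith
      have h3 : a' = κ2 * ((Q + r) * Q ^ ((1 : ℝ) / 3) - Q * Q ^ ((1 : ℝ) / 3)) := by
        rw [hQ3]; field_simp; ring
      rw [h3]
      gcongr
    have := intermediate_value_Icc hQ0 hcont.continuousOn
    obtain ⟨q, hq, he⟩ := this (show a' ∈ Icc _ _ from ⟨by
      simpa [Real.zero_rpow (by norm_num : (4 : ℝ) / 3 ≠ 0)] using hgr, hbig⟩)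
    exact ⟨q, hq.1, he⟩
  set A0 := q ^ ((4 : ℝ) / 3)
  set A1 := (q + r) ^ ((4 : ℝ) / 3) with hA1
  set A2 := (q + 2 * r) ^ ((4 : ℝ) / 3)
  have hA01 : A0 < A1 := Real.rpow_lt_rpow hq (by linarith) (by norm_num)
  have hA12 : A1 < A2 := Real.rpow_lt_rpow (by linarith) (by linarith) (by norm_num)
  have hconv : 2 * A1 < A0 + A2 := by
    have := (strictConvexOn_rpow (p := (4 : ℝ) / 3) (by norm_num)).2 (Set.mem_Ici.2 hq)
      (Set.mem_Ici.2 (show (0 : ℝ) ≤ q + 2 * r by linarith)) (by linarith : q < q + 2 * r).ne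
      (by norm_num : (0 : ℝ) < 1 / 2) (by norm_num : (0 : ℝ) < 1 / 2) (by norm_num)
    have h3 : (1 / 2 : ℝ) • q + (1 / 2 : ℝ) • (q + 2 * r) = q + r := by simp; ring
    rw [h3] at this
    simp only [smul_eq_mul] at this
    linarith
  -- convexity of `w`
  have hwconv : κ2 * (A2 - A1) ≤ w y2' - w y0' := by
    by_contra! hlt
    have hA21 : 0 < A2 - A1 := by linarith
    set κ := max (κ2 / 2) (((w y2' - w y0') / (A2 - A1) + κ2) / 2)
    have hk1 : κ < κ2 := by
      apply max_lt (by linarith)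
      have : (w y2' - w y0') / (A2 - A1) < κ2 := by rwa [div_lt_iff₀ hA21]
      linarith
    have hk0 : 0 < κ := lt_of_lt_of_le (by linarith) (le_max_left _ _)
    have hk2 : w y2' - w y0' < κ * (A2 - A1) := by
      rw [← div_lt_iff₀ hA21]
      have : (w y2' - w y0') / (A2 - A1) < κ2 := by rwa [div_lt_iff₀ hA21]
      exact lt_of_lt_of_le (by linarith) (le_max_right _ _)
    have := ViscSub.convex_profile (q := q) (κ := κ) (S := w y2' - w x0) hw h2 hg2
      (by rw [← hκ2c]; gcongr) hq
      (fun y hy => by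
        have := hw2 y (by simp [dist_eq_norm, hy])
        linarith) (hsub hy0')
    have hmon : (q + ‖y0' - x0‖) ^ ((4 : ℝ) / 3) ≤ A1 := by
      have : ‖y0' - x0‖ ≤ r := by simpa [dist_eq_norm] using hy0'
      rw [hA1]; gcongr
    have h3 : κ * ((q + ‖y0' - x0‖) ^ ((4 : ℝ) / 3) - A0) ≤ κ * (A1 - A0) := by gcongr
    have h4 : κ * (A1 - A0) < κ2 * (A1 - A0) := by
      apply mul_lt_mul_of_pos_right hk1; linarith
    rcases le_total (w y2' - w x0 - κ * (A2 - A0)) 0 with h5 | h5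
    · rw [max_eq_left h5] at this
      linarith
    · rw [max_eq_right h5] at this
      linarith
  -- concavity of `t`
  have hb0 : t y2 - t y0 ≤ κ2 * (A1 - A0) := by linarith
  have ha0 : κ2 * (A2 - A1) ≤ t y0 - t x0 := by linarith
  set s := t y2 - t x0 - κ1 * (A2 - A0)
  set τ := max 0 (s / (2 * r)) with hτ
  have key := ViscSub.concave_profile (κ := κ1) (Q := q + 2 * r) (τ := τ)
      (S := t y2 - t x0) ht h1 hg1
    hκ1c.ge hκ1.le (by linarith) (le_max_left _ _)
    (fun y hy => by
      have := ht2 y (by simp [dist_eq_norm, hy])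
      linarith) (hsub hy0)
  have hy0r : ‖y0 - x0‖ ≤ r := by simpa [dist_eq_norm] using hy0
  have hmon : A1 ≤ (q + 2 * r - ‖y0 - x0‖) ^ ((4 : ℝ) / 3) := by
    rw [hA1]; gcongr; linarith
  have e1 : q + 2 * r - 2 * r = q := by ring
  have hτ0 : 0 ≤ τ := le_max_left _ _
  rw [e1] at key
  have hm1 : κ1 * (A2 - (q + 2 * r - ‖y0 - x0‖) ^ ((4 : ℝ) / 3)) ≤ κ1 * (A2 - A1) := by gcongr
  have hm2 : τ * ‖y0 - x0‖ ≤ τ * r := by gcongr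
  have hk21 : κ1 * (A2 - A1) < κ2 * (A2 - A1) := by
    apply mul_lt_mul_of_pos_right hκ; linarith
  have hk3 : κ1 * (A2 - 2 * A1 + A0) < κ2 * (A2 - 2 * A1 + A0) := by
    apply mul_lt_mul_of_pos_right hκ; linarith
  rcases le_total s 0 with h0 | h0
  · have hτe : τ = 0 := max_eq_left (div_nonpos_of_nonpos_of_nonneg h0 (by linarith))
    rw [hτe] at key hm2
    rw [max_eq_left (by simp; linarith)] at key
    linarith
  · have hτe : τ * (2 * r) = s := by
      rw [hτ, max_eq_right (by positivity)]; field_simp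
    rw [max_eq_left (by linarith)] at key
    linarith

/-- Comparison principle on a disc, stated for a pair `t`, `w = -V`. -/
theorem comparison_ball {t w : E2 → ℝ} {c : E2} {R m0 : ℝ}
    (ht : ContinuousOn t (closedBall c R)) (hw : ContinuousOn w (closedBall c R))
    (hbd : ∀ x, ‖x - c‖ = R → t x + w x ≤ m0)
    (hloc : ∀ x ∈ ball c R, m0 < t x + w x → ∃ δ > 0, ∃ c1 c2 : ℝ, 0 < c1 ∧ c1 < c2 ∧
      ball x δ ⊆ ball c R ∧ ∃ g1 g2 : E2 → ℝ, ViscSub (ball x δ) g1 t ∧ ViscSub (ball x δ) g2 w ∧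
        (∀ y ∈ ball x δ, g1 y < c1) ∧ ∀ y ∈ ball x δ, g2 y < -c2) :
    ∀ x ∈ closedBall c R, t x + w x ≤ m0 := by
  intro z0 hz0
  by_contra! hlt
  set B := closedBall c R with hB
  let r : ℕ → ℝ := fun n => 1 / ((n : ℝ) + 1)
  have hr n : 0 < r n := by positivity
  have hBc := isCompact_closedBall c R
  have hex : ∀ n, ∃ p : E2 × E2 × E2, (p.1 ∈ B ∧ p.2.1 ∈ B ∧ p.2.2 ∈ B ∧ dist p.2.1 p.1 ≤ r n ∧
      dist p.2.2 p.1 ≤ r n) ∧ ∀ x ∈ B, ∀ y ∈ B, ∀ y' ∈ B, dist y x ≤ r n → dist y' x ≤ r n →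
        t y + w y' ≤ t p.2.1 + w p.2.2 := by
    intro n
    let K : Set (E2 × E2 × E2) := (B ×ˢ B ×ˢ B) ∩
      ({p | dist p.2.1 p.1 ≤ r n} ∩ {p | dist p.2.2 p.1 ≤ r n})
    have hK : IsCompact K := (hBc.prod (hBc.prod hBc)).inter_right
      ((isClosed_le (by fun_prop) (by fun_prop)).inter (isClosed_le (by fun_prop) (by fun_prop)))
    obtain ⟨p, hp, hpm⟩ := hK.exists_isMaxOn (f := fun p => t p.2.1 + w p.2.2)
      ⟨(z0, z0, z0), ⟨⟨hz0, hz0, hz0⟩, by simp [(hr n).le], by simp [(hr n).le]⟩⟩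
      ((ht.comp (by fun_prop) fun p hp => hp.1.2.1).add
        (hw.comp (by fun_prop) fun p hp => hp.1.2.2))
    refine ⟨p, ⟨hp.1.1, hp.1.2.1, hp.1.2.2, hp.2.1, hp.2.2⟩, ?_⟩
    intro x hx y hy y' hy' h1 h2
    exact hpm (show (x, y, y') ∈ K from ⟨⟨hx, hy, hy'⟩, h1, h2⟩)
  choose p hp hpm using hex
  obtain ⟨xs, hxs, φ, hφ, hlim⟩ := hBc.tendsto_subseq fun n => (hp n).1
  have hrφ : Tendsto (fun n => r (φ n)) atTop (𝓝 0) :=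
      tendsto_one_div_add_atTop_nhds_zero_nat.comp hφ.tendsto_atTop
  have hl1 : Tendsto (fun n => (p (φ n)).2.1) atTop (𝓝 xs) := by
    refine tendsto_iff_dist_tendsto_zero.2 (squeeze_zero (fun _ => dist_nonneg) (fun n =>
      (dist_triangle _ (p (φ n)).1 _).trans (add_le_add_left (hp (φ n)).2.2.2.1 _)) ?_)
    simpa using hrφ.add (tendsto_iff_dist_tendsto_zero.1 hlim)
  have hl2 : Tendsto (fun n => (p (φ n)).2.2) atTop (𝓝 xs) := by
    refine tendsto_iff_dist_tendsto_zero.2 (squeeze_zero (fun _ => dist_nonneg) (fun n =>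
      (dist_triangle _ (p (φ n)).1 _).trans (add_le_add_left (hp (φ n)).2.2.2.2 _)) ?_)
    simpa using hrφ.add (tendsto_iff_dist_tendsto_zero.1 hlim)
  have hl1' :=
    (ht xs hxs).tendsto.comp (tendsto_nhdsWithin_iff.2 ⟨hl1, Eventually.of_forall fun n =>
      (hp (φ n)).2.1⟩)
  have hl2' :=
    (hw xs hxs).tendsto.comp (tendsto_nhdsWithin_iff.2 ⟨hl2, Eventually.of_forall fun n =>
      (hp (φ n)).2.2.1⟩)
  have hge :=
    ge_of_tendsto (hl1'.add hl2') (Eventually.of_forall fun n =>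
      hpm (φ n) z0 hz0 z0 hz0 z0 hz0 (by simp [(hr _).le]) (by simp [(hr _).le]))
  have hxsb : xs ∈ ball c R := by
    have h1 : ‖xs - c‖ ≤ R := by simpa [hB, dist_eq_norm] using hxs
    rcases h1.lt_or_eq with h | h
    · simpa [dist_eq_norm] using h
    · have := hbd xs h; linarith
  obtain ⟨δ, hδ, c1, c2, hc1, hc, hsub, g1, g2, hg1, hg2, hb1, hb2⟩ := hloc xs hxsb (by linarith)
  have ev1 : ∀ᶠ n in atTop, dist (p (φ n)).1 xs < δ / 2 :=
    (tendsto_iff_dist_tendsto_zero.1 hlim).eventually (gt_mem_nhds (by positivity))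
  have ev2 : ∀ᶠ n in atTop, r (φ n) < δ / 8 := hrφ.eventually (gt_mem_nhds (by positivity))
  obtain ⟨n, hn1, hn2⟩ := (ev1.and ev2).exists
  set x0 := (p (φ n)).1
  have hS : closedBall x0 (2 * r (φ n)) ⊆ ball xs δ :=
    (closedBall_subset_ball' (by linarith))
  have hS' := ball_subset_closedBall.trans hS
  have hSB := (hS.trans hsub).trans ball_subset_closedBall
  refine comparison_local (hr (φ n)) (ht.mono hSB) (hw.mono hSB)
    (hg1.mono hS' fun _ _ => le_rfl) (hg2.mono hS' fun _ _ => le_rfl)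
    (fun y hy => hb1 y (hS' hy)) (fun y hy => hb2 y (hS' hy)) hc1 hc
    (hp (φ n)).2.2.2.1 (hp (φ n)).2.2.2.2 ?_
  intro x hx y hy y' hy'
  have hxr := mem_closedBall.1 hx
  refine hpm (φ n) x (hSB ?_) y (hSB ?_) y' (hSB ?_) hy hy'
  · exact mem_closedBall.2 (by linarith [hr (φ n)])
  · have := dist_triangle y x x0
    exact mem_closedBall.2 (by linarith [mem_closedBall.1 hy])
  · have := dist_triangle y' x x0
    exact mem_closedBall.2 (by linarith [mem_closedBall.1 hy'])

def IsLip (v : E2 → ℝ) : Prop := ∃ C : ℝ≥0, LipschitzWith C v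

theorem gradient_apply (v : E2 → ℝ) (x : E2) (i : Fin 2) : (∇ v x) i = pd i v x := by
  rw [pd, ← inner_gradient_left (𝕜 := ℝ) (f := v) (x := x) (y := EuclideanSpace.single i 1),
    EuclideanSpace.inner_single_right]
  simp

theorem measurable_gradient (v : E2 → ℝ) : Measurable (∇ v) :=
  (InnerProductSpace.toDual ℝ E2).symm.continuous.measurable.comp (measurable_fderiv ℝ v)

theorem norm_gradient_eq (v : E2 → ℝ) (x : E2) : ‖∇ v x‖ = ‖fderiv ℝ v x‖ := by
  rw [gradient, LinearIsometryEquiv.norm_map]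

theorem LipschitzWith.norm_gradient_le {v : E2 → ℝ} {C : ℝ≥0} (h : LipschitzWith C v) (x : E2) :
    ‖∇ v x‖ ≤ C := by
  rw [norm_gradient_eq]; exact norm_fderiv_le_of_lipschitz ℝ h

theorem IsLip.exists_bound {v : E2 → ℝ} (h : IsLip v) : ∃ M : ℝ, 0 ≤ M ∧ ∀ x, ‖∇ v x‖ ≤ M := by
  obtain ⟨C, hC⟩ := h
  exact ⟨C, C.2, hC.norm_gradient_le⟩

theorem IsLip.ae_hasGradientAt {v : E2 → ℝ} (h : IsLip v) : ∀ᵐ x, HasGradientAt v (∇ v x) x := by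
  obtain ⟨C, hC⟩ := h
  filter_upwards [hC.ae_differentiableAt] with x hx using hx.hasGradientAt

theorem IsLip.continuous {v : E2 → ℝ} (h : IsLip v) : Continuous v := h.choose_spec.continuous

theorem IsLip.add {v w : E2 → ℝ} (hv : IsLip v) (hw : IsLip w) : IsLip (fun x => v x + w x) := by
  obtain ⟨C, hC⟩ := hv
  obtain ⟨D, hD⟩ := hw
  exact ⟨C + D, hC.add hD⟩

theorem IsLip.neg {v : E2 → ℝ} (hv : IsLip v) : IsLip (fun x => -v x) := by
  obtain ⟨C, hC⟩ := hv
  exact ⟨C, hC.neg⟩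

theorem IsLip.sub {v w : E2 → ℝ} (hv : IsLip v) (hw : IsLip w) : IsLip (fun x => v x - w x) := by
  simpa [sub_eq_add_neg] using hv.add hw.neg

theorem isLip_const (c : ℝ) : IsLip (fun _ : E2 => c) := ⟨0, LipschitzWith.const c⟩

theorem IsLip.max {v w : E2 → ℝ} (hv : IsLip v) (hw : IsLip w) :
    IsLip (fun x => max (v x) (w x)) := by
  obtain ⟨C, hC⟩ := hv
  obtain ⟨D, hD⟩ := hw
  exact ⟨Max.max C D, hC.max hD⟩

theorem IsLip.translate {v : E2 → ℝ} (hv : IsLip v) (h : E2) : IsLip (fun x => v (x + h)) := by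
  obtain ⟨C, hC⟩ := hv
  exact ⟨C, LipschitzWith.of_dist_le_mul fun x y => by
    simpa using hC.dist_le_mul (x + h) (y + h)⟩

theorem isLip_iff {v : E2 → ℝ} : IsLip v ↔ ∃ C : ℝ, ∀ x y, |v x - v y| ≤ C * ‖x - y‖ := by
  constructor
  · rintro ⟨C, hC⟩
    exact ⟨C, fun x y => by simpa [Real.dist_eq, dist_eq_norm] using hC.dist_le_mul x y⟩
  · rintro ⟨C, hC⟩
    refine ⟨C.toNNReal, LipschitzWith.of_dist_le_mul fun x y => ?_⟩
    rw [Real.dist_eq, dist_eq_norm]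
    exact (hC x y).trans (mul_le_mul_of_nonneg_right (Real.le_coe_toNNReal C) (norm_nonneg _))

theorem IsLip.const_mul {v : E2 → ℝ} (hv : IsLip v) (c : ℝ) : IsLip (fun x => c * v x) := by
  obtain ⟨C, hC⟩ := isLip_iff.1 hv
  refine isLip_iff.2 ⟨|c| * C, fun x y => ?_⟩
  rw [← mul_sub, abs_mul, mul_assoc]
  exact mul_le_mul_of_nonneg_left (hC x y) (abs_nonneg _)

theorem exists_bound_of_hasCompactSupport {w : E2 → ℝ} (hw : Continuous w)
    (hc : HasCompactSupport w) : ∃ b, ∀ x, |w x| ≤ b := by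
  obtain ⟨b, hb⟩ := hc.exists_bound_of_continuous hw
  exact ⟨b, hb⟩

/-- Product of a Lipschitz function with a compactly supported Lipschitz function. -/
theorem IsLip.mul_compact {v w : E2 → ℝ} (hv : IsLip v) (hw : IsLip w)
    (hc : HasCompactSupport w) : IsLip (fun x => v x * w x) := by
  obtain ⟨b, hb⟩ := exists_bound_of_hasCompactSupport hw.continuous hc
  obtain ⟨a, ha⟩ := hc.isCompact.exists_bound_of_continuousOn hv.continuous.continuousOn
  obtain ⟨C, hC⟩ := isLip_iff.1 hv
  obtain ⟨D, hD⟩ := isLip_iff.1 hw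
  have hb0 := (abs_nonneg _).trans (hb 0)
  have key : ∀ x y, y ∈ tsupport w → |v x * w x - v y * w y| ≤ (|C| * b + |a| * |D|) * ‖x - y‖ := by
    intro x y hy
    have e : v x * w x - v y * w y = (v x - v y) * w x + v y * (w x - w y) := by ring
    have hn := norm_nonneg (x - y)
    have h1 : |(v x - v y) * w x| ≤ |C| * ‖x - y‖ * b := by
      rw [abs_mul]
      refine mul_le_mul ((hC x y).trans ?_) (hb x) (abs_nonneg _) (by positivity)
      exact mul_le_mul_of_nonneg_right (le_abs_self C) hn
    have h2 : |v y * (w x - w y)| ≤ |a| * (|D| * ‖x - y‖) := by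
      rw [abs_mul]
      refine mul_le_mul ((ha y hy).trans (le_abs_self a)) ((hD x y).trans ?_)
        (abs_nonneg _) (abs_nonneg _)
      exact mul_le_mul_of_nonneg_right (le_abs_self D) hn
    rw [e]
    refine (abs_add_le _ _).trans ?_
    nlinarith
  refine isLip_iff.2 ⟨|C| * b + |a| * |D|, fun x y => ?_⟩
  by_cases hy : y ∈ tsupport w
  · exact key x y hy
  · by_cases hx : x ∈ tsupport w
    · rw [abs_sub_comm, norm_sub_rev]; exact key y x hx
    · rw [image_eq_zero_of_notMem_tsupport hx, image_eq_zero_of_notMem_tsupport hy]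
      simp
      positivity

theorem _root_.ContDiff.isLip {w : E2 → ℝ} (hw : ContDiff ℝ 1 w) (hc : HasCompactSupport w) :
    IsLip w := by
  obtain ⟨C, hC⟩ := hw.lipschitzWith_of_hasCompactSupport hc (by norm_num)
  exact ⟨C, hC⟩

/-! ### Pointwise gradient calculus -/

theorem HasGradientAt.add' {v w : E2 → ℝ} {a b x : E2} (hv : HasGradientAt v a x)
    (hw : HasGradientAt w b x) : HasGradientAt (fun y => v y + w y) (a + b) x := by
  rw [hasGradientAt_iff_hasFDerivAt] at *
  simpa using! hv.add hw

theorem HasGradientAt.sub' {v w : E2 → ℝ} {a b x : E2} (hv : HasGradientAt v a x)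
    (hw : HasGradientAt w b x) : HasGradientAt (fun y => v y - w y) (a - b) x := by
  rw [hasGradientAt_iff_hasFDerivAt] at *
  simpa using! hv.sub hw

theorem HasGradientAt.neg' {v : E2 → ℝ} {a x : E2} (hv : HasGradientAt v a x) :
    HasGradientAt (fun y => -v y) (-a) x := by
  rw [hasGradientAt_iff_hasFDerivAt] at *
  simpa using! hv.neg

theorem HasGradientAt.mul' {v w : E2 → ℝ} {a b x : E2} (hv : HasGradientAt v a x)
    (hw : HasGradientAt w b x) :
    HasGradientAt (fun y => v y * w y) (v x • b + w x • a) x := by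
  rw [hasGradientAt_iff_hasFDerivAt] at *
  simpa using! hv.mul hw

theorem HasGradientAt.const_mul' {v : E2 → ℝ} {a x : E2} (c : ℝ) (hv : HasGradientAt v a x) :
    HasGradientAt (fun y => c * v y) (c • a) x := by
  rw [hasGradientAt_iff_hasFDerivAt] at *
  simpa using! hv.const_mul c

theorem gradient_translate (v : E2 → ℝ) (h x : E2) : ∇ (fun y => v (y + h)) x = ∇ v (x + h) := by
  rw [gradient, gradient, fderiv_comp_add_right]

theorem gradient_eq_zero_of_min {w : E2 → ℝ} (h0 : ∀ y, 0 ≤ w y) {x : E2} (hx : w x = 0) :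
    ∇ w x = 0 := by
  have : IsLocalMin w x := Eventually.of_forall fun y => by rw [hx]; exact h0 y
  rw [gradient, this.fderiv_eq_zero, map_zero]

theorem gradient_pos_part {g : E2 → ℝ} (hg : Continuous g) (x : E2) :
    ∇ (fun y => max (g y) 0) x = if 0 < g x then ∇ g x else 0 := by
  split_ifs with h
  · refine Filter.EventuallyEq.gradient_eq ?_
    filter_upwards [hg.continuousAt.eventually (lt_mem_nhds h)] with y hy
    exact max_eq_left hy.le
  · exact gradient_eq_zero_of_min (fun y => le_max_right _ _) (max_eq_right (not_lt.1 h))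

/-! ### Integration -/

theorem integrable_of_bdd_compact {f : E2 → ℝ} {K : Set E2} (hf : AEStronglyMeasurable f volume)
    (hK : IsCompact K) (b : ℝ) (hb : ∀ x, |f x| ≤ b) (h0 : ∀ x, x ∉ K → f x = 0) :
    Integrable f := by
  have : IntegrableOn f K := by
    refine Measure.integrableOn_of_bounded (M := b) hK.measure_lt_top.ne hf ?_
    exact Eventually.of_forall hb
  rw [← integrableOn_univ]
  exact this.of_forall_sdiff_eq_zero MeasurableSet.univ fun x hx => h0 x hx.2

theorem IsLip.integral_pd {v φ : E2 → ℝ} (hv : IsLip v) (hφ : IsLip φ)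
    (hc : HasCompactSupport φ) (i : Fin 2) :
    ∫ x, (∇ v x) i * φ x = -∫ x, v x * (∇ φ x) i := by
  obtain ⟨C, hC⟩ := hv
  obtain ⟨D, hD⟩ := hφ
  have e1 : ∫ x, (∇ v x) i * φ x
      = ∫ x, lineDeriv ℝ v x (EuclideanSpace.single i 1) * φ x := by
    refine integral_congr_ae ?_
    filter_upwards [hC.ae_differentiableAt] with x hx
    rw [gradient_apply, pd, hx.lineDeriv_eq_fderiv]
  rw [e1, hC.integral_lineDeriv_mul_eq (μ := volume) hD hc (EuclideanSpace.single i 1),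
    ← integral_neg]
  refine integral_congr_ae ?_
  filter_upwards [hD.ae_differentiableAt] with x hx
  rw [gradient_apply, pd, hx.lineDeriv_eq_fderiv, map_neg]
  ring

/-- Weak convergence of gradients of equi-Lipschitz pointwise convergent sequences. -/
theorem tendsto_integral_gradient_mul {v : ℕ → E2 → ℝ} {V : E2 → ℝ} {M : ℝ≥0}
    (hv : ∀ n, LipschitzWith M (v n)) (hV : LipschitzWith M V)
    (hlim : ∀ x, Tendsto (fun n => v n x) atTop (𝓝 (V x))) {W : E2 → ℝ} (hW : Integrable W)
    (i : Fin 2) :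
    Tendsto (fun n => ∫ x, (∇ (v n) x) i * W x) atTop (𝓝 (∫ x, (∇ V x) i * W x)) := by
  have hcomp : ∀ (a : E2), |a i| ≤ ‖a‖ := fun a => by
    simpa using PiLp.norm_apply_le a i
  have hbd : ∀ {w : E2 → ℝ}, LipschitzWith M w → ∀ x, |(∇ w x) i| ≤ M := fun h x =>
    (hcomp _).trans (h.norm_gradient_le x)
  have hmeas : ∀ w : E2 → ℝ, AEStronglyMeasurable (fun x => (∇ w x) i) volume := fun w =>
    ((EuclideanSpace.proj (𝕜 := ℝ) i).continuous.measurable.comp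
      (measurable_gradient w)).aestronglyMeasurable
  have hitg : ∀ {w : E2 → ℝ}, LipschitzWith M w → ∀ {g : E2 → ℝ}, Integrable g →
      Integrable (fun x => (∇ w x) i * g x) := fun {w} hw {g} hg =>
    hg.bdd_mul (hmeas w) (c := M) (Eventually.of_forall (hbd hw))
  rw [Metric.tendsto_atTop]
  intro ε hε
  obtain ⟨δ, hδ, hδε⟩ : ∃ δ : ℝ, 0 < δ ∧ 2 * (M * δ) < ε / 2 := by
    refine ⟨ε / (8 * (M + 1)), by positivity, ?_⟩
    have : (M : ℝ) * (ε / (8 * (M + 1))) ≤ ε / 8 := by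
      rw [mul_div_assoc', div_le_div_iff₀ (by positivity) (by norm_num)]
      nlinarith [M.2]
    linarith
  obtain ⟨g, hg1, hg2, hg3⟩ := (memLp_one_iff_integrable.2 hW).exist_eLpNorm_sub_le
    ENNReal.one_ne_top le_rfl hδ
  have hgi : Integrable g := hg2.continuous.integrable_of_hasCompactSupport hg1
  have hgW : ∫ x, |W x - g x| ≤ δ := by
    have h1 : ∫⁻ x, ‖(W - g) x‖ₑ ≤ ENNReal.ofReal δ := by
      rwa [eLpNorm_one_eq_lintegral_enorm] at hg3
    have h2 := integral_norm_eq_lintegral_enorm (hW.sub hgi).aestronglyMeasurable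
    simp only [Pi.sub_apply, Real.norm_eq_abs] at h2 h1
    rw [h2]
    exact ENNReal.toReal_le_of_le_ofReal hδ.le h1
  have hgl := (hg2.of_le (by exact_mod_cast le_top)).isLip hg1
  have hdist : ∀ {w : E2 → ℝ}, LipschitzWith M w →
      |(∫ x, (∇ w x) i * W x) - ∫ x, (∇ w x) i * g x| ≤ M * δ := by
    intro w hw
    rw [← integral_sub (hitg hw hW) (hitg hw hgi)]
    refine (abs_integral_le_integral_abs).trans ?_
    calc ∫ x, |(∇ w x) i * W x - (∇ w x) i * g x|
        ≤ ∫ x, M * |W x - g x| := by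
          refine integral_mono ((hitg hw hW).sub (hitg hw hgi)).abs
            ((hW.sub hgi).abs.const_mul _) fun x => ?_
          simp only
          rw [← mul_sub, abs_mul]
          exact mul_le_mul_of_nonneg_right (hbd hw x) (abs_nonneg _)
      _ = M * ∫ x, |W x - g x| := integral_const_mul _ _
      _ ≤ M * δ := mul_le_mul_of_nonneg_left hgW M.2
  have hsm : Tendsto (fun n => ∫ x, (∇ (v n) x) i * g x) atTop (𝓝 (∫ x, (∇ V x) i * g x)) := by
    have e : ∀ {w : E2 → ℝ}, LipschitzWith M w →
        ∫ x, (∇ w x) i * g x = -∫ x, w x * (∇ g x) i := fun hw =>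
      IsLip.integral_pd ⟨M, hw⟩ hgl hg1 i
    simp only [e (hv _), e hV]
    refine Tendsto.neg ?_
    obtain ⟨Cg, hCg⟩ := hgl
    have hsupp : ∀ x, x ∉ tsupport g → (∇ g x) i = 0 := by
      intro x hx
      have := notMem_tsupport_iff_eventuallyEq.1 hx
      rw [this.gradient_eq]
      simp [gradient]
    obtain ⟨B, hB⟩ : ∃ B : ℝ, ∀ x ∈ tsupport g, ∀ n, |v n x| ≤ B := by
      obtain ⟨r, hr⟩ := hg1.isBounded.exists_norm_le
      obtain ⟨b, hb⟩ := (hlim 0).abs.bddAbove_range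
      refine ⟨b + M * r, fun x hx n => ?_⟩
      have h1 := (hv n).dist_le_mul x 0
      rw [Real.dist_eq, dist_zero_right] at h1
      have h2 := hb ⟨n, rfl⟩
      have h3 := hr x hx
      have h4 : |v n x| ≤ |v n 0| + |v n x - v n 0| := by
        simpa using abs_add_le (v n 0) (v n x - v n 0)
      have h5 := mul_le_mul_of_nonneg_left h3 M.2
      simp only [NNReal.val_eq_coe] at h5
      linarith
    refine tendsto_integral_of_dominated_convergence
      (fun x => (tsupport g).indicator (fun _ => |B| * Cg) x) ?_ ?_ ?_ ?_
    · intro n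
      exact (hv n).continuous.aestronglyMeasurable.mul (hmeas g)
    · rw [integrable_indicator_iff hg1.measurableSet]
      exact integrableOn_const hg1.measure_lt_top.ne
    · intro n
      refine Eventually.of_forall fun x => ?_
      by_cases hx : x ∈ tsupport g
      · rw [Set.indicator_of_mem hx, Real.norm_eq_abs, abs_mul]
        exact mul_le_mul ((hB x hx n).trans (le_abs_self B))
          ((hcomp _).trans (hCg.norm_gradient_le x)) (abs_nonneg _) (abs_nonneg _)
      · rw [Set.indicator_of_notMem hx, hsupp x hx]; simp
    · exact Eventually.of_forall fun x => (hlim x).mul_const _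
  obtain ⟨N, hN⟩ := Metric.tendsto_atTop.1 hsm (ε / 2) (by positivity)
  refine ⟨N, fun n hn => ?_⟩
  have h1 := hdist (hv n)
  have h2 := hdist hV
  have h3 := hN n hn
  rw [Real.dist_eq] at h3 ⊢
  rw [abs_lt] at *
  rw [abs_le] at *
  constructor <;> linarith [h1.1, h1.2, h2.1, h2.2, h3.1, h3.2]

/-- Existence for strongly monotone Lipschitz variational inequalities over a complete convex
set, parametrised by `j`. -/
theorem exists_variational_inequality {ι H : Type*} [Nonempty ι] [NormedAddCommGroup H]
    [InnerProductSpace ℝ H] (j N : ι → H) {Λ c : ℝ} (hc : 0 < c)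
    (hΛ : ∀ a b, ‖N a - N b‖ ≤ Λ * ‖j a - j b‖)
    (hmono : ∀ a b, c * ‖j a - j b‖ ^ 2 ≤ ⟪N a - N b, j a - j b⟫)
    (hcomp : IsComplete (range j)) (hconv : Convex ℝ (range j)) :
    ∃ a, ∀ b, 0 ≤ ⟪N a, j b - j a⟫ := by
  set L : ℝ := max Λ (c + 1)
  have hLc : c + 1 ≤ L := le_max_right _ _
  have hL0 : 0 < L := by linarith
  have hΛ' : ∀ a b, ‖N a - N b‖ ≤ L * ‖j a - j b‖ := fun a b =>
    (hΛ a b).trans (mul_le_mul_of_nonneg_right (le_max_left _ _) (norm_nonneg _))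
  set ρ : ℝ := c / L ^ 2 with hρ
  have hρ0 : 0 < ρ := by positivity
  have hproj : ∀ u : H, ∃ b : ι, ∀ d : ι, ⟪u - j b, j d - j b⟫ ≤ 0 := by
    intro u
    obtain ⟨v, ⟨b, rfl⟩, hv⟩ :=
      exists_norm_eq_iInf_of_complete_convex (range_nonempty j) hcomp hconv u
    exact ⟨b, fun d => (norm_eq_iInf_iff_real_inner_le_zero hconv ⟨b, rfl⟩).1 hv _ ⟨d, rfl⟩⟩
  choose P hP using hproj
  let T : ι → ι := fun a => P (j a - ρ • N a)
  set q : ℝ := 1 - c ^ 2 / L ^ 2 with hq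
  have hq1 : q < 1 := by
    have : 0 < c ^ 2 / L ^ 2 := by positivity
    linarith
  have hq0 : 0 ≤ q := by
    have : c ^ 2 / L ^ 2 ≤ 1 := by
      rw [div_le_one (by positivity)]
      exact pow_le_pow_left₀ hc.le (by linarith) 2
    linarith
  have hT a b : ‖j (T a) - j (T b)‖ ≤ √q * ‖j a - j b‖ := by
    have h1 := hP (j a - ρ • N a) (T b)
    have h2 := hP (j b - ρ • N b) (T a)
    set ya := j a - ρ • N a
    set yb := j b - ρ • N b
    change ⟪ya - j (T a), j (T b) - j (T a)⟫ ≤ 0 at h1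
    change ⟪yb - j (T b), j (T a) - j (T b)⟫ ≤ 0 at h2
    have h3 : ‖j (T a) - j (T b)‖ ^ 2 ≤ ⟪ya - yb, j (T a) - j (T b)⟫ := by
      rw [← real_inner_self_eq_norm_sq]
      have : ⟪j (T a) - j (T b), j (T a) - j (T b)⟫
          = ⟪ya - yb, j (T a) - j (T b)⟫ + (⟪ya - j (T a), j (T b) - j (T a)⟫
            + ⟪yb - j (T b), j (T a) - j (T b)⟫) := by
        simp only [inner_sub_left, inner_sub_right]; ring
      linarith
    have h4 : ‖j (T a) - j (T b)‖ ≤ ‖ya - yb‖ := by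
      have := h3.trans (real_inner_le_norm _ _)
      by_contra hcon
      push Not at hcon
      nlinarith [norm_nonneg (ya - yb)]
    have h5 : ‖ya - yb‖ ^ 2 ≤ q * ‖j a - j b‖ ^ 2 := by
      have e : ya - yb = (j a - j b) - ρ • (N a - N b) := by
        simp only [ya, yb, smul_sub]; abel
      rw [e, norm_sub_sq_real, inner_smul_right, norm_smul, mul_pow, Real.norm_eq_abs, sq_abs,
        real_inner_comm]
      have h7 : ‖N a - N b‖ ^ 2 ≤ L ^ 2 * ‖j a - j b‖ ^ 2 := by
        rw [← mul_pow]
        exact pow_le_pow_left₀ (norm_nonneg _) (hΛ' a b) 2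
      have h8 := mul_le_mul_of_nonneg_left (hmono a b) hρ0.le
      have h9 := mul_le_mul_of_nonneg_left h7 (sq_nonneg ρ)
      have e1 : ρ * c = c ^ 2 / L ^ 2 := by rw [hρ]; ring
      have e2 : ρ ^ 2 * L ^ 2 = c ^ 2 / L ^ 2 := by rw [hρ]; field_simp
      have e3 : ρ ^ 2 * (L ^ 2 * ‖j a - j b‖ ^ 2) = c ^ 2 / L ^ 2 * ‖j a - j b‖ ^ 2 := by
        rw [← mul_assoc, e2]
      have e4 : ρ * (c * ‖j a - j b‖ ^ 2) = c ^ 2 / L ^ 2 * ‖j a - j b‖ ^ 2 := by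
        rw [← mul_assoc, e1]
      rw [hq]
      nlinarith
    calc ‖j (T a) - j (T b)‖ ≤ ‖ya - yb‖ := h4
      _ = √(‖ya - yb‖ ^ 2) := (Real.sqrt_sq (norm_nonneg _)).symm
      _ ≤ √(q * ‖j a - j b‖ ^ 2) := Real.sqrt_le_sqrt h5
      _ = √q * ‖j a - j b‖ := by rw [Real.sqrt_mul hq0, Real.sqrt_sq (norm_nonneg _)]
  have := hcomp.completeSpace_coe
  have := (range_nonempty j).to_subtype
  choose g hg using fun x : range j => x.2
  let S : range j → range j := fun x => ⟨j (T (g x)), T (g x), rfl⟩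
  obtain ⟨k, hk⟩ : ∃ k : ℝ≥0, (k : ℝ) = √q := ⟨⟨√q, Real.sqrt_nonneg q⟩, rfl⟩
  have hS : ContractingWith k S := by
    refine ⟨?_, LipschitzWith.of_dist_le_mul fun x y => ?_⟩
    · rw [← NNReal.coe_lt_coe, hk, NNReal.coe_one]
      rw [Real.sqrt_lt' one_pos]; simpa using hq1
    · rw [Subtype.dist_eq, Subtype.dist_eq, dist_eq_norm, dist_eq_norm, hk]
      have := hT (g x) (g y)
      rw [hg, hg] at this
      exact this
  obtain ⟨x, hx⟩ : ∃ x, S x = x := ⟨_, hS.fixedPoint_isFixedPt⟩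
  have hx' : j (T (g x)) = j (g x) := by
    rw [hg]; exact congrArg Subtype.val hx
  refine ⟨g x, fun b => ?_⟩
  have h := hP (j (g x) - ρ • N (g x)) b
  change ⟪j (g x) - ρ • N (g x) - j (T (g x)), j b - j (T (g x))⟫ ≤ 0 at h
  rw [hx', sub_sub_cancel_left, inner_neg_left, inner_smul_left] at h
  simp only [conj_trivial] at h
  by_contra hneg
  push Not at hneg
  nlinarith

/-- `L²` version with pointwise hypotheses. -/
theorem exists_variational_inequality_L2 {ι X E : Type*} [Nonempty ι] [MeasurableSpace X]
    {μ : Measure X} [NormedAddCommGroup E] [InnerProductSpace ℝ E]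
    [CompleteSpace E] (J N : ι → X → E) (hJ : ∀ a, MemLp (J a) 2 μ) (hN : ∀ a, MemLp (N a) 2 μ)
    {Λ c : ℝ} (hc : 0 < c)
    (hΛ : ∀ a b, ∀ᵐ x ∂μ, ‖N a x - N b x‖ ≤ Λ * ‖J a x - J b x‖)
    (hmono : ∀ a b, ∀ᵐ x ∂μ, c * ‖J a x - J b x‖ ^ 2 ≤ ⟪N a x - N b x, J a x - J b x⟫)
    (hconv : ∀ a b, ∀ θ₁ θ₂ : ℝ, 0 ≤ θ₁ → 0 ≤ θ₂ → θ₁ + θ₂ = 1 →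
      ∃ d, ∀ᵐ x ∂μ, J d x = θ₁ • J a x + θ₂ • J b x)
    (hcomp : ∀ (a : ℕ → ι) (y : X → E), MemLp y 2 μ →
      (∀ᵐ x ∂μ, Tendsto (fun n => J (a n) x) atTop (𝓝 (y x))) → ∃ d, ∀ᵐ x ∂μ, J d x = y x) :
    ∃ a, ∀ b, 0 ≤ ∫ x, ⟪N a x, J b x - J a x⟫ ∂μ := by
  let j : ι → Lp E 2 μ := fun a => (hJ a).toLp
  let n : ι → Lp E 2 μ := fun a => (hN a).toLp
  have hjd a b : ∀ᵐ x ∂μ, (j a - j b) x = J a x - J b x := by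
    filter_upwards [Lp.coeFn_sub (j a) (j b), (hJ a).coeFn_toLp, (hJ b).coeFn_toLp]
      with x h1 h2 h3
    rw [h1, Pi.sub_apply, h2, h3]
  have hnd a b : ∀ᵐ x ∂μ, (n a - n b) x = N a x - N b x := by
    filter_upwards [Lp.coeFn_sub (n a) (n b), (hN a).coeFn_toLp, (hN b).coeFn_toLp]
      with x h1 h2 h3
    rw [h1, Pi.sub_apply, h2, h3]
  have key : ∃ a, ∀ b, 0 ≤ ⟪n a, j b - j a⟫ := by
    refine exists_variational_inequality j n hc (Λ := Λ) ?_ ?_ ?_ ?_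
    · intro a b
      refine Lp.norm_le_mul_norm_of_ae_le_mul ?_
      filter_upwards [hjd a b, hnd a b, hΛ a b] with x h1 h2 h3
      rwa [h1, h2]
    · intro a b
      rw [← real_inner_self_eq_norm_sq, L2.inner_def, L2.inner_def, ← integral_const_mul]
      refine integral_mono_ae ?_ ?_ ?_
      · exact (L2.integrable_inner (𝕜 := ℝ) (j a - j b) (j a - j b)).const_mul c
      · exact L2.integrable_inner (𝕜 := ℝ) (n a - n b) (j a - j b)
      · filter_upwards [hjd a b, hnd a b, hmono a b] with x h1 h2 h3
        rw [h1, h2, real_inner_self_eq_norm_sq]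
        exact h3
    · have : IsClosed (range j) := by
        refine IsSeqClosed.isClosed fun w y hw hy => ?_
        choose a ha using hw
        obtain ⟨ns, -, hns⟩ := (tendstoInMeasure_of_tendsto_Lp hy).exists_seq_tendsto_ae
        obtain ⟨d, hd⟩ := hcomp (fun k => a (ns k)) y (Lp.memLp y) (by
          have hall : ∀ᵐ x ∂μ, ∀ k, w (ns k) x = J (a (ns k)) x := by
            rw [ae_all_iff]
            intro k
            rw [← ha]
            exact (hJ _).coeFn_toLp
          filter_upwards [hns, hall] with x h1 h2
          simpa [h2] using h1)
        refine ⟨d, Lp.ext ?_⟩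
        filter_upwards [(hJ d).coeFn_toLp, hd] with x h1 h2
        rw [← h2]; exact h1
      exact this.isComplete
    · rintro _ ⟨a, rfl⟩ _ ⟨b, rfl⟩ θ₁ θ₂ h1 h2 h12
      obtain ⟨d, hd⟩ := hconv a b θ₁ θ₂ h1 h2 h12
      refine ⟨d, Lp.ext ?_⟩
      filter_upwards [hd, (hJ d).coeFn_toLp, (hJ a).coeFn_toLp, (hJ b).coeFn_toLp,
        Lp.coeFn_add (θ₁ • j a) (θ₂ • j b), Lp.coeFn_smul θ₁ (j a), Lp.coeFn_smul θ₂ (j b)]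
        with x e1 e2 e3 e4 e5 e6 e7
      rw [e5, Pi.add_apply, e6, e7, Pi.smul_apply, Pi.smul_apply, e2, e1, e3, e4]
  obtain ⟨a, ha⟩ := key
  refine ⟨a, fun b => ?_⟩
  have h := ha b
  rw [L2.inner_def] at h
  refine h.trans_eq (integral_congr_ae ?_)
  filter_upwards [hjd b a, (hN a).coeFn_toLp] with x h1 h2
  rw [h1, h2]

/-! ### The nonlinearity -/

def om (ε : ℝ) (p : E2) : ℝ := Real.exp (‖p‖ ^ 2 / (2 * ε))

def Aop (ε : ℝ) (p : E2) : E2 := om ε p • p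

theorem one_le_om {ε : ℝ} (hε : 0 < ε) (p : E2) : 1 ≤ om ε p := Real.one_le_exp (by positivity)

theorem continuous_om (ε : ℝ) : Continuous (om ε) := by unfold om; fun_prop

theorem continuous_Aop (ε : ℝ) : Continuous (Aop ε) := (continuous_om ε).smul continuous_id

theorem om_le {ε M : ℝ} (hε : 0 < ε) {p : E2} (hp : ‖p‖ ≤ M) :
    om ε p ≤ Real.exp (M ^ 2 / (2 * ε)) := by
  unfold om; gcongr

theorem om_sub_le {ε M : ℝ} (hε : 0 < ε) {p q : E2} (hp : ‖p‖ ≤ M) (hq : ‖q‖ ≤ M) :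
    |om ε p - om ε q| ≤ Real.exp (M ^ 2 / (2 * ε)) * (M / ε) * ‖p - q‖ := by
  have key : ∀ p q : E2, ‖p‖ ≤ M → ‖q‖ ≤ M →
      om ε p - om ε q ≤ Real.exp (M ^ 2 / (2 * ε)) * (M / ε) * ‖p - q‖ := by
    intro p q hp hq
    have hM := (norm_nonneg _).trans hp
    have h1 : om ε p - om ε q ≤ om ε p * (‖p‖ ^ 2 / (2 * ε) - ‖q‖ ^ 2 / (2 * ε)) := by
      have := Real.add_one_le_exp (‖q‖ ^ 2 / (2 * ε) - ‖p‖ ^ 2 / (2 * ε))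
      have h2 : om ε q = om ε p * Real.exp (‖q‖ ^ 2 / (2 * ε) - ‖p‖ ^ 2 / (2 * ε)) := by
        unfold om; rw [← Real.exp_add]; congr 1; ring
      rw [h2]
      have h3 : 0 < om ε p := Real.exp_pos _
      nlinarith
    have h2 : ‖p‖ ^ 2 / (2 * ε) - ‖q‖ ^ 2 / (2 * ε) ≤ M / ε * ‖p - q‖ := by
      have h3 := norm_sub_norm_le p q
      have h4 : ‖p‖ ^ 2 - ‖q‖ ^ 2 ≤ 2 * M * ‖p - q‖ := by
        have e : ‖p‖ ^ 2 - ‖q‖ ^ 2 = (‖p‖ + ‖q‖) * (‖p‖ - ‖q‖) := by ring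
        rw [e]
        calc (‖p‖ + ‖q‖) * (‖p‖ - ‖q‖) ≤ (‖p‖ + ‖q‖) * ‖p - q‖ := by gcongr
          _ ≤ 2 * M * ‖p - q‖ := by gcongr; linarith
      rw [← sub_div, div_mul_eq_mul_div, div_le_div_iff₀ (by positivity) hε]
      nlinarith
    calc om ε p - om ε q ≤ om ε p * (‖p‖ ^ 2 / (2 * ε) - ‖q‖ ^ 2 / (2 * ε)) := h1
      _ ≤ om ε p * (M / ε * ‖p - q‖) := by gcongr; exact (Real.exp_pos _).le
      _ ≤ Real.exp (M ^ 2 / (2 * ε)) * (M / ε * ‖p - q‖) := by gcongr; exact om_le hε hp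
      _ = _ := by ring
  rw [abs_sub_le_iff]
  exact ⟨key p q hp hq, by rw [norm_sub_rev]; exact key q p hq hp⟩

theorem Aop_mono {ε : ℝ} (hε : 0 < ε) (p q : E2) :
    ‖p - q‖ ^ 2 ≤ ⟪Aop ε p - Aop ε q, p - q⟫ := by
  have e : ⟪Aop ε p - Aop ε q, p - q⟫ = (om ε p + om ε q) / 2 * ‖p - q‖ ^ 2
      + (om ε p - om ε q) / 2 * (‖p‖ ^ 2 - ‖q‖ ^ 2) := by
    have h := norm_sub_sq_real p q
    rw [h]
    simp only [Aop, inner_sub_left, inner_sub_right, inner_smul_left, conj_trivial,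
      real_inner_self_eq_norm_sq]
    rw [real_inner_comm p q]
    ring
  rw [e]
  have h1 : 0 ≤ (om ε p - om ε q) / 2 * (‖p‖ ^ 2 - ‖q‖ ^ 2) := by
    rcases le_total (‖p‖ ^ 2) (‖q‖ ^ 2) with h | h
    · refine mul_nonneg_of_nonpos_of_nonpos ?_ (by linarith)
      have : om ε p ≤ om ε q := by unfold om; gcongr
      linarith
    · refine mul_nonneg ?_ (by linarith)
      have : om ε q ≤ om ε p := by unfold om; gcongr
      linarith
  nlinarith [one_le_om hε p, one_le_om hε q]

theorem Aop_sub_le {ε M : ℝ} (hε : 0 < ε) {p q : E2} (hp : ‖p‖ ≤ M) (hq : ‖q‖ ≤ M) :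
    ‖Aop ε p - Aop ε q‖ ≤ Real.exp (M ^ 2 / (2 * ε)) * (1 + M / ε * M) * ‖p - q‖ := by
  have e : Aop ε p - Aop ε q = om ε p • (p - q) + (om ε p - om ε q) • q := by
    simp only [Aop, smul_sub, sub_smul]; abel
  rw [e]
  refine (norm_add_le _ _).trans ?_
  rw [norm_smul, norm_smul, Real.norm_eq_abs, Real.norm_eq_abs,
    abs_of_pos (by unfold om; positivity : 0 < om ε p)]
  have h1 : om ε p * ‖p - q‖ ≤ Real.exp (M ^ 2 / (2 * ε)) * ‖p - q‖ := by
    gcongr; exact om_le hε hp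
  linarith [mul_le_mul (om_sub_le hε hp hq) hq (norm_nonneg _)
    ((abs_nonneg _).trans (om_sub_le hε hp hq))]

theorem om_mul_sub_le {ε M B B1 B2 d : ℝ} (hε : 0 < ε) {p q : E2} (hp : ‖p‖ ≤ M) (hq : ‖q‖ ≤ M)
    (hB : |B1| ≤ B) (hd : B1 - B2 ≤ -d) (hd0 : 0 ≤ d) :
    om ε p * B1 - om ε q * B2
      ≤ Real.exp (M ^ 2 / (2 * ε)) * (M / ε) * B * ‖p - q‖ - d := by
  have e : om ε p * B1 - om ε q * B2 = (om ε p - om ε q) * B1 + om ε q * (B1 - B2) := by ring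
  have h1 : (om ε p - om ε q) * B1 ≤ Real.exp (M ^ 2 / (2 * ε)) * (M / ε) * ‖p - q‖ * B :=
    (le_abs_self _).trans <| by
      rw [abs_mul]
      exact mul_le_mul (om_sub_le hε hp hq) hB (abs_nonneg _)
        ((abs_nonneg _).trans (om_sub_le hε hp hq))
  have h2 : om ε q * (B1 - B2) ≤ -d := by nlinarith [one_le_om hε q]
  rw [e]; linarith

/-- Two-sided obstacle class. -/
def KS (M : ℝ≥0) (t s : E2 → ℝ) : Set (E2 → ℝ) :=
  {v | LipschitzWith M v ∧ ∀ x, |v x - t x| ≤ s x}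

/-- Integrand of the weak formulation. -/
def vfi (ε lam κ : ℝ) (t F b v ψ : E2 → ℝ) (x : E2) : ℝ :=
  ⟪Aop ε (∇ v x), ∇ ψ x⟫
    + (κ * (v x - b x) - om ε (∇ v x) * ((F x - lam * (v x - t x)) / ε)) * ψ x

theorem gradient_eq_zero_of_zero_off {ψ : E2 → ℝ} {Q : Set E2} (hQ : IsClosed Q)
    (h0 : ∀ x, x ∉ Q → ψ x = 0) {x : E2} (hx : x ∉ Q) : ∇ ψ x = 0 := by
  have : ψ =ᶠ[𝓝 x] fun _ => 0 := by
    filter_upwards [hQ.isOpen_compl.mem_nhds hx] with y hy using h0 y hy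
  rw [this.gradient_eq]
  simp [gradient]

theorem measurable_om_gradient (ε : ℝ) (v : E2 → ℝ) : Measurable fun x => om ε (∇ v x) :=
  (continuous_om ε).measurable.comp (measurable_gradient v)

theorem measurable_Aop_gradient (ε : ℝ) (v : E2 → ℝ) : Measurable fun x => Aop ε (∇ v x) :=
  (continuous_Aop ε).measurable.comp (measurable_gradient v)

theorem norm_Aop_le {ε M : ℝ} (hε : 0 < ε) {p : E2} (hp : ‖p‖ ≤ M) :
    ‖Aop ε p‖ ≤ Real.exp (M ^ 2 / (2 * ε)) * M := by
  rw [Aop, norm_smul, Real.norm_eq_abs, abs_of_pos (by unfold om; positivity : 0 < om ε p)]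
  exact mul_le_mul (om_le hε hp) hp (norm_nonneg _) (Real.exp_pos _).le

theorem integrable_Aop_inner {ε : ℝ} (hε : 0 < ε) {v ψ : E2 → ℝ} (hv : IsLip v) (hψ : IsLip ψ)
    {Q : Set E2} (hQ : IsCompact Q) (h0 : ∀ x, x ∉ Q → ψ x = 0) :
    Integrable fun x => ⟪Aop ε (∇ v x), ∇ ψ x⟫ := by
  obtain ⟨M, hM0, hM⟩ := hv.exists_bound
  obtain ⟨M', hM'0, hM'⟩ := hψ.exists_bound
  refine integrable_of_bdd_compact (K := Q)
    ((measurable_Aop_gradient ε v).inner (measurable_gradient ψ)).aestronglyMeasurable hQ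
    (Real.exp (M ^ 2 / (2 * ε)) * M * M') (fun x => ?_) fun x hx => ?_
  · refine (abs_real_inner_le_norm _ _).trans ?_
    exact mul_le_mul (norm_Aop_le hε (hM x)) (hM' x) (norm_nonneg _) (by positivity)
  · rw [gradient_eq_zero_of_zero_off hQ.isClosed h0 hx, inner_zero_right]

theorem integrable_mul_zero_off {c ψ : E2 → ℝ} (hc : AEStronglyMeasurable c volume)
    {Q : Set E2} (hQ : IsCompact Q) {C : ℝ} (hC : ∀ x ∈ Q, |c x| ≤ C) (hψ : Continuous ψ)
    (h0 : ∀ x, x ∉ Q → ψ x = 0) : Integrable fun x => c x * ψ x := by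
  obtain ⟨D, hD⟩ := hQ.exists_bound_of_continuousOn hψ.continuousOn
  refine integrable_of_bdd_compact (K := Q) (hc.mul hψ.aestronglyMeasurable) hQ (|C| * |D|)
    (fun x => ?_) fun x hx => by rw [h0 x hx, mul_zero]
  by_cases hx : x ∈ Q
  · rw [abs_mul]
    exact mul_le_mul ((hC x hx).trans (le_abs_self C)) ((hD x hx).trans (le_abs_self D))
      (abs_nonneg _) (abs_nonneg _)
  · rw [h0 x hx, mul_zero, abs_zero]; positivity

theorem integrable_om_mul {ε : ℝ} (hε : 0 < ε) {v ψ c : E2 → ℝ} (hv : IsLip v)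
    (hψ : Continuous ψ) (hc : Continuous c) {Q : Set E2} (hQ : IsCompact Q)
    (h0 : ∀ x, x ∉ Q → ψ x = 0) : Integrable fun x => om ε (∇ v x) * c x * ψ x := by
  obtain ⟨M, hM0, hM⟩ := hv.exists_bound
  obtain ⟨D, hD⟩ := hQ.exists_bound_of_continuousOn hc.continuousOn
  refine integrable_mul_zero_off ((measurable_om_gradient ε v).aestronglyMeasurable.mul
    hc.aestronglyMeasurable) hQ (C := Real.exp (M ^ 2 / (2 * ε)) * D) (fun x hx => ?_) hψ h0
  rw [abs_mul, abs_of_pos (by unfold om; positivity : 0 < om ε (∇ v x))]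
  exact mul_le_mul (om_le hε (hM x)) (hD x hx) (abs_nonneg _) (Real.exp_pos _).le

theorem integrable_vfi {ε lam κ : ℝ} (hε : 0 < ε) {t F b v ψ : E2 → ℝ} (ht : Continuous t)
    (hF : Continuous F) (hb : Continuous b) (hv : IsLip v) (hψ : IsLip ψ) {Q : Set E2}
    (hQ : IsCompact Q) (h0 : ∀ x, x ∉ Q → ψ x = 0) : Integrable (vfi ε lam κ t F b v ψ) := by
  have hvc := hv.continuous
  obtain ⟨D, hD⟩ := hQ.exists_bound_of_continuousOn
    (f := fun x => κ * (v x - b x)) (by fun_prop)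
  have h3 := integrable_om_mul hε hv hψ.continuous
    (c := fun x => (F x - lam * (v x - t x)) / ε) (by fun_prop) hQ h0
  refine ((integrable_Aop_inner hε hv hψ hQ h0).add
    ((integrable_mul_zero_off (by fun_prop) hQ hD hψ.continuous h0).sub h3)).congr
    (Eventually.of_forall fun x => ?_)
  simp only [Pi.add_apply, Pi.sub_apply, vfi]
  ring

theorem withLp_norm_sq (y : ℝ) (p : E2) :
    ‖(WithLp.toLp 2 (y, p) : WithLp 2 (ℝ × E2))‖ ^ 2 = y ^ 2 + ‖p‖ ^ 2 := by
  rw [WithLp.prod_norm_sq_eq_of_L2]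
  simp

theorem withLp_norm_le (y : ℝ) (p : E2) :
    ‖(WithLp.toLp 2 (y, p) : WithLp 2 (ℝ × E2))‖ ≤ |y| + ‖p‖ := by
  refine (pow_le_pow_iff_left₀ (by positivity) (by positivity) two_ne_zero).1 ?_
  rw [withLp_norm_sq, ← sq_abs y]
  nlinarith [abs_nonneg y, norm_nonneg p]

theorem le_withLp_norm (y : ℝ) (p : E2) :
    |y| ≤ ‖(WithLp.toLp 2 (y, p) : WithLp 2 (ℝ × E2))‖ ∧
      ‖p‖ ≤ ‖(WithLp.toLp 2 (y, p) : WithLp 2 (ℝ × E2))‖ := by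
  have h := withLp_norm_sq y p
  constructor
  · refine (pow_le_pow_iff_left₀ (by positivity) (by positivity) two_ne_zero).1 ?_
    rw [sq_abs]
    nlinarith
  · refine (pow_le_pow_iff_left₀ (by positivity) (by positivity) two_ne_zero).1 ?_
    nlinarith

/-- Pointwise Lipschitz and monotonicity bounds for the nonlinearity. -/
theorem low_bounds {ε M B lam κ : ℝ} (hε : 0 < ε) (hlam : 0 ≤ lam) (hκ : 0 ≤ κ)
    {p q : E2} (hp : ‖p‖ ≤ M) (hq : ‖q‖ ≤ M) {f0 t0 b0 y z : ℝ} (hy : |(f0 - lam * (y - t0)) / ε| ≤ B)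
    (hz : |(f0 - lam * (z - t0)) / ε| ≤ B) {C : ℝ}
    (hC : C = Real.exp (M ^ 2 / (2 * ε)) * (M / ε) * B) :
    |(κ * (y - b0) - om ε p * ((f0 - lam * (y - t0)) / ε))
        - (κ * (z - b0) - om ε q * ((f0 - lam * (z - t0)) / ε))|
      ≤ (κ + Real.exp (M ^ 2 / (2 * ε)) * (lam / ε)) * |y - z| + C * ‖p - q‖ ∧
    κ * (y - z) ^ 2 - C * ‖p - q‖ * |y - z| ≤
      ((κ * (y - b0) - om ε p * ((f0 - lam * (y - t0)) / ε))
        - (κ * (z - b0) - om ε q * ((f0 - lam * (z - t0)) / ε))) * (y - z) := by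
  set B1 := (f0 - lam * (y - t0)) / ε with hB1
  set B2 := (f0 - lam * (z - t0)) / ε with hB2
  have hd : B1 - B2 = -(lam / ε * (y - z)) := by rw [hB1, hB2]; field_simp; ring
  constructor
  · have e : (κ * (y - b0) - om ε p * B1) - (κ * (z - b0) - om ε q * B2)
        = κ * (y - z) + (-((om ε p - om ε q) * B1) + om ε q * (lam / ε * (y - z))) := by
      have : om ε q * (lam / ε * (y - z)) = om ε q * (B2 - B1) := by
        congr 1; linarith
      rw [this]; ring
    rw [e]
    refine (abs_add_le _ _).trans ?_
    have h1 : |κ * (y - z)| = κ * |y - z| := by rw [abs_mul, abs_of_nonneg hκ]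
    have h2 : |-((om ε p - om ε q) * B1)| ≤ C * ‖p - q‖ := by
      rw [abs_neg, abs_mul, hC]
      calc |om ε p - om ε q| * |B1|
          ≤ (Real.exp (M ^ 2 / (2 * ε)) * (M / ε) * ‖p - q‖) * B :=
            mul_le_mul (om_sub_le hε hp hq) hy (abs_nonneg _)
              ((abs_nonneg _).trans (om_sub_le hε hp hq))
        _ = _ := by ring
    have h3 : |om ε q * (lam / ε * (y - z))| ≤ Real.exp (M ^ 2 / (2 * ε)) *
        (lam / ε) * |y - z| := by
      rw [abs_mul, abs_mul, abs_of_pos (by unfold om; positivity : 0 < om ε q),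
        abs_of_nonneg (by positivity : 0 ≤ lam / ε), mul_assoc]
      exact mul_le_mul_of_nonneg_right (om_le hε hq) (by positivity)
    linarith [abs_add_le (-((om ε p - om ε q) * B1)) (om ε q * (lam / ε * (y - z)))]
  · rcases le_total z y with h | h
    · have h1 := om_mul_sub_le (d := lam / ε * (y - z)) hε hp hq hy (by rw [hd])
        (mul_nonneg (by positivity) (by linarith))
      rw [← hC] at h1
      have h2 := mul_le_mul_of_nonneg_right h1 (sub_nonneg.2 h)
      rw [abs_of_nonneg (sub_nonneg.2 h)]
      have : 0 ≤ lam / ε * (y - z) * (y - z) :=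
        mul_nonneg (mul_nonneg (by positivity) (by linarith)) (by linarith)
      nlinarith
    · have h1 := om_mul_sub_le (B2 := B1) (d := lam / ε * (z - y)) hε hq hp hz (by linarith)
        (mul_nonneg (by positivity) (by linarith))
      rw [← hC] at h1
      have h2 := mul_le_mul_of_nonneg_right h1 (sub_nonneg.2 h)
      rw [abs_of_nonpos (sub_nonpos.2 h), norm_sub_rev p q]
      have : 0 ≤ lam / ε * (z - y) * (z - y) :=
        mul_nonneg (mul_nonneg (by positivity) (by linarith)) (by linarith)
      nlinarith

/-- If equi-Lipschitz functions and their gradients converge, the gradient of the limit is the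
limit of the gradients. -/
theorem gradient_eq_of_tendsto {v : ℕ → E2 → ℝ} {V : E2 → ℝ} {M : ℝ≥0}
    (hv : ∀ n, LipschitzWith M (v n)) (hV : LipschitzWith M V)
    (hlim : ∀ x, Tendsto (fun n => v n x) atTop (𝓝 (V x))) {Q : Set E2} (hQ : IsCompact Q)
    {Y : E2 → E2} (hY : ∀ᵐ x ∂(volume.restrict Q), Tendsto (fun n => ∇ (v n) x) atTop (𝓝 (Y x))) :
    ∀ᵐ x ∂(volume.restrict Q), ∇ V x = Y x := by
  have hmY :=
    aestronglyMeasurable_of_tendsto_ae (u := atTop) (f := fun n x => ∇ (v n) x)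
      (fun n => (measurable_gradient (v n)).aestronglyMeasurable) hY
  have hbY : ∀ᵐ x ∂(volume.restrict Q), ‖Y x‖ ≤ M := by
    filter_upwards [hY] with x hx
    exact le_of_tendsto hx.norm (Eventually.of_forall fun n => (hv n).norm_gradient_le x)
  have hcomp : ∀ (a : E2) i, |a i| ≤ ‖a‖ := fun a i => by
    simpa using PiLp.norm_apply_le a i
  have hfin : IsFiniteMeasure (volume.restrict Q) := ⟨by simpa using hQ.measure_lt_top⟩
  have hi : ∀ i : Fin 2, ∀ᵐ x ∂(volume.restrict Q), (∇ V x) i = Y x i := by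
    intro i
    have hpi : Continuous fun a : E2 => a i := (EuclideanSpace.proj (𝕜 := ℝ) i).continuous
    have hm1 :=
      (hpi.comp_aestronglyMeasurable (measurable_gradient V).aestronglyMeasurable).sub
        (hpi.comp_aestronglyMeasurable hmY)
    have hb1 : ∀ᵐ x ∂(volume.restrict Q), ‖(∇ V x) i - Y x i‖ ≤ 2 * M := by
      filter_upwards [hbY] with x hx
      have h1 := (hcomp (∇ V x) i).trans (hV.norm_gradient_le x)
      have h2 := (hcomp (Y x) i).trans hx
      have h3 := abs_sub (∇ V x i) (Y x i)
      rw [Real.norm_eq_abs]; linarith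
    have hI : IntegrableOn (fun x => (∇ V x) i - Y x i) Q :=
      Integrable.of_bound hm1 _ hb1
    set W : E2 → ℝ := Q.indicator fun x => (∇ V x) i - Y x i
    have hW : Integrable W := (integrable_indicator_iff hQ.measurableSet).2 hI
    have h1 := tendsto_integral_gradient_mul hv hV hlim hW i
    have e : ∀ g : E2 → ℝ, ∫ x, g x * W x = ∫ x in Q, g x * ((∇ V x) i - Y x i) := by
      intro g
      rw [← integral_indicator hQ.measurableSet]
      congr 1; funext x
      by_cases hx : x ∈ Q <;> simp [W, hx]
    simp only [e] at h1
    have h2 : Tendsto (fun n => ∫ x in Q, (∇ (v n) x) i * ((∇ V x) i - Y x i)) atTop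
        (𝓝 (∫ x in Q, Y x i * ((∇ V x) i - Y x i))) := by
      refine tendsto_integral_of_dominated_convergence (fun _ => M * (2 * M)) ?_ ?_ ?_ ?_
      · intro n
        exact (hpi.comp_aestronglyMeasurable
          (measurable_gradient (v n)).aestronglyMeasurable).mul hm1
      · exact integrable_const _
      · intro n
        filter_upwards [hb1] with x hx
        rw [norm_mul]
        exact mul_le_mul ((hcomp _ i).trans ((hv n).norm_gradient_le x)) hx (norm_nonneg _) M.2
      · filter_upwards [hY] with x hx
        exact ((hpi.tendsto _).comp hx).mul_const _
    have h4 : ∫ x in Q, ((∇ V x) i - Y x i) ^ 2 = 0 := by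
      have hi1 :=
        hI.bdd_mul (c := M) (hpi.comp_aestronglyMeasurable
          (measurable_gradient V).aestronglyMeasurable)
          (Eventually.of_forall fun x => (hcomp _ i).trans (hV.norm_gradient_le x))
      have hi2 :=
        hI.bdd_mul (c := M) (hpi.comp_aestronglyMeasurable hmY) (by
          filter_upwards [hbY] with x hx using (hcomp _ i).trans hx)
      have := integral_sub hi1 hi2
      rw [tendsto_nhds_unique h1 h2, sub_self] at this
      rw [← this]
      congr 1; funext x; ring
    have h5 : IntegrableOn (fun x => ((∇ V x) i - Y x i) ^ 2) Q := by
      refine Integrable.of_bound (hm1.pow 2) ((2 * M) ^ 2) ?_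
      filter_upwards [hb1] with x hx
      rw [norm_pow]
      exact pow_le_pow_left₀ (norm_nonneg _) hx 2
    filter_upwards [(integral_eq_zero_iff_of_nonneg (fun x => sq_nonneg _) h5).1 h4] with x hx
    have : (∇ V x) i - Y x i = 0 := by simpa using hx
    linarith
  filter_upwards [hi 0, hi 1] with x h0 h1
  ext i
  fin_cases i
  · exact h0
  · exact h1

/-- Pointwise convergence on a set of full measure propagates. -/
theorem exists_tendsto_of_ae {v : ℕ → E2 → ℝ} {M : ℝ≥0} (hv : ∀ n, LipschitzWith M (v n))
    {U : Set E2} (hU : IsOpen U)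
    (hae : ∀ᵐ x, x ∈ U → ∃ l, Tendsto (fun n => v n x) atTop (𝓝 l)) {x : E2} (hx : x ∈ U) :
    ∃ l, Tendsto (fun n => v n x) atTop (𝓝 l) := by
  refine cauchySeq_tendsto_of_complete (Metric.cauchySeq_iff'.2 fun ε hε => ?_)
  set δ := ε / (4 * (M + 1)) with hδ
  have hne : ∃ y ∈ U ∩ ball x δ, ∃ l, Tendsto (fun n => v n y) atTop (𝓝 l) := by
    by_contra hcon
    push Not at hcon
    have hsub : U ∩ ball x δ ⊆ {x | ¬(x ∈ U → ∃ l, Tendsto (fun n => v n x) atTop (𝓝 l))} := by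
      intro y hy
      simp only [mem_ofPred_eq, Classical.not_imp, not_exists]
      exact ⟨hy.1, hcon y hy⟩
    exact ((hU.inter isOpen_ball).measure_pos volume ⟨x, hx, mem_ball_self (by positivity)⟩).ne'
      (measure_mono_null hsub hae)
  obtain ⟨y, hy, l, hl⟩ := hne
  obtain ⟨N, hN⟩ := Metric.cauchySeq_iff'.1 hl.cauchySeq (ε / 2) (by positivity)
  refine ⟨N, fun n hn => ?_⟩
  have h1 := hN n hn
  have h2 := (hv n).dist_le_mul x y
  have h3 := (hv N).dist_le_mul y x
  have h4 : dist x y < δ := by rw [dist_comm]; exact hy.2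
  have h5 : dist (v n x) (v N x) ≤ dist (v n x) (v n y) + dist (v n y) (v N y)
      + dist (v N y) (v N x) := dist_triangle4 _ _ _ _
  have h6 : (M : ℝ) * dist x y ≤ ε / 4 := by
    have : (M : ℝ) * dist x y ≤ M * δ := mul_le_mul_of_nonneg_left h4.le M.2
    refine this.trans ?_
    rw [hδ, mul_div_assoc', div_le_div_iff₀ (by positivity) (by norm_num)]
    have := M.2
    simp only [NNReal.val_eq_coe] at this
    nlinarith
  rw [dist_comm y x] at h3
  linarith

/-- Standing assumptions for the obstacle problem. -/
structure Obst (M : ℝ≥0) (t s F : E2 → ℝ) : Prop where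
  s_nonneg : ∀ x, 0 ≤ s x
  s_lip : ∀ x y, |s x - s y| ≤ ‖x - y‖
  s_cpt : HasCompactSupport s
  t_lip : LipschitzWith M t
  F_cont : Continuous F

namespace Obst

variable {M : ℝ≥0} {t s F : E2 → ℝ}

theorem eq_off (_h : Obst M t s F) {v : E2 → ℝ} (hv : v ∈ KS M t s) {x : E2}
    (hx : x ∉ tsupport s) : v x = t x := by
  have h1 := hv.2 x
  rw [image_eq_zero_of_notMem_tsupport hx] at h1
  linarith [abs_nonpos_iff.1 h1]

theorem self_mem (h : Obst M t s F) : t ∈ KS M t s :=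
  ⟨h.t_lip, fun x => by simpa using h.s_nonneg x⟩

theorem s_cont (h : Obst M t s F) : Continuous s :=
  (isLip_iff.2 ⟨1, fun x y => by simpa using h.s_lip x y⟩ : IsLip s).continuous

theorem exists_bound (h : Obst M t s F) (ε lam : ℝ) :
    ∃ B, 0 ≤ B ∧ ∀ v ∈ KS M t s, ∀ x ∈ tsupport s, |(F x - lam * (v x - t x)) / ε| ≤ B := by
  obtain ⟨b1, hb1⟩ := h.s_cpt.isCompact.exists_bound_of_continuousOn h.F_cont.continuousOn
  obtain ⟨b2, hb2⟩ := h.s_cpt.exists_bound_of_continuous h.s_cont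
  refine ⟨(|b1| + |lam| * |b2|) / |ε|, by positivity, fun v hv x hx => ?_⟩
  rw [abs_div]
  gcongr
  refine (abs_sub _ _).trans ?_
  rw [abs_mul]
  have h1 := (hv.2 x).trans ((le_abs_self _).trans ((hb2 x).trans (le_abs_self _)))
  have h2 := (hb1 x hx).trans (le_abs_self _)
  rw [Real.norm_eq_abs] at h2
  gcongr

theorem convex_comb (_h : Obst M t s F) {v w : E2 → ℝ} (hv : v ∈ KS M t s) (hw : w ∈ KS M t s)
    {a b : ℝ} (ha : 0 ≤ a) (hb : 0 ≤ b) (hab : a + b = 1) :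
    (fun x => a * v x + b * w x) ∈ KS M t s := by
  refine ⟨LipschitzWith.of_dist_le_mul fun x y => ?_, fun x => ?_⟩
  · have h1 := hv.1.dist_le_mul x y
    have h2 := hw.1.dist_le_mul x y
    rw [Real.dist_eq] at *
    have e : a * v x + b * w x - (a * v y + b * w y) = a * (v x - v y) + b * (w x - w y) := by ring
    rw [e]
    refine (abs_add_le _ _).trans ?_
    rw [abs_mul, abs_mul, abs_of_nonneg ha, abs_of_nonneg hb]
    calc _ ≤ a * (M * dist x y) + b * (M * dist x y) := by gcongr
      _ = (a + b) * (M * dist x y) := by ring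
      _ = _ := by rw [hab, one_mul]
  · have e : a * v x + b * w x - t x = a * (v x - t x) + b * (w x - t x) := by
      have : t x = (a + b) * t x := by rw [hab, one_mul]
      nlinarith
    rw [e]
    refine (abs_add_le _ _).trans ?_
    rw [abs_mul, abs_mul, abs_of_nonneg ha, abs_of_nonneg hb]
    calc _ ≤ a * s x + b * s x := by gcongr <;> [exact hv.2 x; exact hw.2 x]
      _ = (a + b) * s x := by ring
      _ = _ := by rw [hab, one_mul]

theorem limit_mem (_h : Obst M t s F) {v : ℕ → E2 → ℝ} (hv : ∀ n, v n ∈ KS M t s) {V : E2 → ℝ}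
    {l : Filter ℕ} [l.NeBot]
    (hlim : ∀ x, Tendsto (fun n => v n x) l (𝓝 (V x))) : V ∈ KS M t s := by
  refine ⟨LipschitzWith.of_dist_le_mul fun x y => ?_, fun x => ?_⟩
  · exact le_of_tendsto ((hlim x).dist (hlim y))
      (Eventually.of_forall fun n => (hv n).1.dist_le_mul x y)
  · exact le_of_tendsto (((hlim x).sub_const _).abs) (Eventually.of_forall fun n => (hv n).2 x)

theorem min_mem {v z : E2 → ℝ} (hv : v ∈ KS M t s) (hz : LipschitzWith M z)
    (hzt : ∀ x, t x - s x ≤ z x) : (fun x => v x + -max (v x - z x) 0) ∈ KS M t s := by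
  have e : (fun x => v x + -max (v x - z x) 0) = fun x => min (v x) (z x) := by
    funext x
    rcases le_total (v x) (z x) with h | h
    · rw [max_eq_right (by linarith), min_eq_left h]; ring
    · rw [max_eq_left (by linarith), min_eq_right h]; ring
  rw [e]
  refine ⟨by simpa using hv.1.min hz, fun x => ?_⟩
  have h1 := abs_le.1 (hv.2 x)
  refine abs_le.2 ⟨?_, ?_⟩
  · linarith [le_min (by linarith : t x - s x ≤ v x) (hzt x)]
  · linarith [min_le_left (v x) (z x)]

theorem max_mem {v z : E2 → ℝ} (hv : v ∈ KS M t s) (hz : LipschitzWith M z)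
    (hzt : ∀ x, z x ≤ t x + s x) : (fun x => v x + max (z x - v x) 0) ∈ KS M t s := by
  have e : (fun x => v x + max (z x - v x) 0) = fun x => max (v x) (z x) := by
    funext x
    rcases le_total (v x) (z x) with h | h
    · rw [max_eq_left (by linarith), max_eq_right h]; ring
    · rw [max_eq_right (by linarith), max_eq_left h]; ring
  rw [e]
  refine ⟨by simpa using hv.1.max hz, fun x => ?_⟩
  have h1 := abs_le.1 (hv.2 x)
  refine abs_le.2 ⟨?_, ?_⟩
  · linarith [le_max_left (v x) (z x)]
  · linarith [max_le (by linarith : v x ≤ t x + s x) (hzt x)]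

/-- Solvability of the problem with an additional strongly monotone zero order term. -/
theorem exists_inner (h : Obst M t s F) {ε lam κ B C : ℝ} (hε : 0 < ε) (hlam : 0 ≤ lam)
    (hB0 : 0 ≤ B)
    (hB : ∀ v ∈ KS M t s, ∀ x ∈ tsupport s, |(F x - lam * (v x - t x)) / ε| ≤ B)
    (hC : C = Real.exp ((M : ℝ) ^ 2 / (2 * ε)) * (M / ε) * B) (hκ : C ^ 2 / 2 + 1 / 2 ≤ κ)
    {b : E2 → ℝ} (hb : Continuous b) :
    ∃ v ∈ KS M t s, ∀ ψ, IsLip ψ → (fun x => v x + ψ x) ∈ KS M t s →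
      0 ≤ ∫ x, vfi ε lam κ t F b v ψ x := by
  set Q := tsupport s
  have hQc := h.s_cpt
  have hfin : IsFiniteMeasure (volume.restrict Q) := ⟨by simpa using hQc.measure_lt_top⟩
  have hκ0 : 0 ≤ κ := by nlinarith [sq_nonneg C]
  have hC0 : 0 ≤ C := by rw [hC]; positivity
  let J : KS M t s → E2 → WithLp 2 (ℝ × E2) := fun v x => WithLp.toLp 2 (v.1 x, ∇ v.1 x)
  let n1 : KS M t s → E2 → ℝ := fun v x =>
    κ * (v.1 x - b x) - om ε (∇ v.1 x) * ((F x - lam * (v.1 x - t x)) / ε)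
  let N : KS M t s → E2 → WithLp 2 (ℝ × E2) := fun v x =>
    WithLp.toLp 2 (n1 v x, Aop ε (∇ v.1 x))
  have hcont :=
    WithLp.prod_continuous_toLp 2 ℝ E2
  have hJs : ∀ v w : KS M t s, ∀ x, J v x - J w x
      = WithLp.toLp 2 (v.1 x - w.1 x, ∇ v.1 x - ∇ w.1 x) := fun v w x => rfl
  have hNs : ∀ v w : KS M t s, ∀ x, N v x - N w x
      = WithLp.toLp 2 (n1 v x - n1 w x, Aop ε (∇ v.1 x) - Aop ε (∇ w.1 x)) := fun v w x => rfl
  have hg : ∀ (v : KS M t s) x, ‖∇ v.1 x‖ ≤ M := fun v x => v.2.1.norm_gradient_le x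
  have htc := h.t_lip.continuous
  have hFc := h.F_cont
  have hn1m : ∀ v : KS M t s, Measurable (n1 v) := fun v => by
    have h1 : Continuous fun x => κ * (v.1 x - b x) := by
      have := v.2.1.continuous
      fun_prop
    have h2 : Continuous fun x => (F x - lam * (v.1 x - t x)) / ε := by
      have := v.2.1.continuous
      fun_prop
    exact h1.measurable.sub ((measurable_om_gradient ε v.1).mul h2.measurable)
  have hJm : ∀ v : KS M t s, AEStronglyMeasurable (J v) (volume.restrict Q) := fun v =>
    hcont.comp_aestronglyMeasurable
      ((v.2.1.continuous.measurable.aestronglyMeasurable).prodMk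
        (measurable_gradient v.1).aestronglyMeasurable)
  have hNm : ∀ v : KS M t s, AEStronglyMeasurable (N v) (volume.restrict Q) := fun v =>
    hcont.comp_aestronglyMeasurable
      ((hn1m v).aestronglyMeasurable.prodMk (measurable_Aop_gradient ε v.1).aestronglyMeasurable)
  have hmemQ : ∀ᵐ x ∂(volume.restrict Q), x ∈ Q := ae_restrict_mem hQc.measurableSet
  have : Nonempty (KS M t s) := ⟨⟨t, h.self_mem⟩⟩
  have hn1b : ∀ v : KS M t s, ∃ D, ∀ x ∈ Q, |n1 v x| ≤ D := by
    intro v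
    obtain ⟨D, hD⟩ := hQc.exists_bound_of_continuousOn (f := fun x => κ * (v.1 x - b x)) (by
      have := v.2.1.continuous
      fun_prop)
    refine ⟨D + Real.exp ((M : ℝ) ^ 2 / (2 * ε)) * B, fun x hx => ?_⟩
    refine (abs_sub _ _).trans (add_le_add (hD x hx) ?_)
    rw [abs_mul, abs_of_pos (by unfold om; positivity : 0 < om ε (∇ v.1 x))]
    exact mul_le_mul (om_le hε (hg v x)) (hB v.1 v.2 x hx) (abs_nonneg _) (Real.exp_pos _).le
  have key : ∃ v : KS M t s, ∀ w : KS M t s,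
      0 ≤ ∫ x, ⟪N v x, J w x - J v x⟫ ∂(volume.restrict Q) := by
    refine exists_variational_inequality_L2 (μ := volume.restrict Q) J N ?_ ?_
      (c := 1 / 2) (by norm_num)
      (Λ := (κ + Real.exp ((M : ℝ) ^ 2 / (2 * ε)) * (lam / ε)) + C
        + Real.exp ((M : ℝ) ^ 2 / (2 * ε)) * (1 + M / ε * M)) ?_ ?_ ?_ ?_
    · intro v
      obtain ⟨D, hD⟩ := hQc.exists_bound_of_continuousOn v.2.1.continuous.continuousOn
      refine MemLp.of_bound (hJm v) (D + M) ?_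
      filter_upwards [hmemQ] with x hx
      exact (withLp_norm_le _ _).trans (add_le_add (hD x hx) (hg v x))
    · intro v
      obtain ⟨D, hD⟩ := hn1b v
      refine MemLp.of_bound (hNm v) (D + Real.exp ((M : ℝ) ^ 2 / (2 * ε)) * M) ?_
      filter_upwards [hmemQ] with x hx
      exact (withLp_norm_le _ _).trans (add_le_add (hD x hx) (norm_Aop_le hε (hg v x)))
    · intro v w
      filter_upwards [hmemQ] with x hx
      rw [hJs, hNs]
      refine (withLp_norm_le _ _).trans ?_
      have h1 := (low_bounds (b0 := b x) hε hlam hκ0 (hg v x) (hg w x) (hB v.1 v.2 x hx)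
        (hB w.1 w.2 x hx) hC).1
      have h2 := Aop_sub_le hε (hg v x) (hg w x)
      obtain ⟨h3, h4⟩ := le_withLp_norm (v.1 x - w.1 x) (∇ v.1 x - ∇ w.1 x)
      have h5 : 0 ≤ κ + Real.exp ((M : ℝ) ^ 2 / (2 * ε)) * (lam / ε) := by positivity
      have h6 : 0 ≤ Real.exp ((M : ℝ) ^ 2 / (2 * ε)) * (1 + M / ε * M) := by positivity
      have h7 := mul_le_mul_of_nonneg_left h3 h5
      have h8 := mul_le_mul_of_nonneg_left h4 hC0
      have h9 := mul_le_mul_of_nonneg_left h4 h6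
      simp only [n1]
      linarith
    · intro v w
      filter_upwards [hmemQ] with x hx
      rw [hJs, hNs, withLp_norm_sq, WithLp.prod_inner_apply]
      have h1 := (low_bounds (b0 := b x) hε hlam hκ0 (hg v x) (hg w x) (hB v.1 v.2 x hx)
        (hB w.1 w.2 x hx) hC).2
      have h2 := Aop_mono hε (∇ v.1 x) (∇ w.1 x)
      have e : ⟪n1 v x - n1 w x, v.1 x - w.1 x⟫ = (n1 v x - n1 w x) * (v.1 x - w.1 x) := by
        simp [mul_comm]
      simp only
      rw [e]
      simp only [n1]
      have h3 : C * ‖∇ v.1 x - ∇ w.1 x‖ * |v.1 x - w.1 x|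
          ≤ ‖∇ v.1 x - ∇ w.1 x‖ ^ 2 / 2 + C ^ 2 / 2 * (v.1 x - w.1 x) ^ 2 := by
        rw [← sq_abs (v.1 x - w.1 x)]
        nlinarith [sq_nonneg (‖∇ v.1 x - ∇ w.1 x‖ - C * |v.1 x - w.1 x|)]
      linarith [mul_le_mul_of_nonneg_right hκ (sq_nonneg (v.1 x - w.1 x))]
    · intro v w a1 a2 h1 h2 h12
      refine ⟨⟨_, h.convex_comb v.2 w.2 h1 h2 h12⟩, ?_⟩
      have hvl : IsLip v.1 := ⟨M, v.2.1⟩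
      have hwl : IsLip w.1 := ⟨M, w.2.1⟩
      filter_upwards [ae_restrict_of_ae hvl.ae_hasGradientAt,
        ae_restrict_of_ae hwl.ae_hasGradientAt] with x e1 e2
      simp only [J]
      rw [((e1.const_mul' a1).add' (e2.const_mul' a2)).gradient]
      rfl
    · intro a y hy hlim
      have hfst : Continuous fun z : WithLp 2 (ℝ × E2) => z.fst := by fun_prop
      have hsnd : Continuous fun z : WithLp 2 (ℝ × E2) => z.snd := by fun_prop
      have hpt x : ∃ l, Tendsto (fun n => (a n).1 x) atTop (𝓝 l) := by
        by_cases hx : s x = 0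
        · refine ⟨t x, tendsto_const_nhds.congr fun n => ?_⟩
          have := (a n).2.2 x
          rw [hx] at this
          linarith [abs_nonpos_iff.1 this]
        · refine exists_tendsto_of_ae (fun n => (a n).2.1) (U := {x | s x ≠ 0})
            (isOpen_ne_fun h.s_cont continuous_const) ?_ hx
          filter_upwards [(ae_restrict_iff' hQc.measurableSet).1 hlim] with z hz hz0
          exact ⟨_, (hfst.tendsto _).comp (hz (subset_tsupport s hz0))⟩
      choose V hV using hpt
      have hVm := h.limit_mem (fun n => (a n).2) hV
      refine ⟨⟨V, hVm⟩, ?_⟩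
      have hgr := gradient_eq_of_tendsto (fun n => (a n).2.1) hVm.1 hV hQc
        (Y := fun x => (y x).snd) (by
          filter_upwards [hlim] with x hx
          exact (hsnd.tendsto _).comp hx)
      filter_upwards [hgr, hlim] with x e1 e2
      simp only [J]
      rw [e1, tendsto_nhds_unique (hV x) ((hfst.tendsto _).comp e2)]
      rfl
  obtain ⟨v, hv⟩ := key
  refine ⟨v.1, v.2, fun ψ hψ hmem => ?_⟩
  have h0 : ∀ x, x ∉ Q → ψ x = 0 := fun x hx => by
    have e1 := h.eq_off v.2 hx
    linarith [h.eq_off hmem hx]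
  refine (hv ⟨_, hmem⟩).trans_eq ?_
  rw [← setIntegral_eq_integral_of_forall_compl_eq_zero (s := Q)
    (f := fun x => vfi ε lam κ t F b v.1 ψ x)]
  · refine integral_congr_ae ?_
    have hvl : IsLip v.1 := ⟨M, v.2.1⟩
    filter_upwards [ae_restrict_of_ae hvl.ae_hasGradientAt,
      ae_restrict_of_ae hψ.ae_hasGradientAt] with x e1 e2
    rw [hJs, (e1.add' e2).gradient]
    simp only [N, n1, vfi, WithLp.prod_inner_apply, add_sub_cancel_left]
    rw [add_comm]
    congr 1
    simp [mul_comm]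
  · intro x hx
    simp only [vfi]
    rw [h0 x hx, gradient_eq_zero_of_zero_off hQc.isClosed h0 hx]
    simp

end Obst

/-- Vanishing criterion used in all comparison arguments. -/
theorem eq_zero_of_integral_le {w I : E2 → ℝ} (hw : Continuous w) (hc : HasCompactSupport w)
    (hI : Integrable I) (h0 : 0 ≤ ∫ x, I x) {c : ℝ} (hc0 : 0 < c)
    (h : ∀ᵐ x, I x ≤ -(c * w x ^ 2)) : ∀ x, w x = 0 := by
  have hw2 : Integrable fun x => w x ^ 2 := by
    refine (hw.pow 2).integrable_of_hasCompactSupport ?_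
    exact hc.mono fun x hx => by
      simp only [Function.mem_support] at hx ⊢
      exact fun h => hx (by simp [h])
  have h1 : ∫ x, I x ≤ ∫ x, -(c * w x ^ 2) := integral_mono_ae hI (hw2.const_mul c).neg h
  rw [integral_neg, integral_const_mul] at h1
  have h2 : ∫ x, w x ^ 2 = 0 := by
    have : 0 ≤ ∫ x, w x ^ 2 := integral_nonneg fun x => sq_nonneg _
    nlinarith
  have h4 : (fun x => w x ^ 2) = fun _ => 0 :=
    (Continuous.ae_eq_iff_eq volume (hw.pow 2) continuous_const).1
      ((integral_eq_zero_iff_of_nonneg (fun x => sq_nonneg (w x)) hw2).1 h2)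
  intro x
  simpa using congrFun h4 x

/-- Fixed points of contractions for the uniform distance on pointwise closed families. -/
theorem exists_fixed_of_sup_contraction {X : Type*} (S : Set (X → ℝ))
    (hS : ∀ (v : ℕ → X → ℝ) (V : X → ℝ), (∀ n, v n ∈ S) →
      (∀ x, Tendsto (fun n => v n x) atTop (𝓝 (V x))) → V ∈ S)
    (T : S → S) {q : ℝ} (hq0 : 0 ≤ q) (hq : q < 1)
    (hT : ∀ a b : S, ∀ m, 0 ≤ m → (∀ x, |a.1 x - b.1 x| ≤ m) →
      ∀ x, |(T a).1 x - (T b).1 x| ≤ q * m)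
    (v0 : S) {m0 : ℝ} (hm00 : 0 ≤ m0) (hm0 : ∀ x, |v0.1 x - (T v0).1 x| ≤ m0) :
    ∃ V : S, T V = V := by
  let v : ℕ → S := fun n => T^[n] v0
  have hstep : ∀ n x, |(v n).1 x - (v (n + 1)).1 x| ≤ m0 * q ^ n := by
    intro n
    induction n with
    | zero => simpa [v] using hm0
    | succ k ih =>
      intro x
      have h := hT (v k) (v (k + 1)) (m0 * q ^ k) (by positivity) ih x
      simp only [v, Function.iterate_succ_apply'] at h ⊢
      calc _ ≤ _ := h
        _ = _ := by ring
  have hcau := fun x =>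
    cauchySeq_of_le_geometric q m0 hq fun n => by rw [Real.dist_eq]; exact hstep n x
  choose V hV using fun x => cauchySeq_tendsto_of_complete (hcau x)
  have hVS := hS (fun n => (v n).1) V (fun n => (v n).2) hV
  have hunif := fun n x => by
    have := dist_le_of_le_geometric_of_tendsto q m0 hq
      (fun n => by rw [Real.dist_eq]; exact hstep n x) (hV x) n
    rwa [Real.dist_eq] at this
  refine ⟨⟨V, hVS⟩, Subtype.ext (funext fun x => ?_)⟩
  have h1 : Tendsto (fun n => (v (n + 1)).1 x) atTop (𝓝 ((T ⟨V, hVS⟩).1 x)) := by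
    rw [tendsto_iff_dist_tendsto_zero]
    have hz : Tendsto (fun n : ℕ => q * (m0 * q ^ n / (1 - q))) atTop (𝓝 0) := by
      have := tendsto_pow_atTop_nhds_zero_of_lt_one hq0 hq
      simpa using ((this.const_mul m0).div_const (1 - q)).const_mul q
    refine squeeze_zero (fun _ => dist_nonneg) (fun n => ?_) hz
    rw [Real.dist_eq]
    have := hT (v n) ⟨V, hVS⟩ (m0 * q ^ n / (1 - q))
      (div_nonneg (by positivity) (by linarith)) (hunif n) x
    simpa [v, Function.iterate_succ_apply'] using this
  exact tendsto_nhds_unique h1 ((tendsto_add_atTop_iff_nat 1).2 (hV x))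

/-- Basic pointwise estimate behind all comparison arguments for the regularised problem. -/
theorem pair_bound {ε M B B1 B2 d C w : ℝ} (hε : 0 < ε) {p q : E2} (hp : ‖p‖ ≤ M) (hq : ‖q‖ ≤ M)
    (hB : |B1| ≤ B) (hd : B1 - B2 ≤ -d) (hd0 : 0 ≤ d) (hw : 0 ≤ w)
    (hC : C = Real.exp (M ^ 2 / (2 * ε)) * (M / ε) * B) :
    -⟪Aop ε p, p - q⟫ + ⟪Aop ε q, p - q⟫ + (om ε p * B1 - om ε q * B2) * w
      ≤ C ^ 2 / 4 * w ^ 2 - d * w := by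
  have h1 := om_mul_sub_le hε hp hq hB hd hd0
  have h2 := Aop_mono hε p q
  rw [inner_sub_left] at h2
  rw [← hC] at h1
  nlinarith [mul_le_mul_of_nonneg_right h1 hw, sq_nonneg (‖p - q‖ - C / 2 * w)]

/-- Solutions of the regularised bilateral obstacle problem. -/
def IsVI (ε lam : ℝ) (M : ℝ≥0) (t s F v : E2 → ℝ) : Prop :=
  v ∈ KS M t s ∧ ∀ ψ, IsLip ψ → (fun x => v x + ψ x) ∈ KS M t s →
    0 ≤ ∫ x, vfi ε lam 0 t F t v ψ x

namespace Obst

variable {M : ℝ≥0} {t s F : E2 → ℝ}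

theorem isLip_of_mem {v : E2 → ℝ} (hv : v ∈ KS M t s) : IsLip v := ⟨M, hv.1⟩

theorem exists_sol (h : Obst M t s F) {ε lam : ℝ} (hε : 0 < ε) (hlam : 0 < lam) :
    ∃ v, IsVI ε lam M t s F v := by
  obtain ⟨B, hB0, hB⟩ := h.exists_bound ε lam
  set C := Real.exp (M ^ 2 / (2 * ε)) * (M / ε) * B with hC
  set κ := C ^ 2 / 2 + 1 / 2 with hκ
  have hκ0 : 0 < κ := by positivity
  set q := κ / (κ + lam / ε) with hq
  have hle : 0 < lam / ε := by positivity
  have hq1 : q < 1 := by rw [hq, div_lt_one (by positivity)]; linarith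
  have hqm : q * (κ + lam / ε) = κ := by rw [hq]; field_simp
  have hsol := fun b : KS M t s => h.exists_inner hε hlam.le hB0 hB hC (le_refl κ)
    b.2.1.continuous
  choose T hTm hT using hsol
  have hkey : ∀ a b : KS M t s, ∀ m, 0 ≤ m → (∀ x, |a.1 x - b.1 x| ≤ m) →
      ∀ x, T a x - T b x ≤ q * m := by
    intro a b m hm hab
    set va := T a with hva
    set vb := T b with hvb
    have la := isLip_of_mem (hTm a)
    have lb := isLip_of_mem (hTm b)
    set w : E2 → ℝ := fun x => max (va x - (vb x + q * m)) 0 with hw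
    have hgl : IsLip fun x => va x - (vb x + q * m) := la.sub (lb.add (isLip_const _))
    have hwl : IsLip w := hgl.max (isLip_const 0)
    have hqm0 : 0 ≤ q * m := by positivity
    have hw0 x : 0 ≤ w x := le_max_right _ _
    have hwoff x : x ∉ tsupport s → w x = 0 := fun hx => by
      have e1 := h.eq_off (hTm a) hx
      have e2 := h.eq_off (hTm b) hx
      simp only [hw, hva, hvb, e1, e2]
      rw [max_eq_right]; linarith
    have m1 : (fun x => va x + -w x) ∈ KS M t s := by
      refine min_mem (hTm a) ?_ fun x => ?_
      · simpa using (hTm b).1.add (LipschitzWith.const (q * m))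
      · linarith [(abs_le.1 ((hTm b).2 x)).1]
    have m2 : (fun x => vb x + w x) ∈ KS M t s := by
      have := max_mem (hTm b) (z := fun x => va x - q * m) ?_ fun x => ?_
      · simp only [hw]
        convert this using 4
        ring
      · simpa using (hTm a).1.sub (LipschitzWith.const (q * m))
      · linarith [(abs_le.1 ((hTm a).2 x)).2]
    have i1 := hT a _ hwl.neg m1
    have i2 := hT b _ hwl m2
    have n1 := integrable_vfi (κ := κ) (lam := lam) hε h.t_lip.continuous h.F_cont
      a.2.1.continuous la hwl.neg h.s_cpt.isCompact fun x hx => by simp [hwoff x hx]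
    have n2 := integrable_vfi (κ := κ) (lam := lam) hε h.t_lip.continuous h.F_cont
      b.2.1.continuous lb hwl h.s_cpt.isCompact hwoff
    have hz := eq_zero_of_integral_le hwl.continuous
        (HasCompactSupport.intro h.s_cpt.isCompact hwoff) (n1.add n2)
      (by rw [integral_add' n1 n2]; linarith) (c := 1 / 2) (by norm_num) ?_
    · intro x
      have := hz x
      linarith [(le_max_left _ _).trans_eq this]
    filter_upwards [la.ae_hasGradientAt, lb.ae_hasGradientAt, hwl.ae_hasGradientAt]
      with x e1 e2 e3
    simp only [Pi.add_apply, vfi]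
    rw [e3.neg'.gradient, gradient_pos_part hgl.continuous]
    by_cases hx : 0 < va x - (vb x + q * m)
    · rw [if_pos hx, (e1.sub' (e2.add' (hasGradientAt_const x (q * m)))).gradient, add_zero]
      have hxw : w x = va x - (vb x + q * m) := max_eq_left hx.le
      have hxs : x ∈ tsupport s := by
        by_contra hns
        rw [hwoff x hns] at hxw
        linarith
      set B1 := (F x - lam * (va x - t x)) / ε
      set B2 := (F x - lam * (vb x - t x)) / ε
      have hd : B1 - B2 ≤ -(lam / ε * (w x + q * m)) := by
        rw [hxw]
        apply le_of_eq
        simp only [B1, B2]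
        ring
      have hb := pair_bound hε ((hTm a).1.norm_gradient_le x) ((hTm b).1.norm_gradient_le x)
        (hB va (hTm a) x hxs) hd (by have := hw0 x; positivity) (hw0 x) hC
      rw [inner_neg_right]
      have h5 := mul_le_mul_of_nonneg_right (abs_le.1 (hab x)).2 (hw0 x)
      have h7 : va x - vb x = w x + q * m := by rw [hxw]; ring
      have h8 : κ * (va x - vb x) * w x + lam / ε * (w x + q * m) * w x
          = κ * w x ^ 2 + κ * m * w x + lam / ε * w x ^ 2 := by
        rw [h7]
        linear_combination m * w x * hqm
      nlinarith
    · have hxw : w x = 0 := max_eq_right (not_lt.1 hx)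
      rw [if_neg hx, hxw]
      simp
  obtain ⟨V, hV⟩ := exists_fixed_of_sup_contraction (KS M t s)
    (fun v V hv hlim => h.limit_mem hv hlim) (fun b => ⟨T b, hTm b⟩) (by positivity) hq1
    (fun a b m hm hab x => by
      refine abs_sub_le_iff.2 ⟨hkey a b m hm hab x, hkey b a m hm (fun y => ?_) x⟩
      rw [abs_sub_comm]; exact hab y)
    ⟨t, h.self_mem⟩ (m0 := (exists_bound_of_hasCompactSupport h.s_cont h.s_cpt).choose)
    (by
      have := (exists_bound_of_hasCompactSupport h.s_cont h.s_cpt).choose_spec 0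
      exact (abs_nonneg _).trans this)
    (fun x => by
      rw [abs_sub_comm]
      exact ((hTm ⟨t, h.self_mem⟩).2 x).trans ((le_abs_self _).trans
        ((exists_bound_of_hasCompactSupport h.s_cont h.s_cpt).choose_spec x)))
  have hVe : T V = V.1 := congrArg Subtype.val hV
  refine ⟨V.1, V.2, fun ψ hψ hmem => ?_⟩
  have := hT V ψ hψ (by rw [hVe]; exact hmem)
  rw [hVe] at this
  convert this using 2
  funext x
  simp [vfi]

theorem lip_sol (h : Obst M t s F) {ε lam : ℝ} (hε : 0 < ε) (hlam : 0 < lam) {Lt LF : ℝ≥0}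
    (htL : LipschitzWith Lt t) (hFL : LipschitzWith LF F) {v : E2 → ℝ}
    (hv : IsVI ε lam M t s F v) (x y : E2) : |v x - v y| ≤ (Lt + 1 + LF / lam) * ‖x - y‖ := by
  suffices H : ∀ k x : E2, v x - v (x + k) ≤ (Lt + 1 + LF / lam) * ‖k‖ by
    refine abs_sub_le_iff.2 ⟨?_, ?_⟩
    · simpa [norm_sub_rev] using H (y - x) x
    · simpa using H (x - y) y
  intro k
  by_contra! hcon
  obtain ⟨x0, hx0⟩ := hcon
  have hk : 0 < ‖k‖ := by
    rcases (norm_nonneg k).eq_or_lt with h0 | h0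
    · rw [norm_eq_zero.1 h0.symm] at hx0
      simp at hx0
    · exact h0
  obtain ⟨B, hB0, hB⟩ := h.exists_bound ε lam
  set C := Real.exp (M ^ 2 / (2 * ε)) * (M / ε) * B with hC
  set L : ℝ := Lt + 1 + LF / lam with hL
  have hbdd : BddAbove (range fun x => v x - v (x + k)) := by
    refine ⟨M * ‖k‖, ?_⟩
    rintro _ ⟨x, rfl⟩
    have := hv.1.1.dist_le_mul x (x + k)
    rw [Real.dist_eq, dist_eq_norm] at this
    simpa using (le_abs_self _).trans this
  set S := sSup (range fun x => v x - v (x + k))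
  have hSx := fun x => le_csSup hbdd ⟨x, rfl⟩
  set d := lam / ε * ‖k‖ with hd
  have hd0 : 0 < d := by positivity
  set η := 2 * d / (C ^ 2 + 1) with hη
  have hη0 : 0 < η := by positivity
  set m := max (L * ‖k‖) (S - η)
  have hmS : m < S := max_lt (hx0.trans_le (hSx x0)) (by linarith)
  obtain ⟨_, ⟨x1, rfl⟩, hx1⟩ := exists_lt_of_lt_csSup (range_nonempty _) hmS
  have hLm : L * ‖k‖ ≤ m := le_max_left _ _
  have hLt : (Lt + 1 : ℝ) * ‖k‖ ≤ m := by
    refine le_trans ?_ hLm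
    rw [hL]
    have : 0 ≤ LF / lam * ‖k‖ := by positivity
    nlinarith
  have ht1 := fun x y => by
    have := htL.dist_le_mul x y
    rw [Real.dist_eq, dist_eq_norm] at this
    exact (le_abs_self _).trans this
  have hF1 := fun x y => by
    have := hFL.dist_le_mul x y
    rw [Real.dist_eq, dist_eq_norm] at this
    exact (le_abs_self _).trans this
  have hs1 := fun x y => (le_abs_self _).trans (h.s_lip x y)
  have lv := isLip_of_mem hv.1
  set w : E2 → ℝ := fun x => max (v x - (v (x + k) + m)) 0 with hw
  have hgl : IsLip fun x => v x - (v (x + k) + m) := lv.sub ((lv.translate k).add (isLip_const _))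
  have hwl : IsLip w := hgl.max (isLip_const 0)
  have hw0 x : 0 ≤ w x := le_max_right _ _
  have hlow x : t x - s x ≤ v (x + k) + m := by
    have h1 := (abs_le.1 (hv.1.2 (x + k))).1
    have h2 := ht1 x (x + k)
    have h3 := hs1 (x + k) x
    simp only [sub_add_cancel_left, norm_neg, add_sub_cancel_left] at h2 h3
    nlinarith
  have hhigh x : v (x - k) - m ≤ t x + s x := by
    have h1 := (abs_le.1 (hv.1.2 (x - k))).2
    have h2 := ht1 (x - k) x
    have h3 := hs1 (x - k) x
    simp only [sub_sub_cancel_left, norm_neg] at h2 h3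
    nlinarith
  have hwoff x : x ∉ tsupport s → w x = 0 := fun hx => by
    refine max_eq_right ?_
    have e1 := h.eq_off hv.1 hx
    have := hlow x
    rw [image_eq_zero_of_notMem_tsupport hx] at this
    linarith
  have hwoff2 x : x ∉ tsupport s → w (x - k) = 0 := fun hx => by
    refine max_eq_right ?_
    have e1 := h.eq_off hv.1 hx
    have := hhigh x
    rw [image_eq_zero_of_notMem_tsupport hx] at this
    rw [sub_add_cancel]
    linarith
  have m1 : (fun x => v x + -w x) ∈ KS M t s := by
    refine min_mem hv.1 ?_ hlow
    have := LipschitzWith.of_dist_le_mul fun x y => by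
      simpa using hv.1.1.dist_le_mul (x + k) (y + k)
    simpa using this.add (LipschitzWith.const m)
  set w' : E2 → ℝ := fun x => w (x - k) with hw'
  have hwl' : IsLip w' := by
    simpa [hw', sub_eq_add_neg] using hwl.translate (-k)
  have m2 : (fun x => v x + w' x) ∈ KS M t s := by
    have := max_mem hv.1 (z := fun x => v (x - k) - m) ?_ hhigh
    · simp only [hw', hw, sub_add_cancel]
      convert this using 4
      ring
    · have := LipschitzWith.of_dist_le_mul fun x y => by
        simpa using hv.1.1.dist_le_mul (x - k) (y - k)
      simpa using this.sub (LipschitzWith.const m)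
  have i1 := hv.2 _ hwl.neg m1
  have i2 := hv.2 _ hwl' m2
  have htc := h.t_lip.continuous
  have n1 := integrable_vfi (κ := 0) (lam := lam) hε htc h.F_cont htc lv hwl.neg
    h.s_cpt.isCompact fun x hx => by simp [hwoff x hx]
  have n2 := integrable_vfi (κ := 0) (lam := lam) hε htc h.F_cont htc lv hwl'
    h.s_cpt.isCompact hwoff2
  have n2' := n2.comp_add_right k
  rw [← integral_add_right_eq_self _ k] at i2
  have hz := eq_zero_of_integral_le hwl.continuous (HasCompactSupport.intro h.s_cpt.isCompact hwoff)
      (n1.add n2')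
    (by rw [integral_add' n1 n2']; linarith) (c := d / (2 * η)) (by positivity) ?_
  · have := hz x1
    linarith [(le_max_left _ _).trans_eq this]
  filter_upwards [lv.ae_hasGradientAt, (lv.translate k).ae_hasGradientAt, hwl.ae_hasGradientAt] with
    x e1 e2 e3
  have ew : w' (x + k) = w x := by simp [hw']
  have egw : ∇ w' (x + k) = ∇ w x := by
    rw [← gradient_translate]
    congr 1
    funext y
    simp [hw']
  rw [gradient_translate] at e2
  simp only [Pi.add_apply, vfi]
  rw [ew, egw, e3.neg'.gradient, gradient_pos_part hgl.continuous]
  by_cases hx : 0 < v x - (v (x + k) + m)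
  · rw [if_pos hx, (e1.sub' (e2.add' (hasGradientAt_const x m))).gradient, add_zero]
    have hxw : w x = v x - (v (x + k) + m) := max_eq_left hx.le
    have hxs : x ∈ tsupport s := by
      by_contra hns
      rw [hwoff x hns] at hxw
      linarith
    have hwη : w x ≤ η := by
      have h1 := hSx x
      have h2 : S - η ≤ m := le_max_right _ _
      rw [hxw]; linarith
    set B1 := (F x - lam * (v x - t x)) / ε
    set B2 := (F (x + k) - lam * (v (x + k) - t (x + k))) / ε
    have hd' : B1 - B2 ≤ -d := by
      have h1 := hF1 x (x + k)
      have h2 := ht1 x (x + k)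
      simp only [sub_add_cancel_left, norm_neg] at h1 h2
      have h3 : lam * (v x - v (x + k)) ≥ lam * (L * ‖k‖) := by
        apply mul_le_mul_of_nonneg_left _ hlam.le
        linarith
      have h4 : lam * (L * ‖k‖) = lam * Lt * ‖k‖ + lam * ‖k‖ + LF * ‖k‖ := by
        rw [hL]; field_simp
      have h5 := mul_le_mul_of_nonneg_left h2 hlam.le
      simp only [B1, B2, hd]
      rw [← sub_div, div_mul_eq_mul_div, ← neg_div]
      gcongr
      linarith
    have hb := pair_bound hε (hv.1.1.norm_gradient_le x) (hv.1.1.norm_gradient_le (x + k))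
      (hB v hv.1 x hxs) hd' hd0.le (hw0 x) hC
    rw [inner_neg_right]
    have hηd : C ^ 2 / 4 * η ≤ d / 2 := by
      rw [hη]
      have : C ^ 2 / 4 * (2 * d / (C ^ 2 + 1)) = d / 2 * (C ^ 2 / (C ^ 2 + 1)) := by
        field_simp; ring
      rw [this]
      exact mul_le_of_le_one_right (by positivity) ((div_le_one (by positivity)).2 (by linarith))
    have h1 : C ^ 2 / 4 * w x ^ 2 ≤ d / 2 * w x := by
      nlinarith [mul_le_mul_of_nonneg_left hwη (by positivity : 0 ≤ C ^ 2 / 4)]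
    have h2 : d / (2 * η) * w x ^ 2 ≤ d / 2 * w x := by
      have : d / (2 * η) * w x ^ 2 = d / 2 * w x * (w x / η) := by field_simp
      rw [this]
      exact mul_le_of_le_one_right (by have := hw0 x; positivity) ((div_le_one hη0).2 hwη)
    linarith
  · have hxw : w x = 0 := max_eq_right (not_lt.1 hx)
    rw [if_neg hx, hxw]
    simp

end Obst

theorem eventually_close {M : ℝ≥0} {v : ℕ → E2 → ℝ} {V : E2 → ℝ} {l : Filter ℕ}
    (hv : ∀ n, LipschitzWith M (v n)) (hV : LipschitzWith M V)
    (hlim : ∀ x, Tendsto (fun n => v n x) l (𝓝 (V x))) {K : Set E2} (hK : IsCompact K)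
    {η : ℝ} (hη : 0 < η) : ∀ᶠ n in l, ∀ x ∈ K, |v n x - V x| ≤ η := by
  have hr : 0 < η / (4 * (M + 1)) := by positivity
  obtain ⟨T, hTK, hTf, hcov⟩ := hK.finite_cover_balls hr
  have h1 : ∀ᶠ n in l, ∀ y ∈ T, |v n y - V y| < η / 2 := by
    refine (Set.Finite.eventually_all hTf).2 fun y _ => ?_
    filter_upwards [(tendsto_iff_dist_tendsto_zero.1 (hlim y)).eventually
      (gt_mem_nhds (half_pos hη))] with n hn
    rwa [Real.dist_eq] at hn
  filter_upwards [h1] with n hn x hx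
  obtain ⟨y, hyT, hxy⟩ := mem_iUnion₂.1 (hcov hx)
  rw [mem_ball] at hxy
  have h2 := (hv n).dist_le_mul x y
  have h3 := hV.dist_le_mul x y
  have h4 := hn y hyT
  have h5 : M * dist x y ≤ η / 4 := by
    calc M * dist x y ≤ (M + 1) * (η / (4 * (M + 1))) := by gcongr; linarith
      _ = η / 4 := by field_simp
  rw [Real.dist_eq] at h2 h3
  have e : v n x - V x = (v n x - v n y) + (v n y - V y) - (V x - V y) := by ring
  rw [e]
  refine (abs_sub _ _).trans ?_
  refine (add_le_add_left (abs_add_le _ _) _).trans ?_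
  linarith

/-- Divergence form of the regularised operator on smooth functions. -/
theorem integral_Aop_smooth {φ ψ : E2 → ℝ} (hφ : ContDiff ℝ 2 φ) (hc : HasCompactSupport φ)
    (hψ : IsLip ψ) {ε : ℝ} (hε : 0 < ε) :
    ∫ x, ⟪Aop ε (∇ φ x), ∇ ψ x⟫
      = ∫ x, -(om ε (∇ φ x) * (lap φ x + infLap φ x / ε)) * ψ x := by
  have hp := fun i =>
    contDiff_iff_contDiffAt.2 fun x => pd_contDiffAt hφ.contDiffAt i
  have hom : (fun x => om ε (∇ φ x)) = fun x =>
      Real.exp ((pd 0 φ x ^ 2 + pd 1 φ x ^ 2) / (2 * ε)) := by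
    funext x
    rw [om, ← e2_norm_sq, gradient_apply, gradient_apply]
  have hoc : ContDiff ℝ 1 (fun x => om ε (∇ φ x)) := by
    rw [hom]
    have := hp 0
    have := hp 1
    fun_prop
  have hB := fun i => hoc.mul (hp i)
  have hpc : ∀ i, HasCompactSupport (pd i φ) := fun i =>
    (hc.fderiv (𝕜 := ℝ)).mono fun x hx => by
      simp only [Function.mem_support, pd] at hx ⊢
      exact fun h => hx (by rw [h]; rfl)
  have hBc : ∀ i, HasCompactSupport fun x => om ε (∇ φ x) * pd i φ x := fun i =>
    (hpc i).mul_left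
  have hib := fun i => hψ.integral_pd ((fun i => (hB i).isLip (hBc i)) i) (hBc i) i
  have hin i : Integrable fun x => (∇ ψ x) i * (om ε (∇ φ x) * pd i φ x) := by
    obtain ⟨b, hb0, hb⟩ := hψ.exists_bound
    obtain ⟨D, hD⟩ := (hBc i).exists_bound_of_continuous (hB i).continuous
    refine integrable_of_bdd_compact (K := tsupport fun x => om ε (∇ φ x) * pd i φ x) ?_
      (hBc i) (b * D) (fun x => ?_) (fun x hx => ?_)
    · have := (EuclideanSpace.proj (𝕜 := ℝ) i).continuous.measurable.comp (measurable_gradient ψ)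
      exact (this.mul (hB i).continuous.measurable).aestronglyMeasurable
    · rw [abs_mul]
      exact mul_le_mul ((PiLp.norm_apply_le (∇ ψ x) i).trans (hb x)) (hD x) (abs_nonneg _) hb0
    · rw [image_eq_zero_of_notMem_tsupport hx, mul_zero]
  have hin2 i : Integrable fun x => ψ x * (∇ (fun x => om ε (∇ φ x) * pd i φ x) x) i := by
    have hcg : Continuous fun x => (∇ (fun x => om ε (∇ φ x) * pd i φ x) x) i := by
      simp only [gradient_apply, pd]
      exact ((hB i).continuous_fderiv (by norm_num)).clm_apply continuous_const
    refine Continuous.integrable_of_hasCompactSupport (hψ.continuous.mul hcg) ?_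
    refine HasCompactSupport.mul_left ?_
    refine ((hBc i).fderiv (𝕜 := ℝ)).mono fun x hx => ?_
    simp only [Function.mem_support, gradient_apply, pd] at hx ⊢
    exact fun h => hx (by rw [h]; rfl)
  have hd : ∀ x i, (∇ (fun x => om ε (∇ φ x) * pd i φ x) x) i
      = om ε (∇ φ x) * (pd2 i i φ x
        + (pd i φ x * pd 0 φ x * pd2 i 0 φ x + pd i φ x * pd 1 φ x * pd2 i 1 φ x) / ε) := by
    intro x i
    rw [gradient_apply]
    have hd' : ∀ j, HasFDerivAt (pd j φ) (fderiv ℝ (pd j φ) x) x := fun j =>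
      ((hp j).differentiable (by norm_num)).differentiableAt.hasFDerivAt
    have hfun : (fun x => om ε (∇ φ x) * pd i φ x) = fun x =>
        Real.exp ((2 * ε)⁻¹ * (pd 0 φ x ^ 2 + pd 1 φ x ^ 2)) * pd i φ x := by
      funext y
      rw [congrFun hom y]
      congr 2
      ring
    have e0 : om ε (∇ φ x) = Real.exp ((2 * ε)⁻¹ * (pd 0 φ x ^ 2 + pd 1 φ x ^ 2)) := by
      rw [congrFun hom x]
      congr 1
      ring
    rw [hfun, e0, pd]
    erw [(((((hd' 0).pow 2).add ((hd' 1).pow 2)).const_mul (2 * ε)⁻¹).exp.mul (hd' i)).fderiv]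
    simp only [pd2, pd, add_apply, smul_apply, smul_eq_mul,
      Pi.add_apply]
    field_simp
    simp
    ring
  calc ∫ x, ⟪Aop ε (∇ φ x), ∇ ψ x⟫
      = ∫ x, ((∇ ψ x) 0 * (om ε (∇ φ x) * pd 0 φ x) + (∇ ψ x) 1 * (om ε (∇ φ x) * pd 1 φ x)) := by
        refine integral_congr_ae (Eventually.of_forall fun x => ?_)
        simp only [Aop, PiLp.inner_apply, Fin.sum_univ_two, PiLp.smul_apply, gradient_apply]
        simp
    _ = _ := by
        rw [integral_add (hin 0) (hin 1), hib 0, hib 1, ← neg_add,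
          ← integral_add (hin2 0) (hin2 1), ← integral_neg]
        refine integral_congr_ae (Eventually.of_forall fun x => ?_)
        simp only [hd, lap, infLap, Fin.sum_univ_two]
        field_simp
        ring

theorem vfi_neg_data (ε lam : ℝ) (t F v ψ : E2 → ℝ) (x : E2) :
    vfi ε lam 0 (fun y => -t y) (fun y => -F y) (fun y => -t y) (fun y => -v y) ψ x
      = vfi ε lam 0 t F t v (fun y => -ψ y) x := by
  have hg : ∀ w : E2 → ℝ, ∇ (fun y => -w y) x = -∇ w x := fun w => by
    ext i
    simp [gradient_apply, pd_neg]
  simp only [vfi, hg, Aop, om, norm_neg, inner_neg_right, smul_neg, inner_neg_left]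
  ring

theorem KS_neg {M : ℝ≥0} {t s v : E2 → ℝ} (h : v ∈ KS M t s) :
    (fun y => -v y) ∈ KS M (fun y => -t y) s :=
  ⟨h.1.neg, fun x => by
    have := h.2 x
    rwa [← abs_neg, show -(-v x - -t x) = v x - t x by ring]⟩

theorem Obst.neg {M : ℝ≥0} {t s F : E2 → ℝ} (h : Obst M t s F) :
    Obst M (fun y => -t y) s (fun y => -F y) :=
  ⟨h.s_nonneg, h.s_lip, h.s_cpt, h.t_lip.neg, h.F_cont.neg⟩

theorem IsVI.neg {ε lam : ℝ} {M : ℝ≥0} {t s F v : E2 → ℝ} (h : IsVI ε lam M t s F v) :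
    IsVI ε lam M (fun y => -t y) s (fun y => -F y) (fun y => -v y) := by
  refine ⟨KS_neg h.1, fun ψ hψ hmem => ?_⟩
  simp only [vfi_neg_data]
  refine h.2 _ hψ.neg ?_
  simpa [add_comm] using KS_neg hmem

/-- One-sided variations are admissible away from the corresponding obstacle. -/
theorem IsVI.perturb {ε lam : ℝ} {M L : ℝ≥0} {t s F v ψ : E2 → ℝ}
    (h : IsVI ε lam M t s F v) (ho : Obst M t s F) (hL : LipschitzWith L v) (hLM : L + 1 ≤ M)
    (hψ : IsLip ψ) (hc : HasCompactSupport ψ)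
    (hup : (∀ x, ψ x ≤ 0) ∨ ∀ x ∈ tsupport ψ, v x < t x + s x)
    (hlow : (∀ x, 0 ≤ ψ x) ∨ ∀ x ∈ tsupport ψ, t x - s x < v x) :
    0 ≤ ∫ x, vfi ε lam 0 t F t v ψ x := by
  obtain ⟨Cψ, hCψ⟩ := id hψ
  obtain ⟨b, hb⟩ := exists_bound_of_hasCompactSupport hψ.continuous hc
  have hb0 := (abs_nonneg _).trans (hb 0)
  have hvc := h.1.1.continuous
  have htc := ho.t_lip.continuous
  have hsc := ho.s_cont
  have hcup : ∃ c > 0, ∀ x, v x + c * ψ x ≤ t x + s x ∧ c ≤ 1 := by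
    rcases hup with hup | hup
    · refine ⟨1, one_pos, fun x => ⟨?_, le_rfl⟩⟩
      have := hup x
      linarith [(abs_le.1 (h.1.2 x)).2]
    · by_cases hne : (tsupport ψ).Nonempty
      · obtain ⟨x0, hx0, hmin⟩ := hc.isCompact.exists_isMinOn hne
          (f := fun x => t x + s x - v x) (by fun_prop)
        have hp : 0 < t x0 + s x0 - v x0 := by linarith [hup x0 hx0]
        refine ⟨min 1 ((t x0 + s x0 - v x0) / (b + 1)), by positivity,
          fun x => ⟨?_, min_le_left _ _⟩⟩
        by_cases hx : x ∈ tsupport ψ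
        · have h1 : t x0 + s x0 - v x0 ≤ t x + s x - v x := hmin hx
          have h2 : min 1 ((t x0 + s x0 - v x0) / (b + 1)) * ψ x
              ≤ (t x0 + s x0 - v x0) / (b + 1) * (b + 1) :=
            mul_le_mul_of_nonneg (min_le_right _ _)
              ((le_abs_self _).trans ((hb x).trans (by linarith))) (by positivity)
              (by positivity)
          rw [div_mul_cancel₀ _ (by positivity)] at h2
          linarith
        · rw [image_eq_zero_of_notMem_tsupport hx]
          linarith [(abs_le.1 (h.1.2 x)).2]
      · refine ⟨1, one_pos, fun x => ⟨?_, le_rfl⟩⟩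
        rw [image_eq_zero_of_notMem_tsupport (fun hx => hne ⟨x, hx⟩)]
        linarith [(abs_le.1 (h.1.2 x)).2]
  have hclow : ∃ c > 0, ∀ x, t x - s x ≤ v x + c * ψ x ∧ c ≤ 1 := by
    rcases hlow with hlow | hlow
    · refine ⟨1, one_pos, fun x => ⟨?_, le_rfl⟩⟩
      have := hlow x
      linarith [(abs_le.1 (h.1.2 x)).1]
    · by_cases hne : (tsupport ψ).Nonempty
      · obtain ⟨x0, hx0, hmin⟩ := hc.isCompact.exists_isMinOn hne
          (f := fun x => v x - (t x - s x)) (by fun_prop)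
        have hp : 0 < v x0 - (t x0 - s x0) := by linarith [hlow x0 hx0]
        refine ⟨min 1 ((v x0 - (t x0 - s x0)) / (b + 1)), by positivity,
          fun x => ⟨?_, min_le_left _ _⟩⟩
        by_cases hx : x ∈ tsupport ψ
        · have h1 : v x0 - (t x0 - s x0) ≤ v x - (t x - s x) := hmin hx
          have h2 : min 1 ((v x0 - (t x0 - s x0)) / (b + 1)) * -ψ x
              ≤ (v x0 - (t x0 - s x0)) / (b + 1) * (b + 1) :=
            mul_le_mul_of_nonneg (min_le_right _ _)
              ((neg_le_abs _).trans ((hb x).trans (by linarith))) (by positivity)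
              (by positivity)
          rw [div_mul_cancel₀ _ (by positivity)] at h2
          linarith
        · rw [image_eq_zero_of_notMem_tsupport hx]
          linarith [(abs_le.1 (h.1.2 x)).1]
      · refine ⟨1, one_pos, fun x => ⟨?_, le_rfl⟩⟩
        rw [image_eq_zero_of_notMem_tsupport (fun hx => hne ⟨x, hx⟩)]
        linarith [(abs_le.1 (h.1.2 x)).1]
  obtain ⟨c1, hc1, h1⟩ := hcup
  obtain ⟨c2, hc2, h2⟩ := hclow
  set c := min (min c1 c2) (1 / (Cψ + 1))
  have hc0 : 0 < c := by positivity
  have hmem : (fun x => v x + c * ψ x) ∈ KS M t s := by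
    refine ⟨LipschitzWith.of_dist_le_mul fun x y => ?_, fun x => abs_le.2 ⟨?_, ?_⟩⟩
    · have e1 := hL.dist_le_mul x y
      rw [Real.dist_eq] at *
      have e : v x + c * ψ x - (v y + c * ψ y) = (v x - v y) + c * (ψ x - ψ y) := by ring
      rw [e]
      refine (abs_add_le _ _).trans ?_
      rw [abs_mul, abs_of_pos hc0]
      have hLM' : (L : ℝ) + 1 ≤ M := by exact_mod_cast hLM
      have e3 : c * |ψ x - ψ y| ≤ 1 * dist x y := by
        calc c * |ψ x - ψ y| ≤ 1 / (Cψ + 1) * (Cψ * dist x y) :=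
              mul_le_mul (min_le_right _ _) (hCψ.dist_le_mul x y) (abs_nonneg _) (by positivity)
          _ = Cψ / (Cψ + 1) * dist x y := by ring
          _ ≤ 1 * dist x y := by
              gcongr
              exact (div_le_one (by positivity)).2 (by linarith)
      nlinarith [dist_nonneg (x := x) (y := y)]
    · have hx1 := (h1 x).1
      have hx2 := (h2 x).1
      have hv1 := abs_le.1 (h.1.2 x)
      rcases le_total 0 (ψ x) with hs | hs
      · have : 0 ≤ c * ψ x := by positivity
        linarith
      · have : c2 * ψ x ≤ c * ψ x :=
          mul_le_mul_of_nonpos_right ((min_le_left _ _).trans (min_le_right _ _)) hs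
        linarith
    · have hx1 := (h1 x).1
      have hv1 := abs_le.1 (h.1.2 x)
      rcases le_total 0 (ψ x) with hs | hs
      · have : c * ψ x ≤ c1 * ψ x :=
          mul_le_mul_of_nonneg_right ((min_le_left _ _).trans (min_le_left _ _)) hs
        linarith
      · linarith [mul_nonpos_of_nonneg_of_nonpos hc0.le hs]
  have h3 := h.2 _ (hψ.const_mul c) hmem
  have h4 : ∫ x, vfi ε lam 0 t F t v (fun x => c * ψ x) x
      = c * ∫ x, vfi ε lam 0 t F t v ψ x := by
    rw [← integral_const_mul]
    refine integral_congr_ae ?_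
    filter_upwards [hψ.ae_hasGradientAt] with x hx
    simp only [vfi]
    rw [(hx.const_mul' c).gradient, inner_smul_right]
    ring
  rw [h4] at h3
  exact nonneg_of_mul_nonneg_right h3 hc0

theorem contDiff_pd {φ : E2 → ℝ} (hφ : ContDiff ℝ 2 φ) (i : Fin 2) : ContDiff ℝ 1 (pd i φ) :=
  contDiff_iff_contDiffAt.2 fun _ => pd_contDiffAt hφ.contDiffAt i

theorem continuous_pd {φ : E2 → ℝ} (hφ : ContDiff ℝ 1 φ) (i : Fin 2) : Continuous (pd i φ) :=
  (hφ.continuous_fderiv (by norm_num)).clm_apply continuous_const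

theorem continuous_pd2 {φ : E2 → ℝ} (hφ : ContDiff ℝ 2 φ) (i j : Fin 2) : Continuous (pd2 i j φ) :=
  continuous_pd (contDiff_pd hφ j) i

theorem continuous_infLap {φ : E2 → ℝ} (hφ : ContDiff ℝ 2 φ) : Continuous (infLap φ) := by
  have h1 := fun i => (contDiff_pd hφ i).continuous
  have h2 := continuous_pd2 hφ
  unfold infLap
  fun_prop

theorem continuous_lap {φ : E2 → ℝ} (hφ : ContDiff ℝ 2 φ) : Continuous (lap φ) :=
  (continuous_pd2 hφ 0 0).add (continuous_pd2 hφ 1 1)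

theorem infLap_add_sq {φ : E2 → ℝ} (hφ : ContDiff ℝ 2 φ) (δ : ℝ) (x0 : E2) :
    infLap (fun y => φ y + δ * ‖y - x0‖ ^ 2) x0 = infLap φ x0 + 2 * δ * gradSq φ x0 := by
  have hq := fun y => by
    simpa using! ((hasFDerivAt_id (𝕜 := ℝ) y).sub_const x0).norm_sq
  have h1 j : pd j (fun y => φ y + δ * ‖y - x0‖ ^ 2)
      = fun y => pd j φ y + 2 * δ * (y - x0) j := by
    funext y
    have h := ((hφ.differentiable (by norm_num)).differentiableAt).hasFDerivAt.add
      ((hq y).const_mul δ)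
    simp only [pd]
    erw [h.fderiv]
    simp [EuclideanSpace.inner_single_right]
    ring
  have h2 i j : pd2 i j (fun y => φ y + δ * ‖y - x0‖ ^ 2) x0
      = pd2 i j φ x0 + 2 * δ * (if i = j then 1 else 0) := by
    rw [pd2, h1]
    have hc : HasFDerivAt (fun y => (y - x0) j) (EuclideanSpace.proj (𝕜 := ℝ) j) x0 := by
      simpa using! ((EuclideanSpace.proj (𝕜 := ℝ) j : E2 →L[ℝ] ℝ).hasFDerivAt
       ).sub_const (x0 j)
    have h := (((contDiff_pd hφ j).differentiable (by norm_num)).differentiableAt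
     ).hasFDerivAt.add (hc.const_mul (2 * δ))
    rw [pd]
    erw [h.fderiv]
    simp [pd2, pd, eq_comm]
  have h3 j : pd j (fun y => φ y + δ * ‖y - x0‖ ^ 2) x0 = pd j φ x0 := by
    rw [h1]; simp
  simp only [infLap, h2, h3, gradSq, Fin.sum_univ_two]
  simp
  ring

theorem bump_quadratic_bound {C d η w : ℝ} (hd : 0 < d) (hη : 0 < η)
    (hηd : η ≤ 2 * d / (C ^ 2 + 1)) (hw0 : 0 ≤ w) (hwη : w ≤ η) :
    C ^ 2 / 4 * w ^ 2 - d * w ≤ -(d / (2 * η) * w ^ 2) := by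
  have hηd : C ^ 2 / 4 * η ≤ d / 2 := by
    rw [le_div_iff₀ (by positivity)] at hηd
    nlinarith
  have h1 : C ^ 2 / 4 * w ^ 2 ≤ d / 2 * w := by
    nlinarith [mul_le_mul_of_nonneg_left hwη (by positivity : 0 ≤ C ^ 2 / 4)]
  have h2 : d / (2 * η) * w ^ 2 ≤ d / 2 * w := by
    have : d / (2 * η) * w ^ 2 = d / 2 * w * (w / η) := by field_simp
    rw [this]
    exact mul_le_of_le_one_right (by positivity) ((div_le_one hη).2 hwη)
  linarith

theorem div_sub_neg_le {a b c d e : ℝ} (he : 0 < e) (h : a + e * b + c ≤ -d) :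
    a / e - -(b + c / e) ≤ -(d / e) := by
  have : a / e - -(b + c / e) = (a + e * b + c) / e := by field_simp; ring
  rw [this, ← neg_div]
  gcongr

set_option maxHeartbeats 1000000 in
/-- Half-relaxed stability: limits of the regularised problems are viscosity subsolutions away from
the lower obstacle. -/
theorem visc_limit {M L : ℝ≥0} {t s F : E2 → ℝ} (ho : Obst M t s F) (hLM : L + 1 ≤ M) {lam : ℝ}
    (hlam : 0 < lam) {ε : ℕ → ℝ} (hε : ∀ n, 0 < ε n) {l : Filter ℕ} [l.NeBot]
    (hε0 : Tendsto ε l (𝓝 0)) {v : ℕ → E2 → ℝ} (hv : ∀ n, IsVI (ε n) lam M t s F (v n))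
    (hL : ∀ n, LipschitzWith L (v n)) {V : E2 → ℝ}
    (hlim : ∀ x, Tendsto (fun n => v n x) l (𝓝 (V x))) :
    ViscSub {x | t x - s x < V x} (fun x => F x - lam * (V x - t x)) V := by
  intro x0 hx0 φ hφ hmax
  have hVm := ho.limit_mem (fun n => (hv n).1) hlim
  have hVc := hVm.1.continuous
  have htc := ho.t_lip.continuous
  have hsc := ho.s_cont
  have hFc := ho.F_cont
  by_contra! hcon
  set G := gradSq φ x0
  have hG0 : 0 ≤ G := by unfold G gradSq; positivity
  set gap := -infLap φ x0 - (F x0 - lam * (V x0 - t x0))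
  have hgap0 : 0 < gap := by linarith
  set δ := gap / (4 * (G + 1)) with hδ
  have hδ0 : 0 < δ := by positivity
  have hφ1 : ContDiff ℝ 2 fun y => φ y + δ * ‖y - x0‖ ^ 2 := by
    have : ContDiff ℝ 2 fun y : E2 => ‖y - x0‖ ^ 2 := (contDiff_id.sub contDiff_const).norm_sq ℝ
    fun_prop
  obtain ⟨Φ, hΦ, hΦc, hΦe⟩ := exists_contDiff_cutoff (x := x0) hφ1.contDiffAt
  have hIL := infLap_congr hΦe
  rw [infLap_add_sq hφ] at hIL
  set E : E2 → ℝ := fun x => F x - lam * (V x - t x) + infLap Φ x with hE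
  have hEc : Continuous E := by
    have := continuous_infLap hΦ
    fun_prop
  set δ0 := gap / 8 with hδ0'
  have hE0 : E x0 < -(3 * δ0) := by
    have h1 : δ * G ≤ gap / 4 := by
      rw [hδ, div_mul_eq_mul_div, div_le_div_iff₀ (by positivity) (by positivity)]
      nlinarith
    simp only [hE, hIL]
    nlinarith
  set κ0 := (V x0 - (t x0 - s x0)) / 2 with hκ0
  have hκ00 : 0 < κ0 := by
    have : t x0 - s x0 < V x0 := hx0
    linarith
  have hK0 : ∀ᶠ x in 𝓝 x0, κ0 < V x - (t x - s x) := by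
    have : Continuous fun x => V x - (t x - s x) := by fun_prop
    exact this.continuousAt.eventually (lt_mem_nhds (by linarith))
  obtain ⟨ρ', hρ'0, hρ'⟩ := Metric.eventually_nhds_iff_ball.1
    (((hEc.continuousAt.eventually (gt_mem_nhds hE0)).and hK0).and (hΦe.and hmax))
  set ρ := ρ' / 2 with hρ
  have hρ0 : 0 < ρ := by positivity
  have hball : ∀ x ∈ closedBall x0 ρ, E x < -(3 * δ0) ∧ κ0 < V x - (t x - s x) ∧
      Φ x = φ x + δ * ‖x - x0‖ ^ 2 ∧ V x - φ x ≤ V x0 - φ x0 := fun x hx => by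
    obtain ⟨⟨h1, h2⟩, h3, h4⟩ := hρ' x (closedBall_subset_ball (by linarith) hx)
    exact ⟨h1, h2, h3, h4⟩
  have hKc : IsCompact (closedBall x0 ρ) := isCompact_closedBall _ _
  obtain ⟨A, hA⟩ := hKc.exists_bound_of_continuousOn (continuous_lap hΦ).continuousOn
  set η1 := min (κ0 / 2) (min (δ0 / lam) (δ * ρ ^ 2 / 16))
  have hη10 : 0 < η1 := by positivity
  have hev2 : ∀ᶠ n in l, ε n * (|A| + 1) < δ0 := by
    have : Tendsto (fun n => ε n * (|A| + 1)) l (𝓝 0) := by simpa using hε0.mul_const (|A| + 1)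
    exact this.eventually (gt_mem_nhds (by positivity))
  obtain ⟨n, hn1, hn2⟩ := ((eventually_close (fun n => (hv n).1.1) hVm.1 hlim hKc hη10).and
      hev2).exists
  have hεn := hε n
  set e := ε n
  set z := v n
  have hzVI := hv n
  have lz : IsLip z := ⟨M, hzVI.1.1⟩
  have lΦ := (hΦ.of_le (by norm_num)).isLip hΦc
  have hzc := lz.continuous
  have hΦcont := hΦ.continuous
  obtain ⟨B, hB⟩ := hKc.exists_bound_of_continuousOn
    (f := fun x => (F x - lam * (z x - t x)) / e) (by fun_prop)
  obtain ⟨bΦ, hbΦ0, hbΦ⟩ := lΦ.exists_bound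
  set M' := max (M : ℝ) bΦ
  set C := Real.exp (M' ^ 2 / (2 * e)) * (M' / e) * B with hC
  set d := δ0 / e
  have hd0 : 0 < d := by positivity
  set η := min (2 * d / (C ^ 2 + 1)) (δ * ρ ^ 2 / 16)
  have hη0 : 0 < η := by positivity
  obtain ⟨x1, hx1, hmax1⟩ := hKc.exists_isMaxOn ⟨x0, mem_closedBall_self hρ0.le⟩
    (f := fun x => z x - Φ x) (by fun_prop)
  set S := z x1 - Φ x1
  have hSx : ∀ x ∈ closedBall x0 ρ, z x - Φ x ≤ S := fun x hx => hmax1 hx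
  set m := S - η with hm
  set w : E2 → ℝ := fun x => max (z x - (Φ x + m)) 0 with hw
  have hgl : IsLip fun x => z x - (Φ x + m) := lz.sub (lΦ.add (isLip_const _))
  let χ : ContDiffBump x0 := ⟨ρ / 2, ρ, by positivity, by linarith⟩
  set ψ : E2 → ℝ := fun x => w x * χ x with hψ
  have hψl : IsLip ψ := (hgl.max (isLip_const 0)).mul_compact
      ((χ.contDiff (n := 1)).isLip χ.hasCompactSupport) χ.hasCompactSupport
  have hψc : HasCompactSupport ψ := χ.hasCompactSupport.mul_left
  have hψ0 x : 0 ≤ ψ x := mul_nonneg ((fun x => le_max_right _ _) x) χ.nonneg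
  have hψsub : tsupport ψ ⊆ closedBall x0 ρ :=
    (closure_mono (Function.support_mul_subset_right _ _)).trans χ.tsupport_eq.subset
  have hann : ∀ x ∈ closedBall x0 ρ, x ∉ ball x0 (ρ / 2) → z x - (Φ x + m) ≤ 0 := by
    intro x hx hx2
    rw [mem_ball, not_lt, dist_eq_norm] at hx2
    obtain ⟨-, -, h3, h4⟩ := hball x hx
    obtain ⟨-, -, h3', -⟩ := hball x0 (mem_closedBall_self hρ0.le)
    have h5 := (abs_le.1 (hn1 x hx)).2
    have h6 := (abs_le.1 (hn1 x0 (mem_closedBall_self hρ0.le))).1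
    have h7 := hSx x0 (mem_closedBall_self hρ0.le)
    have h8 : η1 ≤ δ * ρ ^ 2 / 16 := (min_le_right _ _).trans (min_le_right _ _)
    have h9 : η ≤ δ * ρ ^ 2 / 16 := min_le_right _ _
    have h10 : δ * (ρ / 2) ^ 2 ≤ δ * ‖x - x0‖ ^ 2 := by gcongr
    simp only [sub_self, norm_zero] at h3'
    have h11 : 0 < δ * ρ ^ 2 := by positivity
    simp only [hm]
    nlinarith
  have hψoff : ∀ x, x ∉ ball x0 (ρ / 2) → ψ x = 0 := by
    intro x hx
    by_cases hx2 : x ∈ closedBall x0 ρ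
    · simp only [hψ, hw]
      rw [max_eq_right (hann x hx2 hx), zero_mul]
    · exact image_eq_zero_of_notMem_tsupport fun h => hx2 (hψsub h)
  have hψon : ∀ x ∈ ball x0 (ρ / 2), ψ x = w x := fun x hx => by
    simp only [hψ]
    rw [χ.one_of_mem_closedBall (ball_subset_closedBall hx), mul_one]
  have i1 := hzVI.perturb ho (hL n) hLM hψl.neg (by simpa using! hψc.neg)
    (Or.inl fun x => by linarith [hψ0 x]) (Or.inr fun x hx => by
      have hx' := hψsub (by
        have : tsupport (fun x => -ψ x) = tsupport ψ := by simp [tsupport]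
        rwa [this] at hx)
      have h1 := (hball x hx').2.1
      have h2 := (abs_le.1 (hn1 x hx')).1
      have h3 : η1 ≤ κ0 / 2 := min_le_left _ _
      linarith)
  have hψoffQ : ∀ x, x ∉ closedBall x0 ρ → ψ x = 0 := fun x hx =>
    hψoff x fun h => hx (ball_subset_closedBall.trans
      (closedBall_subset_closedBall (by linarith)) h)
  have n1 := integrable_vfi (κ := 0) (lam := lam) hεn htc hFc htc lz hψl.neg hKc
    fun x hx => by rw [hψoffQ x hx, neg_zero]
  have n2 := integrable_Aop_inner hεn lΦ hψl hKc hψoffQ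
  have hgc : Continuous fun x => om e (∇ Φ x) := by
    have h1 :=
      (InnerProductSpace.toDual ℝ E2).symm.continuous.comp (hΦ.continuous_fderiv (by norm_num))
    exact (continuous_om e).comp h1
  have n3 : Integrable fun x => om e (∇ Φ x) * (lap Φ x + infLap Φ x / e) * ψ x := by
    refine Continuous.integrable_of_hasCompactSupport ?_ hψc.mul_left
    have := continuous_lap hΦ
    have := continuous_infLap hΦ
    have := hψl.continuous
    fun_prop
  have i3 : ∫ x, om e (∇ Φ x) * (lap Φ x + infLap Φ x / e) * ψ x
      = -∫ x, ⟪Aop e (∇ Φ x), ∇ ψ x⟫ := by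
    rw [integral_Aop_smooth hΦ hΦc hψl hεn, ← integral_neg]
    simp only [neg_mul, neg_neg]
  have hz0 := eq_zero_of_integral_le hψl.continuous hψc ((n1.add n2).add n3)
    (by rw [integral_add' (n1.add n2) n3, integral_add' n1 n2, i3]; linarith)
    (c := d / (2 * η)) (by positivity) ?_
  · have hx1b : x1 ∈ ball x0 (ρ / 2) := by
      by_contra hx
      have := hann x1 hx1 hx
      simp only [hm] at this
      linarith
    have h1 := hz0 x1
    rw [hψon x1 hx1b] at h1
    have := (le_max_left _ _).trans_eq h1
    simp only [hm] at this
    linarith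
  filter_upwards [lz.ae_hasGradientAt, lΦ.ae_hasGradientAt, hψl.ae_hasGradientAt] with x e1 e2 e3
  simp only [Pi.add_apply, vfi]
  rw [e3.neg'.gradient]
  by_cases hx : x ∈ ball x0 (ρ / 2) ∧ 0 < z x - (Φ x + m)
  · obtain ⟨hxb, hxp⟩ := hx
    have hgψ : ∇ ψ x = ∇ z x - ∇ Φ x := by
      have : ψ =ᶠ[𝓝 x] w := by
        filter_upwards [isOpen_ball.mem_nhds hxb] with y hy using hψon y hy
      rw [this.gradient_eq, gradient_pos_part hgl.continuous, if_pos hxp,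
        (e1.sub' (e2.add' (hasGradientAt_const x m))).gradient, add_zero]
    have hxK : x ∈ closedBall x0 ρ := ball_subset_closedBall.trans
      (closedBall_subset_closedBall (by linarith)) hxb
    have hψx : ψ x = z x - (Φ x + m) := by rw [hψon x hxb]; exact max_eq_left hxp.le
    have hB1 := hB x hxK
    rw [Real.norm_eq_abs] at hB1
    have hψη : ψ x ≤ η := by
      have h1 := hSx x hxK
      rw [hψx, hm]; linarith
    have hd' : (F x - lam * (z x - t x)) / e - -(lap Φ x + infLap Φ x / e) ≤ -d := by
      have h1 := (hball x hxK).1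
      have h2 := (abs_le.1 (hn1 x hxK)).1
      have h3 : η1 ≤ δ0 / lam := (min_le_right _ _).trans (min_le_left _ _)
      have h4 : lam * η1 ≤ δ0 := by rwa [le_div_iff₀' hlam] at h3
      have h5 := (le_abs_self _).trans ((hA x hxK).trans (le_abs_self A))
      have h6 : e * lap Φ x ≤ e * (|A| + 1) := by gcongr; linarith
      have h7 : lam * -η1 ≤ lam * (z x - V x) := by gcongr
      refine div_sub_neg_le hεn ?_
      simp only [hE] at h1
      linarith
    have hb := pair_bound hεn ((hzVI.1.1.norm_gradient_le x).trans (le_max_left _ bΦ))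
      ((hbΦ x).trans (le_max_right (M : ℝ) _)) hB1 hd' hd0.le (hψ0 x) hC
    rw [hgψ, inner_neg_right]
    linarith [bump_quadratic_bound (C := C) hd0 hη0 (min_le_left _ _) (hψ0 x) hψη]
  · have hψx : ψ x = 0 := by
      by_cases hxb : x ∈ ball x0 (ρ / 2)
      · rw [hψon x hxb]
        exact max_eq_right (not_lt.1 fun h => hx ⟨hxb, h⟩)
      · exact hψoff x hxb
    rw [gradient_eq_zero_of_min hψ0 hψx, hψx]
    simp

theorem visc_limit_sup {M L : ℝ≥0} {t s F : E2 → ℝ} (ho : Obst M t s F) (hLM : L + 1 ≤ M)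
    {lam : ℝ} (hlam : 0 < lam) {ε : ℕ → ℝ} (hε : ∀ n, 0 < ε n) {l : Filter ℕ} [l.NeBot]
    (hε0 : Tendsto ε l (𝓝 0)) {v : ℕ → E2 → ℝ} (hv : ∀ n, IsVI (ε n) lam M t s F (v n))
    (hL : ∀ n, LipschitzWith L (v n)) {V : E2 → ℝ}
    (hlim : ∀ x, Tendsto (fun n => v n x) l (𝓝 (V x))) :
    ViscSup {x | V x < t x + s x} (fun x => F x - lam * (V x - t x)) V := by
  have h := (visc_limit ho.neg hLM hlam hε hε0 (fun n => (hv n).neg) (fun n => (hL n).neg)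
    (fun x => (hlim x).neg)).neg
  simp only [neg_neg] at h
  refine h.mono (fun x hx => ?_) fun x _ => ?_
  · have : V x < t x + s x := hx
    show -t x - s x < -V x
    linarith
  · linarith

/-! ### `L²` tools -/

theorem MeasureTheory.Integrable.fadd {f g : E2 → ℝ} (hf : Integrable f) (hg : Integrable g) :
    Integrable fun x => f x + g x := hf.add hg

theorem MeasureTheory.Integrable.fsub {f g : E2 → ℝ} (hf : Integrable f) (hg : Integrable g) :
    Integrable fun x => f x - g x := hf.sub hg

theorem MeasureTheory.MemLp.integrable_mul_self {f g : E2 → ℝ} (hf : MemLp f 2 volume)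
    (hg : MemLp g 2 volume) : Integrable fun x => f x * g x :=
  hf.integrable_mul hg

theorem integral_mul_sq_le {f g : E2 → ℝ} (hf : MemLp f 2 volume) (hg : MemLp g 2 volume) :
    (∫ x, f x * g x) ^ 2 ≤ (∫ x, f x ^ 2) * ∫ x, g x ^ 2 := by
  have h : ∀ s : ℝ, 0 ≤ (∫ x, g x ^ 2) * (s * s) + 2 * (∫ x, f x * g x) * s + ∫ x, f x ^ 2 := by
    intro s
    have e : (∫ x, g x ^ 2) * (s * s) + 2 * (∫ x, f x * g x) * s + ∫ x, f x ^ 2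
        = ∫ x, (f x + s * g x) ^ 2 := by
      have e1 : (fun x => (f x + s * g x) ^ 2)
          = fun x => s * s * g x ^ 2 + 2 * s * (f x * g x) + f x ^ 2 := by funext x; ring
      rw [e1, integral_add ((hg.integrable_sq.const_mul _).fadd
          ((hf.integrable_mul_self hg).const_mul _)) hf.integrable_sq,
        integral_add (hg.integrable_sq.const_mul _) ((hf.integrable_mul_self hg).const_mul _),
        integral_const_mul, integral_const_mul]
      ring
    rw [e]
    exact integral_nonneg fun x => sq_nonneg _
  have := discrim_le_zero h
  rw [discrim] at this
  nlinarith

/-- Almost everywhere convergence together with non-increase of the `L²` norm implies strong `L²`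
convergence. -/
theorem tendsto_integral_sub_sq {f : ℕ → E2 → ℝ} {f0 : E2 → ℝ} (hf : ∀ n, MemLp (f n) 2 volume)
    (hf0 : MemLp f0 2 volume) (hle : ∀ n, ∫ x, f n x ^ 2 ≤ ∫ x, f0 x ^ 2)
    (hlim : ∀ᵐ x, Tendsto (fun n => f n x) atTop (𝓝 (f0 x))) :
    Tendsto (fun n => ∫ x, (f n x - f0 x) ^ 2) atTop (𝓝 0) := by
  have hsum := fun n => ((hf n).add hf0).integrable_sq
  have hsub := fun n => ((hf n).sub hf0).integrable_sq
  simp only [Pi.add_apply, Pi.sub_apply] at hsum hsub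
  have hpar n : ∫ x, (f n x - f0 x) ^ 2 ≤ 4 * (∫ x, f0 x ^ 2) - ∫ x, (f n x + f0 x) ^ 2 := by
    have e : ∫ x, ((f n x - f0 x) ^ 2 + (f n x + f0 x) ^ 2)
        = 2 * (∫ x, f n x ^ 2) + 2 * ∫ x, f0 x ^ 2 := by
      rw [← integral_const_mul, ← integral_const_mul,
        ← integral_add ((hf n).integrable_sq.const_mul 2) (hf0.integrable_sq.const_mul 2)]
      congr 1; funext x; ring
    rw [integral_add (hsub n) (hsum n)] at e
    linarith [hle n]
  have hfat : ENNReal.ofReal (4 * ∫ x, f0 x ^ 2)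
      ≤ liminf (fun n => ENNReal.ofReal (∫ x, (f n x + f0 x) ^ 2)) atTop := by
    have e0 : ENNReal.ofReal (4 * ∫ x, f0 x ^ 2) = ∫⁻ x, ENNReal.ofReal ((f0 x + f0 x) ^ 2) := by
      rw [← integral_const_mul, ofReal_integral_eq_lintegral_ofReal
        (hf0.integrable_sq.const_mul 4) (Eventually.of_forall fun x => by positivity)]
      congr 1; funext x; congr 1; ring
    have e1 := fun n =>
      ofReal_integral_eq_lintegral_ofReal (hsum n) (Eventually.of_forall fun x => sq_nonneg _)
    simp only [e0, e1]
    refine le_trans (le_of_eq ?_) (lintegral_liminf_le' fun n =>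
      (hsum n).aestronglyMeasurable.aemeasurable.ennreal_ofReal)
    refine lintegral_congr_ae ?_
    filter_upwards [hlim] with x hx
    exact ((ENNReal.continuous_ofReal.tendsto _).comp
      ((hx.add_const (f0 x)).pow 2)).liminf_eq.symm
  rw [Metric.tendsto_atTop]
  intro η hη
  have hev : ∀ᶠ n in atTop, 4 * (∫ x, f0 x ^ 2) - η < ∫ x, (f n x + f0 x) ^ 2 := by
    by_cases h0 : 4 * (∫ x, f0 x ^ 2) - η < 0
    · exact Eventually.of_forall fun n => h0.trans_le (integral_nonneg fun x => sq_nonneg _)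
    · push Not at h0
      have : ENNReal.ofReal (4 * (∫ x, f0 x ^ 2) - η)
          < liminf (fun n => ENNReal.ofReal (∫ x, (f n x + f0 x) ^ 2)) atTop :=
        lt_of_lt_of_le ((ENNReal.ofReal_lt_ofReal_iff (by linarith)).2 (by linarith)) hfat
      filter_upwards [eventually_lt_of_lt_liminf this] with n hn
      exact ((ENNReal.ofReal_lt_ofReal_iff_of_nonneg h0).1 hn)
  obtain ⟨N, hN⟩ := eventually_atTop.1 hev
  refine ⟨N, fun n hn => ?_⟩
  rw [dist_zero_right, Real.norm_of_nonneg (integral_nonneg fun x => sq_nonneg _)]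
  linarith [hN n hn, hpar n]

/-! ### Mollification -/

/-- A standard sequence of bump functions shrinking to the origin. -/
def stdBump (n : ℕ) : ContDiffBump (0 : E2) where
  rIn := 1 / (2 * (n + 1))
  rOut := 1 / (n + 1)
  rIn_pos := by positivity
  rIn_lt_rOut := by
    rw [div_lt_div_iff₀ (by positivity) (by positivity)]
    have : (0 : ℝ) ≤ n := Nat.cast_nonneg n
    linarith

/-- The mollifier attached to `stdBump`. -/
def mker (n : ℕ) : E2 → ℝ := (stdBump n).normed volume

/-- Mollification. -/
def moll (n : ℕ) (w : E2 → ℝ) (x : E2) : ℝ := ∫ y, mker n (x - y) * w y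

theorem moll_eq (n : ℕ) (w : E2 → ℝ) :
    moll n w = convolution (mker n) w (ContinuousLinearMap.lsmul ℝ ℝ) volume := by
  funext x
  rw [convolution_lsmul_swap]
  rfl

theorem stdBump_rOut_tendsto : Tendsto (fun n => (stdBump n).rOut) atTop (𝓝 0) :=
  tendsto_one_div_add_atTop_nhds_zero_nat

theorem mker_nonneg (n : ℕ) (x : E2) : 0 ≤ mker n x := (stdBump n).nonneg_normed x

theorem mker_contDiff (n : ℕ) {m : ℕ∞} : ContDiff ℝ m (mker n) := (stdBump n).contDiff_normed

theorem mker_hasCompactSupport (n : ℕ) : HasCompactSupport (mker n) :=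
  (stdBump n).hasCompactSupport_normed

theorem mker_tsupport (n : ℕ) : tsupport (mker n) = closedBall 0 (stdBump n).rOut :=
  (stdBump n).tsupport_normed_eq

theorem mker_eq_zero {n : ℕ} {x : E2} (h : (stdBump n).rOut < ‖x‖) : mker n x = 0 :=
  image_eq_zero_of_notMem_tsupport fun hx => by
    rw [mker_tsupport, mem_closedBall_zero_iff] at hx
    linarith

theorem mker_integral (n : ℕ) : ∫ x, mker n x = 1 := (stdBump n).integral_normed

theorem mker_integrable (n : ℕ) : Integrable (mker n) := (stdBump n).integrable_normed

theorem mker_integral_sub (n : ℕ) (x : E2) : ∫ y, mker n (x - y) = 1 := by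
  rw [integral_sub_left_eq_self (mker n) volume x, mker_integral]

theorem integrable_mker_mul (n : ℕ) (x : E2) {w : E2 → ℝ} (hw : LocallyIntegrable w) :
    Integrable fun y => mker n (x - y) * w y := by
  have := (mker_hasCompactSupport n).convolutionExists_left (ContinuousLinearMap.lsmul ℝ ℝ)
    (mker_contDiff n (m := 0)).continuous hw x
  rw [convolutionExistsAt_iff_integrable_swap] at this
  exact this

theorem moll_contDiff (n : ℕ) {w : E2 → ℝ} (hw : LocallyIntegrable w) {m : ℕ∞} :
    ContDiff ℝ m (moll n w) := by
  rw [moll_eq]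
  exact (mker_hasCompactSupport n).contDiff_convolution_left _ (mker_contDiff n) hw

theorem moll_tendsto_ae {w : E2 → ℝ} (hw : LocallyIntegrable w) :
    ∀ᵐ x, Tendsto (fun n => moll n w x) atTop (𝓝 (w x)) := by
  have := ContDiffBump.ae_convolution_tendsto_right_of_locallyIntegrable
    (φ := stdBump) (K := 2) stdBump_rOut_tendsto (Eventually.of_forall fun n => by
      simp only [stdBump]
      field_simp
      exact le_rfl) hw
  filter_upwards [this] with x hx
  simp only [moll_eq]
  exact hx

theorem moll_abs_le (n : ℕ) {w : E2 → ℝ} {b : ℝ} (hw : LocallyIntegrable w) (hb : ∀ x, |w x| ≤ b)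
    (x : E2) : |moll n w x| ≤ b := by
  calc |moll n w x| ≤ ∫ y, |mker n (x - y) * w y| := abs_integral_le_integral_abs
    _ ≤ ∫ y, mker n (x - y) * b := by
        refine integral_mono (integrable_mker_mul n x hw).abs
          (((mker_integrable n).comp_sub_left x).mul_const b) fun y => ?_
        simp only [abs_mul, abs_of_nonneg (mker_nonneg n _)]
        exact mul_le_mul_of_nonneg_left (hb y) (mker_nonneg n _)
    _ = b := by rw [integral_mul_const, mker_integral_sub, one_mul]

theorem moll_eq_zero {n : ℕ} {w : E2 → ℝ} {x : E2}
    (h : ∀ y, ‖x - y‖ ≤ (stdBump n).rOut → w y = 0) : moll n w x = 0 := by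
  rw [moll]
  refine integral_eq_zero_of_ae (Eventually.of_forall fun y => ?_)
  by_cases hy : ‖x - y‖ ≤ (stdBump n).rOut
  · simp [h y hy]
  · simp [mker_eq_zero (not_le.1 hy)]

theorem moll_sub_abs_le {n : ℕ} {w : E2 → ℝ} (hw : LocallyIntegrable w) {x : E2} {η a : ℝ}
    (h : ∀ y, ‖x - y‖ ≤ (stdBump n).rOut → |w y - a| ≤ η) : |moll n w x - a| ≤ η := by
  have h1 := integrable_mker_mul n x hw
  have h2 :=
    ((mker_integrable n).comp_sub_left x).mul_const a
  have e : moll n w x - a = ∫ y, mker n (x - y) * (w y - a) := by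
    simp only [mul_sub]
    rw [integral_sub h1 h2, integral_mul_const, mker_integral_sub, one_mul, moll]
  rw [e]
  calc _ ≤ ∫ y, |mker n (x - y) * (w y - a)| := abs_integral_le_integral_abs
    _ ≤ ∫ y, mker n (x - y) * η := by
        refine integral_mono ?_ (((mker_integrable n).comp_sub_left x).mul_const η) fun y => ?_
        · simp only [mul_sub]; exact (h1.sub h2).abs
        simp only [abs_mul, abs_of_nonneg (mker_nonneg n _)]
        by_cases hy : ‖x - y‖ ≤ (stdBump n).rOut
        · exact mul_le_mul_of_nonneg_left (h y hy) (mker_nonneg n _)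
        · simp [mker_eq_zero (not_le.1 hy)]
    _ = η := by rw [integral_mul_const, mker_integral_sub, one_mul]

theorem moll_hasCompactSupport (n : ℕ) {w : E2 → ℝ} (hw : HasCompactSupport w) :
    HasCompactSupport (moll n w) := by
  rw [moll_eq]
  exact (mker_hasCompactSupport n).convolution _ hw

theorem moll_lipschitz (n : ℕ) {w : E2 → ℝ} {M : ℝ≥0} (hw : LipschitzWith M w) :
    LipschitzWith M (moll n w) := by
  refine LipschitzWith.of_dist_le_mul fun x y => ?_
  have hc := hw.continuous
  have e x : moll n w x = ∫ z, mker n z * w (x - z) := by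
    rw [moll_eq]; rfl
  have hi := fun x => by
    simpa using (integrable_mker_mul n x hc.locallyIntegrable).comp_sub_left x
  rw [Real.dist_eq, e x, e y, ← integral_sub (hi x) (hi y)]
  calc _ ≤ ∫ z, |mker n z * w (x - z) - mker n z * w (y - z)| := abs_integral_le_integral_abs
    _ ≤ ∫ z, mker n z * (M * dist x y) := by
        refine integral_mono ((hi x).sub (hi y)).abs ((mker_integrable n).mul_const _) fun z => ?_
        simp only [← mul_sub, abs_mul, abs_of_nonneg (mker_nonneg n _)]
        refine mul_le_mul_of_nonneg_left ?_ (mker_nonneg n _)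
        have := hw.dist_le_mul (x - z) (y - z)
        rwa [Real.dist_eq, dist_sub_right] at this
    _ = _ := by rw [integral_mul_const, mker_integral, one_mul]

theorem mker_sub_contDiff (n : ℕ) (x : E2) {m : ℕ∞} : ContDiff ℝ m fun y => mker n (x - y) :=
  (mker_contDiff n).comp (contDiff_const.sub contDiff_id)

theorem mker_sub_tsupport (n : ℕ) (x : E2) :
    tsupport (fun y => mker n (x - y)) ⊆ closedBall x (stdBump n).rOut := by
  refine closure_minimal (fun y hy => ?_) isClosed_closedBall
  rw [mem_closedBall, dist_comm, dist_eq_norm]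
  by_contra! h
  exact hy (mker_eq_zero h)

theorem mker_sub_hasCompactSupport (n : ℕ) (x : E2) : HasCompactSupport fun y => mker n (x - y) :=
  HasCompactSupport.of_support_subset_isCompact (isCompact_closedBall x (stdBump n).rOut)
    (subset_closure.trans (mker_sub_tsupport n x))

theorem pd_mker_sub (n : ℕ) (x y : E2) (i : Fin 2) :
    pd i (fun y => mker n (x - y)) y = -pd i (mker n) (x - y) := by
  have h1 := ((mker_contDiff n (m := 1)).differentiable (by norm_num)).differentiableAt
    (x := x - y) |>.hasFDerivAt
  rw [pd, pd]
  erw [(h1.comp y ((hasFDerivAt_id y).const_sub x)).fderiv]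
  simp

theorem pd_moll (n : ℕ) {w : E2 → ℝ} (hw : LocallyIntegrable w) (i : Fin 2) (x : E2) :
    pd i (moll n w) x = ∫ y, pd i (mker n) (x - y) * w y := by
  have h := (mker_hasCompactSupport n).hasFDerivAt_convolution_left
    (ContinuousLinearMap.lsmul ℝ ℝ) (mker_contDiff n) hw x
  have he := (mker_hasCompactSupport n).fderiv (𝕜 := ℝ) |>.convolutionExists_left
    ((ContinuousLinearMap.lsmul ℝ ℝ).precompL E2)
      ((mker_contDiff n (m := 1)).continuous_fderiv (by norm_num)) hw x
  rw [pd, moll_eq, h.fderiv, convolution_def, ContinuousLinearMap.integral_apply he,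
    ← integral_sub_left_eq_self _ volume x]
  refine integral_congr_ae (Eventually.of_forall fun y => ?_)
  simp [pd]

theorem pd_moll_of_weak {n : ℕ} {w H : E2 → ℝ} (hw : LocallyIntegrable w) {i : Fin 2} {x : E2}
    (h : ∫ y, w y * pd i (fun y => mker n (x - y)) y = -∫ y, H y * mker n (x - y)) :
    pd i (moll n w) x = moll n H x := by
  rw [pd_moll n hw, moll]
  simp only [pd_mker_sub, mul_neg, integral_neg, neg_inj] at h
  simpa only [mul_comm] using h

theorem pd_moll_of_isLip (n : ℕ) {v : E2 → ℝ} (hv : IsLip v) (i : Fin 2) (x : E2) :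
    pd i (moll n v) x = moll n (fun y => (∇ v y) i) x := by
  refine pd_moll_of_weak hv.continuous.locallyIntegrable ?_
  have := hv.integral_pd ((mker_sub_contDiff n x).isLip (mker_sub_hasCompactSupport n x))
    (mker_sub_hasCompactSupport n x) i
  simp only [gradient_apply] at this ⊢
  linarith

theorem moll_sq_le (n : ℕ) {w : E2 → ℝ} (hw : MemLp w 2 volume) (x : E2) :
    moll n w x ^ 2 ≤ moll n (fun y => w y ^ 2) x := by
  have h1 := integrable_mker_mul n x (hw.locallyIntegrable (by norm_num))
  have h2 := integrable_mker_mul n x hw.integrable_sq.locallyIntegrable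
  set m := moll n w x with hm
  have h4 : 0 ≤ ∫ y, mker n (x - y) * (w y - m) ^ 2 :=
    integral_nonneg fun y => mul_nonneg (mker_nonneg n _) (sq_nonneg _)
  have e : (fun y => mker n (x - y) * (w y - m) ^ 2) = fun y =>
      mker n (x - y) * w y ^ 2 - 2 * m * (mker n (x - y) * w y) + m ^ 2 * mker n (x - y) := by
    funext y; ring
  rw [e, integral_add (h2.fsub (h1.const_mul _))
    (((mker_integrable n).comp_sub_left x).const_mul _), integral_sub h2 (h1.const_mul _),
    integral_const_mul, integral_const_mul, mker_integral_sub] at h4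
  change 0 ≤ moll n (fun y => w y ^ 2) x - 2 * m * moll n w x + m ^ 2 * 1 at h4
  rw [← hm] at h4
  linarith

theorem moll_integral_le (n : ℕ) {w : E2 → ℝ} (hw : Integrable w) :
    Integrable (moll n w) ∧ ∫ x, moll n w x = ∫ x, w x := by
  rw [moll_eq]
  refine ⟨(mker_integrable n).integrable_convolution _ hw, ?_⟩
  rw [integral_convolution _ (mker_integrable n) hw, mker_integral]
  simp

theorem moll_memLp (n : ℕ) {w : E2 → ℝ} (hw : MemLp w 2 volume) :
    MemLp (moll n w) 2 volume ∧ ∫ x, moll n w x ^ 2 ≤ ∫ x, w x ^ 2 := by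
  have hi := moll_integral_le n hw.integrable_sq
  have hc :=
    (moll_contDiff n (hw.locallyIntegrable (by norm_num)) (m := 0)).continuous
  have hI : Integrable fun x => moll n w x ^ 2 :=
    hi.1.mono' (hc.pow 2).aestronglyMeasurable (Eventually.of_forall fun x => by
      rw [Real.norm_of_nonneg (sq_nonneg _)]
      exact moll_sq_le n hw x)
  refine ⟨(memLp_two_iff_integrable_sq hc.aestronglyMeasurable).2 hI, ?_⟩
  rw [← hi.2]
  exact integral_mono hI hi.1 (moll_sq_le n hw)

theorem moll_tendsto_L2 {w : E2 → ℝ} (hw : MemLp w 2 volume) :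
    Tendsto (fun n => ∫ x, (moll n w x - w x) ^ 2) atTop (𝓝 0) :=
  tendsto_integral_sub_sq (fun n => (moll_memLp n hw).1) hw (fun n => (moll_memLp n hw).2)
    (moll_tendsto_ae (hw.locallyIntegrable (by norm_num)))

/-- Smooth test functions supported in `U`. -/
structure IsTest (U : Set E2) (φ : E2 → ℝ) : Prop where
  smooth : ContDiff ℝ (⊤ : ℕ∞) φ
  cpt : HasCompactSupport φ
  supp : tsupport φ ⊆ U

theorem IsTest.mono {U V : Set E2} {φ : E2 → ℝ} (h : IsTest U φ) (hUV : U ⊆ V) : IsTest V φ :=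
  ⟨h.1, h.2, h.3.trans hUV⟩

theorem IsTest.isLip {U : Set E2} {φ : E2 → ℝ} (h : IsTest U φ) : IsLip φ :=
  (h.smooth.of_le (by exact_mod_cast le_top)).isLip h.cpt

theorem IsTest.memLp {U : Set E2} {φ : E2 → ℝ} (h : IsTest U φ) : MemLp φ 2 volume :=
  h.smooth.continuous.memLp_of_hasCompactSupport h.cpt

/-- The linear space of test functions. -/
def testSpace (U : Set E2) : Submodule ℝ (E2 → ℝ) where
  carrier := {φ | IsTest U φ}
  add_mem' := fun {a b} ha hb => ⟨ha.1.add hb.1, ha.2.add hb.2,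
    (tsupport_add a b).trans (union_subset ha.3 hb.3)⟩
  zero_mem' := ⟨contDiff_const, HasCompactSupport.zero, by
    have : tsupport (0 : E2 → ℝ) = ∅ := by simp [tsupport]
    rw [this]; exact empty_subset _⟩
  smul_mem' := fun c a ha => ⟨contDiff_const.smul ha.1, ha.2.smul_left (f := fun _ => c),
    (tsupport_smul_subset_right (fun _ => c) a).trans ha.3⟩

theorem norm_toLp_sq {φ : E2 → ℝ} (h : MemLp φ 2 volume) : ‖h.toLp φ‖ ^ 2 = ∫ x, φ x ^ 2 := by
  rw [← real_inner_self_eq_norm_sq, L2.inner_def]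
  refine integral_congr_ae ?_
  filter_upwards [h.coeFn_toLp] with x hx
  rw [hx]; simp [sq]

theorem exists_l2_rep {S : Submodule ℝ (E2 → ℝ)} (hS : ∀ φ ∈ S, MemLp φ 2 volume)
    (T : S →ₗ[ℝ] ℝ) {C : ℝ} (hC0 : 0 ≤ C) (hC : ∀ φ : S, T φ ^ 2 ≤ C * ∫ x, (φ : E2 → ℝ) x ^ 2) :
    ∃ G : E2 → ℝ, MemLp G 2 volume ∧ ∫ x, G x ^ 2 ≤ C ∧
      ∀ φ : S, T φ = ∫ x, G x * (φ : E2 → ℝ) x := by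
  let j : S →ₗ[ℝ] Lp ℝ 2 volume :=
    { toFun := fun φ => (hS φ φ.2).toLp _
      map_add' := fun a b => rfl
      map_smul' := fun c a => rfl }
  have hj : ∀ φ, ‖j φ‖ ^ 2 = ∫ x, (φ : E2 → ℝ) x ^ 2 := fun φ => norm_toLp_sq (hS φ φ.2)
  have hT φ : |T φ| ≤ √C * ‖j φ‖ := by
    refine abs_le_of_sq_le_sq ?_ (by positivity) |> fun h => h
    rw [mul_pow, Real.sq_sqrt hC0, hj]; exact hC φ
  have hker : LinearMap.ker j ≤ LinearMap.ker T := by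
    intro φ hφ
    have := hT φ
    rw [hφ, norm_zero, mul_zero] at this
    exact abs_eq_zero.1 (le_antisymm this (abs_nonneg _))
  let f0 : LinearMap.range j →ₗ[ℝ] ℝ :=
    ((LinearMap.ker j).liftQ T hker).comp j.quotKerEquivRange.symm.toLinearMap
  have hf0 φ : f0 ⟨j φ, φ, rfl⟩ = T φ := by
    have : j.quotKerEquivRange.symm ⟨j φ, φ, rfl⟩ = (LinearMap.ker j).mkQ φ := by
      rw [LinearEquiv.symm_apply_eq]
      rfl
    simp only [f0, LinearMap.comp_apply, LinearEquiv.coe_coe, this]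
    rfl
  let f : LinearMap.range j →L[ℝ] ℝ := f0.mkContinuous (√C) (by
    rintro ⟨y, φ, rfl⟩
    rw [hf0]; exact hT φ)
  obtain ⟨F, hF, hFn⟩ := exists_extension_norm_eq (LinearMap.range j) f
  let g := (InnerProductSpace.toDual ℝ (Lp ℝ 2 (volume : Measure E2))).symm F
  have hg : ‖g‖ ≤ √C := by
    rw [LinearIsometryEquiv.norm_map, hFn]
    exact LinearMap.mkContinuous_norm_le _ (by positivity) _
  refine ⟨g, Lp.memLp g, ?_, ?_⟩
  · rw [← norm_toLp_sq (Lp.memLp g), Lp.toLp_coeFn]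
    calc ‖g‖ ^ 2 ≤ √C ^ 2 := by gcongr
      _ = C := Real.sq_sqrt hC0
  · intro φ
    have h1 : F (j φ) = T φ := by
      rw [← hf0 φ]; exact hF ⟨j φ, φ, rfl⟩
    rw [← h1, ← InnerProductSpace.toDual_symm_apply, L2.inner_def]
    refine integral_congr_ae ?_
    filter_upwards [(hS φ φ.2).coeFn_toLp] with x hx
    have : (j φ : E2 → ℝ) x = (φ : E2 → ℝ) x := hx
    rw [this]; simp [g, mul_comm]

theorem pd_add_fun {φ ψ : E2 → ℝ} (hφ : Differentiable ℝ φ) (hψ : Differentiable ℝ ψ) (i : Fin 2)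
    (x : E2) : pd i (φ + ψ) x = pd i φ x + pd i ψ x := by
  unfold pd; rw [fderiv_add (hφ x) (hψ x)]; rfl

theorem pd_const_smul {φ : E2 → ℝ} (hφ : Differentiable ℝ φ) (c : ℝ) (i : Fin 2)
    (x : E2) : pd i (c • φ) x = c * pd i φ x := by
  unfold pd; rw [fderiv_const_smul (hφ x)]; rfl

theorem IsTest.pd_continuous {U : Set E2} {φ : E2 → ℝ} (h : IsTest U φ) (i : Fin 2) :
    Continuous (pd i φ) :=
  (h.smooth.continuous_fderiv (by simp)).clm_apply continuous_const

theorem IsTest.pd_cpt {U : Set E2} {φ : E2 → ℝ} (h : IsTest U φ) (i : Fin 2) :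
    HasCompactSupport (pd i φ) :=
  h.cpt.fderiv_apply (𝕜 := ℝ) _

theorem IsTest.integrable_mul_pd {U : Set E2} {φ w : E2 → ℝ} (h : IsTest U φ)
    (hw : LocallyIntegrable w volume) (i : Fin 2) : Integrable fun x => w x * pd i φ x := by
  simpa [mul_comm] using
    hw.integrable_smul_left_of_hasCompactSupport (h.pd_continuous i) (h.pd_cpt i)

theorem exists_weak_pd {U : Set E2} {w : E2 → ℝ} (hw : LocallyIntegrable w volume) {C : ℝ}
    (hC0 : 0 ≤ C) {i : Fin 2}
    (hC : ∀ φ, IsTest U φ → (∫ x, w x * pd i φ x) ^ 2 ≤ C * ∫ x, φ x ^ 2) :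
    ∃ G : E2 → ℝ, MemLp G 2 volume ∧ ∫ x, G x ^ 2 ≤ C ∧
      ∀ φ, IsTest U φ → ∫ x, w x * pd i φ x = - ∫ x, G x * φ x := by
  have hd : ∀ φ : testSpace U, Differentiable ℝ (φ : E2 → ℝ) := fun φ =>
    φ.2.smooth.differentiable (by simp)
  let T : testSpace U →ₗ[ℝ] ℝ :=
    { toFun := fun φ => - ∫ x, w x * pd i φ x
      map_add' := by
        intro a b
        rw [← neg_add, ← integral_add (IsTest.integrable_mul_pd a.2 hw i)
          (IsTest.integrable_mul_pd b.2 hw i)]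
        congr 1
        refine integral_congr_ae (.of_forall fun x => ?_)
        simp only [Submodule.coe_add]
        rw [pd_add_fun (hd a) (hd b)]; ring
      map_smul' := by
        intro c a
        rw [RingHom.id_apply, smul_eq_mul, mul_neg, ← integral_const_mul]
        congr 1
        refine integral_congr_ae (.of_forall fun x => ?_)
        simp only [Submodule.coe_smul]
        rw [pd_const_smul (hd a)]; ring }
  obtain ⟨G, h1, h2, h3⟩ := exists_l2_rep (S := testSpace U) (fun φ hφ => IsTest.memLp hφ) T hC0
    (fun φ => by
      change (-_) ^ 2 ≤ _
      rw [neg_sq]; exact hC φ φ.2)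
  refine ⟨G, h1, h2, fun φ hφ => ?_⟩
  rw [← h3 ⟨φ, hφ⟩]
  exact (neg_neg _).symm

/-- Weak solutions of `-div(A_ε(Dv)) + …`, i.e. of `-εΔv - Δ_∞ v = g`, in divergence form. -/
def WS (ε : ℝ) (D : Set E2) (g v : E2 → ℝ) : Prop :=
  ∀ ψ : E2 → ℝ, IsLip ψ → HasCompactSupport ψ → tsupport ψ ⊆ D →
    ∫ x, (⟪Aop ε (∇ v x), ∇ ψ x⟫ - om ε (∇ v x) * (g x / ε) * ψ x) = 0

theorem WS.mono {ε : ℝ} {D D' : Set E2} {g v : E2 → ℝ} (h : WS ε D g v) (hD : D' ⊆ D) :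
    WS ε D' g v := fun ψ h1 h2 h3 => h ψ h1 h2 (h3.trans hD)

theorem integrable_WS {ε : ℝ} (hε : 0 < ε) {g v ψ : E2 → ℝ} (hv : IsLip v) (hg : Continuous g)
    (hψ : IsLip ψ) (hc : HasCompactSupport ψ) :
    Integrable fun x => ⟪Aop ε (∇ v x), ∇ ψ x⟫ - om ε (∇ v x) * (g x / ε) * ψ x :=
  (integrable_Aop_inner hε hv hψ hc.isCompact fun _ hx => image_eq_zero_of_notMem_tsupport hx).fsub
    (integrable_om_mul hε hv hψ.continuous (hg.div_const ε) hc.isCompact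
      fun _ hx => image_eq_zero_of_notMem_tsupport hx)

theorem tsupport_translate (ψ : E2 → ℝ) (h : E2) :
    tsupport (fun x => ψ (x + h)) = (fun x => x + h) ⁻¹' tsupport ψ :=
  tsupport_comp_eq_preimage ψ (Homeomorph.addRight h)

theorem HasCompactSupport.translate {ψ : E2 → ℝ} (hc : HasCompactSupport ψ) (h : E2) :
    HasCompactSupport fun x => ψ (x + h) :=
  hc.comp_homeomorph (Homeomorph.addRight h)

theorem quotient_pointwise {ε M b Lg Z H : ℝ} (hε : 0 < ε) {p q n : E2} {a w g1 g0 : ℝ}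
    (hp : ‖p‖ ≤ M) (hq : ‖q‖ ≤ M) (hb : |g1| ≤ b) (hg : |g1 - g0| ≤ Lg * H) (ha : |a| ≤ 1)
    (hn : ‖n‖ ≤ Z) (hw : |w| ≤ M * H) (hH : 0 ≤ H) :
    1 / 2 * (a ^ 2 * ‖p - q‖ ^ 2)
      - (4 * (Real.exp (M ^ 2 / (2 * ε)) * (1 + M / ε * M) * Z * M) ^ 2
        + (Real.exp (M ^ 2 / (2 * ε)) * (M / ε) * b * M / ε) ^ 2
        + Real.exp (M ^ 2 / (2 * ε)) * Lg * M / ε) * H ^ 2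
    ≤ ⟪Aop ε p - Aop ε q, a ^ 2 • (p - q) + (2 * a * w) • n⟫
      - (om ε p * (g1 / ε) - om ε q * (g0 / ε)) * (a ^ 2 * w) := by
  have hM := (norm_nonneg _).trans hp
  have hb0 := (abs_nonneg _).trans hb
  have hLH := (abs_nonneg _).trans hg
  set E := Real.exp (M ^ 2 / (2 * ε))
  set K1 := E * (1 + M / ε * M)
  set δ := ‖p - q‖
  have h1 :=
    mul_le_mul_of_nonneg_left (Aop_mono hε p q) (sq_nonneg a)
  have h2 : |2 * a * w * ⟪Aop ε p - Aop ε q, n⟫| ≤ 2 * |a| * (M * H) * (K1 * δ * Z) := by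
    rw [abs_mul, abs_mul, abs_mul, abs_two]
    have := (abs_real_inner_le_norm (Aop ε p - Aop ε q) n).trans
      (mul_le_mul (Aop_sub_le hε hp hq) hn (norm_nonneg _) (by positivity))
    gcongr
  have h3 : |(om ε p * (g1 / ε) - om ε q * (g0 / ε)) * (a ^ 2 * w)|
      ≤ (E * (M / ε) * δ * b / ε + E * (Lg * H) / ε) * (|a| * |a| * (M * H)) := by
    have e : om ε p * (g1 / ε) - om ε q * (g0 / ε)
        = (om ε p - om ε q) * g1 / ε + om ε q * (g1 - g0) / ε := by ring
    rw [e, abs_mul, abs_mul (a ^ 2), abs_pow, sq]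
    have i1 : |(om ε p - om ε q) * g1 / ε| ≤ E * (M / ε) * δ * b / ε := by
      rw [abs_div, abs_mul, abs_of_pos hε]
      have := om_sub_le hε hp hq
      gcongr
    have i2 : |om ε q * (g1 - g0) / ε| ≤ E * (Lg * H) / ε := by
      rw [abs_div, abs_mul, abs_of_pos hε, abs_of_pos (zero_lt_one.trans_le (one_le_om hε q))]
      have := om_le hε hq
      gcongr
    have := (abs_add_le ((om ε p - om ε q) * g1 / ε) (om ε q * (g1 - g0) / ε)).trans
      (add_le_add i1 i2)
    gcongr
  rw [inner_add_right, real_inner_smul_right, real_inner_smul_right]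
  have h2' := (abs_le.1 h2).1
  have h3' := (abs_le.1 h3).2
  have ha2 := sq_abs a
  have k1 : 2 * |a| * (M * H) * (K1 * δ * Z)
      ≤ 1 / 4 * (a ^ 2 * δ ^ 2) + 4 * (K1 * Z * M) ^ 2 * H ^ 2 := by
    rw [← ha2]
    nlinarith [sq_nonneg (1 / 2 * (|a| * δ) - 2 * (K1 * Z * M * H))]
  have k2 : (E * (M / ε) * δ * b / ε) * (|a| * |a| * (M * H))
      ≤ 1 / 4 * (a ^ 2 * δ ^ 2) + (E * (M / ε) * b * M / ε) ^ 2 * H ^ 2 := by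
    rw [← ha2]
    set Y := E * (M / ε) * b * M / ε with hY
    have e : (E * (M / ε) * δ * b / ε) * (|a| * |a| * (M * H)) = |a| * (|a| * δ * (Y * H)) := by
      rw [hY]; ring
    have : |a| * (|a| * δ * (Y * H)) ≤ 1 * (|a| * δ * (Y * H)) := by gcongr
    rw [e]
    nlinarith [sq_nonneg (1 / 2 * (|a| * δ) - Y * H)]
  have k3 : E * (Lg * H) / ε * (|a| * |a| * (M * H)) ≤ E * Lg * M / ε * H ^ 2 := by
    have e : E * Lg * M / ε * H ^ 2 = E * (Lg * H) / ε * (1 * 1 * (M * H)) := by ring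
    rw [e]
    gcongr
  linarith

theorem WS.diff_quotient {ε : ℝ} (hε : 0 < ε) {D : Set E2} {g v : E2 → ℝ} (hv : IsLip v)
    (hg : IsLip g) {b : ℝ} (hgb : ∀ x, |g x| ≤ b) (hWS : WS ε D g v) {ζ : E2 → ℝ} (hζ : IsLip ζ)
    (hc : HasCompactSupport ζ) (hζ1 : ∀ x, |ζ x| ≤ 1) :
    ∃ C, 0 ≤ C ∧ ∀ h : E2, (∀ x ∈ tsupport ζ, closedBall x ‖h‖ ⊆ D) →
      Integrable (fun x => ζ x ^ 2 * ‖∇ v (x + h) - ∇ v x‖ ^ 2) ∧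
      ∫ x, ζ x ^ 2 * ‖∇ v (x + h) - ∇ v x‖ ^ 2 ≤ C * ‖h‖ ^ 2 := by
  obtain ⟨M, hM⟩ := id hv
  obtain ⟨Lg, hLg⟩ := id hg
  obtain ⟨Z, hZ0, hZ⟩ := hζ.exists_bound
  have hvM := hM.norm_gradient_le
  set C3 := 4 * (Real.exp (M ^ 2 / (2 * ε)) * (1 + M / ε * M) * Z * M) ^ 2
        + (Real.exp (M ^ 2 / (2 * ε)) * (M / ε) * b * M / ε) ^ 2
        + Real.exp (M ^ 2 / (2 * ε)) * Lg * M / ε with hC3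
  have hQ := hc.isCompact
  refine ⟨2 * (C3 * volume.real (tsupport ζ)), by positivity, fun h hD => ?_⟩
  have hitg : Integrable (fun x => ζ x ^ 2 * ‖∇ v (x + h) - ∇ v x‖ ^ 2) := by
    refine integrable_of_bdd_compact (K := tsupport ζ) ?_ hQ ((2 * M) ^ 2) (fun x => ?_) ?_
    · exact ((hζ.continuous.pow 2).measurable.mul
        ((((measurable_gradient v).comp (measurable_add_const h)).sub
          (measurable_gradient v)).norm.pow_const 2)).aestronglyMeasurable
    · have h1 : ‖∇ v (x + h) - ∇ v x‖ ≤ 2 * M := by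
        linarith [norm_sub_le (∇ v (x + h)) (∇ v x), hvM x, hvM (x + h)]
      have h2 : ζ x ^ 2 ≤ 1 := by rw [← sq_abs]; exact pow_le_one₀ (abs_nonneg _) (hζ1 x)
      rw [abs_of_nonneg (by positivity), ← one_mul ((2 * (M : ℝ)) ^ 2)]
      gcongr
    · intro x hx
      rw [image_eq_zero_of_notMem_tsupport hx]; ring
  refine ⟨hitg, ?_⟩
  set w : E2 → ℝ := fun x => v (x + h) - v x
  set ψ : E2 → ℝ := fun x => w x * (ζ x * ζ x) with hψ
  have hzz : HasCompactSupport fun x => ζ x * ζ x := hc.mul_right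
  have hψL : IsLip ψ := ((hv.translate h).sub hv).mul_compact (hζ.mul_compact hζ hc) hzz
  have hψc : HasCompactSupport ψ := hzz.mul_left
  have hψs : tsupport ψ ⊆ tsupport ζ :=
    (tsupport_mul_subset_right).trans (tsupport_mul_subset_right)
  have hψ'c := hψc.translate (-h)
  have I1 := hWS (fun x => ψ (x + -h)) (hψL.translate (-h)) hψ'c (by
    rw [tsupport_translate]
    intro x hx
    refine hD (x + -h) (hψs hx) ?_
    rw [mem_closedBall, dist_eq_norm]; simp)
  have J1 := integrable_WS hε hv hg.continuous (hψL.translate (-h)) hψ'c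
  rw [← integral_add_right_eq_self _ h] at I1
  replace J1 := J1.comp_add_right h
  simp only [gradient_translate, add_neg_cancel_right] at I1 J1
  have J0 := integrable_WS hε hv hg.continuous hψL hψc
  have I := integral_sub J1 J0
  rw [hWS ψ hψL hψc fun x hx => hD x (hψs hx) (mem_closedBall_self (norm_nonneg _)), I1, sub_zero]
    at I
  have hind : Integrable ((tsupport ζ).indicator fun _ => C3 * ‖h‖ ^ 2) :=
    (integrable_indicator_iff hQ.measurableSet).2 (integrableOn_const hQ.measure_lt_top.ne)
  have key : ∫ x, (1 / 2 * (ζ x ^ 2 * ‖∇ v (x + h) - ∇ v x‖ ^ 2)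
      - (tsupport ζ).indicator (fun _ => C3 * ‖h‖ ^ 2) x) ≤ 0 := by
    rw [← I]
    refine integral_mono_ae ((hitg.const_mul _).fsub hind) (J1.fsub J0) ?_
    filter_upwards [hv.ae_hasGradientAt, (hv.translate h).ae_hasGradientAt,
      hζ.ae_hasGradientAt] with x hx1 hx2 hx3
    by_cases hx : x ∈ tsupport ζ
    · rw [gradient_translate] at hx2
      have hg' : ∇ ψ x = ζ x ^ 2 • (∇ v (x + h) - ∇ v x) + (2 * ζ x * w x) • ∇ ζ x := by
        rw [((hx2.sub' hx1).mul' (hx3.mul' hx3)).gradient]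
        module
      have := quotient_pointwise (M := M) (Lg := Lg) (Z := Z) (H := ‖h‖) hε
        (w := w x)
        (hvM (x + h)) (hvM x) (hgb (x + h)) (by
          have := hLg.dist_le_mul (x + h) x
          simpa [Real.dist_eq, dist_eq_norm] using this) (hζ1 x) (hZ x) (by
          have := hM.dist_le_mul (x + h) x
          simpa [Real.dist_eq, dist_eq_norm] using this) (norm_nonneg h)
      rw [indicator_of_mem hx, hg']
      refine this.trans (le_of_eq ?_)
      rw [inner_sub_left]
      ring
    · have h0 : ∇ ψ x = 0 := gradient_eq_zero_of_zero_off (isClosed_tsupport ζ)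
        (fun y hy => by simp [hψ, image_eq_zero_of_notMem_tsupport hy]) hx
      rw [indicator_of_notMem hx, h0, image_eq_zero_of_notMem_tsupport hx]
      simp [hψ, image_eq_zero_of_notMem_tsupport hx]
  rw [integral_sub (hitg.const_mul _) hind, integral_const_mul,
    integral_indicator hQ.measurableSet, setIntegral_const, smul_eq_mul] at key
  linarith

theorem integral_translate_sub {w φ : E2 → ℝ} (hw : LocallyIntegrable w volume)
    (hφ : Continuous φ) (hc : HasCompactSupport φ) (h : E2) :
    ∫ x, w x * (φ (x - h) - φ x) = ∫ x, (w (x + h) - w x) * φ x := by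
  have i0 : Integrable fun x => w x * φ x := by
    simpa [mul_comm] using hw.integrable_smul_left_of_hasCompactSupport hφ hc
  have i1 : Integrable fun x => w x * φ (x - h) := by
    simpa [mul_comm, sub_eq_add_neg] using hw.integrable_smul_left_of_hasCompactSupport
      (hφ.comp (continuous_add_const (-h))) (hc.translate (-h))
  have e : ∫ x, w x * φ (x - h) = ∫ x, w (x + h) * φ x := by
    rw [← integral_add_right_eq_self _ h]; simp
  simp only [mul_sub, sub_mul]
  rw [integral_sub i1 i0, integral_sub (by simpa using i1.comp_add_right h) i0, e]

theorem tendsto_difference_quotient {U : Set E2} {w φ : E2 → ℝ} (hw : LocallyIntegrable w volume)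
    (hφ : IsTest U φ) (j : Fin 2) :
    Tendsto (fun n : ℕ => ∫ x, w x * ((n + 1 : ℝ) *
      (φ (x - (n + 1 : ℝ)⁻¹ • EuclideanSpace.single j 1) - φ x))) atTop
      (𝓝 (- ∫ x, w x * pd j φ x)) := by
  obtain ⟨L, hL⟩ := hφ.isLip
  have hK : IsCompact (cthickening 1 (tsupport φ)) := hφ.cpt.isCompact.cthickening
  rw [← integral_neg]
  have hn : ∀ n : ℕ, ‖(n + 1 : ℝ)⁻¹ • (EuclideanSpace.single j 1 : E2)‖ = (n + 1 : ℝ)⁻¹ := by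
    intro n
    rw [norm_smul, PiLp.norm_single, norm_one, mul_one, Real.norm_of_nonneg (by positivity)]
  refine tendsto_integral_of_dominated_convergence
    (fun x => (cthickening 1 (tsupport φ)).indicator (fun x => ‖w x‖ * L) x) (fun n => ?_) ?_
    (fun n => .of_forall fun x => ?_) (.of_forall fun x => ?_)
  · exact hw.aestronglyMeasurable.mul (by
      have := hφ.smooth.continuous
      fun_prop)
  · exact (integrable_indicator_iff hK.measurableSet).2
      ((hw.integrableOn_isCompact hK).norm.mul_const _)
  · by_cases hx : x ∈ cthickening 1 (tsupport φ)
    · rw [indicator_of_mem hx, norm_mul]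
      refine mul_le_mul_of_nonneg_left ?_ (norm_nonneg _)
      have h1 := hL.dist_le_mul (x - (n + 1 : ℝ)⁻¹ • EuclideanSpace.single j 1) x
      rw [dist_eq_norm, dist_eq_norm, sub_sub_cancel_left, norm_neg, hn] at h1
      rw [norm_mul, Real.norm_of_nonneg (by positivity : (0 : ℝ) ≤ n + 1)]
      calc (n + 1 : ℝ) * _ ≤ (n + 1 : ℝ) * (L * (n + 1 : ℝ)⁻¹) := by gcongr
        _ = L := by field_simp
    · rw [indicator_of_notMem hx]
      have h2 : x - (n + 1 : ℝ)⁻¹ • EuclideanSpace.single j 1 ∉ tsupport φ := by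
        intro h
        refine hx (mem_cthickening_of_dist_le _ _ _ _ h ?_)
        rw [dist_eq_norm, sub_sub_cancel, hn]
        exact inv_le_one_of_one_le₀ (by linarith)
      rw [image_eq_zero_of_notMem_tsupport fun h => hx (self_subset_cthickening _ h),
        image_eq_zero_of_notMem_tsupport h2]
      simp
  · rw [← mul_neg]
    refine tendsto_const_nhds.mul ?_
    have hc : Tendsto (fun n : ℕ => ‖(n + 1 : ℝ)‖) atTop atTop := by
      refine tendsto_norm_atTop_atTop.comp
        (tendsto_atTop_add_const_right _ _ tendsto_natCast_atTop_atTop)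
    have := (hφ.smooth.differentiable (by simp) x).hasFDerivAt.lim
        (-(EuclideanSpace.single j 1 : E2)) hc
    rw [map_neg] at this
    refine this.congr fun n => ?_
    rw [smul_eq_mul, smul_neg, sub_eq_add_neg x]

/-- `H i j` is the weak derivative `∂_j ∂_i v ∈ L²` on `U`. -/
structure W22 (U : Set E2) (v : E2 → ℝ) (H : Fin 2 → Fin 2 → E2 → ℝ) : Prop where
  memLp : ∀ i j, MemLp (H i j) 2 volume
  weak : ∀ i j φ, IsTest U φ → ∫ x, (∇ v x) i * pd j φ x = - ∫ x, H i j x * φ x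

theorem IsLip.locallyIntegrable_grad {v : E2 → ℝ} (hv : IsLip v) (i : Fin 2) :
    LocallyIntegrable (fun x => (∇ v x) i) volume := by
  obtain ⟨M, hM0, hM⟩ := hv.exists_bound
  refine (locallyIntegrable_const M).mono ?_ (.of_forall fun x => ?_)
  · exact ((EuclideanSpace.proj i : E2 →L[ℝ] ℝ).continuous.measurable.comp
      (measurable_gradient v)).aestronglyMeasurable
  · rw [Real.norm_of_nonneg hM0]
    exact (PiLp.norm_apply_le _ _).trans (hM x)

theorem WS.exists_W22 {ε : ℝ} (hε : 0 < ε) {D U : Set E2} (hD : IsOpen D) {g v : E2 → ℝ}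
    (hv : IsLip v) (hg : IsLip g) {b : ℝ} (hgb : ∀ x, |g x| ≤ b) (hWS : WS ε D g v) {ζ : E2 → ℝ}
    (hζ : IsLip ζ) (hc : HasCompactSupport ζ) (hζ1 : ∀ x, |ζ x| ≤ 1) (hζD : tsupport ζ ⊆ D)
    (hU : ∀ x ∈ U, ζ x = 1) : ∃ H, W22 U v H := by
  obtain ⟨C, hC0, hC⟩ := hWS.diff_quotient hε hv hg hgb hζ hc hζ1
  obtain ⟨r, hr, hrD⟩ := hc.isCompact.exists_cthickening_subset_open hD hζD
  have key : ∀ i j φ, IsTest U φ → (∫ x, (∇ v x) i * pd j φ x) ^ 2 ≤ C * ∫ x, φ x ^ 2 := by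
    intro i j φ hφ
    have hl := ((tendsto_difference_quotient (hv.locallyIntegrable_grad i) hφ j).pow 2)
    rw [neg_sq] at hl
    refine le_of_tendsto hl ?_
    have hev : ∀ᶠ n : ℕ in atTop, (n + 1 : ℝ)⁻¹ < r := by
      have := tendsto_one_div_add_atTop_nhds_zero_nat (𝕜 := ℝ)
      simpa using this.eventually (gt_mem_nhds hr)
    filter_upwards [hev] with n hn
    set h : E2 := (n + 1 : ℝ)⁻¹ • EuclideanSpace.single j 1 with hh
    have hnh : ‖h‖ = (n + 1 : ℝ)⁻¹ := by
      rw [hh, norm_smul, PiLp.norm_single, norm_one, mul_one,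
        Real.norm_of_nonneg (by positivity)]
    obtain ⟨hi, hle⟩ := hC h fun x hx => (closedBall_subset_cthickening hx _).trans
      ((cthickening_mono (by rw [hnh]; exact hn.le) _).trans hrD)
    have e1 : ∫ x, (∇ v x) i * ((n + 1 : ℝ) * (φ (x - h) - φ x))
        = (n + 1 : ℝ) * ∫ x, (ζ x * ((∇ v (x + h)) i - (∇ v x) i)) * φ x := by
      have := integral_translate_sub (hv.locallyIntegrable_grad i) hφ.smooth.continuous hφ.cpt h
      rw [show (∫ x, (ζ x * ((∇ v (x + h)) i - (∇ v x) i)) * φ x)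
        = ∫ x, ((∇ v (x + h)) i - (∇ v x) i) * φ x from integral_congr_ae (.of_forall fun x => by
          by_cases hx : x ∈ tsupport φ
          · simp [hU x (hφ.supp hx)]
          · simp [image_eq_zero_of_notMem_tsupport hx]), ← this, ← integral_const_mul]
      congr 1; ext x; ring
    have hmeas : AEStronglyMeasurable (fun x => ζ x * ((∇ v (x + h)) i - (∇ v x) i)) volume := by
      have := (EuclideanSpace.proj i : E2 →L[ℝ] ℝ).continuous.measurable.comp
          (measurable_gradient v)
      exact (hζ.continuous.measurable.mul ((this.comp (measurable_add_const h)).sub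
        this)).aestronglyMeasurable
    have hpt x : (ζ x * ((∇ v (x + h)) i - (∇ v x) i)) ^ 2
        ≤ ζ x ^ 2 * ‖∇ v (x + h) - ∇ v x‖ ^ 2 := by
      rw [mul_pow]
      have := PiLp.norm_apply_le (∇ v (x + h) - ∇ v x) i
      rw [PiLp.sub_apply, Real.norm_eq_abs] at this
      have h2 : ((∇ v (x + h)) i - (∇ v x) i) ^ 2 ≤ ‖∇ v (x + h) - ∇ v x‖ ^ 2 := by
        rw [← sq_abs]; gcongr
      gcongr
    have hitg : Integrable fun x => (ζ x * ((∇ v (x + h)) i - (∇ v x) i)) ^ 2 :=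
      hi.mono' (hmeas.pow 2) (.of_forall fun x => by
        rw [Real.norm_of_nonneg (sq_nonneg _)]; exact hpt x)
    rw [e1, mul_pow]
    calc (n + 1 : ℝ) ^ 2 * (∫ x, (ζ x * ((∇ v (x + h)) i - (∇ v x) i)) * φ x) ^ 2
        ≤ (n + 1 : ℝ) ^ 2 * ((C * ‖h‖ ^ 2) * ∫ x, φ x ^ 2) := by
          gcongr
          exact (integral_mul_sq_le ((memLp_two_iff_integrable_sq hmeas).2 hitg) hφ.memLp).trans
            (mul_le_mul_of_nonneg_right
            ((integral_mono hitg hi hpt).trans hle) (integral_nonneg fun x => sq_nonneg _))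
      _ = C * ∫ x, φ x ^ 2 := by rw [hnh]; field_simp
  choose H h1 h2 h3 using fun i j => exists_weak_pd (hv.locallyIntegrable_grad i) hC0 (key i j)
  exact ⟨H, h1, h3⟩

theorem exists_dominated_subseq {D : ℕ → E2 → ℝ} (h0 : ∀ n x, 0 ≤ D n x)
    (hD : ∀ n, Integrable (D n)) (hlim : Tendsto (fun n => ∫ x, D n x) atTop (𝓝 0)) :
    ∃ φ : ℕ → ℕ, StrictMono φ ∧ ∃ B : E2 → ℝ, Integrable B ∧ ∀ᵐ x, ∀ n, D (φ n) x ≤ B x := by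
  obtain ⟨φ, hφ, hle⟩ := extraction_forall_of_eventually'
    (P := fun n k => ∫ x, D k x ≤ (1 / 2 : ℝ) ^ n)
    (fun n => by
      obtain ⟨N, hN⟩ := eventually_atTop.1 (hlim.eventually (ge_mem_nhds (by positivity :
        0 < (1 / 2 : ℝ) ^ n)))
      exact ⟨N, hN⟩)
  set S : E2 → ℝ≥0∞ := fun x => ∑' n, ENNReal.ofReal (D (φ n) x) with hS
  have hm : ∀ n, AEMeasurable (fun x => ENNReal.ofReal (D (φ n) x)) volume := fun n =>
    (hD _).aestronglyMeasurable.aemeasurable.ennreal_ofReal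
  have hfin : ∫⁻ x, S x ≠ ∞ := by
    rw [hS, lintegral_tsum hm]
    have : ∀ n, ∫⁻ x, ENNReal.ofReal (D (φ n) x) ≤ ENNReal.ofReal ((1 / 2 : ℝ) ^ n) := by
      intro n
      rw [← ofReal_integral_eq_lintegral_ofReal (hD _) (.of_forall (h0 _))]
      exact ENNReal.ofReal_le_ofReal (hle n)
    refine ne_top_of_le_ne_top ?_ (ENNReal.tsum_le_tsum this)
    rw [← ENNReal.ofReal_tsum_of_nonneg (fun n => by positivity)
      (summable_geometric_of_lt_one (by norm_num) (by norm_num))]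
    exact ENNReal.ofReal_ne_top
  have hSm : AEMeasurable S volume := by
    exact AEMeasurable.tsum hm
  refine ⟨φ, hφ, fun x => (S x).toReal, integrable_toReal_of_lintegral_ne_top hSm hfin, ?_⟩
  filter_upwards [ae_lt_top' hSm hfin] with x hx n
  rw [← ENNReal.ofReal_le_iff_le_toReal hx.ne]
  exact ENNReal.le_tsum n

theorem tendsto_e2 {l : Filter ℕ} {p : ℕ → E2} {q : E2}
    (h : ∀ i, Tendsto (fun n => p n i) l (𝓝 (q i))) : Tendsto p l (𝓝 q) := by
  exact ((PiLp.continuous_toLp 2 fun _ => ℝ).tendsto _).comp (tendsto_pi_nhds.2 h)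

/-- Identities for smooth functions with quadratic dependence on the Hessian extend to `W^{2,2}`. -/
theorem W22.limit {U : Set E2} {v : E2 → ℝ} {H : Fin 2 → Fin 2 → E2 → ℝ} (hW : W22 U v H)
    (hU : IsOpen U) (hv : IsLip v) (hvc : HasCompactSupport v) {K : Set E2} (hK : IsCompact K)
    (hKU : K ⊆ U) {Q : E2 → E2 → (Fin 2 → Fin 2 → ℝ) → ℝ}
    (hQm : Measurable fun z : E2 × E2 × (Fin 2 → Fin 2 → ℝ) => Q z.1 z.2.1 z.2.2)
    (hQc : ∀ x, Continuous fun z : E2 × (Fin 2 → Fin 2 → ℝ) => Q x z.1 z.2)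
    (hQb : ∀ M, ∃ C, ∀ x p h, ‖p‖ ≤ M → |Q x p h| ≤ C * (1 + ∑ i, ∑ j, h i j ^ 2))
    (hQ0 : ∀ x, x ∉ K → ∀ p h, Q x p h = 0)
    (hid : ∀ V : E2 → ℝ, ContDiff ℝ (⊤ : ℕ∞) V → HasCompactSupport V →
      ∫ x, Q x (∇ V x) (fun i j => pd j (pd i V) x) = 0) :
    Integrable (fun x => Q x (∇ v x) fun i j => H i j x) ∧
      ∫ x, Q x (∇ v x) (fun i j => H i j x) = 0 := by
  obtain ⟨M, hM⟩ := id hv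
  obtain ⟨C, hC⟩ := hQb M
  have hC0 : 0 ≤ C := by
    have := (abs_nonneg _).trans (hC 0 0 0 (by simp))
    simpa using this
  have hHl := fun i j =>
    (hW.memLp i j).locallyIntegrable (by norm_num)
  have hpd := fun n i =>
    funext fun x => pd_moll_of_isLip n hv i x
  have hpd2 n i j x : closedBall x (stdBump n).rOut ⊆ U →
      pd j (pd i (moll n v)) x = moll n (H i j) x := by
    intro hx
    rw [hpd]
    exact pd_moll_of_weak (hv.locallyIntegrable_grad i) (hW.weak i j _
      ⟨mker_sub_contDiff n x, mker_sub_hasCompactSupport n x, (mker_sub_tsupport n x).trans hx⟩)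
  obtain ⟨r, hr, hrU⟩ := hK.exists_cthickening_subset_open hU hKU
  obtain ⟨N, hN⟩ := eventually_atTop.1 (stdBump_rOut_tendsto.eventually (gt_mem_nhds hr))
  have hpdK :=
    fun n hn x hx i j => hpd2 n i j x ((closedBall_subset_cthickening hx _).trans
      ((cthickening_mono (hN n hn).le _).trans hrU))
  set D : ℕ → E2 → ℝ := fun n x => ∑ i, ∑ j, (moll n (H i j) x - H i j x) ^ 2 with hD
  have hDi : ∀ n i j, Integrable fun x => (moll n (H i j) x - H i j x) ^ 2 := fun n i j =>
    ((moll_memLp n (hW.memLp i j)).1.sub (hW.memLp i j)).integrable_sq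
  obtain ⟨φ, hφ, B, hB, hDB⟩ := exists_dominated_subseq (D := D)
    (fun n x => Finset.sum_nonneg fun i _ => Finset.sum_nonneg fun j _ => sq_nonneg _)
    (fun n => integrable_finsetSum _ fun i _ => integrable_finsetSum _ fun j _ => hDi n i j) (by
      have : ∀ n, ∫ x, D n x = ∑ i, ∑ j, ∫ x, (moll n (H i j) x - H i j x) ^ 2 := by
        intro n
        rw [hD, integral_finsetSum _ fun i _ => integrable_finsetSum _ fun j _ => hDi n i j]
        exact Finset.sum_congr rfl fun i _ => integral_finsetSum _ fun j _ => hDi n i j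
      simp only [this]
      have := tendsto_finsetSum Finset.univ fun (i : Fin 2) _ =>
        tendsto_finsetSum Finset.univ fun (j : Fin 2) _ => moll_tendsto_L2 (hW.memLp i j)
      simpa using this)
  have hmeas : ∀ (w : E2 → ℝ) (h : Fin 2 → Fin 2 → E2 → ℝ), (∀ i j, AEMeasurable (h i j) volume) →
      AEStronglyMeasurable (fun x => Q x (∇ w x) fun i j => h i j x) volume := by
    intro w h hh
    refine AEMeasurable.aestronglyMeasurable (hQm.comp_aemeasurable
      (aemeasurable_id.prodMk ((fun {w} => measurable_gradient w).aemeasurable.prodMk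
      (aemeasurable_pi_lambda _ fun i => aemeasurable_pi_lambda _ fun j => hh i j))))
  have hHm := fun i j =>
    (hW.memLp i j).aestronglyMeasurable.aemeasurable
  set G : E2 → ℝ := fun x => C * (K.indicator (fun _ => 1) x
    + (2 * B x + 2 * ∑ i, ∑ j, H i j x ^ 2)) with hG
  have hH2 : Integrable fun x => ∑ i, ∑ j, H i j x ^ 2 :=
    integrable_finsetSum _ fun i _ => integrable_finsetSum _ fun j _ =>
      (hW.memLp i j).integrable_sq
  have hGi : Integrable G := (((integrable_indicator_iff hK.measurableSet).2
    (integrableOn_const hK.measure_lt_top.ne)).add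
      ((hB.const_mul 2).add (hH2.const_mul 2))).const_mul C
  have hBn : ∀ᵐ x, 0 ≤ B x := by
    filter_upwards [hDB] with x hx
    exact (Finset.sum_nonneg fun i _ => Finset.sum_nonneg fun j _ => sq_nonneg _).trans (hx 0)
  have hi0 : Integrable (fun x => Q x (∇ v x) fun i j => H i j x) := by
    refine hGi.mono' (hmeas v H hHm) ?_
    filter_upwards [hBn] with x hx
    by_cases hxK : x ∈ K
    · refine (hC x _ _ (hM.norm_gradient_le x)).trans (mul_le_mul_of_nonneg_left ?_ hC0)
      rw [indicator_of_mem hxK]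
      have : 0 ≤ ∑ i, ∑ j, H i j x ^ 2 :=
        Finset.sum_nonneg fun i _ => Finset.sum_nonneg fun j _ => sq_nonneg _
      linarith
    · rw [hQ0 x hxK, norm_zero]
      have : 0 ≤ ∑ i, ∑ j, H i j x ^ 2 :=
        Finset.sum_nonneg fun i _ => Finset.sum_nonneg fun j _ => sq_nonneg _
      refine mul_nonneg hC0 (add_nonneg (indicator_nonneg (fun _ _ => zero_le_one) _)
        (by positivity))
  refine ⟨hi0, ?_⟩
  have hφN n : N ≤ φ (n + N) := by
    have := hφ.id_le (n + N); simp only [id] at this; omega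
  have hT : Tendsto (fun n => ∫ x, Q x (∇ (moll (φ (n + N)) v) x)
      fun i j => moll (φ (n + N)) (H i j) x) atTop
      (𝓝 (∫ x, Q x (∇ v x) fun i j => H i j x)) := by
    refine tendsto_integral_of_dominated_convergence G (fun n => ?_) hGi (fun n => ?_) ?_
    · exact hmeas _ _ fun i j => (moll_memLp _ (hW.memLp i j)).1.aestronglyMeasurable.aemeasurable
    · filter_upwards [hBn, hDB] with x hx hxD
      by_cases hxK : x ∈ K
      · refine (hC x _ _ ((moll_lipschitz _ hM).norm_gradient_le x)).trans
          (mul_le_mul_of_nonneg_left ?_ hC0)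
        rw [indicator_of_mem hxK]
        have h1 := hxD (n + N)
        have h2 : ∑ i, ∑ j, moll (φ (n + N)) (H i j) x ^ 2
            ≤ 2 * D (φ (n + N)) x + 2 * ∑ i, ∑ j, H i j x ^ 2 := by
          rw [hD, Finset.mul_sum, Finset.mul_sum, ← Finset.sum_add_distrib]
          refine Finset.sum_le_sum fun i _ => ?_
          rw [Finset.mul_sum, Finset.mul_sum, ← Finset.sum_add_distrib]
          refine Finset.sum_le_sum fun j _ => ?_
          nlinarith [sq_nonneg (moll (φ (n + N)) (H i j) x - 2 * H i j x)]
        linarith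
      · rw [hQ0 x hxK, norm_zero]
        have : 0 ≤ ∑ i, ∑ j, H i j x ^ 2 :=
          Finset.sum_nonneg fun i _ => Finset.sum_nonneg fun j _ => sq_nonneg _
        refine mul_nonneg hC0
          (add_nonneg (indicator_nonneg (fun _ _ => zero_le_one) _) (by positivity))
    · have a2 :=
        ae_all_iff.2 fun i => ae_all_iff.2 fun j => moll_tendsto_ae (hHl i j)
      filter_upwards [ae_all_iff.2 fun i => moll_tendsto_ae (hv.locallyIntegrable_grad i), a2] with
        x h1 h2
      have t1 : Tendsto (fun n => ∇ (moll n v) x) atTop (𝓝 (∇ v x)) := tendsto_e2 fun i => by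
        simp only [gradient_apply (moll _ v), hpd]; exact h1 i
      exact ((hQc x).tendsto (∇ v x, fun i j => H i j x)).comp
        ((t1.prodMk_nhds (tendsto_pi_nhds.2 fun i => tendsto_pi_nhds.2 fun j => h2 i j)).comp
        (hφ.tendsto_atTop.comp (tendsto_add_atTop_nat N)))
  have hz n : ∫ x, Q x (∇ (moll (φ (n + N)) v) x)
      (fun i j => moll (φ (n + N)) (H i j) x) = 0 := by
    rw [← hid _ (moll_contDiff (φ (n + N)) hv.continuous.locallyIntegrable)
      (moll_hasCompactSupport _ hvc)]
    refine integral_congr_ae (.of_forall fun x => ?_)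
    by_cases hxK : x ∈ K
    · simp only [hpdK _ (hφN n) x hxK]
    · simp only [hQ0 x hxK]
  simp only [hz] at hT
  exact (tendsto_nhds_unique hT tendsto_const_nhds)

/-- Functions of `(x, p, h)`, growing at most like `|h|^k` locally uniformly in `p`. -/
structure Grow (k : ℕ) (Q : E2 → E2 → (Fin 2 → Fin 2 → ℝ) → ℝ) : Prop where
  meas : Measurable fun z : E2 × E2 × (Fin 2 → Fin 2 → ℝ) => Q z.1 z.2.1 z.2.2
  cont : ∀ x, Continuous fun z : E2 × (Fin 2 → Fin 2 → ℝ) => Q x z.1 z.2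
  bdd : ∀ M, ∃ C, 0 ≤ C ∧ ∀ x p h, ‖p‖ ≤ M → |Q x p h| ≤ C * √(1 + ∑ i, ∑ j, h i j ^ 2) ^ k

theorem one_le_hessNorm (h : Fin 2 → Fin 2 → ℝ) : 1 ≤ √(1 + ∑ i, ∑ j, h i j ^ 2) := by
  rw [Real.one_le_sqrt]
  have : 0 ≤ ∑ i, ∑ j, h i j ^ 2 :=
    Finset.sum_nonneg fun i _ => Finset.sum_nonneg fun j _ => sq_nonneg _
  linarith

theorem Grow.mono {k l : ℕ} {Q : E2 → E2 → (Fin 2 → Fin 2 → ℝ) → ℝ} (h : Grow k Q) (hkl : k ≤ l) :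
    Grow l Q := by
  refine ⟨h.meas, h.cont, fun M => ?_⟩
  obtain ⟨C, hC0, hC⟩ := h.bdd M
  exact ⟨C, hC0, fun x p h' hp => (hC x p h' hp).trans (mul_le_mul_of_nonneg_left
    (pow_le_pow_right₀ (one_le_hessNorm h') hkl) hC0)⟩

theorem Grow.add {k : ℕ} {Q R : E2 → E2 → (Fin 2 → Fin 2 → ℝ) → ℝ} (hQ : Grow k Q)
    (hR : Grow k R) : Grow k fun x p h => Q x p h + R x p h := by
  refine ⟨hQ.meas.add hR.meas, fun x => (hQ.cont x).add (hR.cont x), fun M => ?_⟩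
  obtain ⟨C, hC0, hC⟩ := hQ.bdd M
  obtain ⟨D, hD0, hD⟩ := hR.bdd M
  refine ⟨C + D, by positivity, fun x p h hp => ?_⟩
  rw [add_mul]
  exact (abs_add_le _ _).trans (add_le_add (hC x p h hp) (hD x p h hp))

theorem Grow.mul {k l : ℕ} {Q R : E2 → E2 → (Fin 2 → Fin 2 → ℝ) → ℝ} (hQ : Grow k Q)
    (hR : Grow l R) : Grow (k + l) fun x p h => Q x p h * R x p h := by
  refine ⟨hQ.meas.mul hR.meas, fun x => (hQ.cont x).mul (hR.cont x), fun M => ?_⟩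
  obtain ⟨C, hC0, hC⟩ := hQ.bdd M
  obtain ⟨D, hD0, hD⟩ := hR.bdd M
  refine ⟨C * D, by positivity, fun x p h hp => ?_⟩
  rw [abs_mul, pow_add]
  refine (mul_le_mul (hC x p h hp) (hD x p h hp) (abs_nonneg _) (by positivity)).trans (le_of_eq ?_)
  ring

theorem grow_of_bdd {c : E2 → ℝ} (hc : Measurable c) {b : ℝ} (hb : ∀ x, |c x| ≤ b) :
    Grow 0 fun x _ _ => c x :=
  ⟨hc.comp measurable_fst, fun _ => continuous_const, fun _ =>
    ⟨b, (abs_nonneg _).trans (hb 0), fun x _ _ _ => by simpa using hb x⟩⟩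

theorem grow_of_continuous {c : E2 → ℝ} (hc : Continuous c) : Grow 0 fun _ p _ => c p := by
  refine ⟨hc.measurable.comp (measurable_fst.comp measurable_snd),
    fun _ => hc.comp continuous_fst, fun M => ?_⟩
  obtain ⟨C, hC⟩ := (isCompact_closedBall 0 M).exists_bound_of_continuousOn hc.continuousOn
  refine ⟨|C|, abs_nonneg _, fun x p h hp => ?_⟩
  simpa using (hC p (by simpa using hp)).trans (le_abs_self C)

theorem grow_const (c : ℝ) : Grow 0 fun _ _ _ => c := grow_of_continuous continuous_const

theorem grow_coord (i : Fin 2) : Grow 0 fun _ p _ => p i :=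
  grow_of_continuous (by fun_prop)

theorem grow_hess (i j : Fin 2) : Grow 1 fun _ _ h => h i j := by
  refine ⟨by fun_prop, fun x => by fun_prop, fun M => ⟨1, zero_le_one, fun x p h _ => ?_⟩⟩
  rw [one_mul, pow_one]
  refine Real.abs_le_sqrt ?_
  have h1 : h i j ^ 2 ≤ ∑ j, h i j ^ 2 :=
    Finset.single_le_sum (fun _ _ => sq_nonneg _) (Finset.mem_univ j)
  have h2 : ∑ j, h i j ^ 2 ≤ ∑ i, ∑ j, h i j ^ 2 :=
    Finset.single_le_sum
      (fun i _ => Finset.sum_nonneg fun j _ => sq_nonneg _) (Finset.mem_univ i)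
  linarith

theorem Grow.neg {k : ℕ} {Q : E2 → E2 → (Fin 2 → Fin 2 → ℝ) → ℝ} (hQ : Grow k Q) :
    Grow k fun x p h => -Q x p h := by
  simpa using (grow_const (-1)).mul hQ

theorem Grow.sub {k : ℕ} {Q R : E2 → E2 → (Fin 2 → Fin 2 → ℝ) → ℝ} (hQ : Grow k Q)
    (hR : Grow k R) : Grow k fun x p h => Q x p h - R x p h := by
  simpa [sub_eq_add_neg] using hQ.add hR.neg

theorem Grow.sum {k : ℕ} {Q : Fin 2 → E2 → E2 → (Fin 2 → Fin 2 → ℝ) → ℝ} (hQ : ∀ i, Grow k (Q i)) :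
    Grow k fun x p h => ∑ i, Q i x p h := by
  simpa only [Fin.sum_univ_two] using (hQ 0).add (hQ 1)

theorem Grow.coef_mul {k : ℕ} {Q R : E2 → E2 → (Fin 2 → Fin 2 → ℝ) → ℝ} (hQ : Grow 0 Q)
    (hR : Grow k R) : Grow k fun x p h => Q x p h * R x p h := by
  simpa using hQ.mul hR

theorem W22.limit_grow {U : Set E2} {v : E2 → ℝ} {H : Fin 2 → Fin 2 → E2 → ℝ} (hW : W22 U v H)
    (hU : IsOpen U) (hv : IsLip v) (hvc : HasCompactSupport v) {K : Set E2} (hK : IsCompact K)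
    (hKU : K ⊆ U) {Q : E2 → E2 → (Fin 2 → Fin 2 → ℝ) → ℝ} (hQ : Grow 2 Q)
    (hQ0 : ∀ x, x ∉ K → ∀ p h, Q x p h = 0)
    (hid : ∀ V : E2 → ℝ, ContDiff ℝ (⊤ : ℕ∞) V → HasCompactSupport V →
      ∫ x, Q x (∇ V x) (fun i j => pd j (pd i V) x) = 0) :
    Integrable (fun x => Q x (∇ v x) fun i j => H i j x) ∧
      ∫ x, Q x (∇ v x) (fun i j => H i j x) = 0 := by
  refine hW.limit hU hv hvc hK hKU hQ.meas hQ.cont (fun M => ?_) hQ0 hid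
  obtain ⟨C, _, hC⟩ := hQ.bdd M
  refine ⟨C, fun x p h hp => (hC x p h hp).trans (le_of_eq ?_)⟩
  rw [Real.sq_sqrt]
  have : 0 ≤ ∑ i, ∑ j, h i j ^ 2 :=
    Finset.sum_nonneg fun i _ => Finset.sum_nonneg fun j _ => sq_nonneg _
  linarith

theorem IsLip.gradient_coord_measurable {v : E2 → ℝ} (i : Fin 2) :
    Measurable fun x => (∇ v x) i :=
  (EuclideanSpace.proj i : E2 →L[ℝ] ℝ).continuous.measurable.comp (measurable_gradient v)

theorem IsLip.grow_gradient {v : E2 → ℝ} (hv : IsLip v) (i : Fin 2) :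
    Grow 0 fun x _ _ => (∇ v x) i := by
  obtain ⟨M, _, hM⟩ := hv.exists_bound
  exact grow_of_bdd (IsLip.gradient_coord_measurable i) fun x =>
    (PiLp.norm_apply_le _ _).trans (hM x)

theorem inner_e2 (p q : E2) : ⟪p, q⟫ = ∑ i, p i * q i := by
  simp [PiLp.inner_apply, mul_comm]

theorem W22.ae_equation {ε : ℝ} (hε : 0 < ε) {U : Set E2} (hU : IsOpen U) {g v : E2 → ℝ}
    (hv : IsLip v) (hvc : HasCompactSupport v) (hg : Continuous g) (hWS : WS ε U g v)
    {H : Fin 2 → Fin 2 → E2 → ℝ} (hW : W22 U v H) :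
    ∀ᵐ x, x ∈ U → ε * (∑ i, H i i x) + ∑ i, ∑ j, (∇ v x) i * (∇ v x) j * H i j x = - g x := by
  obtain ⟨M, hM0, hM⟩ := hv.exists_bound
  have hHl := fun i j =>
    (hW.memLp i j).locallyIntegrable (by norm_num)
  set f : E2 → ℝ := fun x => om ε (∇ v x) *
    ((∑ i, H i i x) + (∑ i, ∑ j, (∇ v x) i * (∇ v x) j * H i j x) / ε + g x / ε) with hf
  have hbm : ∀ {c h : E2 → ℝ} {C : ℝ}, Measurable c → (∀ x, |c x| ≤ C) →
      LocallyIntegrable h volume → LocallyIntegrable (fun x => c x * h x) volume := by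
    intro c h C hc hC hh x
    obtain ⟨s, hs, hi⟩ := hh x
    exact ⟨s, hs, hi.bdd_mul hc.aestronglyMeasurable (.of_forall hC)⟩
  have hcoord i x : |(∇ v x) i| ≤ M := (PiLp.norm_apply_le _ _).trans (hM x)
  have hfl : LocallyIntegrable f volume := by
    refine hbm (measurable_om_gradient ε v) (C := Real.exp (M ^ 2 / (2 * ε))) (fun x => ?_) ?_
    · rw [abs_of_pos (zero_lt_one.trans_le (one_le_om hε _))]
      exact om_le hε (hM x)
    · have hp i j : LocallyIntegrable (fun x => (∇ v x) i * (∇ v x) j * H i j x) volume := by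
        refine hbm ((IsLip.gradient_coord_measurable i).mul (IsLip.gradient_coord_measurable j))
          (C := M * M) (fun x => ?_) (hHl i j)
        rw [abs_mul]
        exact mul_le_mul (hcoord i x) (hcoord j x) (abs_nonneg _) hM0
      simp only [Fin.sum_univ_two, div_eq_inv_mul]
      have := ((((hp 0 0).add (hp 0 1)).add ((hp 1 0).add (hp 1 1))).smul ε⁻¹)
      exact (((hHl 0 0).add (hHl 1 1)).add this).add (hg.locallyIntegrable.smul ε⁻¹)
  have key := hU.ae_eq_zero_of_integral_contDiff_smul_eq_zero
    (hfl.locallyIntegrableOn U) (fun ψ h1 h2 h3 => by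
      have hψ : IsTest U ψ := ⟨h1, h2, h3⟩
      have hψ1 := h1.continuous
      obtain ⟨b, hb⟩ := exists_bound_of_hasCompactSupport hψ1 h2
      have hom := grow_of_continuous (continuous_om ε)
      have hQ : Grow 2 fun x p h => (∑ i, (om ε p * p i) * (∇ ψ x) i)
          + om ε p * ψ x * ((∑ i, h i i) + ε⁻¹ * ∑ i, ∑ j, (p i * p j) * h i j) := by
        refine ((Grow.sum fun i => (hom.mul (grow_coord i)).mul
          ((fun i => hψ.isLip.grow_gradient i) i)).mono (by simp)).add
          (((hom.mul (grow_of_bdd hψ1.measurable hb)).coef_mul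
            ((Grow.sum fun i => grow_hess i i).add ((grow_const _).coef_mul
              (Grow.sum fun i => Grow.sum fun j =>
                ((grow_coord i).mul (grow_coord j)).coef_mul (grow_hess i j))))).mono one_le_two)
      obtain ⟨i1, e1⟩ := hW.limit_grow hU hv hvc h2.isCompact h3 hQ (fun x hx p h => by
          have := gradient_eq_zero_of_zero_off (isClosed_tsupport ψ)
            (fun y hy => image_eq_zero_of_notMem_tsupport hy) hx
          rw [this, image_eq_zero_of_notMem_tsupport hx]; simp) (fun V hV hVc => by
        have hV2 : ContDiff ℝ 2 V := by exact_mod_cast contDiff_infty.1 hV 2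
        have := integral_Aop_smooth hV2 hVc hψ.isLip hε
        rw [← sub_eq_zero, ← integral_sub] at this
        · rw [← this]
          refine integral_congr_ae (.of_forall fun x => ?_)
          simp only [inner_e2, Aop, PiLp.smul_apply, smul_eq_mul, lap, infLap, pd2,
            gradient_apply, Fin.sum_univ_two, div_eq_inv_mul]
          ring
        · exact integrable_Aop_inner hε (hV2.of_le (by norm_num) |>.isLip hVc) hψ.isLip h2.isCompact
            fun _ hx => image_eq_zero_of_notMem_tsupport hx
        · refine integrable_mul_zero_off (Q := tsupport ψ) (Continuous.aestronglyMeasurable ?_)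
            h2.isCompact (C := (h2.isCompact.exists_bound_of_continuousOn (f := fun x =>
              -(om ε (∇ V x) * (lap V x + infLap V x / ε))) (Continuous.continuousOn ?_)).choose)
            (Exists.choose_spec (h2.isCompact.exists_bound_of_continuousOn (f := fun x =>
              -(om ε (∇ V x) * (lap V x + infLap V x / ε))) (Continuous.continuousOn ?_)))
            hψ1 fun _ hx => image_eq_zero_of_notMem_tsupport hx
          all_goals
            have a1 : Continuous (∇ V) := (LinearIsometryEquiv.continuous _).comp
              (hV2.continuous_fderiv (by norm_num))
            exact (((continuous_om ε).comp a1).mul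
              ((continuous_lap hV2).add ((continuous_infLap hV2).div_const ε))).neg)
      have e3 := integral_sub i1 (integrable_WS hε hv hg hψ.isLip h2)
      rw [e1, hWS ψ hψ.isLip h2 h3, sub_zero] at e3
      rw [← e3]
      refine integral_congr_ae (.of_forall fun x => ?_)
      simp only [inner_e2, Aop, PiLp.smul_apply, smul_eq_mul, Fin.sum_univ_two, hf, div_eq_inv_mul]
      ring)
  filter_upwards [key] with x hx hxU
  have h0 := hx hxU
  simp only [hf, mul_eq_zero, (zero_lt_one.trans_le (one_le_om hε _)).ne', false_or] at h0
  field_simp at h0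
  linarith

theorem pd_comm {w : E2 → ℝ} (hw : ContDiff ℝ 2 w) (i j : Fin 2) :
    pd i (pd j w) = pd j (pd i w) := by
  funext x
  have hd : ∀ a : E2, ∀ b : E2, fderiv ℝ (fun y => fderiv ℝ w y a) x b
      = fderiv ℝ (fderiv ℝ w) x b a := by
    intro a b
    rw [fderiv_clm_apply ((hw.fderiv_right (m := 1) (by norm_num)).differentiable (by norm_num) x)
      (differentiableAt_const a)]
    simp
  change fderiv ℝ (fun y => fderiv ℝ w y _) x _ = fderiv ℝ (fun y => fderiv ℝ w y _) x _
  rw [hd, hd]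
  exact hw.contDiffAt.isSymmSndFDerivAt (by simp) _ _

theorem ContDiff.pd_smooth {w : E2 → ℝ} (hw : ContDiff ℝ (⊤ : ℕ∞) w) (i : Fin 2) :
    ContDiff ℝ (⊤ : ℕ∞) (pd i w) :=
  (hw.fderiv_right (m := (⊤ : ℕ∞)) (by simp)).clm_apply contDiff_const

theorem integral_pd_eq_zero {W : E2 → ℝ} (hW : ContDiff ℝ 1 W) (hc : HasCompactSupport W)
    (i : Fin 2) : ∫ x, pd i W x = 0 := by
  have := (isLip_const 1).integral_pd (hW.isLip hc) hc i
  simp only [gradient_apply, one_mul] at this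
  have h0 : ∀ x : E2, pd i (fun _ => 1) x = 0 := fun x => by simp [pd]
  simp only [h0, zero_mul, integral_zero] at this
  linarith

/-- `φ` has partial derivatives `a` at `x`. -/
def HasPd (φ : E2 → ℝ) (a : Fin 2 → ℝ) (x : E2) : Prop :=
  DifferentiableAt ℝ φ x ∧ ∀ i, pd i φ x = a i

theorem ContDiff.hasPd {w : E2 → ℝ} (hw : ContDiff ℝ (⊤ : ℕ∞) w) (x : E2) :
    HasPd w (fun i => pd i w x) x :=
  ⟨hw.differentiable (by simp) x, fun _ => rfl⟩

theorem HasPd.add {φ ψ : E2 → ℝ} {a b : Fin 2 → ℝ} {x : E2} (h1 : HasPd φ a x)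
    (h2 : HasPd ψ b x) : HasPd (fun y => φ y + ψ y) (fun i => a i + b i) x :=
  ⟨h1.1.add h2.1, fun i => by
    beta_reduce; rw [← h1.2, ← h2.2]; unfold pd; erw [fderiv_add h1.1 h2.1]; rfl⟩

theorem HasPd.sub {φ ψ : E2 → ℝ} {a b : Fin 2 → ℝ} {x : E2} (h1 : HasPd φ a x)
    (h2 : HasPd ψ b x) : HasPd (fun y => φ y - ψ y) (fun i => a i - b i) x :=
  ⟨h1.1.sub h2.1, fun i => by
    beta_reduce; rw [← h1.2, ← h2.2]; unfold pd; erw [fderiv_sub h1.1 h2.1]; rfl⟩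

theorem HasPd.mul {φ ψ : E2 → ℝ} {a b : Fin 2 → ℝ} {x : E2} (h1 : HasPd φ a x)
    (h2 : HasPd ψ b x) : HasPd (fun y => φ y * ψ y) (fun i => φ x * b i + ψ x * a i) x :=
  ⟨h1.1.mul h2.1, fun i => by
    beta_reduce; rw [← h1.2, ← h2.2]; unfold pd; erw [fderiv_mul h1.1 h2.1]; rfl⟩

theorem HasPd.const (c : ℝ) (x : E2) : HasPd (fun _ => c) (fun _ => 0) x :=
  ⟨differentiableAt_const c, fun i => by simp [pd]⟩

theorem HasPd.comp {φ : E2 → ℝ} {a : Fin 2 → ℝ} {x : E2} (h1 : HasPd φ a x) {F : ℝ → ℝ} {F' : ℝ}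
    (hF : HasDerivAt F F' (φ x)) : HasPd (fun y => F (φ y)) (fun i => F' * a i) x := by
  have := hF.comp_hasFDerivAt x h1.1.hasFDerivAt
  refine ⟨this.differentiableAt, fun i => ?_⟩
  beta_reduce; rw [← h1.2]; unfold pd; erw [this.fderiv]; rfl

/-- Weights in the energy identity, as functions of `P = |p|²`. -/
def kf (α e P : ℝ) : ℝ := (P + e) ^ (α - 3) * (α * P + 2 * e)

def kd (α e P : ℝ) : ℝ := (α - 3) * (P + e) ^ (α - 4) * (α * P + 2 * e) + α * (P + e) ^ (α - 3)

def Kf (α e P : ℝ) : ℝ := P * (P + e) ^ (α - 2)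

def Kd (α e P : ℝ) : ℝ := (P + e) ^ (α - 3) * ((α - 1) * P + e)

theorem hasDerivAt_kf {α e P : ℝ} (h : 0 < P + e) : HasDerivAt (kf α e) (kd α e P) P := by
  have h1 : HasDerivAt (fun P => P + e) 1 P := (hasDerivAt_id P).add_const e
  have h3 : HasDerivAt (fun P => α * P + 2 * e) α P := by
    simpa using ((hasDerivAt_id P).const_mul α).add_const (2 * e)
  refine ((h1.rpow_const (p := α - 3) (Or.inl h.ne')).mul h3).congr_deriv ?_
  unfold kd
  rw [show α - 3 - 1 = α - 4 by ring]; ring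

theorem hasDerivAt_Kf {α e P : ℝ} (h : 0 < P + e) : HasDerivAt (Kf α e) (Kd α e P) P := by
  have h1 : HasDerivAt (fun P => P + e) 1 P := (hasDerivAt_id P).add_const e
  refine ((hasDerivAt_id P).mul (h1.rpow_const (p := α - 2) (Or.inl h.ne'))).congr_deriv ?_
  unfold Kd
  rw [show α - 2 - 1 = α - 3 by ring, show α - 2 = (α - 3) + 1 by ring, Real.rpow_add_one h.ne']
  simp; ring

theorem Kf_add {α e P : ℝ} (h : 0 < P + e) : (P + e) ^ (α - 2) + Kd α e P = kf α e P := by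
  unfold Kd kf
  rw [show α - 2 = (α - 3) + 1 by ring, Real.rpow_add_one h.ne']
  ring

/-- `P = |DV|²`. -/
theorem hasPd_gradSq {V : E2 → ℝ} (hV : ContDiff ℝ (⊤ : ℕ∞) V) (x : E2) :
    HasPd (fun y => ‖∇ V y‖ ^ 2) (fun i => 2 * ∑ j, pd i (pd j V) x * pd j V x) x := by
  have e : (fun y => ‖∇ V y‖ ^ 2) = fun y => pd 0 V y * pd 0 V y + pd 1 V y * pd 1 V y := by
    funext y
    rw [← real_inner_self_eq_norm_sq, inner_e2]
    simp [gradient_apply, Fin.sum_univ_two]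
  rw [e]
  have := (((hV.pd_smooth 0).hasPd x).mul ((hV.pd_smooth 0).hasPd x)).add
    (((hV.pd_smooth 1).hasPd x).mul ((hV.pd_smooth 1).hasPd x))
  refine ⟨this.1, fun i => ?_⟩
  rw [this.2]; beta_reduce; rw [Fin.sum_univ_two]; ring

theorem contDiff_gradSq {V : E2 → ℝ} (hV : ContDiff ℝ (⊤ : ℕ∞) V) :
    ContDiff ℝ (⊤ : ℕ∞) fun y => ‖∇ V y‖ ^ 2 :=
  ((LinearIsometryEquiv.contDiff _).comp (hV.fderiv_right (m := (⊤ : ℕ∞)) (by simp))).norm_sq ℝ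

theorem contDiff_rpow_gradSq {V : E2 → ℝ} (hV : ContDiff ℝ (⊤ : ℕ∞) V) {e : ℝ} (he : 0 < e)
    (s : ℝ) : ContDiff ℝ (⊤ : ℕ∞) fun y => (‖∇ V y‖ ^ 2 + e) ^ s :=
  ((contDiff_gradSq hV).add contDiff_const).rpow_const_of_ne fun x => by positivity

theorem contDiff_kf {V : E2 → ℝ} (hV : ContDiff ℝ (⊤ : ℕ∞) V) {e : ℝ} (he : 0 < e) (α : ℝ) :
    ContDiff ℝ (⊤ : ℕ∞) fun y => kf α e (‖∇ V y‖ ^ 2) :=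
  (contDiff_rpow_gradSq hV he _).mul ((contDiff_const.mul (contDiff_gradSq hV)).add contDiff_const)

theorem contDiff_Kf {V : E2 → ℝ} (hV : ContDiff ℝ (⊤ : ℕ∞) V) {e : ℝ} (he : 0 < e) (α : ℝ) :
    ContDiff ℝ (⊤ : ℕ∞) fun y => Kf α e (‖∇ V y‖ ^ 2) :=
  (contDiff_gradSq hV).mul (contDiff_rpow_gradSq hV he _)

/-- Integrand of the divergence identity. -/
def idDet (α e : ℝ) (ζ : E2 → ℝ) (x p : E2) (h : Fin 2 → Fin 2 → ℝ) : ℝ :=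
  ζ x * kf α e (‖p‖ ^ 2) * ((∑ i, h i i) * (∑ i, ∑ j, p i * p j * h i j)
      - ∑ i, (∑ j, h j i * p j) ^ 2)
    - Kf α e (‖p‖ ^ 2) * (∑ i, pd i ζ x * ∑ j, h j i * p j)
    - Kd α e (‖p‖ ^ 2) * (∑ i, p i * pd i ζ x) * (∑ i, ∑ j, p i * p j * h i j)
    - 1 / 2 * Kf α e (‖p‖ ^ 2) * ∑ i, ∑ j, p i * p j * pd i (pd j ζ) x

theorem integral_idDet {V ζ : E2 → ℝ} (hV : ContDiff ℝ (⊤ : ℕ∞) V)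
    (hζ : ContDiff ℝ (⊤ : ℕ∞) ζ) (hc : HasCompactSupport ζ) {α e : ℝ} (he : 0 < e) :
    ∫ x, idDet α e ζ x (∇ V x) (fun i j => pd j (pd i V) x) = 0 := by
  have hp := hV.pd_smooth
  have hh := fun i j => (hp j).pd_smooth i
  have hKc := contDiff_Kf hV he α
  have hz := hζ.pd_smooth
  set q : E2 → ℝ := fun y => pd 0 V y * pd 0 ζ y + pd 1 V y * pd 1 ζ y with hq
  have hqc := ((hp 0).mul (hz 0)).add ((hp 1).mul (hz 1))
  set W0 : E2 → ℝ := fun y => ζ y * (Kf α e (‖∇ V y‖ ^ 2)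
      * (pd 1 (pd 1 V) y * pd 0 V y - pd 0 (pd 1 V) y * pd 1 V y))
    - Kf α e (‖∇ V y‖ ^ 2) * (q y * pd 0 V y) with hW0
  set W1 : E2 → ℝ := fun y => ζ y * (Kf α e (‖∇ V y‖ ^ 2)
      * (pd 0 (pd 0 V) y * pd 1 V y - pd 0 (pd 1 V) y * pd 0 V y))
    - Kf α e (‖∇ V y‖ ^ 2) * (q y * pd 1 V y) with hW1
  have c0 := (hζ.mul (hKc.mul (((hh 1 1).mul (hp 0)).sub
    ((hh 0 1).mul (hp 1))))).sub (hKc.mul (hqc.mul (hp 0)))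
  have c1 := (hζ.mul (hKc.mul (((hh 0 0).mul (hp 1)).sub
    ((hh 0 1).mul (hp 0))))).sub (hKc.mul (hqc.mul (hp 1)))
  have hzz i x : x ∉ tsupport ζ → pd i ζ x = 0 := fun hx => by
    rw [← gradient_apply, gradient_eq_zero_of_zero_off (isClosed_tsupport ζ)
      (fun y hy => image_eq_zero_of_notMem_tsupport hy) hx]; rfl
  have s0 : HasCompactSupport W0 := .intro hc.isCompact fun x hx => by
    simp [hW0, hq, image_eq_zero_of_notMem_tsupport hx, hzz _ x hx]
  have s1 : HasCompactSupport W1 := .intro hc.isCompact fun x hx => by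
    simp [hW1, hq, image_eq_zero_of_notMem_tsupport hx, hzz _ x hx]
  have i0 := integral_pd_eq_zero (by exact_mod_cast contDiff_infty.1 c0 1) s0 0
  have i1 := integral_pd_eq_zero (by exact_mod_cast contDiff_infty.1 c1 1) s1 1
  have j : ∀ {W : E2 → ℝ} i, ContDiff ℝ (⊤ : ℕ∞) W → HasCompactSupport W →
      Integrable (pd i W) := fun i hW hWc =>
    (hW.pd_smooth i).continuous.integrable_of_hasCompactSupport (hWc.fderiv_apply (𝕜 := ℝ) _)
  have key := integral_add (j 0 c0 s0) (j 1 c1 s1)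
  rw [i0, i1, add_zero] at key
  have e2 : ∫ x, idDet α e ζ x (∇ V x) (fun i j => pd j (pd i V) x)
      = ∫ x, 1 / 2 * (pd 0 W0 x + pd 1 W1 x) := by
    refine integral_congr_ae (.of_forall fun x => ?_)
    have hpos : 0 < ‖∇ V x‖ ^ 2 + e := by positivity
    have dK := (hasPd_gradSq hV x).comp (hasDerivAt_Kf (α := α) (e := e) hpos)
    have dp := fun i => (hp i).hasPd x
    have dh := fun i j => (hh i j).hasPd x
    have dz := fun i => (hz i).hasPd x
    have dq := ((dp 0).mul (dz 0)).add ((dp 1).mul (dz 1))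
    have d0 := (((hζ.hasPd x).mul (dK.mul (((dh 1 1).mul (dp 0)).sub
      ((dh 0 1).mul (dp 1))))).sub (dK.mul (dq.mul (dp 0)))).2 0
    have d1 := (((hζ.hasPd x).mul (dK.mul (((dh 0 0).mul (dp 1)).sub
      ((dh 0 1).mul (dp 0))))).sub (dK.mul (dq.mul (dp 1)))).2 1
    have hζ2 : ContDiff ℝ 2 ζ := by exact_mod_cast contDiff_infty.1 hζ 2
    have hp2 := fun i => by
      exact_mod_cast contDiff_infty.1 (hp i) 2
    have t1 := pd_comm (by exact_mod_cast contDiff_infty.1 hV 2) 1 0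
    have t3 : pd 1 (pd 0 (pd 0 V)) = pd 0 (pd 0 (pd 1 V)) := by
      rw [pd_comm (hp2 0) 1 0, t1]
    change _ = 1 / 2 * (pd 0 W0 x + pd 1 W1 x)
    rw [show pd 0 W0 x = _ from d0, show pd 1 W1 x = _ from d1]
    have hP : ‖∇ V x‖ ^ 2 = pd 0 V x * pd 0 V x + pd 1 V x * pd 1 V x := by
      rw [← real_inner_self_eq_norm_sq, inner_e2]
      simp [gradient_apply, Fin.sum_univ_two]
    have hKK : Kf α e (‖∇ V x‖ ^ 2) = (pd 0 V x * pd 0 V x + pd 1 V x * pd 1 V x)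
      * (‖∇ V x‖ ^ 2 + e) ^ (α - 2) := by rw [Kf, ← hP]
    simp only [idDet, gradient_apply, Fin.sum_univ_two, t1, pd_comm (hp2 1) 1 0, t3,
      pd_comm hζ2 1 0, ← Kf_add (α := α) hpos, hKK]
    ring
  rw [e2, integral_const_mul, key, mul_zero]

/-- Integrand of the identity obtained by testing with the right-hand side. -/
def idRhs (α e : ℝ) (ζ g : E2 → ℝ) (x p : E2) (h : Fin 2 → Fin 2 → ℝ) : ℝ :=
  kf α e (‖p‖ ^ 2) * ζ x * (∑ i, (∇ g x) i * p i)
    + g x * (2 * ζ x * kd α e (‖p‖ ^ 2) * (∑ i, ∑ j, p i * p j * h i j)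
    + kf α e (‖p‖ ^ 2) * (∑ i, p i * pd i ζ x) + ζ x * kf α e (‖p‖ ^ 2) * ∑ i, h i i)

theorem integral_idRhs {V ζ g : E2 → ℝ} (hV : ContDiff ℝ (⊤ : ℕ∞) V) (hg : IsLip g)
    (hζ : ContDiff ℝ (⊤ : ℕ∞) ζ) (hc : HasCompactSupport ζ) {α e : ℝ} (he : 0 < e) :
    ∫ x, idRhs α e ζ g x (∇ V x) (fun i j => pd j (pd i V) x) = 0 := by
  have hp := hV.pd_smooth
  set W : Fin 2 → E2 → ℝ := fun i y => ζ y * (kf α e (‖∇ V y‖ ^ 2) * pd i V y) with hW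
  have c i : ContDiff ℝ (⊤ : ℕ∞) (W i) := hζ.mul ((contDiff_kf hV he α).mul (hp i))
  have s i : HasCompactSupport (W i) := hc.mul_right
  have l := fun i =>
    ContDiff.isLip (by exact_mod_cast contDiff_infty.1 (c i) 1) (s i)
  have key := fun i => hg.integral_pd (l i) (s i) i
  have j1 := fun i => by
    simpa [mul_comm] using (hg.locallyIntegrable_grad i).integrable_smul_left_of_hasCompactSupport
      (c i).continuous (s i)
  have j2 : ∀ i, Integrable fun x => g x * pd i (W i) x := fun i =>
    (hg.continuous.mul ((c i).pd_smooth i).continuous).integrable_of_hasCompactSupport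
      ((s i).fderiv_apply (𝕜 := ℝ) _).mul_left
  simp only [gradient_apply (W _)] at key
  have e0 i : ∫ x, ((∇ g x) i * W i x + g x * pd i (W i) x) = 0 := by
    rw [integral_add (j1 i) (j2 i), key]; ring
  have e1 := integral_add ((j1 0).fadd (j2 0)) ((j1 1).fadd (j2 1))
  rw [e0, e0, add_zero] at e1
  rw [← e1]
  refine integral_congr_ae (.of_forall fun x => ?_)
  have dk := (hasPd_gradSq hV x).comp (hasDerivAt_kf (α := α) (e := e) (by positivity))
  simp only [hW, fun i => ((hζ.hasPd x).mul (dk.mul ((hp i).hasPd x))).2 i, idRhs, gradient_apply V,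
    Fin.sum_univ_two]
  ring

/-- Integrand of the weak formulation of the derivative of `(|Dv|² + e)^{s}`. -/
def idPow (s e : ℝ) (φ : E2 → ℝ) (i : Fin 2) (x p : E2) (h : Fin 2 → Fin 2 → ℝ) : ℝ :=
  (‖p‖ ^ 2 + e) ^ s * pd i φ x
    + φ x * (2 * s * (‖p‖ ^ 2 + e) ^ (s - 1)) * ∑ j, h j i * p j

theorem integral_idPow {V φ : E2 → ℝ} (hV : ContDiff ℝ (⊤ : ℕ∞) V)
    (hφ : ContDiff ℝ (⊤ : ℕ∞) φ) (hc : HasCompactSupport φ) {s e : ℝ} (he : 0 < e) (i : Fin 2) :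
    ∫ x, idPow s e φ i x (∇ V x) (fun i j => pd j (pd i V) x) = 0 := by
  set A : E2 → ℝ := fun y => (‖∇ V y‖ ^ 2 + e) ^ s with hA
  have cA := contDiff_rpow_gradSq hV he s
  have c1 : ContDiff ℝ 1 fun y => A y * φ y := by exact_mod_cast contDiff_infty.1 (cA.mul hφ) 1
  rw [← integral_pd_eq_zero c1 hc.mul_left i]
  refine integral_congr_ae (.of_forall fun x => ?_)
  have hpos : 0 < ‖∇ V x‖ ^ 2 + e := by positivity
  have h1 : HasDerivAt (fun P => (P + e) ^ s) (s * (‖∇ V x‖ ^ 2 + e) ^ (s - 1)) (‖∇ V x‖ ^ 2) := by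
    simpa using ((hasDerivAt_id (‖∇ V x‖ ^ 2)).add_const e).rpow_const (Or.inl hpos.ne')
  have := (((hasPd_gradSq hV x).comp h1).mul (hφ.hasPd x)).2 i
  beta_reduce at this ⊢
  rw [this]
  simp only [idPow, gradient_apply, Fin.sum_univ_two]
  ring

theorem sq_le_of_forall_young {a b c : ℝ} (ha : 0 ≤ a) (hb : 0 ≤ b)
    (h : ∀ τ : ℝ, 0 < τ → a ≤ τ * b + c / τ) : 0 ≤ c ∧ a ^ 2 ≤ 4 * b * c := by
  have h1 : ∀ τ : ℝ, 0 < τ → 0 ≤ b * (τ * τ) + -a * τ + c := fun τ hτ => by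
    have := mul_le_mul_of_nonneg_right (h τ hτ) hτ.le
    rw [add_mul, div_mul_cancel₀ _ hτ.ne'] at this
    linarith
  have hc : 0 ≤ c := by
    have ht : Tendsto (fun τ => b * (τ * τ) + -a * τ + c) (𝓝[>] 0)
        (𝓝 (b * (0 * 0) + -a * 0 + c)) :=
      (Continuous.tendsto (by fun_prop) 0).mono_left nhdsWithin_le_nhds
    have := ge_of_tendsto ht (eventually_nhdsWithin_of_forall fun τ hτ => h1 τ hτ)
    simpa using this
  refine ⟨hc, ?_⟩
  have := discrim_le_zero (c := c) fun τ => by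
    rcases lt_or_ge 0 τ with hτ | hτ
    · exact h1 τ hτ
    · have := mul_nonneg ha (neg_nonneg.2 hτ)
      linarith [mul_nonneg hb (mul_self_nonneg τ)]
  rw [discrim] at this
  linarith

theorem abs_le_young {a s t δ : ℝ} (hs : 0 ≤ s) (ht : 0 ≤ t) (hδ : 0 < δ) (h : a ^ 2 ≤ s * t) :
    |a| ≤ δ * s + t / (4 * δ) := by
  refine abs_le_of_sq_le_sq ?_ (by positivity)
  refine h.trans ?_
  have : δ * s * (t / (4 * δ)) = s * t / 4 := by field_simp
  nlinarith [sq_nonneg (δ * s - t / (4 * δ))]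

theorem rpow_le_kf {α e P : ℝ} (hα : 1 ≤ α) (he : 0 < e) (hP : 0 ≤ P) :
    (P + e) ^ (α - 2) ≤ kf α e P := by
  have hz : 0 < P + e := by positivity
  rw [kf, show α - 2 = (α - 3) + 1 by ring, Real.rpow_add_one hz.ne']
  exact mul_le_mul_of_nonneg_left (by nlinarith) (by positivity)

theorem kf_le_rpow {α e P : ℝ} (hα : 1 ≤ α) (he : 0 < e) (hP : 0 ≤ P) :
    kf α e P ≤ (α + 2) * (P + e) ^ (α - 2) := by
  have hz : 0 < P + e := by positivity
  rw [kf, show α - 2 = (α - 3) + 1 by ring, Real.rpow_add_one hz.ne']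
  have : 0 < (P + e) ^ (α - 3) := by positivity
  have h2 : α * P + 2 * e ≤ (α + 2) * (P + e) := by nlinarith
  nlinarith

theorem Kd_nonneg {α e P : ℝ} (hα : 1 ≤ α) (he : 0 < e) (hP : 0 ≤ P) : 0 ≤ Kd α e P :=
  mul_nonneg (by positivity) (add_nonneg (mul_nonneg (by linarith) hP) he.le)

theorem Kd_le_kf {α e P : ℝ} (he : 0 < e) (hP : 0 ≤ P) : Kd α e P ≤ kf α e P :=
  mul_le_mul_of_nonneg_left (by nlinarith) (by positivity)

theorem kd_eq {α e P : ℝ} (he : 0 < e) (hP : 0 ≤ P) :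
    kd α e P = (α - 2) * ((P + e) ^ (α - 4) * (α * P + 3 * e)) := by
  have hz : 0 < P + e := by positivity
  rw [kd, show α - 3 = (α - 4) + 1 by ring, Real.rpow_add_one hz.ne']
  ring

/-- The indefinite lower-order term is absorbed because `α > 3/2`. -/
theorem kd_mul_le {α e ε P X Y D g θ : ℝ} (hα : 1 ≤ α) (hθ0 : 0 ≤ θ) (hθ : 2 * (2 - α) ≤ θ)
    (he : 0 < e) (hε : 0 < ε) (hP : 0 ≤ P) (hD : D ^ 2 ≤ P * X) (hX : 0 ≤ X)
    (hg : D + ε * Y = -g) :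
    2 * g * kd α e P * D ≤ (θ + 4 * |α - 2| * (ε / e)) * kf α e P * (X + ε * Y ^ 2) := by
  have hz : 0 < P + e := by positivity
  set q := X + ε * Y ^ 2 with hq
  have hq0 : 0 ≤ q := by positivity
  set w := (P + e) ^ (α - 4)
  have hw0 : 0 < w := by positivity
  have hkd := kd_eq (α := α) he hP
  have hk : kf α e P = w * (P + e) * (α * P + 2 * e) := by
    rw [kf, show α - 3 = (α - 4) + 1 by ring, Real.rpow_add_one hz.ne']
  have hg' : g = -D - ε * Y := by linarith
  have hm0 : 0 ≤ w * (α * P + 3 * e) := by positivity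
  have hεe : ε * (w * (α * P + 3 * e)) ≤ 2 * (ε / e) * kf α e P := by
    rw [hk]
    have h1 : e * (α * P + 3 * e) ≤ 2 * ((P + e) * (α * P + 2 * e)) := by
      nlinarith [mul_nonneg hP hP, mul_nonneg hP he.le, mul_nonneg (mul_nonneg hP hP)
        (by linarith : 0 ≤ α),
        mul_nonneg (mul_nonneg hP he.le) (by linarith : 0 ≤ α), mul_pos he he]
    have h2 := mul_le_mul_of_nonneg_left h1 (by positivity : 0 ≤ w * (ε / e))
    have h3 : w * (ε / e) * (e * (α * P + 3 * e)) = ε * (w * (α * P + 3 * e)) := by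
      field_simp
    linarith
  have hk0 : 0 ≤ kf α e P := by rw [hk]; positivity
  rcases le_or_gt 2 α with h | h
  · have h1 : g * D ≤ ε * q := by
      rw [hg', hq]; nlinarith [sq_nonneg (D + ε * Y / 2), mul_nonneg hε.le hX, sq_nonneg (ε * Y)]
    rw [abs_of_nonneg (by linarith), hkd]
    calc 2 * g * ((α - 2) * (w * (α * P + 3 * e))) * D
        = 2 * (α - 2) * (w * (α * P + 3 * e)) * (g * D) := by ring
      _ ≤ 2 * (α - 2) * (w * (α * P + 3 * e)) * (ε * q) :=
          mul_le_mul_of_nonneg_left h1 (mul_nonneg (by linarith) hm0)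
      _ = 2 * (α - 2) * q * (ε * (w * (α * P + 3 * e))) := by ring
      _ ≤ 2 * (α - 2) * q * (2 * (ε / e) * kf α e P) :=
          mul_le_mul_of_nonneg_left hεe (mul_nonneg (by linarith) hq0)
      _ ≤ _ := by nlinarith [mul_nonneg hθ0 (mul_nonneg hk0 hq0)]
  · have h1 : -(g * D) ≤ (P + ε) * q := by
      rw [hg', hq]
      nlinarith [sq_nonneg (D - ε * Y), mul_nonneg hε.le hX, mul_nonneg hP hX, sq_nonneg (ε * Y),
        mul_nonneg hP (mul_nonneg hε.le (sq_nonneg Y)), sq_nonneg Y, mul_nonneg hε.le (sq_nonneg Y)]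
    have h2 : 2 * (2 - α) * (w * (α * P + 3 * e)) * P ≤ θ * kf α e P := by
      have h3 : w * (α * P + 3 * e) * P ≤ kf α e P := by
        rw [hk]
        have h4 : (α * P + 3 * e) * P ≤ (P + e) * (α * P + 2 * e) := by
          nlinarith [mul_nonneg hP he.le, mul_pos he he]
        nlinarith [mul_le_mul_of_nonneg_left h4 hw0.le]
      calc _ = 2 * (2 - α) * (w * (α * P + 3 * e) * P) := by ring
        _ ≤ 2 * (2 - α) * kf α e P := mul_le_mul_of_nonneg_left h3 (by linarith)
        _ ≤ _ := mul_le_mul_of_nonneg_right hθ hk0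
    rw [abs_of_neg (by linarith), hkd]
    calc 2 * g * ((α - 2) * (w * (α * P + 3 * e))) * D
        = 2 * (2 - α) * (w * (α * P + 3 * e)) * (-(g * D)) := by ring
      _ ≤ 2 * (2 - α) * (w * (α * P + 3 * e)) * ((P + ε) * q) :=
          mul_le_mul_of_nonneg_left h1 (mul_nonneg (by linarith) hm0)
      _ = (2 * (2 - α) * (w * (α * P + 3 * e)) * P + 2 * (2 - α) * (ε * (w * (α * P + 3 * e)))) *
        q := by
          ring
      _ ≤ (θ * kf α e P + 2 * (2 - α) * (2 * (ε / e) * kf α e P)) * q :=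
          mul_le_mul_of_nonneg_right
            (add_le_add h2 (mul_le_mul_of_nonneg_left hεe (by linarith : 0 ≤ 2 * (2 - α)))) hq0
      _ = _ := by ring

theorem sq_rhs_le {ε P X Y D g : ℝ} (hε : 0 < ε) (hP : 0 ≤ P) (hX : 0 ≤ X) (hD : D ^ 2 ≤ P * X)
    (hg : D + ε * Y = -g) : g ^ 2 ≤ (P + ε) * (X + ε * Y ^ 2) := by
  have e1 : g = -D - ε * Y := by linarith
  have h2 : 2 * (D * Y) ≤ X + P * Y ^ 2 := by
    have h3 : (2 * (D * Y)) ^ 2 ≤ (X + P * Y ^ 2) ^ 2 := by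
      nlinarith [sq_nonneg (X - P * Y ^ 2)]
    exact (abs_le_of_sq_le_sq h3 (by positivity) |> (le_abs_self _).trans)
  have h4 := mul_le_mul_of_nonneg_left h2 hε.le
  have e2 : g ^ 2 = D ^ 2 + ε * (2 * (D * Y)) + (ε * Y) ^ 2 := by rw [e1]; ring
  rw [e2]
  linarith

set_option maxHeartbeats 400000 in
theorem energy_pointwise {α e ε P X Y D g θ B ζ χ A T Q δ : ℝ} (hα : 1 ≤ α) (hθ0 : 0 ≤ θ)
    (hθ : 2 * (2 - α) ≤ θ) (hδ : 0 < δ) (hδθ : θ + 5 * δ ≤ 1) (he : 0 < e) (hε : 0 < ε)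
    (hεe : ε ≤ e) (hεδ : 4 * |α - 2| * (ε / e) ≤ δ)
    (hP : 0 ≤ P) (hX : 0 ≤ X) (hD : D ^ 2 ≤ P * X) (hg : D + ε * Y = -g)
    (hB : 0 ≤ B) (hζ : 0 ≤ ζ) (hχ0 : 0 ≤ χ) (hχ : ζ * χ = ζ)
    (hA : A ^ 2 ≤ P * (B * ζ)) (hT : T ^ 2 ≤ X * (B * ζ)) (hQ : |Q| ≤ B * P * χ) :
    ζ * kf α e P * (Y * D - X) - Kf α e P * T - Kd α e P * A * D - 1 / 2 * Kf α e P * Q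
      + g * (2 * ζ * kd α e P * D + kf α e P * A + ζ * kf α e P * Y)
      ≤ (α + 2) * 5 / δ * B * χ * ((P + e) ^ (α - 1) * P) - δ / 4 *
        (ζ * ((P + e) ^ (α - 2) * X)) := by
  have hz : 0 < P + e := by positivity
  have h1 := mul_le_mul_of_nonneg_left (kd_mul_le hα hθ0 hθ he hε hP hD hX hg) hζ
  set q := X + ε * Y ^ 2 with hq
  have hXq : X ≤ q := by rw [hq]; nlinarith [mul_nonneg hε.le (sq_nonneg Y)]
  set k := kf α e P with hk
  have hkl := rpow_le_kf hα he hP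
  have hku := kf_le_rpow hα he hP
  rw [← hk] at hkl hku
  have hk0 := (by positivity : 0 ≤ (P + e) ^ (α - 2)).trans hkl
  have hK : Kf α e P ≤ k * P := by
    rw [Kf, mul_comm]; exact mul_le_mul_of_nonneg_right hkl hP
  have hK0 : 0 ≤ Kf α e P := by rw [Kf]; positivity
  have hKd : Kd α e P ≤ k := Kd_le_kf he hP
  set N := B * χ * ((P + e) * P) with hN
  have hN0 : 0 ≤ N := by positivity
  have hg2 : g ^ 2 ≤ (P + e) * q := by
    have := sq_rhs_le hε hP hX hD hg
    exact this.trans (mul_le_mul_of_nonneg_right (by linarith) (by positivity))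
  have y2 : |g * A| ≤ δ * (ζ * q) + N / (4 * δ) := by
    refine abs_le_young (by positivity) hN0 hδ ?_
    rw [mul_pow]
    calc g ^ 2 * A ^ 2 ≤ ((P + e) * q) * (P * (B * ζ)) :=
          mul_le_mul hg2 hA (sq_nonneg _) (by positivity)
      _ = ((P + e) * q) * (P * (B * (ζ * χ))) := by rw [hχ]
      _ = _ := by rw [hN]; ring
  have y3 : |P * T| ≤ δ * (ζ * q) + N / (4 * δ) := by
    refine abs_le_young (by positivity) hN0 hδ ?_
    rw [mul_pow]
    calc P ^ 2 * T ^ 2 ≤ (P * (P + e)) * (q * (B * ζ)) := by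
          refine mul_le_mul (by nlinarith) (hT.trans ?_) (sq_nonneg _) (by positivity)
          exact mul_le_mul_of_nonneg_right hXq (by positivity)
      _ = (P * (P + e)) * (q * (B * (ζ * χ))) := by rw [hχ]
      _ = _ := by rw [hN]; ring
  have y4 : |A * D| ≤ δ * (ζ * q) + N / (4 * δ) := by
    refine abs_le_young (by positivity) hN0 hδ ?_
    rw [mul_pow]
    calc A ^ 2 * D ^ 2 ≤ (P * (B * ζ)) * ((P + e) * q) := by
          refine mul_le_mul hA (hD.trans ?_) (sq_nonneg _) (by positivity)
          exact mul_le_mul (by linarith) hXq hX hz.le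
      _ = (P * (B * (ζ * χ))) * ((P + e) * q) := by rw [hχ]
      _ = _ := by rw [hN]; ring
  set R := δ * (ζ * q) + N / (4 * δ) with hR
  have hR0 := (abs_nonneg _).trans y2
  have t2 := mul_le_mul_of_nonneg_left ((le_abs_self _).trans y2) hk0
  have t3 : -(Kf α e P * T) ≤ k * R := by
    calc -(Kf α e P * T) ≤ Kf α e P * |T| := by
          rw [← mul_neg]; exact mul_le_mul_of_nonneg_left (neg_le_abs T) hK0
      _ ≤ k * P * |T| := mul_le_mul_of_nonneg_right hK (abs_nonneg _)
      _ = k * |P * T| := by rw [abs_mul, abs_of_nonneg hP]; ring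
      _ ≤ _ := mul_le_mul_of_nonneg_left y3 hk0
  have t4 : -(Kd α e P * A * D) ≤ k * R := by
    calc -(Kd α e P * A * D) = Kd α e P * (-(A * D)) := by ring
      _ ≤ Kd α e P * |A * D| := mul_le_mul_of_nonneg_left (neg_le_abs _) (Kd_nonneg hα he hP)
      _ ≤ k * |A * D| := mul_le_mul_of_nonneg_right hKd (abs_nonneg _)
      _ ≤ _ := mul_le_mul_of_nonneg_left y4 hk0
  have t5 : -(1 / 2 * Kf α e P * Q) ≤ k * N := by
    calc -(1 / 2 * Kf α e P * Q) = Kf α e P * (-Q) / 2 := by ring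
      _ ≤ Kf α e P * |Q| := by
          have a1 := mul_le_mul_of_nonneg_left (neg_le_abs Q) hK0
          linarith [mul_nonneg hK0 (abs_nonneg Q)]
      _ ≤ (k * P) * (B * P * χ) := mul_le_mul hK hQ (abs_nonneg _) (by positivity)
      _ ≤ k * N := by
          have a1 : 0 ≤ k * (B * χ * (e * P)) := by positivity
          have a2 : k * N = k * P * (B * P * χ) + k * (B * χ * (e * P)) := by rw [hN]; ring
          linarith
  have e0 : Y * D - X + g * Y = -q := by
    rw [hq, show g = -D - ε * Y by linarith]; ring
  have m1 : ζ * ((θ + 4 * |α - 2| * (ε / e)) * k * q) ≤ (θ + δ) * (k * (ζ * q)) := by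
    have : 0 ≤ k * (ζ * q) := by positivity
    have a1 := mul_le_mul_of_nonneg_right hεδ this
    have a2 : ζ * ((θ + 4 * |α - 2| * (ε / e)) * k * q)
      = θ * (k * (ζ * q)) + 4 * |α - 2| * (ε / e) * (k * (ζ * q)) := by ring
    linarith
  have hkN : k * N ≤ (α + 2) * (B * χ * ((P + e) ^ (α - 1) * P)) := by
    calc k * N ≤ (α + 2) * (P + e) ^ (α - 2) * N := mul_le_mul_of_nonneg_right hku hN0
      _ = _ := by
          rw [hN, show α - 1 = (α - 2) + 1 by ring, Real.rpow_add_one hz.ne']; ring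
  have hkX : δ / 4 * (ζ * ((P + e) ^ (α - 2) * X)) ≤ δ / 4 * (k * (ζ * q)) := by
    have := mul_le_mul hkl hXq hX hk0
    have a1 := mul_le_mul_of_nonneg_left this (by positivity : 0 ≤ δ / 4 * ζ)
    have a2 : δ / 4 * (k * (ζ * q)) = δ / 4 * ζ * (k * q) := by ring
    have a3 : δ / 4 * (ζ * ((P + e) ^ (α - 2) * X)) = δ / 4 * ζ * ((P + e) ^ (α - 2) * X) := by ring
    linarith
  have tot : ζ * k * (Y * D - X) - Kf α e P * T - Kd α e P * A * D - 1 / 2 * Kf α e P * Q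
      + g * (2 * ζ * kd α e P * D + k * A + ζ * k * Y)
      = -(k * (ζ * q)) + ζ * (2 * g * kd α e P * D) + k * (g * A) + -(Kf α e P * T)
        + -(Kd α e P * A * D) + -(1 / 2 * Kf α e P * Q) := by
    linear_combination (ζ * k) * e0
  have hkR : k * R = δ * (k * (ζ * q)) + (1 / (4 * δ)) * (k * N) := by rw [hR]; ring
  rw [tot]
  have hfin : (3 * (1 / (4 * δ)) + 1) * (k * N) ≤ (α + 2) * 5 / δ * B * χ *
      ((P + e) ^ (α - 1) * P) := by
    have c1 : 3 * (1 / (4 * δ)) + 1 ≤ 5 / δ := by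
      rw [← sub_nonneg]
      have : 5 / δ - (3 * (1 / (4 * δ)) + 1) = (17 / 4 - δ) / δ := by field_simp; ring
      rw [this]; exact div_nonneg (by linarith) hδ.le
    calc _ ≤ 5 / δ * (k * N) := mul_le_mul_of_nonneg_right c1 (by positivity)
      _ ≤ 5 / δ * ((α + 2) * (B * χ * ((P + e) ^ (α - 1) * P))) :=
          mul_le_mul_of_nonneg_left hkN (by positivity)
      _ = _ := by ring
  have hkq : 0 ≤ k * (ζ * q) := by positivity
  clear_value k N q R
  clear hD hA hT hQ hg2 y2 y3 y4 hK hKd hku hkl e0 hg hXq tot hN hR hX hε hεe hεδ hP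
  have hs := mul_le_mul_of_nonneg_right hδθ hkq
  set W := k * (ζ * q)
  have hdW : 0 ≤ δ * W := by positivity
  have hkR' : 3 * (k * R) = 3 * (δ * W) + 3 * (1 / (4 * δ)) * (k * N) := by rw [hkR]; ring
  linarith [h1.trans m1]

/-- Cutoff functions whose derivatives are controlled by a single constant. -/
structure Cut (B : ℝ) (ζ : E2 → ℝ) : Prop where
  smooth : ContDiff ℝ (⊤ : ℕ∞) ζ
  cpt : HasCompactSupport ζ
  nonneg : ∀ x, 0 ≤ ζ x
  le_one : ∀ x, ζ x ≤ 1
  grad : ∀ x, ∑ i, pd i ζ x ^ 2 ≤ B * ζ x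
  hess : ∀ x p : E2, |∑ i, ∑ j, p i * p j * pd i (pd j ζ) x| ≤ B * ‖p‖ ^ 2
  hess_zero : ∀ x, ζ x = 0 → ∀ p : E2, ∑ i, ∑ j, p i * p j * pd i (pd j ζ) x = 0

theorem pd_eq_zero_off {w : E2 → ℝ} {x : E2} (hx : x ∉ tsupport w) (i : Fin 2) : pd i w x = 0 := by
  rw [← gradient_apply, gradient_eq_zero_of_zero_off (isClosed_tsupport w)
    (fun y hy => image_eq_zero_of_notMem_tsupport hy) hx]; rfl

theorem tsupport_pd_subset (w : E2 → ℝ) (i : Fin 2) : tsupport (pd i w) ⊆ tsupport w :=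
  closure_minimal (fun x hx => by
    by_contra h
    exact hx (pd_eq_zero_off h i)) (isClosed_tsupport w)

theorem hasCompactSupport_pd {w : E2 → ℝ} (hc : HasCompactSupport w) (i : Fin 2) :
    HasCompactSupport (pd i w) := hc.mono' ((subset_tsupport _).trans (tsupport_pd_subset w i))

theorem grow_of_cpt {w : E2 → ℝ} (hw : Continuous w) (hc : HasCompactSupport w) :
    Grow 0 fun x _ _ => w x := by
  obtain ⟨b, hb⟩ := exists_bound_of_hasCompactSupport hw hc
  exact grow_of_bdd hw.measurable hb

theorem Grow.sq {Q : E2 → E2 → (Fin 2 → Fin 2 → ℝ) → ℝ} (hQ : Grow 1 Q) :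
    Grow 2 fun x p h => Q x p h ^ 2 := by
  simpa only [_root_.sq] using hQ.mul hQ

theorem continuous_rpow_normSq {e : ℝ} (he : 0 < e) (s : ℝ) :
    Continuous fun p : E2 => (‖p‖ ^ 2 + e) ^ s :=
  ((continuous_norm.pow 2).add_const e).rpow_const fun _ => Or.inl
    (add_pos_of_nonneg_of_pos (sq_nonneg _) he).ne'

theorem continuous_kf {e : ℝ} (he : 0 < e) (α : ℝ) : Continuous fun p : E2 => kf α e (‖p‖ ^ 2) :=
  (continuous_rpow_normSq he _).mul (by fun_prop)

theorem continuous_kd {e : ℝ} (he : 0 < e) (α : ℝ) : Continuous fun p : E2 => kd α e (‖p‖ ^ 2) :=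
  ((continuous_const.mul (continuous_rpow_normSq he _)).mul (by fun_prop)).add
    (continuous_const.mul (continuous_rpow_normSq he _))

theorem continuous_Kf {e : ℝ} (he : 0 < e) (α : ℝ) : Continuous fun p : E2 => Kf α e (‖p‖ ^ 2) :=
  (continuous_norm.pow 2).mul (continuous_rpow_normSq he _)

theorem continuous_Kd {e : ℝ} (he : 0 < e) (α : ℝ) : Continuous fun p : E2 => Kd α e (‖p‖ ^ 2) :=
  (continuous_rpow_normSq he _).mul (by fun_prop)

theorem grow_hessQuad : Grow 1 fun _ p h => ∑ i, ∑ j, p i * p j * h i j :=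
  Grow.sum fun i => Grow.sum fun j => ((grow_coord i).coef_mul (grow_coord j)).coef_mul
    (grow_hess i j)

theorem grow_hessVec (i : Fin 2) : Grow 1 fun _ p h => ∑ j, h j i * p j :=
  Grow.sum fun j => (grow_hess j i).mul (grow_coord j)

theorem grow_idDet {α e : ℝ} (he : 0 < e) {ζ : E2 → ℝ} (hζ : ContDiff ℝ (⊤ : ℕ∞) ζ)
    (hc : HasCompactSupport ζ) : Grow 2 (idDet α e ζ) := by
  have g1 := fun i =>
    grow_of_cpt (hζ.pd_smooth i).continuous (hasCompactSupport_pd hc i)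
  have g2 := fun i j =>
    grow_of_cpt ((hζ.pd_smooth j).pd_smooth i).continuous
      (hasCompactSupport_pd (hasCompactSupport_pd hc j) i)
  have gK := grow_of_continuous (continuous_Kf he α)
  have gL := Grow.sum fun i => grow_hess i i
  have s1 := ((grow_of_cpt hζ.continuous hc).coef_mul
    (grow_of_continuous (continuous_kf he α))).coef_mul
      ((gL.mul grow_hessQuad).sub (Grow.sum fun i => (grow_hessVec i).sq))
  have s3 := ((grow_of_continuous (continuous_Kd he α)).coef_mul
    (Grow.sum fun i => (grow_coord i).coef_mul (g1 i))).coef_mul grow_hessQuad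
  have s4 := ((grow_const (1 / 2)).coef_mul gK).coef_mul (Grow.sum fun i => Grow.sum fun j =>
    ((grow_coord i).coef_mul (grow_coord j)).coef_mul (g2 i j))
  exact ((s1.sub ((gK.coef_mul (Grow.sum fun i => (g1 i).coef_mul (grow_hessVec i))).mono
    (by norm_num))).sub (s3.mono (by norm_num))).sub (s4.mono (by norm_num))

theorem grow_idRhs {α e : ℝ} (he : 0 < e) {ζ g : E2 → ℝ} (hζ : ContDiff ℝ (⊤ : ℕ∞) ζ)
    (hc : HasCompactSupport ζ) (hg : IsLip g) {b : ℝ} (hgb : ∀ x, |g x| ≤ b) :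
    Grow 2 (idRhs α e ζ g) := by
  have g1 := fun i =>
    grow_of_cpt (hζ.pd_smooth i).continuous (hasCompactSupport_pd hc i)
  have gz := grow_of_cpt hζ.continuous hc
  have gk := grow_of_continuous (continuous_kf he α)
  have s1 := (gk.coef_mul gz).coef_mul
    (Grow.sum fun i => (hg.grow_gradient i).coef_mul (grow_coord i))
  have s2 := (((grow_const 2).coef_mul gz).coef_mul
    (grow_of_continuous (continuous_kd he α))).coef_mul grow_hessQuad
  have s4 := (gz.coef_mul gk).coef_mul (Grow.sum fun i => grow_hess i i)
  have s5 := (grow_of_bdd hg.continuous.measurable hgb).coef_mul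
    ((s2.add ((gk.coef_mul (Grow.sum fun i => (grow_coord i).coef_mul (g1 i))).mono
      (by norm_num))).add s4)
  exact (s1.mono (by norm_num)).add (s5.mono (by norm_num))

theorem grow_idPow {s e : ℝ} (he : 0 < e) {φ : E2 → ℝ} (hφ : ContDiff ℝ (⊤ : ℕ∞) φ)
    (hc : HasCompactSupport φ) (i : Fin 2) : Grow 2 (idPow s e φ i) := by
  have s1 := (grow_of_continuous (continuous_rpow_normSq he s)).coef_mul
    (grow_of_cpt (hφ.pd_smooth i).continuous (hasCompactSupport_pd hc i))
  have s2 := ((grow_of_cpt hφ.continuous hc).coef_mul ((grow_const (2 * s)).coef_mul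
    (grow_of_continuous (continuous_rpow_normSq he (s - 1))))).coef_mul (grow_hessVec i)
  exact (s1.mono (by norm_num)).add (s2.mono (by norm_num))

/-- Absorption constant. -/
def dl (α : ℝ) : ℝ := (1 - max 0 (2 * (2 - α))) / 5

theorem dl_pos {α : ℝ} (hα : 3 / 2 < α) : 0 < dl α := by
  have : max 0 (2 * (2 - α)) < 1 := max_lt one_pos (by linarith)
  unfold dl; linarith

/-- Density of the right-hand side of the energy inequality. -/
def En (α e B : ℝ) (ζ g v : E2 → ℝ) (x : E2) : ℝ :=
  kf α e (‖∇ v x‖ ^ 2) * ζ x * ⟪∇ g x, ∇ v x⟫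
    + (α + 2) * 5 / dl α * B * (Function.support ζ).indicator (fun _ => (1 : ℝ)) x
      * ((‖∇ v x‖ ^ 2 + e) ^ (α - 1) * ‖∇ v x‖ ^ 2)

theorem IsLip.integrable_comp_mul {v w : E2 → ℝ} (hv : IsLip v) {c : E2 → ℝ} (hc : Continuous c)
    (hw : Integrable w) : Integrable fun x => c (∇ v x) * w x := by
  obtain ⟨M, _, hM⟩ := hv.exists_bound
  obtain ⟨C, hC⟩ := (isCompact_closedBall 0 M).exists_bound_of_continuousOn hc.continuousOn
  exact hw.bdd_mul (hc.measurable.comp (measurable_gradient v)).aestronglyMeasurable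
    (.of_forall fun x => hC _ (by simpa using hM x))

theorem Cut.integrable_support {B : ℝ} {ζ : E2 → ℝ} (hζ : Cut B ζ) :
    Integrable ((Function.support ζ).indicator fun _ => (1 : ℝ)) := by
  rw [integrable_indicator_iff hζ.smooth.continuous.isOpen_support.measurableSet]
  exact integrableOn_const ((measure_mono (subset_tsupport ζ)).trans_lt
    hζ.cpt.isCompact.measure_lt_top).ne (by simp)

theorem integrable_inner_gradient {w v : E2 → ℝ} (hw : IsLip w) (hv : IsLip v) {ζ : E2 → ℝ}
    (hζ : Integrable ζ) : Integrable fun x => ⟪∇ w x, ∇ v x⟫ * ζ x := by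
  obtain ⟨M, _, hM⟩ := hv.exists_bound
  obtain ⟨N, hN0, hN⟩ := hw.exists_bound
  exact hζ.bdd_mul ((measurable_gradient w).inner (measurable_gradient v)).aestronglyMeasurable
    (.of_forall fun x => (norm_inner_le_norm _ _).trans
      (mul_le_mul (hN x) (hM x) (norm_nonneg _) hN0))

theorem Cut.integrable_kf {α e B : ℝ} (he : 0 < e) {ζ g v : E2 → ℝ} (hζ : Cut B ζ) (hg : IsLip g)
    (hv : IsLip v) : Integrable fun x => kf α e (‖∇ v x‖ ^ 2) * ζ x * ⟪∇ g x, ∇ v x⟫ := by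
  have := hv.integrable_comp_mul (continuous_kf he α) (integrable_inner_gradient hg hv
    (hζ.smooth.continuous.integrable_of_hasCompactSupport hζ.cpt))
  exact this.congr (.of_forall fun x => by beta_reduce; ring)

theorem Cut.integrable_En {α e B : ℝ} (he : 0 < e) {ζ g v : E2 → ℝ} (hζ : Cut B ζ) (hg : IsLip g)
    (hv : IsLip v) : Integrable (En α e B ζ g v) := by
  refine (hζ.integrable_kf he hg hv).fadd ?_
  have := (hv.integrable_comp_mul ((continuous_rpow_normSq he (α - 1)).mul
    (continuous_norm.pow 2)) hζ.integrable_support).const_mul ((α + 2) * 5 / dl α * B)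
  exact this.congr (.of_forall fun x => by simp only [Pi.mul_apply, Pi.pow_apply]; ring)

theorem norm_sq_eq_sum (p : E2) : ‖p‖ ^ 2 = ∑ i, p i ^ 2 := by
  rw [← real_inner_self_eq_norm_sq, inner_e2]
  exact Finset.sum_congr rfl fun i _ => by ring

theorem sum_mul_sq_le (a b : Fin 2 → ℝ) : (∑ i, a i * b i) ^ 2 ≤ (∑ i, a i ^ 2) * ∑ i, b i ^ 2 :=
  Finset.sum_mul_sq_le_sq_mul_sq _ _ _

theorem idDet_add_idRhs_le {α e ε B : ℝ} (hα : 3 / 2 < α) (he : 0 < e) (hε : 0 < ε) (hεe : ε ≤ e)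
    (hεδ : 4 * |α - 2| * (ε / e) ≤ dl α) (hB : 0 ≤ B) {ζ g v : E2 → ℝ} (hζ : Cut B ζ) {x : E2}
    {h : Fin 2 → Fin 2 → ℝ}
    (heq : ε * (∑ i, h i i) + ∑ i, ∑ j, (∇ v x) i * (∇ v x) j * h i j = - g x) :
    idDet α e ζ x (∇ v x) h + idRhs α e ζ g x (∇ v x) h
      ≤ En α e B ζ g v x - dl α / 4 * (ζ x * ((‖∇ v x‖ ^ 2 + e) ^ (α - 2)
        * ∑ i, (∑ j, h j i * (∇ v x) j) ^ 2)) := by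
  set p := ∇ v x with hp
  set Y := ∑ i, h i i
  set D := ∑ i, ∑ j, p i * p j * h i j with hDdef
  set X := ∑ i, (∑ j, h j i * p j) ^ 2
  have hD : D ^ 2 ≤ ‖p‖ ^ 2 * X := by
    have e1 : D = ∑ i, p i * ∑ j, h j i * p j := by
      rw [hDdef]; simp only [Fin.sum_univ_two]; ring
    rw [e1, norm_sq_eq_sum]
    exact sum_mul_sq_le _ _
  have hA : (∑ i, p i * pd i ζ x) ^ 2 ≤ ‖p‖ ^ 2 * (B * ζ x) := by
    rw [norm_sq_eq_sum]
    exact (sum_mul_sq_le _ _).trans (mul_le_mul_of_nonneg_left (hζ.grad x)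
      (Finset.sum_nonneg fun _ _ => sq_nonneg _))
  have hT : (∑ i, pd i ζ x * ∑ j, h j i * p j) ^ 2 ≤ X * (B * ζ x) := by
    rw [mul_comm X]
    exact (sum_mul_sq_le _ _).trans (mul_le_mul_of_nonneg_right (hζ.grad x)
      (Finset.sum_nonneg fun _ _ => sq_nonneg _))
  set χ := (Function.support ζ).indicator (fun _ => (1 : ℝ)) x with hχd
  have hχ0 : 0 ≤ χ := Set.indicator_nonneg (fun _ _ => zero_le_one) _
  have hχ : ζ x * χ = ζ x := by
    by_cases h0 : ζ x = 0
    · simp [h0]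
    · rw [hχd, Set.indicator_of_mem (by exact h0), mul_one]
  have hQ : |∑ i, ∑ j, p i * p j * pd i (pd j ζ) x| ≤ B * ‖p‖ ^ 2 * χ := by
    by_cases h0 : ζ x = 0
    · rw [hζ.hess_zero x h0 p, abs_zero]; positivity
    · rw [hχd, Set.indicator_of_mem (by exact h0), mul_one]; exact hζ.hess x p
  have := energy_pointwise (by linarith) (le_max_left 0 (2 * (2 - α))) (le_max_right _ _)
    (dl_pos hα) (by unfold dl; linarith) he hε hεe hεδ (sq_nonneg ‖p‖)
    (Finset.sum_nonneg fun _ _ => sq_nonneg _ : 0 ≤ X) hD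
    (by rw [← heq]; ring : D + ε * Y = - g x) hB (hζ.nonneg x) hχ0 hχ hA hT hQ
  simp only [idDet, idRhs, En, ← hp, ← hχd, inner_e2 _ _]
  linarith

theorem energy_inequality {α e ε B : ℝ} (hα : 3 / 2 < α) (he : 0 < e) (hε : 0 < ε) (hεe : ε ≤ e)
    (hεδ : 4 * |α - 2| * (ε / e) ≤ dl α) (hB : 0 ≤ B) {U : Set E2} (hU : IsOpen U)
    {ζ g v : E2 → ℝ} (hv : IsLip v) (hvc : HasCompactSupport v) (hg : IsLip g) {b : ℝ}
    (hgb : ∀ x, |g x| ≤ b) (hWS : WS ε U g v) {H : Fin 2 → Fin 2 → E2 → ℝ} (hW : W22 U v H)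
    (hζ : Cut B ζ) (hζU : tsupport ζ ⊆ U) :
    0 ≤ ∫ x, En α e B ζ g v x ∧ ∀ i φ, IsTest U φ → (∀ x, φ x ≠ 0 → ζ x = 1) →
      (∫ x, (‖∇ v x‖ ^ 2 + e) ^ (α / 2) * pd i φ x) ^ 2
        ≤ 4 * (∫ x, φ x ^ 2) * (α ^ 2 / dl α * ∫ x, En α e B ζ g v x) := by
  have hδ := dl_pos hα
  obtain ⟨j1, k1⟩ := hW.limit_grow hU hv hvc hζ.cpt.isCompact hζU
    (grow_idDet he hζ.smooth hζ.cpt)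
    (fun x hx p h => by
      simp [idDet, image_eq_zero_of_notMem_tsupport hx, pd_eq_zero_off hx,
        pd_eq_zero_off (fun h' => hx (tsupport_pd_subset ζ _ h'))])
    (fun V hV _ => integral_idDet hV hζ.smooth hζ.cpt he)
  obtain ⟨j2, k2⟩ := hW.limit_grow hU hv hvc hζ.cpt.isCompact hζU
    (grow_idRhs he hζ.smooth hζ.cpt hg hgb)
    (fun x hx p h => by
      simp [idRhs, image_eq_zero_of_notMem_tsupport hx, pd_eq_zero_off hx])
    (fun V hV _ => integral_idRhs hV hg hζ.smooth hζ.cpt he)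
  have jE := hζ.integrable_En (α := α) he hg hv
  have key : ∀ i φ, IsTest U φ → (∀ x, φ x ≠ 0 → ζ x = 1) → ∀ τ : ℝ, 0 < τ →
      ∫ x, (‖∇ v x‖ ^ 2 + e) ^ (α / 2) * pd i φ x
        ≤ τ * (∫ x, φ x ^ 2) + (α ^ 2 / dl α * ∫ x, En α e B ζ g v x) / τ := by
    intro i φ hφ hφζ τ hτ
    obtain ⟨j3, k3⟩ := hW.limit_grow hU hv hvc hφ.cpt.isCompact hφ.supp
      (grow_idPow he hφ.smooth hφ.cpt i)
      (fun x hx p h => by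
        simp [idPow, image_eq_zero_of_notMem_tsupport hx, pd_eq_zero_off hx])
      (fun V hV _ => integral_idPow hV hφ.smooth hφ.cpt he i)
    have j4 : Integrable fun x => φ x ^ 2 :=
      (hφ.smooth.continuous.pow 2).integrable_of_hasCompactSupport (by
        simpa only [_root_.sq] using hφ.cpt.mul_left)
    have j5 := hv.integrable_comp_mul (continuous_rpow_normSq he (α / 2))
      ((hφ.pd_continuous i).integrable_of_hasCompactSupport (hφ.pd_cpt i))
    set c := α ^ 2 / dl α / τ with hc
    have hc0 : 0 < c := by positivity
    have hmain := integral_mono_ae j5 ((j3.fadd (j4.const_mul τ)).fadd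
      (((jE.fsub j1).fsub j2).const_mul c)) ?_
    · rw [integral_add (j3.fadd (j4.const_mul τ)) (((jE.fsub j1).fsub j2).const_mul c),
        integral_add j3 (j4.const_mul τ), integral_const_mul, integral_const_mul,
        integral_sub (jE.fsub j1) j2, integral_sub jE j1, k1, k2, k3] at hmain
      refine hmain.trans (le_of_eq ?_)
      rw [hc]; ring
    · filter_upwards [hW.ae_equation hε hU hv hvc hg.continuous hWS] with x hx
      set z := ‖∇ v x‖ ^ 2 + e with hzd
      set q := ∑ j, H j i x * (∇ v x) j with hq
      have hexp : idPow (α / 2) e φ i x (∇ v x) (fun i j => H i j x)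
          = z ^ (α / 2) * pd i φ x + φ x * (α * z ^ (α / 2 - 1)) * q := by
        rw [idPow, ← hzd, ← hq]; ring
      beta_reduce
      rw [hexp]
      by_cases hxU : x ∈ U
      · have hle := idDet_add_idRhs_le (v := v) (h := fun i j => H i j x) hα he hε hεe hεδ hB hζ
            (hx hxU)
        rw [← hzd] at hle
        set Sg := ∑ i, (∑ j, H j i x * (∇ v x) j) ^ 2 with hSg
        have hqS : q ^ 2 ≤ Sg := by
          rw [hSg, hq]
          exact Finset.single_le_sum (f := fun i => (∑ j, H j i x * (∇ v x) j) ^ 2)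
            (fun _ _ => sq_nonneg _) (Finset.mem_univ i)
        have hm := mul_le_mul_of_nonneg_left hle hc0.le
        have hcd : c * (dl α / 4) = α ^ 2 / (4 * τ) := by rw [hc]; field_simp
        have hfin : 0 ≤ φ x * (α * z ^ (α / 2 - 1)) * q + τ * φ x ^ 2
            + α ^ 2 / (4 * τ) * (ζ x * (z ^ (α - 2) * Sg)) := by
          have hζ0 := hζ.nonneg x
          by_cases h0 : φ x = 0
          · rw [h0]
            have : 0 ≤ α ^ 2 / (4 * τ) * (ζ x * (z ^ (α - 2) * Sg)) := by positivity
            linarith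
          · rw [hφζ x h0, one_mul]
            have hzz : z ^ (α - 2) = z ^ (α / 2 - 1) * z ^ (α / 2 - 1) := by
              rw [← Real.rpow_add (by positivity)]; ring_nf
            set y := z ^ (α / 2 - 1)
            have h1 : α ^ 2 / (4 * τ) * (y * y * q ^ 2) ≤ α ^ 2 / (4 * τ) * (z ^ (α - 2) * Sg) := by
              rw [hzz]; gcongr
            have h2 : φ x * (α * y) * q + τ * φ x ^ 2 + α ^ 2 / (4 * τ) * (y * y * q ^ 2)
                = τ * (φ x + α * y * q / (2 * τ)) ^ 2 := by field_simp; ring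
            have h3 : 0 ≤ τ * (φ x + α * y * q / (2 * τ)) ^ 2 := by positivity
            linarith
        have e1 : c * (En α e B ζ g v x - dl α / 4 * (ζ x * (z ^ (α - 2) * Sg)))
            = c * En α e B ζ g v x - α ^ 2 / (4 * τ) * (ζ x * (z ^ (α - 2) * Sg)) := by
          rw [← hcd]; ring
        rw [e1] at hm
        linarith
      · have hxt := fun h => hxU (hζU h)
        have z2 : ∀ i j, pd i (pd j ζ) x = 0 := fun i j =>
          pd_eq_zero_off (fun h => hxt (tsupport_pd_subset ζ _ h)) i
        simp [En, idDet, idRhs, image_eq_zero_of_notMem_tsupport hxt,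
          image_eq_zero_of_notMem_tsupport fun h => hxU (hφ.supp h), pd_eq_zero_off hxt, z2]
  constructor
  · have h0 : IsTest U (fun _ => 0) :=
      ⟨contDiff_const, .zero, by simp [tsupport]⟩
    refine (sq_le_of_forall_young le_rfl le_rfl (c := α ^ 2 / dl α * ∫ x, En α e B ζ g v x)
      fun τ hτ => ?_).1 |> fun h => nonneg_of_mul_nonneg_right h (by positivity)
    simpa [pd] using key 0 _ h0 (by simp) τ hτ
  · intro i φ hφ hφζ
    have hsq : 0 ≤ ∫ x, φ x ^ 2 := integral_nonneg fun x => sq_nonneg _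
    rcases le_total 0 (∫ x, (‖∇ v x‖ ^ 2 + e) ^ (α / 2) * pd i φ x) with h | h
    · exact (sq_le_of_forall_young h hsq (key i φ hφ hφζ)).2
    · have hn : IsTest U fun x => -φ x :=
        ⟨hφ.smooth.neg, hφ.cpt.neg,
          (closure_mono fun x hx => neg_ne_zero.1 hx).trans hφ.supp⟩
      have := (sq_le_of_forall_young (neg_nonneg.2 h) hsq
        fun τ hτ => by
          have := key i _ hn (fun x hx => hφζ x (neg_ne_zero.1 hx)) τ hτ
          simpa [pd_neg, integral_neg] using this).2
      rwa [neg_sq] at this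

theorem kf_mul_self_mono {α e M : ℝ} (hα : 3 / 2 < α) (he : 0 < e) (hM : 0 ≤ M) :
    ∃ c, 0 < c ∧ ∀ a ∈ Icc 0 M, c ≤ kf α e (a ^ 2) ∧ ∀ b ∈ Icc 0 M,
      c * (a - b) ^ 2 ≤ (kf α e (a ^ 2) * a - kf α e (b ^ 2) * b) * (a - b) := by
  have hderiv : ∀ a, HasDerivAt (fun s => kf α e (s ^ 2)) (kd α e (a ^ 2) * (2 * a)) a := fun a =>
    (hasDerivAt_kf (by positivity)).comp a (by simpa using hasDerivAt_pow 2 a)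
  have hpos : ∀ s, 0 < kf α e (s ^ 2) := fun s =>
    lt_of_lt_of_le (by positivity) (rpow_le_kf (by linarith) he (sq_nonneg s))
  obtain ⟨s0, -, hs0⟩ := (isCompact_Icc (a := 0)).exists_isMinOn
    ⟨0, left_mem_Icc.2 hM⟩ (continuous_iff_continuousAt.2 fun a =>
      (hderiv a).continuousAt).continuousOn
  set θ := max 0 (2 * (2 - α))
  have hθ0 : 0 ≤ θ := le_max_left _ _
  have hθ1 : θ < 1 := max_lt one_pos (by linarith)
  set c := (1 - θ) * kf α e (s0 ^ 2) with hc
  have hle : ∀ a ∈ Icc 0 M, kf α e (s0 ^ 2) ≤ kf α e (a ^ 2) := fun a ha => hs0 ha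
  have hkd : ∀ P, 0 ≤ P → -(θ * kf α e P) ≤ 2 * kd α e P * P := by
    intro P hP
    have hz : 0 < P + e := by positivity
    have hk : kf α e P = (P + e) ^ (α - 4) * ((P + e) * (α * P + 2 * e)) := by
      rw [kf, show α - 3 = (α - 4) + 1 by ring, Real.rpow_add_one hz.ne']; ring
    rw [kd_eq he hP, hk]
    set w := (P + e) ^ (α - 4)
    have hw0 : 0 < w := by positivity
    have h1 : P * (α * P + 3 * e) ≤ (P + e) * (α * P + 2 * e) := by
      nlinarith [mul_nonneg hP he.le]
    have h2 :=
      (mul_le_mul_of_nonneg_right (le_max_right _ _) (mul_nonneg hP (by nlinarith))).trans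
        (mul_le_mul_of_nonneg_left h1 hθ0)
    linarith [mul_le_mul_of_nonneg_left h2 hw0.le]
  have hm : MonotoneOn (fun s => kf α e (s ^ 2) * s - c * s) (Icc 0 M) := by
    have hd : ∀ a, HasDerivAt (fun s => kf α e (s ^ 2) * s - c * s)
        (kd α e (a ^ 2) * (2 * a) * a + kf α e (a ^ 2) * 1 - c * 1) a := fun a =>
      ((hderiv a).mul (hasDerivAt_id a)).sub ((hasDerivAt_id a).const_mul c)
    refine monotoneOn_of_deriv_nonneg (convex_Icc 0 M)
      (fun a _ => (hd a).continuousAt.continuousWithinAt)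
      (fun a _ => (hd a).differentiableAt.differentiableWithinAt) fun a ha => ?_
    rw [(hd a).deriv]
    have h1 := hkd (a ^ 2) (sq_nonneg a)
    linarith [mul_le_mul_of_nonneg_left (hle a (interior_subset ha)) (by linarith : 0 ≤ 1 - θ)]
  refine ⟨c, mul_pos (by linarith) (hpos _), fun a ha => ⟨?_, fun b hb => ?_⟩⟩
  · have := hle a ha
    have h := mul_nonneg hθ0 (hpos s0).le
    rw [hc]; linarith
  · rcases le_total a b with h | h
    · have h1 := hm ha hb h
      linarith [mul_nonneg (sub_nonneg.2 h1) (sub_nonneg.2 h)]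
    · have h2 := mul_nonneg (sub_nonneg.2 (hm hb ha h)) (sub_nonneg.2 h)
      linarith

theorem kf_smul_mono {α e M : ℝ} (hα : 3 / 2 < α) (he : 0 < e) (hM : 0 ≤ M) :
    ∃ c, 0 < c ∧ ∀ p q : E2, ‖p‖ ≤ M → ‖q‖ ≤ M →
      c * ‖p - q‖ ^ 2 ≤ kf α e (‖p‖ ^ 2) * ⟪p, p - q⟫ - kf α e (‖q‖ ^ 2) * ⟪q, p - q⟫ := by
  obtain ⟨c, hc, h⟩ := kf_mul_self_mono hα he hM
  refine ⟨c, hc, fun p q hp hq => ?_⟩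
  obtain ⟨h1, h2⟩ := h ‖p‖ ⟨norm_nonneg _, hp⟩
  have h3 := (h ‖q‖ ⟨norm_nonneg _, hq⟩).1
  have h4 := h2 ‖q‖ ⟨norm_nonneg _, hq⟩
  rw [norm_sub_sq_real, inner_sub_right, inner_sub_right, real_inner_self_eq_norm_sq,
    real_inner_self_eq_norm_sq, real_inner_comm p q]
  have h6 := mul_nonneg (by linarith : 0 ≤ kf α e (‖p‖ ^ 2) + kf α e (‖q‖ ^ 2) - 2 * c)
    (sub_nonneg.2 (real_inner_le_norm p q))
  rw [real_inner_comm] at h6 ⊢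
  linarith

/-- Dominated convergence for functions of uniformly bounded gradients. -/
theorem tendsto_integral_comp_gradient {v : ℕ → E2 → ℝ} {t w : E2 → ℝ} {L : ℝ≥0}
    (hv : ∀ n, LipschitzWith L (v n)) {c : E2 → ℝ} (hc : Continuous c)
    (hw : Integrable w)
    (hlim : ∀ᵐ x, w x ≠ 0 → Tendsto (fun n => ∇ (v n) x) atTop (𝓝 (∇ t x))) :
    Tendsto (fun n => ∫ x, c (∇ (v n) x) * w x) atTop (𝓝 (∫ x, c (∇ t x) * w x)) := by
  obtain ⟨C, hC⟩ := (isCompact_closedBall (0 : E2) L).exists_bound_of_continuousOn hc.continuousOn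
  refine tendsto_integral_of_dominated_convergence (fun x => C * ‖w x‖) (fun n => ?_)
    (hw.norm.const_mul C) (fun n => .of_forall fun x => ?_) ?_
  · exact (hc.measurable.comp (measurable_gradient _)).aestronglyMeasurable.mul hw.1
  · rw [norm_mul]
    exact mul_le_mul_of_nonneg_right (hC _ (by simpa using (hv n).norm_gradient_le x))
      (norm_nonneg _)
  · filter_upwards [hlim] with x hx
    by_cases h : w x = 0
    · simp [h]
    · exact ((hc.tendsto _).comp (hx h)).mul_const _

theorem exists_subseq_tendsto_ae {D : ℕ → E2 → ℝ} (h0 : ∀ n x, 0 ≤ D n x)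
    (hD : ∀ n, Integrable (D n)) (hlim : Tendsto (fun n => ∫ x, D n x) atTop (𝓝 0)) :
    ∃ σ : ℕ → ℕ, StrictMono σ ∧ ∀ᵐ x, Tendsto (fun n => D (σ n) x) atTop (𝓝 0) := by
  have h1 : TendstoInMeasure volume D atTop (fun _ => 0) := by
    refine tendstoInMeasure_of_tendsto_eLpNorm one_ne_zero (fun n => (hD n).1)
      aestronglyMeasurable_const ?_
    have h2 n : eLpNorm (D n - fun _ => 0) 1 volume = ENNReal.ofReal (∫ x, D n x) := by
      rw [eLpNorm_one_eq_lintegral_enorm,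
        ofReal_integral_eq_lintegral_ofReal (hD n) (.of_forall (h0 n))]
      refine lintegral_congr fun x => ?_
      simp only [Pi.sub_apply, sub_zero]
      exact Real.enorm_of_nonneg (h0 n x)
    simp_rw [h2]
    simpa using ENNReal.tendsto_ofReal hlim
  exact h1.exists_seq_tendsto_ae

/-- The part of the energy containing the right-hand side. -/
def Src (α e : ℝ) (ζ g v : E2 → ℝ) : ℝ := ∫ x, kf α e (‖∇ v x‖ ^ 2) * ζ x * ⟪∇ g x, ∇ v x⟫

/-- The lower-order part of the energy. -/
def Low (α e B : ℝ) (ζ v : E2 → ℝ) : ℝ :=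
  ∫ x, ((α + 2) * 5 / dl α * B * ((‖∇ v x‖ ^ 2 + e) ^ (α - 1) * ‖∇ v x‖ ^ 2))
      * (Function.support ζ).indicator (fun _ => (1 : ℝ)) x

theorem continuous_low {α e B : ℝ} (he : 0 < e) : Continuous fun p : E2 =>
    (α + 2) * 5 / dl α * B * ((‖p‖ ^ 2 + e) ^ (α - 1) * ‖p‖ ^ 2) :=
  continuous_const.mul ((continuous_rpow_normSq he (α - 1)).mul (continuous_norm.pow 2))

theorem Cut.integral_En {α e B : ℝ} (he : 0 < e) {ζ g v : E2 → ℝ} (hζ : Cut B ζ) (hg : IsLip g)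
    (hv : IsLip v) : ∫ x, En α e B ζ g v x = Src α e ζ g v + Low α e B ζ v := by
  rw [Src, Low, ← integral_add (hζ.integrable_kf he hg hv)
    (hv.integrable_comp_mul (continuous_low (α := α) (B := B) he) hζ.integrable_support)]
  exact integral_congr_ae (.of_forall fun x => by simp only [En]; ring)

theorem tendsto_low {α e B : ℝ} (he : 0 < e) {ζ t : E2 → ℝ} (hζ : Cut B ζ) {v : ℕ → E2 → ℝ}
    {L : ℝ≥0} (hv : ∀ n, LipschitzWith L (v n))
    (hlim : ∀ᵐ x, ζ x ≠ 0 → Tendsto (fun n => ∇ (v n) x) atTop (𝓝 (∇ t x))) :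
    Tendsto (fun n => Low α e B ζ (v n)) atTop (𝓝 (Low α e B ζ t)) := by
  refine tendsto_integral_comp_gradient hv (continuous_low he) hζ.integrable_support ?_
  filter_upwards [hlim] with x hx h
  exact hx (by by_contra h0; simp [h0] at h)

/-- Penalised energies: the penalty controls the distance of the gradients. -/
theorem Cut.penalty_le {α e B lam : ℝ} (he : 0 < e) (hlam : 0 ≤ lam) {ζ F v t : E2 → ℝ}
    (hζ : Cut B ζ) {L : ℝ≥0} (hv : LipschitzWith L v) (ht : LipschitzWith L t) (hF : IsLip F)
    {c : ℝ} (hc : ∀ p q : E2, ‖p‖ ≤ L → ‖q‖ ≤ L →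
      c * ‖p - q‖ ^ 2 ≤ kf α e (‖p‖ ^ 2) * ⟪p, p - q⟫ - kf α e (‖q‖ ^ 2) * ⟪q, p - q⟫) :
    ∫ x, En α e B ζ (fun x => F x - lam * (v x - t x)) v x
      ≤ Src α e ζ F v + Low α e B ζ v
        - lam * (c * ∫ x, ζ x * ‖∇ v x - ∇ t x‖ ^ 2)
        - lam * ∫ x, ζ x * (kf α e (‖∇ t x‖ ^ 2) * ⟪∇ t x, ∇ v x - ∇ t x⟫) := by
  have hv' : IsLip v := ⟨L, hv⟩
  have ht' : IsLip t := ⟨L, ht⟩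
  have hg := hF.sub ((hv'.sub ht').const_mul lam)
  have hζi := hζ.smooth.continuous.integrable_of_hasCompactSupport hζ.cpt (μ := volume)
  have hbd x : ‖∇ v x - ∇ t x‖ ≤ 2 * L := (norm_sub_le _ _).trans
    (by linarith [hv.norm_gradient_le x, ht.norm_gradient_le x])
  have i1 : Integrable fun x => ζ x * ‖∇ v x - ∇ t x‖ ^ 2 := by
    refine (hζi.bdd_mul (f := fun x => ‖∇ v x - ∇ t x‖ ^ 2) (c := (2 * (L : ℝ)) ^ 2)
      (((measurable_gradient v).sub (measurable_gradient t)).norm.pow_const 2).aestronglyMeasurable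
      (.of_forall fun x => ?_)).congr (.of_forall fun x => by beta_reduce; ring)
    rw [norm_pow, norm_norm]
    exact pow_le_pow_left₀ (norm_nonneg _) (hbd x) 2
  have i2 : Integrable fun x => ζ x * (kf α e (‖∇ t x‖ ^ 2) * ⟪∇ t x, ∇ v x - ∇ t x⟫) := by
    have h1 : Integrable fun x => ⟪∇ t x, ∇ v x - ∇ t x⟫ * ζ x := by
      refine ((integrable_inner_gradient ht' hv' hζi).fsub
        (integrable_inner_gradient ht' ht' hζi)).congr (.of_forall fun x => ?_)
      simp only [inner_sub_right]; ring
    exact (ht'.integrable_comp_mul (continuous_kf he α) h1).congr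
      (.of_forall fun x => by beta_reduce; ring)
  rw [hζ.integral_En he hg hv', Src, Src]
  have i4 := hζ.integrable_kf (α := α) he hF hv'
  suffices h : ∫ x, kf α e (‖∇ v x‖ ^ 2) * ζ x * ⟪∇ (fun x => F x - lam * (v x - t x)) x, ∇ v x⟫
      ≤ ∫ x, (kf α e (‖∇ v x‖ ^ 2) * ζ x * ⟪∇ F x, ∇ v x⟫
        - lam * (c * (ζ x * ‖∇ v x - ∇ t x‖ ^ 2)
        + ζ x * (kf α e (‖∇ t x‖ ^ 2) * ⟪∇ t x, ∇ v x - ∇ t x⟫))) by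
    rw [integral_sub i4 (((i1.const_mul c).fadd i2).const_mul lam), integral_const_mul,
      integral_add (i1.const_mul c) i2, integral_const_mul] at h
    linarith
  refine integral_mono_ae (hζ.integrable_kf (α := α) he hg hv')
    (i4.fsub (((i1.const_mul c).fadd i2).const_mul lam)) ?_
  filter_upwards [hv'.ae_hasGradientAt, ht'.ae_hasGradientAt, hF.ae_hasGradientAt] with x a1 a2 a3
  rw [(a3.sub' ((a1.sub' a2).const_mul' lam)).gradient]
  have h2 := mul_le_mul_of_nonneg_left
      (hc (∇ v x) (∇ t x) (hv.norm_gradient_le x) (ht.norm_gradient_le x))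
      (mul_nonneg hlam (hζ.nonneg x))
  simp only [inner_sub_left, inner_sub_right, real_inner_smul_left] at h2 ⊢
  rw [real_inner_comm (∇ v x) (∇ t x)] at h2 ⊢
  linarith

/-- Passage to the limit in penalised energies. -/
theorem penalised_limit {α e B T0 : ℝ} (hα : 3 / 2 < α) (he : 0 < e)
    {ζ t : E2 → ℝ} (hζ : Cut B ζ) {L : ℝ≥0} (ht : LipschitzWith L t) {v F : ℕ → E2 → ℝ}
    (hv : ∀ n, LipschitzWith L (v n)) (hF : ∀ n, IsLip (F n)) {lam : ℕ → ℝ}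
    (hlam0 : ∀ n, 0 < lam n) (hlam : Tendsto lam atTop atTop)
    (hE : ∀ n, 0 ≤ ∫ x, En α e B ζ (fun x => F n x - lam n * (v n x - t x)) (v n) x)
    (hT : ∀ n, Src α e ζ (F n) (v n) ≤ T0)
    (hη : Tendsto (fun n => lam n * ∫ x, ζ x * (kf α e (‖∇ t x‖ ^ 2)
      * ⟪∇ t x, ∇ (v n) x - ∇ t x⟫)) atTop (𝓝 0)) :
    ∃ σ : ℕ → ℕ, StrictMono σ ∧
      (∀ᵐ x, ζ x ≠ 0 → Tendsto (fun n => ∇ (v (σ n)) x) atTop (𝓝 (∇ t x))) ∧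
      ∀ T', (∀ η, 0 < η → ∀ᶠ n in atTop, Src α e ζ (F (σ n)) (v (σ n)) ≤ T' + η) →
        0 ≤ T' + Low α e B ζ t ∧ ∀ K, 0 ≤ K → ∀ φ : E2 → ℝ, Integrable φ →
        (∀ x, φ x ≠ 0 → ζ x ≠ 0) →
        (∀ n, (∫ x, (‖∇ (v n) x‖ ^ 2 + e) ^ (α / 2) * φ x) ^ 2
          ≤ K * ∫ x, En α e B ζ (fun x => F n x - lam n * (v n x - t x)) (v n) x) →
        (∫ x, (‖∇ t x‖ ^ 2 + e) ^ (α / 2) * φ x) ^ 2 ≤ K * (T' + Low α e B ζ t) := by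
  obtain ⟨c, hc0, hc⟩ := kf_smul_mono (M := L) hα he L.2
  set E := fun n => ∫ x, En α e B ζ (fun x => F n x - lam n * (v n x - t x)) (v n) x
  set D := fun n x => ζ x * ‖∇ (v n) x - ∇ t x‖ ^ 2 with hDdef
  set r := fun n => lam n * ∫ x, ζ x * (kf α e (‖∇ t x‖ ^ 2)
      * ⟪∇ t x, ∇ (v n) x - ∇ t x⟫) with hr
  have hD0 n x : 0 ≤ D n x := mul_nonneg (hζ.nonneg x) (sq_nonneg _)
  have hDi n : Integrable (D n) := by
    refine (hζ.smooth.continuous.integrable_of_hasCompactSupport hζ.cpt (μ := volume).bdd_mul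
      (f := fun x => ‖∇ (v n) x - ∇ t x‖ ^ 2) (c := (2 * (L : ℝ)) ^ 2)
      (((measurable_gradient _).sub (measurable_gradient t)).norm.pow_const 2).aestronglyMeasurable
      (.of_forall fun x => ?_)).congr (.of_forall fun x => by simp only [hDdef]; ring)
    rw [norm_pow, norm_norm]
    exact pow_le_pow_left₀ (norm_nonneg _) ((norm_sub_le _ _).trans
      (by linarith [(hv n).norm_gradient_le x, ht.norm_gradient_le x])) 2
  have hpen := fun n =>
    hζ.penalty_le he (hlam0 n).le (hv n) ht (hF n) hc
  have hDint0 n : 0 ≤ ∫ x, D n x := integral_nonneg (hD0 n)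
  obtain ⟨Z0, hZ0⟩ : ∃ Z0, ∀ n, Low α e B ζ (v n) ≤ Z0 := by
    obtain ⟨C, hC⟩ := (isCompact_closedBall (0 : E2) L).exists_bound_of_continuousOn
      (continuous_low (α := α) (B := B) he).continuousOn
    refine ⟨∫ x, C * (Function.support ζ).indicator (fun _ => (1 : ℝ)) x, fun n => ?_⟩
    refine integral_mono (IsLip.integrable_comp_mul ⟨L, hv n⟩ (continuous_low he)
      hζ.integrable_support) (hζ.integrable_support.const_mul C) fun x => ?_
    exact mul_le_mul_of_nonneg_right ((le_abs_self _).trans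
      (hC _ (by simpa using (hv n).norm_gradient_le x)))
      (indicator_nonneg (fun _ _ => zero_le_one) x)
  obtain ⟨b, hb⟩ := hη.bddBelow_range
  have hDlim : Tendsto (fun n => ∫ x, D n x) atTop (𝓝 0) := by
    refine squeeze_zero hDint0 (g := fun n => (|T0 + Z0 - b| / c) / lam n) (fun n => ?_)
      (tendsto_const_nhds.div_atTop hlam)
    rw [div_div, le_div_iff₀ (mul_pos hc0 (hlam0 n))]
    have := hE n
    have := hpen n
    have := le_abs_self (T0 + Z0 - b)
    have := hT n
    have := hZ0 n
    have := (fun n => hb ⟨n, rfl⟩) n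
    nlinarith
  obtain ⟨σ, hσ, hσlim⟩ := exists_subseq_tendsto_ae hD0 hDi hDlim
  have hgr : ∀ᵐ x, ζ x ≠ 0 → Tendsto (fun n => ∇ (v (σ n)) x) atTop (𝓝 (∇ t x)) := by
    filter_upwards [hσlim] with x hx hne
    have h1 : Tendsto (fun n => ‖∇ (v (σ n)) x - ∇ t x‖ ^ 2) atTop (𝓝 0) := by
      simpa only [hDdef, mul_zero, inv_mul_cancel_left₀ hne] using hx.const_mul (ζ x)⁻¹
    rw [tendsto_iff_norm_sub_tendsto_zero]
    have h2 := (Real.continuous_sqrt.tendsto 0).comp h1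
    simpa [Function.comp_def, Real.sqrt_sq (norm_nonneg _)] using h2
  refine ⟨σ, hσ, hgr, fun T' hT' => ?_⟩
  have hEe : ∀ η, 0 < η → ∀ᶠ n in atTop, E (σ n) ≤ T' + Low α e B ζ t + η := by
    intro η hη0
    have h1 := (hη.comp hσ.tendsto_atTop).eventually (lt_mem_nhds (show -(η / 3) < 0 by linarith))
    have h2 := (tendsto_low (α := α) (B := B) he hζ (fun n => hv (σ n)) hgr).eventually
        (gt_mem_nhds (show Low α e B ζ t < Low α e B ζ t + η / 3 by linarith))
    filter_upwards [h1, h2, hT' (η / 3) (by linarith)] with n a1 a2 a3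
    have a4 := hpen (σ n)
    have a5 := mul_nonneg (hlam0 (σ n)).le (mul_nonneg hc0.le (hDint0 (σ n)))
    change -(η / 3) < r (σ n) at a1
    linarith
  refine ⟨?_, fun K hK φ hφ hφζ h => ?_⟩
  · refine le_of_forall_pos_le_add fun η hη0 => ?_
    obtain ⟨n, hn⟩ := (hEe η hη0).exists
    exact (hE _).trans hn
  · have h1 : Tendsto (fun n => (∫ x, (‖∇ (v (σ n)) x‖ ^ 2 + e) ^ (α / 2) * φ x) ^ 2) atTop
        (𝓝 ((∫ x, (‖∇ t x‖ ^ 2 + e) ^ (α / 2) * φ x) ^ 2)) := by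
      refine (tendsto_integral_comp_gradient (fun n => hv (σ n))
        (continuous_rpow_normSq he (α / 2)) hφ ?_).pow 2
      filter_upwards [hgr] with x hx h0 using hx (hφζ x h0)
    refine le_of_forall_pos_le_add fun η hη0 => ?_
    refine le_of_tendsto h1 ?_
    filter_upwards [hEe (η / (K + 1)) (by positivity)] with n hn
    refine (h (σ n)).trans ((mul_le_mul_of_nonneg_left hn hK).trans ?_)
    have : K * (η / (K + 1)) ≤ η := by
      rw [mul_div_assoc', div_le_iff₀ (by linarith)]; nlinarith
    linarith

/-! ### Cutoff functions -/

theorem pd_comp_affine {w : E2 → ℝ} (hw : ContDiff ℝ (⊤ : ℕ∞) w) (a : ℝ) (c : E2) (i : Fin 2) :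
    pd i (fun x => w (a • (x - c))) = fun x => a * pd i w (a • (x - c)) := by
  funext x
  have h2 := ((hw.differentiable (by simp)).differentiableAt
    (x := a • (x - c))).hasFDerivAt.comp x (((hasFDerivAt_id x).sub_const c).const_smul a)
  rw [pd]
  erw [h2.fderiv]
  simp [pd]

theorem contDiff_comp_affine {w : E2 → ℝ} (hw : ContDiff ℝ (⊤ : ℕ∞) w) (a : ℝ) (c : E2) :
    ContDiff ℝ (⊤ : ℕ∞) fun x => w (a • (x - c)) :=
  hw.comp ((contDiff_id.sub contDiff_const).const_smul a)

theorem Cut.rescale {B : ℝ} {ζ : E2 → ℝ} (h : Cut B ζ) {R : ℝ} (hR : 0 < R) (c : E2) :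
    Cut (B / R ^ 2) fun x => ζ (R⁻¹ • (x - c)) := by
  have h2 : ∀ i j, pd i (pd j fun x => ζ (R⁻¹ • (x - c)))
      = fun x => R⁻¹ * (R⁻¹ * pd i (pd j ζ) (R⁻¹ • (x - c))) := by
    intro i j
    rw [pd_comp_affine h.smooth]
    rw [show (fun x => R⁻¹ * pd j ζ (R⁻¹ • (x - c)))
      = fun x => (fun x => R⁻¹ * pd j ζ x) (R⁻¹ • (x - c)) from rfl, pd_comp_affine
        (contDiff_const.mul (h.smooth.pd_smooth j))]
    funext x
    rw [((HasPd.const R⁻¹ _).mul ((h.smooth.pd_smooth j).hasPd _)).2 i]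
    simp
  have e2 : ∀ x p : E2, ∑ i, ∑ j, p i * p j * pd i (pd j fun x => ζ (R⁻¹ • (x - c))) x
      = (R⁻¹) ^ 2 * ∑ i, ∑ j, p i * p j * pd i (pd j ζ) (R⁻¹ • (x - c)) := by
    intro x p
    simp only [h2, Finset.mul_sum]
    exact Finset.sum_congr rfl fun i _ => Finset.sum_congr rfl fun j _ => by ring
  refine ⟨contDiff_comp_affine h.smooth _ _, ?_, fun x => h.nonneg _, fun x => h.le_one _, ?_, ?_,
    ?_⟩
  · have := h.cpt.comp_homeomorph ((Homeomorph.subRight c).trans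
      (Homeomorph.smulOfNeZero R⁻¹ (inv_ne_zero hR.ne')))
    exact this
  · intro x
    simp only [pd_comp_affine h.smooth, mul_pow, ← Finset.mul_sum]
    refine (mul_le_mul_of_nonneg_left (h.grad (R⁻¹ • (x - c))) (sq_nonneg R⁻¹)).trans_eq ?_
    field_simp
  · intro x p
    rw [e2, abs_mul, abs_of_nonneg (sq_nonneg _)]
    refine (mul_le_mul_of_nonneg_left (h.hess _ p) (sq_nonneg _)).trans_eq ?_
    field_simp
  · intro x hx p
    rw [e2, h.hess_zero _ hx, mul_zero]

theorem exists_cut_unit : ∃ B, 0 < B ∧ ∃ ζ : E2 → ℝ, Cut B ζ ∧ (∀ x, ‖x‖ ≤ 1 → ζ x = 1) ∧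
    ∀ x, 3 / 2 ≤ ‖x‖ → ζ x = 0 := by
  let b : ContDiffBump (0 : E2) := ⟨1, 3 / 2, one_pos, by norm_num⟩
  have hb : ContDiff ℝ (⊤ : ℕ∞) b := b.contDiff
  have hc := b.hasCompactSupport
  have hsm := fun i => hb.pd_smooth i
  have hbd1 := fun i =>
    exists_bound_of_hasCompactSupport (hsm i).continuous (hasCompactSupport_pd hc i)
  have hbd2 := fun i j =>
    exists_bound_of_hasCompactSupport ((hsm j).pd_smooth i).continuous
      (hasCompactSupport_pd (hasCompactSupport_pd hc j) i)
  choose M1 hM1 using hbd1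
  choose M2 hM2 using hbd2
  obtain ⟨M, hM0, hM1', hM2'⟩ : ∃ M, 1 ≤ M ∧ (∀ i x, |pd i b x| ≤ M) ∧
      ∀ i j x, |pd i (pd j b) x| ≤ M := by
    refine ⟨1 + ∑ i, |M1 i| + ∑ i, ∑ j, |M2 i j|, ?_, fun i x => (hM1 i x).trans ?_,
      fun i j x => (hM2 i j x).trans ?_⟩ <;>
    · try fin_cases i
      all_goals try fin_cases j
      all_goals simp only [Fin.sum_univ_two, Fin.zero_eta, Fin.mk_one, Fin.isValue]
      all_goals
        linarith [abs_nonneg (M1 0), abs_nonneg (M1 1), abs_nonneg (M2 0 0), abs_nonneg (M2 0 1),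
          abs_nonneg (M2 1 0), abs_nonneg (M2 1 1), le_abs_self (M1 0), le_abs_self (M1 1),
          le_abs_self (M2 0 0), le_abs_self (M2 0 1), le_abs_self (M2 1 0), le_abs_self (M2 1 1)]
  have h1 : ∀ j, pd j (fun x => b x ^ 4) = fun x => 4 * b x ^ 3 * pd j b x := by
    intro j; funext x
    have := ((hb.hasPd x).comp (hasDerivAt_pow 4 (b x))).2 j
    rw [this]; norm_num
  have h2 : ∀ i j, pd i (pd j fun x => b x ^ 4) = fun x =>
      12 * b x ^ 2 * (pd i b x * pd j b x) + 4 * b x ^ 3 * pd i (pd j b) x := by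
    intro i j; funext x
    rw [h1]
    have := ((((HasPd.const 4 x).mul ((hb.hasPd x).comp (hasDerivAt_pow 3 (b x))))).mul
      ((hsm j).hasPd x)).2 i
    rw [this]; push_cast; ring
  have hb0 x : 0 ≤ b x := b.nonneg
  have hb1 x : b x ≤ 1 := b.le_one
  refine ⟨100 * M ^ 2, by positivity, fun x => b x ^ 4, ⟨hb.pow 4, ?_, fun x => by positivity,
    fun x => pow_le_one₀ (hb0 x) (hb1 x), fun x => ?_, fun x p => ?_, fun x hx p => ?_⟩,
    fun x hx => ?_, fun x hx => ?_⟩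
  · exact hc.comp_left (g := fun s => s ^ 4) (by norm_num)
  · simp only [h1, Fin.sum_univ_two]
    have a0 := sq_le_sq' (abs_le.1 (hM1' 0 x)).1 (abs_le.1 (hM1' 0 x)).2
    have a1 := sq_le_sq' (abs_le.1 (hM1' 1 x)).1 (abs_le.1 (hM1' 1 x)).2
    have hp : b x ^ 6 ≤ b x ^ 4 := pow_le_pow_of_le_one (hb0 x) (hb1 x) (by norm_num)
    have h6 : 0 ≤ b x ^ 6 := by positivity
    nlinarith
  · have hsum : ∑ i, ∑ j, p i * p j * pd i (pd j fun x => b x ^ 4) x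
        = 12 * b x ^ 2 * (p 0 * pd 0 b x + p 1 * pd 1 b x) ^ 2
          + 4 * b x ^ 3 * (p 0 * p 0 * pd 0 (pd 0 b) x + p 0 * p 1 * pd 0 (pd 1 b) x
            + (p 1 * p 0 * pd 1 (pd 0 b) x + p 1 * p 1 * pd 1 (pd 1 b) x)) := by
      simp only [h2, Fin.sum_univ_two]; ring
    rw [hsum, norm_sq_eq_sum, Fin.sum_univ_two]
    set q0 := |p 0|
    set q1 := |p 1|
    have hq : p 0 ^ 2 + p 1 ^ 2 = q0 ^ 2 + q1 ^ 2 := by rw [sq_abs, sq_abs]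
    have k1 : |p 0 * pd 0 b x + p 1 * pd 1 b x| ≤ (q0 + q1) * M := by
      refine (abs_add_le _ _).trans ?_
      rw [abs_mul, abs_mul, add_mul]
      exact add_le_add (mul_le_mul_of_nonneg_left (hM1' 0 x) (abs_nonneg _))
        (mul_le_mul_of_nonneg_left (hM1' 1 x) (abs_nonneg _))
    have k2 : |p 0 * p 0 * pd 0 (pd 0 b) x + p 0 * p 1 * pd 0 (pd 1 b) x
            + (p 1 * p 0 * pd 1 (pd 0 b) x + p 1 * p 1 * pd 1 (pd 1 b) x)|
        ≤ (q0 + q1) ^ 2 * M := by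
      have t i j : |p i * p j * pd i (pd j b) x| ≤ |p i| * |p j| * M := by
        rw [abs_mul, abs_mul]
        exact mul_le_mul_of_nonneg_left (hM2' i j x) (by positivity)
      refine (abs_add_le _ _).trans ((add_le_add (abs_add_le _ _) (abs_add_le _ _)).trans ?_)
      have := t 0 0
      have := t 0 1
      have := t 1 0
      have := t 1 1
      calc _ ≤ (q0 * q0 * M + q0 * q1 * M) + (q1 * q0 * M + q1 * q1 * M) := by gcongr
        _ = _ := by ring
    have hb2 : b x ^ 2 ≤ 1 := pow_le_one₀ (hb0 x) (hb1 x)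
    have hb3 : b x ^ 3 ≤ 1 := pow_le_one₀ (hb0 x) (hb1 x)
    have hb30 : 0 ≤ b x ^ 3 := by have := hb0 x; positivity
    have k4 : |12 * b x ^ 2 * (p 0 * pd 0 b x + p 1 * pd 1 b x) ^ 2| ≤ 12 *
        ((q0 + q1) * M) ^ 2 := by
      rw [abs_of_nonneg (by positivity)]
      have := mul_le_mul hb2 (sq_le_sq' (abs_le.1 k1).1 (abs_le.1 k1).2) (sq_nonneg _) zero_le_one
      linarith
    have k5 : |4 * b x ^ 3 * (p 0 * p 0 * pd 0 (pd 0 b) x + p 0 * p 1 * pd 0 (pd 1 b) x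
            + (p 1 * p 0 * pd 1 (pd 0 b) x + p 1 * p 1 * pd 1 (pd 1 b) x))|
        ≤ 4 * ((q0 + q1) ^ 2 * M) := by
      rw [abs_mul, abs_of_nonneg (by positivity)]
      linarith [mul_le_mul hb3 k2 (abs_nonneg _) zero_le_one]
    refine (abs_add_le _ _).trans ((add_le_add k4 k5).trans ?_)
    rw [hq]
    have m1 : (q0 + q1) ^ 2 ≤ 2 * (q0 ^ 2 + q1 ^ 2) := by nlinarith [sq_nonneg (q0 - q1)]
    have m2 : M ≤ M ^ 2 := by nlinarith
    have m3 := mul_le_mul_of_nonneg_right m1 (sq_nonneg M)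
    have m4 := mul_le_mul_of_nonneg_left m2 (sq_nonneg (q0 + q1))
    have m5 : 0 ≤ (q0 ^ 2 + q1 ^ 2) * M ^ 2 := by positivity
    rw [mul_pow]; linarith
  · have : b x = 0 := by simpa using hx
    simp only [h2, this]; simp
  · have := b.one_of_mem_closedBall (by simpa [b] using hx)
    simp [this]
  · simp [b.zero_of_le_dist (by simpa [b] using hx)]

theorem exists_cut : ∃ B, 0 < B ∧ ∀ (c : E2) (R : ℝ), 0 < R → ∃ ζ : E2 → ℝ, Cut (B / R ^ 2) ζ ∧
    (∀ x ∈ closedBall c R, ζ x = 1) ∧ tsupport ζ ⊆ closedBall c (3 * R / 2) := by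
  obtain ⟨B, hB, ζ, hζ, h1, h0⟩ := exists_cut_unit
  refine ⟨B, hB, fun c R hR => ⟨_, hζ.rescale hR c, fun x hx => h1 _ ?_, ?_⟩⟩
  · rw [norm_smul, norm_inv, Real.norm_of_nonneg hR.le, inv_mul_le_iff₀ hR, mul_one]
    rwa [mem_closedBall, dist_eq_norm] at hx
  · refine closure_minimal (fun x hx => ?_) isClosed_closedBall
    by_contra hn
    rw [mem_closedBall, dist_eq_norm, not_le] at hn
    refine hx (h0 _ ?_)
    rw [norm_smul, norm_inv, Real.norm_of_nonneg hR.le, le_inv_mul_iff₀ hR]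
    linarith

/-! ### Pairing with mollified functions of bounded variation -/

theorem mker_neg (n : ℕ) (x : E2) : mker n (-x) = mker n x := (stdBump n).normed_neg x

theorem pd_mker_neg (n : ℕ) (i : Fin 2) (x : E2) : pd i (mker n) (-x) = -pd i (mker n) x := by
  have h := pd_mker_sub n 0 x i
  simp only [zero_sub, mker_neg] at h
  rw [← neg_eq_iff_eq_neg.2 h]

theorem integral_pd_moll_mul (n : ℕ) {f w : E2 → ℝ} (hf : Integrable f) (hw : Integrable w)
    (i : Fin 2) : ∫ x, pd i (moll n f) x * w x = -∫ y, f y * pd i (moll n w) y := by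
  have hk := continuous_pd (mker_contDiff n) i
  obtain ⟨M, hM⟩ := exists_bound_of_hasCompactSupport hk
    (hasCompactSupport_pd (mker_hasCompactSupport n) i)
  have hitg :=
    (hw.mul_prod hf).bdd_mul (hk.comp (continuous_fst.sub continuous_snd)).aestronglyMeasurable
      (.of_forall fun z => hM _)
  calc ∫ x, pd i (moll n f) x * w x
      = ∫ x, ∫ y, pd i (mker n) (x - y) * (w x * f y) := by
        refine integral_congr_ae (.of_forall fun x => ?_)
        beta_reduce
        rw [pd_moll n hf.locallyIntegrable, ← integral_mul_const]
        exact integral_congr_ae (.of_forall fun y => by beta_reduce; ring)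
    _ = ∫ y, ∫ x, pd i (mker n) (x - y) * (w x * f y) := integral_integral_swap hitg
    _ = _ := by
        rw [← integral_neg]
        refine integral_congr_ae (.of_forall fun y => ?_)
        beta_reduce
        rw [pd_moll n hw.locallyIntegrable, ← integral_const_mul, ← integral_neg]
        refine integral_congr_ae (.of_forall fun x => ?_)
        beta_reduce
        rw [← neg_sub, pd_mker_neg]; ring

/-- Mollification of vector fields. -/
def mollV (n : ℕ) (W : E2 → E2) (x : E2) : E2 := WithLp.toLp 2 fun i => moll n (fun y => W y i) x

theorem norm_mollV_le (n : ℕ) {W : E2 → E2} (hW : Integrable W) {b : ℝ} (hb : ∀ x, ‖W x‖ ≤ b)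
    (x : E2) : ‖mollV n W x‖ ≤ b := by
  have hk := (mker_sub_contDiff n x (m := 0)).continuous
  obtain ⟨M, hM⟩ := exists_bound_of_hasCompactSupport hk (mker_sub_hasCompactSupport n x)
  have h1 :=
    hW.bdd_smul M hk.aestronglyMeasurable (.of_forall fun y => hM y)
  have h2 : mollV n W x = ∫ y, mker n (x - y) • W y := by
    ext i
    exact (EuclideanSpace.proj i : E2 →L[ℝ] ℝ).integral_comp_comm h1
  rw [h2]
  calc ‖∫ y, mker n (x - y) • W y‖ ≤ ∫ y, ‖mker n (x - y) • W y‖ := norm_integral_le_integral_norm _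
    _ ≤ ∫ y, mker n (x - y) * b := by
        refine integral_mono h1.norm (((mker_integrable n).comp_sub_left x).mul_const b) fun y => ?_
        beta_reduce
        rw [norm_smul, Real.norm_of_nonneg (mker_nonneg n _)]
        exact mul_le_mul_of_nonneg_left (hb y) (mker_nonneg n _)
    _ = b := by rw [integral_mul_const, mker_integral_sub, one_mul]

theorem bv_pairing_le {f : E2 → ℝ} {c : E2} {r1 ρ r2 b : ℝ} {n : ℕ}
    (hbv : BddAbove (bvPairings f (ball c r2))) (hf : Integrable ((closedBall c ρ).indicator f))
    (hρ : ρ < r2) (hn : r1 + (stdBump n).rOut < ρ) (hb : 0 < b) {W : E2 → E2}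
    (hW : Measurable W) (hWb : ∀ x, ‖W x‖ ≤ b) (hW0 : ∀ x ∉ closedBall c r1, W x = 0) :
    ∫ x, ⟪∇ (moll n ((closedBall c ρ).indicator f)) x, W x⟫ ≤ b * bvNorm f (ball c r2) := by
  set fb := (closedBall c ρ).indicator f with hfb
  set rn := (stdBump n).rOut
  have hWi : Integrable W := by
    have : IntegrableOn W (closedBall c r1) :=
      Measure.integrableOn_of_bounded (M := b) (isCompact_closedBall c r1).measure_lt_top.ne
        hW.aestronglyMeasurable (.of_forall hWb)
    refine (integrableOn_iff_integrable_of_support_subset fun x hx => ?_).1 this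
    by_contra h; exact hx (hW0 x h)
  have hWc i : Integrable fun x => W x i := (EuclideanSpace.proj i : E2 →L[ℝ] ℝ).integrable_comp hWi
  have hv0 : ∀ x ∉ closedBall c (r1 + rn), ∀ i, moll n (fun y => W y i) x = 0 := by
    intro x hx i
    refine moll_eq_zero fun y hy => ?_
    rw [hW0 y fun h => hx ?_]; rfl
    rw [mem_closedBall, dist_eq_norm] at h ⊢
    calc ‖x - c‖ = ‖(x - y) + (y - c)‖ := by congr 1; abel
      _ ≤ rn + r1 := (norm_add_le _ _).trans (add_le_add hy h)
      _ = _ := add_comm _ _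
  set Φ : E2 → E2 := fun x => (-b⁻¹) • mollV n W x with hΦ
  have hΦi i : (fun x => Φ x i) = fun x => (-b⁻¹) * moll n (fun y => W y i) x := rfl
  have hmc : ∀ i {m : ℕ∞}, ContDiff ℝ m (moll n fun y => W y i) := fun i =>
    moll_contDiff n (hWc i).locallyIntegrable
  have hΦsupp : tsupport Φ ⊆ closedBall c (r1 + rn) := by
    refine closure_minimal (fun x hx => ?_) isClosed_closedBall
    by_contra h
    refine hx ?_
    have : mollV n W x = 0 := by ext i; exact hv0 x h i
    simp [hΦ, this]
  have hdiv x : divg Φ x = (-b⁻¹) * ∑ i, pd i (moll n fun y => W y i) x := by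
    rw [divg, Finset.mul_sum]
    refine Finset.sum_congr rfl fun i _ => ?_
    rw [hΦi, ((HasPd.const (-b⁻¹) x).mul ((hmc i).hasPd x)).2 i]; simp
  have hdiv0 : ∀ x ∉ closedBall c (r1 + rn), divg Φ x = 0 := by
    intro x hx
    rw [hdiv]
    refine mul_eq_zero_of_right _ (Finset.sum_eq_zero fun i _ => pd_eq_zero_off (fun h => hx ?_) i)
    refine closure_minimal (fun y hy => ?_) isClosed_closedBall h
    by_contra h'; exact hy (hv0 y h' i)
  have hmem : ∫ x in ball c r2, f x * divg Φ x ∈ bvPairings f (ball c r2) := by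
    refine ⟨Φ, ?_, ?_, hΦsupp.trans (closedBall_subset_ball (by linarith)), fun x => ?_, rfl⟩
    · rw [contDiff_euclidean]
      exact fun i => contDiff_const.mul (hmc i)
    · exact (isCompact_closedBall c (r1 + rn)).of_isClosed_subset (isClosed_tsupport _) hΦsupp
    · simp only [hΦ]
      rw [norm_smul, norm_neg, norm_inv, Real.norm_of_nonneg hb.le, inv_mul_le_iff₀ hb, mul_one]
      exact norm_mollV_le n hWi hWb x
  have h1 : ∫ x in ball c r2, f x * divg Φ x = ∫ x, fb x * divg Φ x := by
    rw [← integral_indicator measurableSet_ball]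
    refine integral_congr_ae (.of_forall fun x => ?_)
    beta_reduce
    by_cases hx : x ∈ closedBall c (r1 + rn)
    · rw [indicator_of_mem (closedBall_subset_ball (by linarith) hx), hfb,
        indicator_of_mem (closedBall_subset_closedBall (by linarith) hx)]
    · rw [hdiv0 x hx, mul_zero]
      exact indicator_apply_eq_zero.2 fun _ => by rw [hdiv0 x hx, mul_zero]
  have hpi : ∀ i {g : E2 → ℝ}, Integrable g → ∀ w : E2 → ℝ, Integrable w →
      Integrable fun x => w x * pd i (moll n g) x := by
    intro i g hg w hw
    obtain ⟨M, hM⟩ : ∃ M, ∀ x, |pd i (moll n g) x| ≤ M := by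
      obtain ⟨M, hM⟩ := exists_bound_of_hasCompactSupport (continuous_pd (mker_contDiff n) i)
        (hasCompactSupport_pd (mker_hasCompactSupport n) i)
      refine ⟨∫ y, M * |g y|, fun x => ?_⟩
      rw [pd_moll n hg.locallyIntegrable]
      refine (abs_integral_le_integral_abs).trans (integral_mono_of_nonneg
        (.of_forall fun y => abs_nonneg _) (hg.abs.const_mul M) (.of_forall fun y => ?_))
      beta_reduce
      rw [abs_mul]
      exact mul_le_mul_of_nonneg_right (hM _) (abs_nonneg _)
    exact (hw.bdd_mul (continuous_pd (moll_contDiff n hg.locallyIntegrable) i).aestronglyMeasurable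
      (.of_forall hM)).congr (.of_forall fun x => mul_comm _ _)
  have h2 : ∫ x, ⟪∇ (moll n fb) x, W x⟫ = -∫ y, fb y * ∑ i, pd i (moll n fun y => W y i) y := by
    calc ∫ x, ⟪∇ (moll n fb) x, W x⟫ = ∫ x, ∑ i, pd i (moll n fb) x * W x i :=
          integral_congr_ae (.of_forall fun x => by
            beta_reduce; rw [inner_e2]; simp only [gradient_apply])
      _ = ∑ i, ∫ x, pd i (moll n fb) x * W x i := integral_finsetSum _ fun i _ =>
          (hpi i hf _ (hWc i)).congr (.of_forall fun x => mul_comm _ _)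
      _ = ∑ i, -∫ y, fb y * pd i (moll n fun y => W y i) y :=
          Finset.sum_congr rfl fun i _ => integral_pd_moll_mul n hf (hWc i) i
      _ = -∫ y, ∑ i, fb y * pd i (moll n fun y => W y i) y := by
          rw [integral_finsetSum _ fun i _ => hpi i (hWc i) _ hf, Finset.sum_neg_distrib]
      _ = _ := by simp only [Finset.mul_sum]
  have h3 : ∫ x, ⟪∇ (moll n fb) x, W x⟫ = b * ∫ x, fb x * divg Φ x := by
    rw [h2, ← integral_neg, ← integral_const_mul]
    refine integral_congr_ae (.of_forall fun x => ?_)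
    beta_reduce
    rw [hdiv]; field_simp
  rw [h3, ← h1]
  exact mul_le_mul_of_nonneg_left (le_csSup hbv hmem) hb.le

/-! ### Regularised obstacle problems on balls -/

theorem exists_lip_ext {w : E2 → ℝ} {c : E2} {ρ m : ℝ} {L : ℝ≥0} (hρ : 0 ≤ ρ)
    (hw : LipschitzOnWith L w (closedBall c ρ)) (hb : ∀ x ∈ closedBall c ρ, |w x| ≤ m) :
    ∃ w' : E2 → ℝ, LipschitzWith (L + m.toNNReal) w' ∧ HasCompactSupport w' ∧ (∀ x, |w' x| ≤ m) ∧
      ∀ x ∈ closedBall c ρ, w' x = w x := by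
  have hm := (abs_nonneg _).trans (hb c (mem_closedBall_self hρ))
  obtain ⟨w1, h1, h1e⟩ := hw.extend_real
  set g : E2 → ℝ := fun x => max 0 (min m (m * (1 + ρ - dist x c)))
  have hg : LipschitzWith m.toNNReal g := by
    refine ((LipschitzWith.of_dist_le_mul fun x y => ?_).const_min m).const_max 0
    rw [Real.dist_eq, Real.coe_toNNReal _ hm, ← mul_sub, sub_sub_sub_cancel_left, abs_mul,
      abs_of_nonneg hm, dist_comm x y]
    exact mul_le_mul_of_nonneg_left (abs_dist_sub_le y x c) hm
  have hg0 x : 0 ≤ g x := le_max_left _ _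
  have hgm x : g x ≤ m := max_le hm (min_le_left _ _)
  refine ⟨fun x => max (-g x) (min (g x) (w1 x)), (hg.neg.max (hg.min h1)).weaken ?_,
    HasCompactSupport.intro (isCompact_closedBall c (ρ + 1)) fun x hx => ?_, fun x => ?_,
    fun x hx => ?_⟩
  · simp
  · have : g x = 0 := max_eq_left <| (min_le_right _ _).trans <|
      mul_nonpos_of_nonneg_of_nonpos hm (by rw [mem_closedBall] at hx; linarith)
    simp [this]
  · exact (abs_le.2 ⟨le_max_left _ _, max_le (by linarith [hg0 x]) (min_le_left _ _)⟩).trans (hgm x)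
  · have e : g x = m := by
      have := mul_le_mul_of_nonneg_left (show 1 ≤ 1 + ρ - dist x c by
        linarith [mem_closedBall.1 hx]) hm
      rw [← max_eq_right hm, ← min_eq_left (by linarith : m ≤ m * (1 + ρ - dist x c))]
    have := abs_le.1 (hb x hx)
    rw [h1e hx] at this
    simp [e, h1e hx, this]

/-- Radial obstacle width. -/
def cone (c : E2) (r : ℝ) (x : E2) : ℝ := max 0 (r - ‖x - c‖)

theorem obst_cone {M : ℝ≥0} {t F : E2 → ℝ} (c : E2) (r : ℝ) (ht : LipschitzWith M t)
    (hF : Continuous F) : Obst M t (cone c r) F := by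
  refine ⟨fun x => le_max_left _ _, fun x y => ?_, ?_, ht, hF⟩
  · refine (abs_max_sub_max_le_max _ _ _ _).trans ?_
    rw [sub_self, abs_zero, max_eq_right (abs_nonneg _), sub_sub_sub_cancel_left, abs_sub_comm]
    exact (abs_norm_sub_norm_le _ _).trans_eq (by congr 1; abel)
  · refine HasCompactSupport.intro (isCompact_closedBall c r) fun x hx => ?_
    rw [mem_closedBall, not_le, dist_eq_norm] at hx
    exact max_eq_left (by linarith)

theorem Obst.exists_hyper_limit {M : ℝ≥0} {t s F : E2 → ℝ} (ho : Obst M t s F)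
    {v : ℕ → E2 → ℝ} (hv : ∀ n, v n ∈ KS M t s) :
    ∃ V ∈ KS M t s, ∀ x, Tendsto (fun n => v n x) (hyperfilter ℕ) (𝓝 (V x)) := by
  have h x : ∃ a, Tendsto (fun n => v n x) (hyperfilter ℕ) (𝓝 a) := by
    have h1 n : v n x ∈ Icc (t x - s x) (t x + s x) := by
      have := abs_le.1 ((hv n).2 x)
      exact ⟨by linarith, by linarith⟩
    obtain ⟨a, -, ha⟩ := (isCompact_Icc).ultrafilter_le_nhds
      ((hyperfilter ℕ).map fun n => v n x)
      (le_principal_iff.2 (by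
        rw [Ultrafilter.coe_map]
        exact mem_map.2 (univ_mem' h1)))
    exact ⟨a, ha⟩
  choose V hV using h
  exact ⟨V, ho.limit_mem hv hV, hV⟩

theorem Obst.exists_subseq {M : ℝ≥0} {t s F : E2 → ℝ} (ho : Obst M t s F) {v : ℕ → E2 → ℝ}
    (hv : ∀ n, v n ∈ KS M t s) {V : E2 → ℝ} (hV : V ∈ KS M t s)
    (hlim : ∀ x, Tendsto (fun n => v n x) (hyperfilter ℕ) (𝓝 (V x))) :
    ∃ σ : ℕ → ℕ, (∀ k, k ≤ σ k) ∧ ∀ k x, |v (σ k) x - V x| ≤ 1 / ((k : ℝ) + 1) := by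
  have h : ∀ k : ℕ, ∃ n, k ≤ n ∧ ∀ x, |v n x - V x| ≤ 1 / (k + 1) := by
    intro k
    have h1 := eventually_close (fun n => (hv n).1) hV.1 hlim ho.s_cpt.isCompact
      (by positivity : 0 < 1 / ((k : ℝ) + 1))
    have h2 :=
      Nat.hyperfilter_le_atTop (eventually_ge_atTop k)
    obtain ⟨n, a1, a2⟩ := (h1.and h2).exists
    refine ⟨n, a2, fun x => ?_⟩
    by_cases hx : x ∈ tsupport s
    · exact a1 x hx
    · have e1 := (hv n).2 x
      have e2 := hV.2 x
      rw [image_eq_zero_of_notMem_tsupport hx] at e1 e2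
      have e3 := abs_nonpos_iff.1 e1
      have e4 := abs_nonpos_iff.1 e2
      rw [show v n x - V x = 0 by linarith, abs_zero]
      positivity
  choose σ h1 h2 using h
  exact ⟨σ, h1, h2⟩

theorem obstacle_comparison {M : ℝ≥0} {t F f V : E2 → ℝ} {c : E2} {r lam m0 : ℝ}
    (hV : V ∈ KS M t (cone c r)) (ht : Continuous t) (hF : Continuous F) (hlam : 0 < lam)
    (hf : ContinuousOn f (ball c r)) (hf0 : ∀ x ∈ ball c r, 0 < f x)
    (hsub : ViscSub (ball c r) f t) (hsup : ViscSup (ball c r) f t) (hm0 : 0 ≤ m0)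
    (hFf : ∀ x ∈ ball c r, |F x - f x| ≤ lam * m0)
    (hVsub : ViscSub {x | t x - cone c r x < V x} (fun x => F x - lam * (V x - t x)) V)
    (hVsup : ViscSup {x | V x < t x + cone c r x} (fun x => F x - lam * (V x - t x)) V) (x : E2) :
    |V x - t x| ≤ m0 := by
  have hVc := hV.1.continuous
  have hs0 x : 0 ≤ cone c r x := le_max_left _ _
  have hoff : ∀ x, r ≤ ‖x - c‖ → V x = t x := fun x hx => by
    have h1 := hV.2 x
    rw [cone, max_eq_left (by linarith)] at h1
    linarith [abs_nonpos_iff.1 h1]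
  set G := fun x => F x - lam * (V x - t x) with hG
  have hGc : Continuous G := hF.sub (continuous_const.mul (hVc.sub ht))
  have nbhd : ∀ x ∈ ball c r, ∀ {Q : Set E2}, IsOpen Q → x ∈ Q → ∀ a b : ℝ, G x < a → b < f x →
      ∃ δ > 0, ball x δ ⊆ ball c r ∧ ball x δ ⊆ Q ∧ ∀ y ∈ ball x δ, G y < a ∧ b < f y := by
    intro x hx Q hQ hxQ a b ha hb
    have e1 := hGc.continuousAt.eventually (gt_mem_nhds ha)
    have e2 := (hf.continuousAt (isOpen_ball.mem_nhds hx)).eventually (lt_mem_nhds hb)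
    obtain ⟨δ, hδ, h⟩ := Metric.eventually_nhds_iff_ball.1 (((e1.and e2).and
      (isOpen_ball.mem_nhds hx)).and (hQ.mem_nhds hxQ))
    exact ⟨δ, hδ, fun y hy => (h y hy).1.2, fun y hy => (h y hy).2, fun y hy => (h y hy).1.1⟩
  have nbhd' : ∀ x ∈ ball c r, ∀ {Q : Set E2}, IsOpen Q → x ∈ Q → ∀ a b : ℝ, f x < a → b < G x →
      ∃ δ > 0, ball x δ ⊆ ball c r ∧ ball x δ ⊆ Q ∧ ∀ y ∈ ball x δ, f y < a ∧ b < G y := by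
    intro x hx Q hQ hxQ a b ha hb
    obtain ⟨δ, hδ, h⟩ := Metric.eventually_nhds_iff_ball.1
        (((((hf.continuousAt (isOpen_ball.mem_nhds hx)).eventually (gt_mem_nhds ha)).and
        (hGc.continuousAt.eventually (lt_mem_nhds hb))).and
      (isOpen_ball.mem_nhds hx)).and (hQ.mem_nhds hxQ))
    exact ⟨δ, hδ, fun y hy => (h y hy).1.2, fun y hy => (h y hy).2, fun y hy => (h y hy).1.1⟩
  have hsc : Continuous (cone c r) :=
    continuous_const.max (continuous_const.sub (continuous_id.sub continuous_const).norm)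
  have up : ∀ x ∈ closedBall c r, V x + (-t x) ≤ m0 := by
    refine comparison_ball hVc.continuousOn ht.neg.continuousOn
      (fun x hx => by rw [hoff x hx.ge]; linarith) fun x hx hlt => ?_
    have hfx := hFf x hx
    have hGf : G x < f x := by
      have h1 := mul_lt_mul_of_pos_left (show m0 < V x - t x by linarith) hlam
      have h2 := (abs_le.1 hfx).2
      simp only [hG]; linarith
    obtain ⟨c1, h1, h2⟩ := exists_between (max_lt hGf (hf0 x hx))
    obtain ⟨c2, h3, h4⟩ := exists_between h2
    obtain ⟨δ, hδ, d1, d2, d3⟩ := nbhd x hx (isOpen_lt (ht.sub hsc) hVc)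
      (show t x - cone c r x < V x by linarith [hs0 x]) c1 c2 ((le_max_left _ _).trans_lt h1) h4
    refine ⟨δ, hδ, c1, c2, (le_max_right _ _).trans_lt h1, h3, d1, G, _,
      hVsub.mono d2 fun _ _ => le_rfl,
      (hsup.mono d1 fun _ _ => le_rfl).neg, fun y hy => (d3 y hy).1, fun y hy => ?_⟩
    linarith [(d3 y hy).2]
  have lo : ∀ x ∈ closedBall c r, t x + (-V x) ≤ m0 := by
    refine comparison_ball ht.continuousOn hVc.neg.continuousOn
      (fun x hx => by rw [hoff x hx.ge]; linarith) fun x hx hlt => ?_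
    have hGf : f x < G x := by
      have h1 := mul_lt_mul_of_pos_left (show m0 < t x - V x by linarith) hlam
      have h2 := (abs_le.1 (hFf x hx)).1
      simp only [hG]; linarith
    obtain ⟨c1, h1, h2⟩ := exists_between hGf
    obtain ⟨c2, h3, h4⟩ := exists_between h2
    obtain ⟨δ, hδ, d1, d2, d3⟩ := nbhd' x hx (isOpen_lt hVc (ht.add hsc))
      (show V x < t x + cone c r x by linarith [hs0 x]) c1 c2 h1 h4
    refine ⟨δ, hδ, c1, c2, (hf0 x hx).trans h1, h3, d1, f, _, hsub.mono d1 fun _ _ => le_rfl,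
      (hVsup.mono d2 fun _ _ => le_rfl).neg, fun y hy => (d3 y hy).1, fun y hy => ?_⟩
    linarith [(d3 y hy).2]
  by_cases hx : x ∈ closedBall c r
  · exact abs_le.2 ⟨by linarith [lo x hx], by linarith [up x hx]⟩
  · rw [mem_closedBall, not_le, dist_eq_norm] at hx
    rwa [hoff x hx.le, sub_self, abs_zero]

theorem obstacle_limit {t F f : E2 → ℝ} {c : E2} {r lam m0 : ℝ} {Lt LF L : ℝ≥0}
    (htL : LipschitzWith Lt t) (hFL : LipschitzWith LF F) (hlam : 0 < lam)
    (hL : (Lt : ℝ) + 1 + LF / lam ≤ L)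
    (hf : ContinuousOn f (ball c r)) (hf0 : ∀ x ∈ ball c r, 0 < f x)
    (hsub : ViscSub (ball c r) f t) (hsup : ViscSup (ball c r) f t) (hm0 : 0 ≤ m0)
    (hFf : ∀ x ∈ ball c r, |F x - f x| ≤ lam * m0) :
    ∃ V : E2 → ℝ, LipschitzWith L V ∧ (∀ x, |V x - t x| ≤ m0) ∧
      ViscSub {x | t x - cone c r x < V x} (fun x => F x - lam * (V x - t x)) V ∧
      ViscSup {x | V x < t x + cone c r x} (fun x => F x - lam * (V x - t x)) V ∧
      ∃ (ε : ℕ → ℝ) (v : ℕ → E2 → ℝ), (∀ n, 0 < ε n) ∧ Tendsto ε atTop (𝓝 0) ∧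
        (∀ n, IsVI (ε n) lam (L + 1) t (cone c r) F (v n)) ∧ (∀ n, LipschitzWith L (v n)) ∧
        ∀ n x, |v n x - V x| ≤ 1 / ((n : ℝ) + 1) := by
  have hLtL : Lt ≤ L + 1 := by
    rw [← NNReal.coe_le_coe]; push_cast
    have : 0 ≤ LF / lam := by positivity
    linarith
  have ho := obst_cone (F := F) c r (htL.weaken hLtL) hFL.continuous
  set ε : ℕ → ℝ := fun n => 1 / (n + 1)
  have hε n : 0 < ε n := by positivity
  have hε0 : Tendsto ε atTop (𝓝 0) := tendsto_one_div_add_atTop_nhds_zero_nat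
  choose v hv using fun n => ho.exists_sol (hε n) hlam
  have hvL n : LipschitzWith L (v n) := LipschitzWith.of_dist_le_mul fun x y => by
    rw [Real.dist_eq, dist_eq_norm]
    exact (ho.lip_sol (hε n) hlam htL hFL (hv n) x y).trans
      (mul_le_mul_of_nonneg_right hL (norm_nonneg _))
  obtain ⟨V, hV, hlim⟩ := ho.exists_hyper_limit fun n => (hv n).1
  have hVL := LipschitzWith.of_dist_le_mul fun x y =>
    le_of_tendsto ((hlim x).dist (hlim y)) (.of_forall fun n => (hvL n).dist_le_mul x y)
  have hε0' := hε0.mono_left Nat.hyperfilter_le_atTop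
  have h1 := visc_limit ho le_rfl hlam hε hε0' hv hvL hlim
  have h2 := visc_limit_sup ho le_rfl hlam hε hε0' hv hvL hlim
  obtain ⟨σ, hσ, hσl⟩ := ho.exists_subseq (fun n => (hv n).1) hV hlim
  exact ⟨V, hVL, obstacle_comparison hV htL.continuous hFL.continuous hlam hf hf0 hsub hsup hm0
    hFf h1 h2, h1, h2, fun n => ε (σ n), fun n => v (σ n), fun n => hε _,
    hε0.comp (tendsto_atTop_mono hσ tendsto_id), fun n => hv _, fun n => hvL _, hσl⟩

/-- Without contact the variational inequality is an equation. -/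
theorem IsVI.weak_solution {ε lam : ℝ} {M L : ℝ≥0} {t s F v : E2 → ℝ} {U : Set E2}
    (h : IsVI ε lam M t s F v) (ho : Obst M t s F) (hL : LipschitzWith L v) (hLM : L + 1 ≤ M)
    (hU : ∀ x ∈ U, |v x - t x| < s x) : WS ε U (fun x => F x - lam * (v x - t x)) v := by
  intro ψ hψ hc hψU
  have hlt : ∀ x ∈ U, v x < t x + s x ∧ t x - s x < v x := fun x hx => by
    have := abs_lt.1 (hU x hx)
    exact ⟨by linarith, by linarith⟩
  have e : ∀ ψ : E2 → ℝ, ∀ x, vfi ε lam 0 t F t v ψ x = ⟪Aop ε (∇ v x), ∇ ψ x⟫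
      - om ε (∇ v x) * ((F x - lam * (v x - t x)) / ε) * ψ x := fun ψ x => by
    rw [vfi]; ring
  have h1 := h.perturb ho hL hLM hψ hc (.inr fun x hx => (hlt x (hψU hx)).1)
    (.inr fun x hx => (hlt x (hψU hx)).2)
  have hs :=
    (closure_mono fun x (hx : -ψ x ≠ 0) => neg_ne_zero.1 hx).trans hψU
  have h2 := h.perturb ho hL hLM hψ.neg hc.neg (.inr fun x hx => (hlt x (hs hx)).1)
    (.inr fun x hx => (hlt x (hs hx)).2)
  have h3 : ∫ x, vfi ε lam 0 t F t v (fun x => -ψ x) x = -∫ x, vfi ε lam 0 t F t v ψ x := by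
    rw [← integral_neg]
    refine integral_congr_ae ?_
    filter_upwards [hψ.ae_hasGradientAt] with x hx
    rw [vfi, vfi, hx.neg'.gradient, inner_neg_right]; ring
  simp only [← e]
  rw [h3] at h2
  linarith

theorem tendsto_integral_kf_inner {α e B : ℝ} (he : 0 < e) {ζ : E2 → ℝ} (hζ : Cut B ζ)
    {v : ℕ → E2 → ℝ} {t : E2 → ℝ} {M : ℝ≥0} (hv : ∀ n, LipschitzWith M (v n))
    (ht : LipschitzWith M t) (hlim : ∀ x, Tendsto (fun n => v n x) atTop (𝓝 (t x))) :
    Tendsto (fun n => ∫ x, ζ x * (kf α e (‖∇ t x‖ ^ 2) * ⟪∇ t x, ∇ (v n) x - ∇ t x⟫))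
      atTop (𝓝 0) := by
  have hW := fun i =>
    IsLip.integrable_comp_mul ⟨M, ht⟩ (c := fun p => kf α e (‖p‖ ^ 2) * p i)
      ((continuous_kf he α).mul (by fun_prop))
        (hζ.smooth.continuous.integrable_of_hasCompactSupport hζ.cpt (μ := volume))
  have hgi : ∀ {w : E2 → ℝ}, LipschitzWith M w → ∀ i,
      Integrable fun x => (∇ w x) i * (kf α e (‖∇ t x‖ ^ 2) * (∇ t x) i * ζ x) := by
    intro w hw i
    refine (hW i).bdd_mul (c := M) ((EuclideanSpace.proj i : E2 →L[ℝ] ℝ).continuous.measurable.comp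
      (measurable_gradient w)).aestronglyMeasurable (.of_forall fun x => ?_)
    exact (PiLp.norm_apply_le _ _).trans (hw.norm_gradient_le x)
  have h := tendsto_finsetSum Finset.univ fun i (_ : i ∈ (Finset.univ : Finset (Fin 2))) =>
    (tendsto_integral_gradient_mul hv ht hlim (hW i) i).sub
      (tendsto_const_nhds (x := ∫ x, (∇ t x) i * (kf α e (‖∇ t x‖ ^ 2) * (∇ t x) i * ζ x)))
  simp only [sub_self, Finset.sum_const_zero] at h
  refine h.congr fun n => ?_
  have e1 := fun i =>
    (integral_sub (hgi (hv n) i) (hgi ht i)).symm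
  simp only [e1]
  rw [← integral_finsetSum _ fun i _ => (hgi (hv n) i).fsub (hgi ht i)]
  refine integral_congr_ae (.of_forall fun x => ?_)
  simp only [inner_e2, Fin.sum_univ_two, PiLp.sub_apply]
  ring

theorem energy_approx {α e B : ℝ} (hα : 3 / 2 < α) (he : 0 < e) (hB : 0 ≤ B) {c : E2} {r r' : ℝ}
    (hr' : 0 < r') (hr : r' < r) {t F : E2 → ℝ} {Lt LF L : ℝ≥0} (ht : LipschitzWith Lt t)
    (htc : HasCompactSupport t) (hF : LipschitzWith LF F) {b : ℝ} (hFb : ∀ x, |F x| ≤ b)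
    (hsub : ViscSub (ball c r) F t) (hsup : ViscSup (ball c r) F t) (hF0 : ∀ x ∈ ball c r, 0 < F x)
    {ζ : E2 → ℝ} (hζ : Cut B ζ) (hζr : tsupport ζ ⊆ closedBall c r') {lam η : ℝ} (hlam : 0 < lam)
    (hL : (Lt : ℝ) + 1 + LF / lam ≤ L) (hη : 0 < η) :
    ∃ v : E2 → ℝ, LipschitzWith L v ∧
      0 ≤ ∫ x, En α e B ζ (fun x => F x - lam * (v x - t x)) v x ∧
      (∀ i φ, IsTest univ φ → (∀ x, φ x ≠ 0 → ζ x = 1) →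
        (∫ x, (‖∇ v x‖ ^ 2 + e) ^ (α / 2) * pd i φ x) ^ 2 ≤ 4 * (∫ x, φ x ^ 2) *
          (α ^ 2 / dl α * ∫ x, En α e B ζ (fun x => F x - lam * (v x - t x)) v x)) ∧
      |lam * ∫ x, ζ x * (kf α e (‖∇ t x‖ ^ 2) * ⟪∇ t x, ∇ v x - ∇ t x⟫)| ≤ η := by
  obtain ⟨V, hVL, hVt, -, -, ε, v, hε, hε0, hv, hvL, hvV⟩ := obstacle_limit ht hF hlam hL
    hF.continuous.continuousOn hF0 hsub hsup le_rfl (fun x _ => by simp)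
  obtain rfl : V = t := funext fun x => by
    have := abs_nonpos_iff.1 (hVt x); linarith
  have h1n := tendsto_one_div_add_atTop_nhds_zero_nat (𝕜 := ℝ)
  have hlim x : Tendsto (fun n => v n x) atTop (𝓝 (V x)) := by
    rw [tendsto_iff_norm_sub_tendsto_zero]
    exact squeeze_zero (fun _ => norm_nonneg _) (fun n => hvV n x) h1n
  have e1 := (tendsto_integral_kf_inner (α := α) he hζ hvL hVL hlim).const_mul lam
  rw [mul_zero] at e1
  have e3 : ∀ᶠ n in atTop, 4 * |α - 2| * (ε n / e) < dl α := by
    exact ((hε0.div_const e).const_mul (4 * |α - 2|)).eventually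
      (gt_mem_nhds (by simpa using dl_pos hα))
  set r1 := (r' + r) / 2 with hr1
  set r2 := (r1 + r) / 2 with hr2
  have e4 : ∀ᶠ n : ℕ in atTop, 1 / (n + 1) < r - r2 :=
    h1n.eventually (gt_mem_nhds (by linarith))
  obtain ⟨n, ⟨⟨⟨k1, k2⟩, k3⟩, k4⟩⟩ :=
      ((((e1.abs.eventually (gt_mem_nhds (show |0| < η by simpa using hη))).and
      (hε0.eventually (gt_mem_nhds he))).and e3).and e4).exists
  refine ⟨v n, hvL n, ?_⟩
  have hg := IsLip.sub ⟨LF, hF⟩ ((IsLip.sub ⟨L, hvL n⟩ ⟨L, hVL⟩).const_mul lam)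
  have hgb : ∀ x, |F x - lam * (v n x - V x)| ≤ b + lam * (1 / (n + 1)) := fun x =>
    (abs_sub _ _).trans (add_le_add (hFb x) (by
      rw [abs_mul, abs_of_pos hlam]; exact mul_le_mul_of_nonneg_left (hvV n x) hlam.le))
  have hWS : WS (ε n) (ball c r2) (fun x => F x - lam * (v n x - V x)) (v n) := by
    refine (hv n).weak_solution (obst_cone c r (hVL.weaken (by simp)) hF.continuous)
      (hvL n) le_rfl fun x hx => (hvV n x).trans_lt ?_
    rw [mem_ball, dist_eq_norm] at hx
    exact lt_max_of_lt_right (by linarith)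
  let χ : ContDiffBump c := ⟨r1, (r1 + r2) / 2, by linarith, by linarith⟩
  obtain ⟨H, hH⟩ := hWS.exists_W22 (hε n) isOpen_ball ⟨L, hvL n⟩ hg hgb
    (ContDiff.isLip χ.contDiff χ.hasCompactSupport) χ.hasCompactSupport
    (fun x => by rw [abs_of_nonneg χ.nonneg]; exact χ.le_one)
    (by rw [χ.tsupport_eq]; exact closedBall_subset_ball (show (r1 + r2) / 2 < r2 by linarith))
    (U := ball c r1) (fun x hx => χ.one_of_mem_closedBall (ball_subset_closedBall hx))
  have hvc : HasCompactSupport (v n) := by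
    refine HasCompactSupport.intro ((isCompact_closedBall c r).union htc.isCompact) fun x hx => ?_
    rw [mem_union, not_or, mem_closedBall, dist_eq_norm] at hx
    have h1 := (hv n).1.2 x
    rw [cone, max_eq_left (by linarith), abs_nonpos_iff] at h1
    rw [image_eq_zero_of_notMem_tsupport hx.2] at h1
    linarith
  have hsubs : tsupport ζ ⊆ ball c r1 := hζr.trans (closedBall_subset_ball (by linarith))
  have h := energy_inequality hα he (hε n) k2.le k3.le hB isOpen_ball ⟨L, hvL n⟩ hvc hg hgb
    (hWS.mono (ball_subset_ball (by linarith))) hH hζ hsubs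
  refine ⟨h.1, fun i φ hφ h1 => h.2 i φ ⟨hφ.smooth, hφ.cpt, ?_⟩ h1, k1.le⟩
  exact (closure_mono fun x hx => by
    rw [Function.mem_support, h1 x hx]; exact one_ne_zero).trans hsubs

theorem abs_Src_le {α e B : ℝ} (he : 0 < e) {ζ : E2 → ℝ} (hζ : Cut B ζ) (L LF : ℝ≥0) :
    ∃ T0, ∀ F v : E2 → ℝ, LipschitzWith LF F → LipschitzWith L v → Src α e ζ F v ≤ T0 := by
  obtain ⟨C, hC⟩ := (isCompact_closedBall 0 L).exists_bound_of_continuousOn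
    (continuous_kf he α).continuousOn
  refine ⟨∫ x, C * (LF * L) * ζ x, fun F v hF hv => integral_mono
    (hζ.integrable_kf he ⟨LF, hF⟩ ⟨L, hv⟩)
      (hζ.smooth.continuous.integrable_of_hasCompactSupport hζ.cpt (μ := volume).const_mul _) fun
      x => ?_⟩
  have h1 := hC (∇ v x) (by simpa using hv.norm_gradient_le x)
  have h2 : ‖⟪∇ F x, ∇ v x⟫‖ ≤ LF * L := (norm_inner_le_norm _ _).trans
    (mul_le_mul (hF.norm_gradient_le x) (hv.norm_gradient_le x) (norm_nonneg _) LF.2)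
  calc kf α e (‖∇ v x‖ ^ 2) * ζ x * ⟪∇ F x, ∇ v x⟫
      = (kf α e (‖∇ v x‖ ^ 2) * ⟪∇ F x, ∇ v x⟫) * ζ x := by ring
    _ ≤ (C * (LF * L)) * ζ x := mul_le_mul_of_nonneg_right ((le_abs_self _).trans (by
        rw [abs_mul]
        exact mul_le_mul h1 h2 (abs_nonneg _) ((norm_nonneg _).trans h1))) (hζ.nonneg x)

theorem tendsto_Src {α e B : ℝ} (he : 0 < e) {ζ : E2 → ℝ} (hζ : Cut B ζ) {L : ℝ≥0}
    {v : ℕ → E2 → ℝ} {t F : E2 → ℝ} (hF : IsLip F) (hv : ∀ n, LipschitzWith L (v n))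
    (ht : LipschitzWith L t)
    (hlim : ∀ᵐ x, ζ x ≠ 0 → Tendsto (fun n => ∇ (v n) x) atTop (𝓝 (∇ t x))) :
    Tendsto (fun n => Src α e ζ F (v n)) atTop (𝓝 (Src α e ζ F t)) := by
  have hc : ∀ i, Continuous fun p : E2 => kf α e (‖p‖ ^ 2) * p i := fun i =>
    (continuous_kf he α).mul (by fun_prop)
  obtain ⟨M, hM0, hM⟩ := hF.exists_bound
  have hw i : Integrable fun x => (∇ F x) i * ζ x := by
    refine hζ.smooth.continuous.integrable_of_hasCompactSupport hζ.cpt (μ := volume).bdd_mul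
      (c := M) ((EuclideanSpace.proj i : E2 →L[ℝ] ℝ).continuous.measurable.comp
      (measurable_gradient F)).aestronglyMeasurable (.of_forall fun x => ?_)
    exact (PiLp.norm_apply_le _ _).trans (hM x)
  have key : ∀ {w : E2 → ℝ}, LipschitzWith L w → Src α e ζ F w
      = ∑ i, ∫ x, kf α e (‖∇ w x‖ ^ 2) * (∇ w x) i * ((∇ F x) i * ζ x) := by
    intro w hwL
    rw [← integral_finsetSum _ fun i _ => IsLip.integrable_comp_mul ⟨L, hwL⟩ (hc i) (hw i), Src]
    refine integral_congr_ae (.of_forall fun x => ?_)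
    simp only [inner_e2, Fin.sum_univ_two]
    ring
  rw [key ht]
  refine Tendsto.congr (fun n => (key (hv n)).symm) (tendsto_finsetSum _ fun i _ => ?_)
  refine tendsto_integral_comp_gradient hv (hc i) (hw i) ?_
  filter_upwards [hlim] with x hx h
  exact hx (right_ne_zero_of_mul h)

/-- The energy inequality for Lipschitz viscosity solutions with a Lipschitz positive right-hand
side. -/
theorem energy_visc {α e B : ℝ} (hα : 3 / 2 < α) (he : 0 < e) (hB : 0 ≤ B) {c : E2} {r r' : ℝ}
    (hr' : 0 < r') (hr : r' < r) {t F : E2 → ℝ} (ht : IsLip t)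
    (htc : HasCompactSupport t) (hF : IsLip F) {b : ℝ} (hFb : ∀ x, |F x| ≤ b)
    (hsub : ViscSub (ball c r) F t) (hsup : ViscSup (ball c r) F t) (hF0 : ∀ x ∈ ball c r, 0 < F x)
    {ζ : E2 → ℝ} (hζ : Cut B ζ) (hζr : tsupport ζ ⊆ closedBall c r') :
    0 ≤ ∫ x, En α e B ζ F t x ∧ ∀ i φ, IsTest univ φ → (∀ x, φ x ≠ 0 → ζ x = 1) →
      (∫ x, (‖∇ t x‖ ^ 2 + e) ^ (α / 2) * pd i φ x) ^ 2
        ≤ 4 * (∫ x, φ x ^ 2) * (α ^ 2 / dl α * ∫ x, En α e B ζ F t x) := by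
  obtain ⟨Lt, ht⟩ := ht
  obtain ⟨LF, hF⟩ := hF
  set L : ℝ≥0 := Lt + 1 + LF with hL
  have hL1 : ∀ n : ℕ, (Lt : ℝ) + 1 + LF / ((n : ℝ) + 1) ≤ L := fun n => by
    have := div_le_self LF.2 (by linarith [n.cast_nonneg (α := ℝ)] : (1 : ℝ) ≤ (n : ℝ) + 1)
    rw [hL]; push_cast
    linarith [show ((LF : ℝ)) / ((n : ℝ) + 1) ≤ LF from this]
  choose v hvL hE hφ hη using fun n : ℕ => energy_approx hα he hB hr' hr ht htc hF hFb hsub hsup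
    hF0 hζ hζr (by positivity : (0 : ℝ) < (n : ℝ) + 1) (hL1 n)
    (by positivity : (0 : ℝ) < 1 / ((n : ℝ) + 1))
  obtain ⟨T0, hT0⟩ := abs_Src_le (α := α) he hζ L LF
  have htL : LipschitzWith L t := ht.weaken (by rw [hL, add_assoc]; exact le_self_add)
  have h0 := squeeze_zero_norm (a := fun n : ℕ => 1 / ((n : ℝ) + 1)) (fun n => by
    rw [Real.norm_eq_abs]; exact hη n) (tendsto_one_div_add_atTop_nhds_zero_nat (𝕜 := ℝ))
  obtain ⟨σ, hσ, hg, hall⟩ := penalised_limit (F := fun _ => F) hα he hζ htL hvL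
    (fun _ => ⟨LF, hF⟩) (fun n => by positivity)
    (tendsto_atTop_add_const_right _ 1 tendsto_natCast_atTop_atTop) hE
    (fun n => hT0 F (v n) hF (hvL n)) h0
  obtain ⟨k1, k2⟩ := hall (Src α e ζ F t) fun η hη =>
    ((tendsto_Src (α := α) he hζ ⟨LF, hF⟩ (fun n => hvL (σ n)) htL hg).eventually
      (gt_mem_nhds (show _ < Src α e ζ F t + η by linarith))).mono fun _ h => h.le
  rw [hζ.integral_En he ⟨LF, hF⟩ ⟨L, htL⟩]
  refine ⟨k1, fun i φ hφt h1 => ?_⟩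
  rw [← mul_assoc]
  have hnn := integral_nonneg (μ := volume) (f := fun x => φ x ^ 2) fun x => sq_nonneg _
  refine k2 _ (by have := dl_pos hα; positivity) _
    ((hφt.pd_continuous i).integrable_of_hasCompactSupport
    (hφt.pd_cpt i)) (fun x hx => ?_) fun n => by rw [mul_assoc]; exact hφ n i φ hφt h1
  have : x ∈ tsupport φ := by
    by_contra h
    exact hx (pd_eq_zero_off h i)
  have := closure_minimal (s := Function.support φ) (fun y hy => h1 y hy)
      (isClosed_singleton.preimage hζ.smooth.continuous) this
  rw [this]; exact one_ne_zero

/-- A viscosity solution of `-Δ_∞ u = f` with `f > 0` on a ball of radius `2R`. -/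
structure BallSol (c : E2) (R m N : ℝ) (f u : E2 → ℝ) : Prop where
  pos : 0 < R
  f_cont : ContinuousOn f (closedBall c (2 * R))
  f_pos : ∀ x ∈ closedBall c (2 * R), 0 < f x
  f_le : ∀ x ∈ closedBall c (2 * R), f x ≤ N
  u_cont : ContinuousOn u (closedBall c (2 * R))
  u_le : ∀ x ∈ closedBall c (2 * R), |u x| ≤ m
  sub : ViscSub (ball c (2 * R)) f u
  sup : ViscSup (ball c (2 * R)) f u
  bv : BddAbove (bvPairings f (ball c (2 * R)))

/-- The scale-invariant size entering the gradient estimate. -/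
def size (R m N : ℝ) : ℝ := m / R + (R * N) ^ ((1 : ℝ) / 3)

namespace BallSol

variable {c : E2} {R m N : ℝ} {f u : E2 → ℝ}

theorem N_pos (h : BallSol c R m N f u) : 0 < N := by
  have hc : c ∈ closedBall c (2 * R) := mem_closedBall_self (by linarith [h.pos])
  exact (h.f_pos c hc).trans_le (h.f_le c hc)

theorem m_nonneg (h : BallSol c R m N f u) : 0 ≤ m :=
  (abs_nonneg _).trans (h.u_le c (mem_closedBall_self (by linarith [h.pos])))

theorem size_pos (h : BallSol c R m N f u) : 0 < size R m N :=
  add_pos_of_nonneg_of_pos (div_nonneg h.m_nonneg h.pos.le)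
    (Real.rpow_pos_of_pos (mul_pos h.pos h.N_pos) _)

theorem lipschitz (h : BallSol c R m N f u) {g v : E2 → ℝ} {ρ ρ' : ℝ} (hv : ViscSub (ball c ρ) g v)
    (hvc : ContinuousOn v (ball c ρ))
    (hvm : ∀ x ∈ ball c ρ, |v x| ≤ m + R * (R * N) ^ ((1 : ℝ) / 3))
    (hg : ∀ x ∈ ball c ρ, g x ≤ 2 * N) (hρ : ρ' + R / 16 < ρ) :
    LipschitzOnWith (66 * size R m N).toNNReal v (closedBall c ρ') := by
  have hR := h.pos
  have hN := h.N_pos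
  set q := (R * N) ^ ((1 : ℝ) / 3) with hq
  have hA : 4 * (m + R * q) / (R / 16) + 2 * (2 * (R / 16) * (2 * N)) ^ ((1 : ℝ) / 3)
      ≤ 66 * size R m N := by
    have h1 : (2 * (R / 16) * (2 * N)) ^ ((1 : ℝ) / 3) ≤ q :=
      Real.rpow_le_rpow (by positivity) (by nlinarith) (by norm_num)
    have h2 : 4 * (m + R * q) / (R / 16) = 64 * (m / R) + 64 * q := by field_simp; ring
    have h3 := div_nonneg h.m_nonneg hR.le
    rw [h2, size, ← hq]
    linarith
  have key : ∀ x ∈ closedBall c ρ', ∀ y ∈ closedBall c ρ',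
      v x - v y ≤ 66 * size R m N * ‖x - y‖ := by
    intro x hx y hy
    refine (hv.sub_le_mul hvc (F := 2 * N) (by linarith) (ρ0 := R / 16) (by positivity) hvm hg
      (closedBall_subset_ball' ?_) (closedBall_subset_ball (by linarith) hx)).trans
      (mul_le_mul_of_nonneg_right hA (norm_nonneg _))
    linarith [mem_closedBall.1 hy]
  refine LipschitzOnWith.of_dist_le_mul fun x hx y hy => ?_
  rw [Real.coe_toNNReal _ (by linarith [h.size_pos]), Real.dist_eq, dist_eq_norm, abs_le]
  have h2 := key y hy x hx
  rw [norm_sub_rev] at h2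
  exact ⟨by linarith, key x hx y hy⟩

theorem lipschitzOn (h : BallSol c R m N f u) :
    LipschitzOnWith (66 * size R m N).toNNReal u (closedBall c (15 * R / 8)) := by
  have hR := h.pos
  have hq : 0 ≤ R * (R * N) ^ ((1 : ℝ) / 3) :=
    mul_nonneg hR.le (Real.rpow_nonneg (mul_nonneg hR.le h.N_pos.le) _)
  exact h.lipschitz h.sub (h.u_cont.mono ball_subset_closedBall)
    (fun x hx => (h.u_le x (ball_subset_closedBall hx)).trans (by linarith))
    (fun x hx => (h.f_le x (ball_subset_closedBall hx)).trans (by linarith [h.N_pos]))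
    (by linarith)

/-- The truncated right-hand side. -/
def trunc (c : E2) (R : ℝ) (f : E2 → ℝ) : E2 → ℝ := (closedBall c (31 * R / 16)).indicator f

theorem abs_trunc_le (h : BallSol c R m N f u) (x : E2) : |trunc c R f x| ≤ N := by
  by_cases hx : x ∈ closedBall c (31 * R / 16)
  · have hx' := closedBall_subset_closedBall (by linarith [h.pos] : 31 * R / 16 ≤ 2 * R) hx
    rw [trunc, indicator_of_mem hx, abs_of_pos (h.f_pos x hx')]
    exact h.f_le x hx'
  · rw [trunc, indicator_of_notMem hx, abs_zero]
    exact h.N_pos.le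

theorem integrable_trunc (h : BallSol c R m N f u) : Integrable (trunc c R f) :=
  (integrable_indicator_iff measurableSet_closedBall).2
    ((h.f_cont.mono (closedBall_subset_closedBall (by linarith [h.pos]))).integrableOn_compact
      (isCompact_closedBall _ _))

theorem isLip_moll (h : BallSol c R m N f u) (n : ℕ) : IsLip (moll n (trunc c R f)) := by
  have h1 :=
    HasCompactSupport.intro (isCompact_closedBall c (31 * R / 16)) fun x hx =>
      indicator_of_notMem hx f
  exact ContDiff.isLip (by exact_mod_cast moll_contDiff n h.integrable_trunc.locallyIntegrable)
    (moll_hasCompactSupport n h1)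

theorem exists_moll_close (h : BallSol c R m N f u) {η : ℝ} (hη : 0 < η) :
    ∃ n, (stdBump n).rOut < R / 16 ∧
      ∀ x ∈ ball c (15 * R / 8), |moll n (trunc c R f) x - f x| ≤ η := by
  have hR := h.pos
  obtain ⟨δ, hδ, hd⟩ := Metric.uniformContinuousOn_iff.1
      ((isCompact_closedBall c (2 * R)).uniformContinuousOn_of_continuous h.f_cont) η hη
  obtain ⟨n, hn⟩ := (stdBump_rOut_tendsto.eventually
    (gt_mem_nhds (show 0 < min δ (R / 16) by positivity))).exists
  refine ⟨n, hn.trans_le (min_le_right _ _), fun x hx => ?_⟩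
  refine moll_sub_abs_le h.integrable_trunc.locallyIntegrable fun y hy => ?_
  have hx' := mem_ball.1 hx
  have h1 : dist y c ≤ 31 * R / 16 := by
    have := dist_triangle y x c
    rw [dist_comm y x, dist_eq_norm x y] at this
    linarith [hn.trans_le (min_le_right _ _)]
  rw [trunc, indicator_of_mem (mem_closedBall.2 h1)]
  refine (hd y (mem_closedBall.2 (by linarith)) x (mem_closedBall.2 (by linarith)) ?_).le
  rw [dist_comm, dist_eq_norm]
  exact hy.trans_lt (hn.trans_le (min_le_left _ _))

theorem exists_approx (h : BallSol c R m N f u) {t : E2 → ℝ} {L : ℝ≥0} (ht : LipschitzWith L t)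
    (htu : ∀ x ∈ closedBall c (15 * R / 8), t x = u x) {lam η : ℝ} (hlam : 1 ≤ lam)
    (hη : 0 < η) :
    ∃ (n : ℕ) (V : E2 → ℝ), (stdBump n).rOut < R / 16 ∧
      LipschitzOnWith (66 * size R m N).toNNReal V (closedBall c (13 * R / 8)) ∧
      (∀ x, |V x - t x| ≤ η) ∧
      ViscSub (ball c (13 * R / 8)) (fun x => moll n (trunc c R f) x - lam * (V x - t x)) V ∧
      ViscSup (ball c (13 * R / 8)) (fun x => moll n (trunc c R f) x - lam * (V x - t x)) V ∧
      ∀ x ∈ ball c (13 * R / 8), 0 < moll n (trunc c R f) x - lam * (V x - t x) := by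
  have hR := h.pos
  have hN := h.N_pos
  obtain ⟨x0, hx0, hmin⟩ := (isCompact_closedBall c (2 * R)).exists_isMinOn
    ⟨c, mem_closedBall_self (by linarith)⟩ h.f_cont
  have hf0 := h.f_pos x0 hx0
  obtain ⟨a, ha, a1, a2, a3, a4, a5⟩ : ∃ a > 0, a ≤ η ∧ a < R / 8 ∧ 2 * a < f x0 ∧ 2 * a ≤ N ∧
      a ≤ R * (R * N) ^ ((1 : ℝ) / 3) := by
    obtain ⟨a, ha, hle⟩ : ∃ a > 0, a ≤ min η (min (R / 9) (min (f x0 / 3) (min (N / 2)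
      (R * (R * N) ^ ((1 : ℝ) / 3))))) := ⟨_, by positivity, le_rfl⟩
    simp only [le_min_iff] at hle
    obtain ⟨a1, a2, a3, a4, a5⟩ := hle
    exact ⟨a, ha, a1, by linarith, by linarith, by linarith, a5⟩
  obtain ⟨n, hn, hnf⟩ := h.exists_moll_close ha
  have hlam0 : 0 < lam := by linarith
  have hal := div_le_self ha.le hlam
  have s1 : ball c (15 * R / 8) ⊆ closedBall c (2 * R) :=
    ball_subset_closedBall.trans (closedBall_subset_closedBall (by linarith))
  have s2 : ball c (15 * R / 8) ⊆ ball c (2 * R) := ball_subset_ball (by linarith)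
  obtain ⟨LF, hLF⟩ := h.isLip_moll n
  set F := moll n (trunc c R f)
  have hua := fun x hx => (htu x (ball_subset_closedBall hx)).symm
  obtain ⟨V, hVL, hVt, hsub, hsup, -⟩ := obstacle_limit (r := 15 * R / 8)
    (L := L + 1 + (LF / lam).toNNReal) ht hLF hlam0
    (by push_cast; rw [Real.coe_toNNReal _ (by positivity)]) (h.f_cont.mono s1)
    (fun x hx => h.f_pos x (s1 hx))
    ((h.sub.mono s2 fun _ _ => le_rfl).congr isOpen_ball hua)
    ((h.sup.mono s2 fun _ _ => le_rfl).congr isOpen_ball hua)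
    (m0 := a / lam) (by positivity)
      (fun x hx => by rw [mul_div_cancel₀ _ hlam0.ne']; exact hnf x hx)
  have hVb x : |lam * (V x - t x)| ≤ a := by
    rw [abs_mul, abs_of_pos hlam0]
    calc lam * |V x - t x| ≤ lam * (a / lam) := mul_le_mul_of_nonneg_left (hVt x) hlam0.le
      _ = a := by field_simp
  have hcone : ∀ x ∈ ball c (7 * R / 4), |V x - t x| < cone c (15 * R / 8) x := fun x hx => by
    refine (hVt x).trans_lt (lt_max_of_lt_right ?_)
    rw [mem_ball, dist_eq_norm] at hx
    linarith
  have hG : ∀ x ∈ ball c (15 * R / 8), f x - 2 * a ≤ F x - lam * (V x - t x) ∧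
      F x - lam * (V x - t x) ≤ f x + 2 * a := fun x hx => by
    have k1 := abs_le.1 (hVb x)
    have k2 := abs_le.1 (hnf x hx)
    exact ⟨by linarith, by linarith⟩
  have b1 : ball c (7 * R / 4) ⊆ ball c (15 * R / 8) := ball_subset_ball (by linarith)
  have b2 : ball c (13 * R / 8) ⊆ ball c (7 * R / 4) := ball_subset_ball (by linarith)
  have hsub' :=
    hsub.mono (fun x hx => by
      show t x - _ < V x
      linarith [(abs_lt.1 (hcone x hx)).1]) fun _ _ => le_rfl
  have hsup' :=
    hsup.mono (fun x hx => by
      show V x < t x + _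
      linarith [(abs_lt.1 (hcone x hx)).2]) fun _ _ => le_rfl
  refine ⟨n, V, hn, ?_, fun x => (hVt x).trans (hal.trans a1),
    hsub'.mono b2 fun _ _ => le_rfl, hsup'.mono b2 fun _ _ => le_rfl, fun x hx => ?_⟩
  · refine h.lipschitz hsub' hVL.continuous.continuousOn (fun x hx => ?_) (fun x hx => ?_)
      (by linarith)
    · have k1 := h.u_le x (s1 (b1 hx))
      rw [hua x (b1 hx)] at k1
      calc |V x| = |t x + (V x - t x)| := by congr 1; ring
        _ ≤ _ := (abs_add_le _ _).trans (add_le_add k1 ((hVt x).trans (hal.trans a5)))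
    · linarith [(hG x (b1 hx)).2, h.f_le x (s1 (b1 hx))]
  · have k1 : f x0 ≤ f x := hmin (s1 (b1 (b2 hx)))
    linarith [(hG x (b1 (b2 hx))).1]

end BallSol

theorem norm_gradient_le_of_lipschitzOnWith {v : E2 → ℝ} {A : ℝ≥0} {s : Set E2} {x : E2}
    (h : LipschitzOnWith A v s) (hx : s ∈ 𝓝 x) : ‖∇ v x‖ ≤ A := by
  rw [norm_gradient_eq]
  exact norm_fderiv_le_of_lipschitzOn ℝ hx h

theorem norm_kf_smul_le {α e A : ℝ} (hα : 3 / 2 < α) (he : 0 < e) {p : E2} (hp : ‖p‖ ≤ A) {z : ℝ}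
    (hz0 : 0 ≤ z) (hz1 : z ≤ 1) :
    ‖(kf α e (‖p‖ ^ 2) * z) • p‖ ≤ (α + 2) * (A ^ 2 + e) ^ (α - 3 / 2) := by
  have hP : 0 < ‖p‖ ^ 2 + e := by positivity
  have h1 : ‖p‖ ≤ (‖p‖ ^ 2 + e) ^ ((1 : ℝ) / 2) := by
    rw [← Real.sqrt_eq_rpow]
    exact Real.le_sqrt_of_sq_le (by linarith)
  rw [norm_smul, Real.norm_of_nonneg
    (mul_nonneg ((Real.rpow_nonneg hP.le _).trans (rpow_le_kf (by linarith) he (sq_nonneg _))) hz0)]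
  calc kf α e (‖p‖ ^ 2) * z * ‖p‖ ≤ ((α + 2) * (‖p‖ ^ 2 + e) ^ (α - 2)) * 1
        * (‖p‖ ^ 2 + e) ^ ((1 : ℝ) / 2) := by
        have := kf_le_rpow (α := α) (by linarith) he (sq_nonneg ‖p‖)
        gcongr
    _ = (α + 2) * (‖p‖ ^ 2 + e) ^ (α - 3 / 2) := by
        rw [mul_one, mul_assoc, ← Real.rpow_add hP]; ring_nf
    _ ≤ _ := by
        refine mul_le_mul_of_nonneg_left (Real.rpow_le_rpow hP.le ?_ (by linarith)) (by linarith)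
        linarith [pow_le_pow_left₀ (norm_nonneg p) hp 2]

namespace BallSol

variable {c : E2} {R m N : ℝ} {f u : E2 → ℝ}

theorem Src_le (h : BallSol c R m N f u) {α e B : ℝ} (hα : 3 / 2 < α) (he : 0 < e) {ζ v : E2 → ℝ}
    (hζ : Cut B ζ) (hζr : tsupport ζ ⊆ closedBall c (3 * R / 2)) {A : ℝ≥0}
    (hv : LipschitzOnWith A v (closedBall c (13 * R / 8))) {n : ℕ}
    (hn : (stdBump n).rOut < R / 16) :
    Src α e ζ (moll n (trunc c R f)) v
      ≤ (α + 2) * ((A : ℝ) ^ 2 + e) ^ (α - 3 / 2) * bvNorm f (ball c (2 * R)) := by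
  have hR := h.pos
  have h0 : ∀ x, x ∉ closedBall c (3 * R / 2) → ζ x = 0 := fun x hx =>
    image_eq_zero_of_notMem_tsupport fun h' => hx (hζr h')
  have hb : 0 < (α + 2) * (A ^ 2 + e) ^ (α - 3 / 2) := by
    positivity
  have hW : Measurable fun x => (kf α e (‖∇ v x‖ ^ 2) * ζ x) • ∇ v x :=
    (((continuous_kf he α).measurable.comp (measurable_gradient v)).mul
      hζ.smooth.continuous.measurable).smul (measurable_gradient v)
  refine le_of_eq_of_le (integral_congr_ae (.of_forall fun x => ?_))
    (bv_pairing_le (n := n) (r1 := 3 * R / 2) (ρ := 31 * R / 16) h.bv h.integrable_trunc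
      (by linarith)
      (by linarith) hb hW (fun x => ?_) fun x hx => ?_)
  · show _ = ⟪∇ (moll n (trunc c R f)) x, (kf α e (‖∇ v x‖ ^ 2) * ζ x) • ∇ v x⟫
    rw [inner_smul_right]
  · by_cases hx : x ∈ closedBall c (3 * R / 2)
    · refine norm_kf_smul_le hα he (norm_gradient_le_of_lipschitzOnWith hv ?_)
        (hζ.nonneg x) (hζ.le_one x)
      exact mem_of_superset (isOpen_ball.mem_nhds (closedBall_subset_ball (by linarith) hx))
        ball_subset_closedBall
    · rw [h0 x hx, mul_zero, zero_smul, norm_zero]; exact hb.le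
  · rw [h0 x hx, mul_zero, zero_smul]

theorem exists_energy_approx (h : BallSol c R m N f u) {α e B : ℝ} (hα : 3 / 2 < α) (he : 0 < e)
    (hB : 0 ≤ B) {ζ : E2 → ℝ} (hζ : Cut B ζ) (hζr : tsupport ζ ⊆ closedBall c (3 * R / 2))
    {t : E2 → ℝ} {L : ℝ≥0} (ht : LipschitzWith L t) (htc : HasCompactSupport t)
    (htu : ∀ x ∈ closedBall c (15 * R / 8), t x = u x) {lam η : ℝ} (hlam : 1 ≤ lam)
    (hη : 0 < η) (hη1 : η ≤ 1) :
    ∃ F v : E2 → ℝ, IsLip F ∧ LipschitzWith (L + ((66 * size R m N).toNNReal + L + 1)) v ∧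
      (∀ x, |v x - t x| ≤ η) ∧
      0 ≤ ∫ x, En α e B ζ (fun x => F x - lam * (v x - t x)) v x ∧
      (∀ i φ, IsTest univ φ → (∀ x, φ x ≠ 0 → ζ x = 1) →
        (∫ x, (‖∇ v x‖ ^ 2 + e) ^ (α / 2) * pd i φ x) ^ 2 ≤ 4 * (∫ x, φ x ^ 2) *
          (α ^ 2 / dl α * ∫ x, En α e B ζ (fun x => F x - lam * (v x - t x)) v x)) ∧
      Src α e ζ F v ≤ (α + 2) * ((66 * size R m N) ^ 2 + e) ^ (α - 3 / 2)
        * bvNorm f (ball c (2 * R)) := by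
  have hR := h.pos
  obtain ⟨n, V, hn, hVL, hVt, hsub, hsup, hpos⟩ := h.exists_approx ht htu hlam hη
  set F := moll n (trunc c R f)
  obtain ⟨w, hwL, hwc, hwb, hwV⟩ := exists_lip_ext (w := fun x => V x - t x)
    (ρ := 13 * R / 8) (by positivity) (hVL.sub ht.lipschitzOnWith) fun x _ => hVt x
  have hwL' := hwL.weaken (K' := (66 * size R m N).toNNReal + L + 1)
    (add_le_add le_rfl (by rw [Real.toNNReal_le_one]; exact hη1))
  have hvL := ht.add hwL'
  have hvV : ∀ x ∈ closedBall c (13 * R / 8), t x + w x = V x := fun x hx => by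
    rw [hwV x hx]; ring
  have hvV' := fun x hx =>
    (hvV x (ball_subset_closedBall hx)).symm
  have hvt x : t x + w x - t x = w x := by ring
  have hG : ∀ x ∈ ball c (13 * R / 8), F x - lam * (V x - t x) = F x - lam * (t x + w x - t x) :=
    fun x hx => by rw [hvV' x hx]
  have hFL := h.isLip_moll n
  have hvA : LipschitzOnWith (66 * size R m N).toNNReal (fun x => t x + w x)
      (closedBall c (13 * R / 8)) := fun x hx y hy => by
    beta_reduce
    rw [hvV x hx, hvV y hy]; exact hVL hx hy
  have hS := h.Src_le hα he hζ hζr hvA hn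
  rw [Real.coe_toNNReal _ (by linarith [h.size_pos])] at hS
  have hE := energy_visc hα he hB (r := 13 * R / 8) (r' := 3 * R / 2) (by positivity)
    (by linarith) (t := fun x => t x + w x) (F := fun x => F x - lam * (t x + w x - t x))
    ⟨_, hvL⟩ (htc.add hwc)
    (hFL.sub ((IsLip.sub ⟨_, hvL⟩ ⟨_, ht⟩).const_mul lam))
    (fun x => (abs_sub _ _).trans (add_le_add
      (moll_abs_le n h.integrable_trunc.locallyIntegrable h.abs_trunc_le x) (by
        rw [abs_mul, hvt, abs_of_pos (by linarith)]
        exact mul_le_mul_of_nonneg_left (hwb x) (by linarith))))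
    ((hsub.congr isOpen_ball hvV').mono Subset.rfl fun x hx => (hG x hx).le)
    ((hsup.congr isOpen_ball hvV').mono Subset.rfl fun x hx => (hG x hx).ge)
    (fun x hx => by rw [← hG x hx]; exact hpos x hx) hζ hζr
  exact ⟨F, _, hFL, hvL, fun x => by rw [hvt]; exact hwb x, hE.1, hE.2, hS⟩

/-- The regularised energy estimate on a ball. -/
theorem energy (h : BallSol c R m N f u) {α e B : ℝ} (hα : 3 / 2 < α) (he : 0 < e)
    (hB : 0 ≤ B) {ζ : E2 → ℝ} (hζ : Cut B ζ) (hζr : tsupport ζ ⊆ closedBall c (3 * R / 2))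
    {t : E2 → ℝ} {L : ℝ≥0} (ht : LipschitzWith L t) (htc : HasCompactSupport t)
    (htu : ∀ x ∈ closedBall c (15 * R / 8), t x = u x) (i : Fin 2) {φ : E2 → ℝ}
    (hφ : IsTest univ φ) (h1 : ∀ x, φ x ≠ 0 → ζ x = 1) :
    (∫ x, (‖∇ t x‖ ^ 2 + e) ^ (α / 2) * pd i φ x) ^ 2
      ≤ 4 * (∫ x, φ x ^ 2) * (α ^ 2 / dl α) * ((α + 2) * ((66 * size R m N) ^ 2 + e) ^ (α - 3 / 2)
        * bvNorm f (ball c (2 * R)) + Low α e B ζ t) := by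
  set L' := L + ((66 * size R m N).toNNReal + L + 1)
  have htL : LipschitzWith L' t := ht.weaken le_self_add
  have step : ∀ n : ℕ, ∃ F v : E2 → ℝ, (IsLip F ∧ LipschitzWith L' v ∧
      0 ≤ ∫ x, En α e B ζ (fun x => F x - ((n : ℝ) + 1) * (v x - t x)) v x ∧
      (∀ i φ, IsTest univ φ → (∀ x, φ x ≠ 0 → ζ x = 1) →
        (∫ x, (‖∇ v x‖ ^ 2 + e) ^ (α / 2) * pd i φ x) ^ 2 ≤ 4 * (∫ x, φ x ^ 2) *
          (α ^ 2 / dl α * ∫ x, En α e B ζ (fun x => F x - ((n : ℝ) + 1) * (v x - t x)) v x)) ∧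
      Src α e ζ F v ≤ (α + 2) * ((66 * size R m N) ^ 2 + e) ^ (α - 3 / 2)
        * bvNorm f (ball c (2 * R))) ∧
      |((n : ℝ) + 1) * ∫ x, ζ x * (kf α e (‖∇ t x‖ ^ 2) * ⟪∇ t x, ∇ v x - ∇ t x⟫)|
        ≤ 1 / ((n : ℝ) + 1) := by
    intro n
    choose F v p1 p2 p3 p4 p5 p6 using fun k : ℕ => h.exists_energy_approx hα he hB hζ hζr ht htc
      htu
      (lam := (n : ℝ) + 1) (η := 1 / ((k : ℝ) + 1)) (by linarith [n.cast_nonneg (α := ℝ)])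
      (by positivity) (div_le_one_of_le₀ (by linarith [k.cast_nonneg (α := ℝ)]) (by positivity))
    have hlim x : Tendsto (fun k => v k x) atTop (𝓝 (t x)) := by
      rw [tendsto_iff_norm_sub_tendsto_zero]
      exact squeeze_zero (fun _ => norm_nonneg _) (fun k => p3 k x)
        (tendsto_one_div_add_atTop_nhds_zero_nat (𝕜 := ℝ))
    have e1 := ((tendsto_integral_kf_inner (α := α) he hζ p2 htL hlim).const_mul ((n : ℝ) + 1)).abs
    rw [mul_zero, abs_zero] at e1
    obtain ⟨k, hk⟩ := (e1.eventually (gt_mem_nhds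
      (by positivity : (0 : ℝ) < 1 / ((n : ℝ) + 1)))).exists
    exact ⟨F k, v k, ⟨p1 k, p2 k, p4 k, p5 k, p6 k⟩, hk.le⟩
  choose F v hp hη using step
  have h0 := squeeze_zero_norm (a := fun n : ℕ => 1 / ((n : ℝ) + 1)) (fun n => by
    rw [Real.norm_eq_abs]; exact hη n) (tendsto_one_div_add_atTop_nhds_zero_nat (𝕜 := ℝ))
  obtain ⟨σ, hσ, hg, hall⟩ := penalised_limit (F := F) hα he hζ htL (fun n => (hp n).2.1)
    (fun n => (hp n).1) (fun n => by positivity)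
    (tendsto_atTop_add_const_right _ 1 tendsto_natCast_atTop_atTop) (fun n => (hp n).2.2.1)
    (fun n => (hp n).2.2.2.2) h0
  obtain ⟨k1, k2⟩ := hall _ fun η hη => .of_forall fun n => ((hp (σ n)).2.2.2.2).trans
    (le_add_of_nonneg_right hη.le)
  refine k2 _ (by
    have := dl_pos hα
    have := integral_nonneg (μ := volume) (f := fun x => φ x ^ 2) fun x => sq_nonneg _
    positivity) _ ((hφ.pd_continuous i).integrable_of_hasCompactSupport
    (hφ.pd_cpt i)) (fun x hx => ?_) fun n => by
      rw [mul_assoc]; exact (hp n).2.2.2.1 i φ hφ h1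
  have : x ∈ tsupport φ := by
    by_contra h
    exact hx (pd_eq_zero_off h i)
  have := closure_minimal (s := Function.support φ) (fun y hy => h1 y hy)
      (isClosed_singleton.preimage hζ.smooth.continuous) this
  rw [this]; exact one_ne_zero

end BallSol

theorem IsLip.tendsto_integral_param {v w : E2 → ℝ} (hv : IsLip v) {k : ℝ → E2 → ℝ}
    (hk : Continuous fun p : ℝ × E2 => k p.1 p.2) (hw : Integrable w) :
    Tendsto (fun n : ℕ => ∫ x, k (1 / ((n : ℝ) + 1)) (∇ v x) * w x) atTop
      (𝓝 (∫ x, k 0 (∇ v x) * w x)) := by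
  obtain ⟨M, _, hM⟩ := hv.exists_bound
  obtain ⟨C, hC⟩ := ((isCompact_Icc (a := 0)).prod
    (isCompact_closedBall 0 M)).exists_bound_of_continuousOn hk.continuousOn
  have h01 : ∀ n : ℕ, 1 / ((n : ℝ) + 1) ∈ Icc 0 1 := fun n =>
    ⟨by positivity, div_le_one_of_le₀ (by linarith) (by positivity)⟩
  refine tendsto_integral_of_dominated_convergence (fun x => C * ‖w x‖) (fun n => ?_)
    (hw.norm.const_mul _) (fun n => .of_forall fun x => ?_) (.of_forall fun x => ?_)
  · exact ((hk.comp (by fun_prop : Continuous fun p => (1 / ((n : ℝ) + 1), p))).measurable.comp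
      (measurable_gradient v)).aestronglyMeasurable.mul hw.1
  · rw [norm_mul]
    exact mul_le_mul_of_nonneg_right (hC (_, _) ⟨h01 n, mem_closedBall_zero_iff.2 (hM x)⟩)
      (norm_nonneg _)
  · exact (((hk.comp (by fun_prop : Continuous fun s => (s, ∇ v x))).tendsto 0).comp
      (tendsto_one_div_add_atTop_nhds_zero_nat (𝕜 := ℝ))).mul_const _

theorem tendsto_Low {α B : ℝ} (hα : 3 / 2 < α) {ζ : E2 → ℝ} (hζ : Cut B ζ) {v : E2 → ℝ}
    (hv : IsLip v) : Tendsto (fun n : ℕ => Low α (1 / ((n : ℝ) + 1)) B ζ v) atTop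
      (𝓝 (Low α 0 B ζ v)) := by
  have hk : Continuous fun p : ℝ × E2 =>
      (α + 2) * 5 / dl α * B * ((‖p.2‖ ^ 2 + p.1) ^ (α - 1) * ‖p.2‖ ^ 2) :=
    continuous_const.mul (((by fun_prop : Continuous fun p : ℝ × E2 => ‖p.2‖ ^ 2 + p.1).rpow_const
      fun _ => .inr (by linarith)).mul (by fun_prop))
  exact hv.tendsto_integral_param (k := fun s p => (α + 2) * 5 / dl α * B *
    ((‖p‖ ^ 2 + s) ^ (α - 1) * ‖p‖ ^ 2)) hk hζ.integrable_support

theorem norm_sq_rpow (p : E2) (s : ℝ) : (‖p‖ ^ 2 + 0) ^ s = ‖p‖ ^ (2 * s) := by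
  rw [add_zero, Real.rpow_mul (norm_nonneg p)]; norm_num

theorem IsLip.integrableOn_rpow {v : E2 → ℝ} (hv : IsLip v) {s : ℝ} (hs : 0 ≤ s) {K : Set E2}
    (hK : IsCompact K) : IntegrableOn (fun x => ‖∇ v x‖ ^ s) K := by
  obtain ⟨M, _, hM⟩ := hv.exists_bound
  refine IntegrableOn.of_bound hK.measure_lt_top
    ((measurable_gradient v).norm.pow_const s).aestronglyMeasurable (M ^ s)
    (.of_forall fun x => ?_)
  rw [Real.norm_of_nonneg (Real.rpow_nonneg (norm_nonneg _) _)]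
  exact Real.rpow_le_rpow (norm_nonneg _) (hM x) hs

theorem Low_zero_le {α B : ℝ} (hα : 3 / 2 < α) (hB : 0 ≤ B) {ζ : E2 → ℝ} {c : E2} {ρ : ℝ}
    (hζr : tsupport ζ ⊆ closedBall c ρ) {v : E2 → ℝ} (hv : IsLip v) :
    Low α 0 B ζ v ≤ (α + 2) * 5 / dl α * B * ∫ x in closedBall c ρ, ‖∇ v x‖ ^ (2 * α) := by
  have hk0 : 0 ≤ (α + 2) * 5 / dl α * B :=
    mul_nonneg (div_nonneg (by linarith) (dl_pos hα).le) hB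
  have hm : MeasurableSet (closedBall c ρ) := measurableSet_closedBall
  rw [Low, ← integral_const_mul, ← integral_indicator hm]
  refine integral_mono_of_nonneg (.of_forall fun x => ?_)
    ((integrable_indicator_iff hm).2
      ((hv.integrableOn_rpow (s := 2 * α) (by linarith) (isCompact_closedBall c ρ)).const_mul _))
      (.of_forall fun x => ?_)
  · exact mul_nonneg (mul_nonneg hk0 (by positivity)) (indicator_nonneg (fun _ _ => zero_le_one) x)
  · beta_reduce
    rw [norm_sq_rpow, ← Real.rpow_natCast]
    by_cases hx : x ∈ Function.support ζ
    · rw [indicator_of_mem hx, indicator_of_mem (hζr (subset_tsupport _ hx)), mul_one,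
        ← Real.rpow_add_of_nonneg (norm_nonneg _) (by linarith) (by norm_num)]
      refine le_of_eq ?_
      congr 2; push_cast; ring
    · rw [indicator_of_notMem hx, mul_zero]
      exact indicator_nonneg (fun _ _ => mul_nonneg hk0 (by positivity)) x

theorem bvNorm_nonneg {f : E2 → ℝ} {U : Set E2} (h : BddAbove (bvPairings f U)) :
    0 ≤ bvNorm f U := by
  refine le_csSup h ⟨fun _ => 0, contDiff_const, HasCompactSupport.zero, ?_, by simp, ?_⟩
  · rw [show (fun _ => (0 : E2)) = 0 from rfl, tsupport_zero]; exact empty_subset _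
  · simp [divg, pd]

namespace BallSol

theorem estimate {α : ℝ} (hα : 3 / 2 < α) : ∃ C, 0 < C ∧ ∀ {c : E2} {R m N : ℝ} {f u : E2 → ℝ},
    BallSol c R m N f u → ∃ t, IsLip t ∧ (∀ x ∈ closedBall c (15 * R / 8), t x = u x) ∧
    ∀ i φ, IsTest (ball c R) φ → (∫ x, ‖∇ t x‖ ^ α * pd i φ x) ^ 2
      ≤ C * (1 / R ^ 2 * (∫ x in closedBall c (3 * R / 2), ‖∇ t x‖ ^ (2 * α))
        + bvNorm f (ball c (2 * R)) * size R m N ^ (2 * α - 3)) * ∫ x, φ x ^ 2 := by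
  obtain ⟨B, hB, hcut⟩ := exists_cut
  have hδ := dl_pos hα
  refine ⟨4 * (α ^ 2 / dl α) * ((α + 2) * 66 ^ (2 * α - 3) + (α + 2) * 5 / dl α * B),
    by positivity, fun {c R m N f u} h => ?_⟩
  have hR := h.pos
  obtain ⟨ζ, hζ, hζ1, hζr⟩ := hcut c R hR
  obtain ⟨t, htL, htc, -, htu⟩ := exists_lip_ext (by positivity) h.lipschitzOn
    fun x hx => h.u_le x (closedBall_subset_closedBall (by linarith) hx)
  refine ⟨t, ⟨_, htL⟩, htu, fun i φ hφ => ?_⟩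
  have hkl : Continuous fun p : ℝ × E2 => (‖p.2‖ ^ 2 + p.1) ^ (α / 2) :=
    (by fun_prop : Continuous fun p : ℝ × E2 => ‖p.2‖ ^ 2 + p.1).rpow_const
      fun _ => .inr (by linarith)
  have l1 := (IsLip.tendsto_integral_param ⟨_, htL⟩ (k := fun s p => (‖p‖ ^ 2 + s) ^ (α / 2))
    hkl ((hφ.pd_continuous i).integrable_of_hasCompactSupport (hφ.pd_cpt i) (μ := volume))).pow 2
  have l2 : Tendsto (fun n : ℕ => ((66 * size R m N) ^ 2 + 1 / (n + 1)) ^ (α - 3 / 2)) atTop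
      (𝓝 (((66 * size R m N) ^ 2 + 0) ^ (α - 3 / 2))) :=
    ((tendsto_one_div_add_atTop_nhds_zero_nat (𝕜 := ℝ)).const_add _).rpow_const
      (.inr (by linarith))
  have l4 := ((((l2.const_mul (α + 2)).mul_const (bvNorm f (ball c (2 * R)))).add
      (tendsto_Low hα hζ (v := t) ⟨_, htL⟩)).const_mul
    (4 * (∫ x, φ x ^ 2) * (α ^ 2 / dl α)))
  have l5 := le_of_tendsto_of_tendsto' l1 l4 fun n => h.energy hα
    (by positivity : 0 < 1 / ((n : ℝ) + 1)) (by positivity) hζ hζr htL htc htu i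
    (hφ.mono (subset_univ _)) fun x hx =>
      hζ1 x (ball_subset_closedBall (hφ.supp (subset_tsupport _ hx)))
  simp only [norm_sq_rpow] at l5
  have e0 : 2 * (α / 2) = α := by ring
  have e1 : ((66 * size R m N) ^ 2 + 0) ^ (α - 3 / 2)
      = 66 ^ (2 * α - 3) * size R m N ^ (2 * α - 3) := by
    rw [add_zero, ← Real.rpow_natCast, ← Real.rpow_mul (by linarith [h.size_pos]),
      Real.mul_rpow (by norm_num) h.size_pos.le]
    ring_nf
  rw [e0, e1] at l5
  have hlow := Low_zero_le hα (by positivity : 0 ≤ B / R ^ 2) hζr (v := t) ⟨_, htL⟩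
  set I := ∫ x in closedBall c (3 * R / 2), ‖∇ t x‖ ^ (2 * α)
  set S := size R m N ^ (2 * α - 3)
  have hS0 : 0 ≤ S := Real.rpow_nonneg h.size_pos.le _
  set b := bvNorm f (ball c (2 * R))
  refine l5.trans ?_
  have hx1 : (α + 2) * 5 / dl α * (B / R ^ 2) * I
      = ((α + 2) * 5 / dl α * B) * (1 / R ^ 2 * I) := by ring
  rw [hx1] at hlow
  have hx2 : 0 ≤ 1 / R ^ 2 * I := by positivity
  have hx3 : 0 ≤ (α + 2) * 5 / dl α * B := by positivity
  have hx4 : 0 ≤ (α + 2) * 66 ^ (2 * α - 3) := by positivity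
  have hx5 := mul_nonneg hx4 hx2
  have hx6 := mul_nonneg hx3 (mul_nonneg (bvNorm_nonneg h.bv) hS0)
  have hx7 : (α + 2) * (66 ^ (2 * α - 3) * S) * b + Low α 0 (B / R ^ 2) ζ t
      ≤ ((α + 2) * 66 ^ (2 * α - 3) + (α + 2) * 5 / dl α * B) * (1 / R ^ 2 * I + b * S) := by
    linarith
  calc _ ≤ 4 * (∫ x, φ x ^ 2) * (α ^ 2 / dl α) * (((α + 2) * 66 ^ (2 * α - 3)
          + (α + 2) * 5 / dl α * B) * (1 / R ^ 2 * I + b * S)) :=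
        mul_le_mul_of_nonneg_left hx7 (by positivity)
    _ = _ := by ring

theorem exists_weak {α : ℝ} (hα : 3 / 2 < α) : ∃ C, 0 < C ∧
    ∀ {c : E2} {R m N : ℝ} {f u : E2 → ℝ}, BallSol c R m N f u →
    ∃ t, IsLip t ∧ (∀ x ∈ closedBall c (15 * R / 8), t x = u x) ∧
    ∃ H : Fin 2 → E2 → ℝ, ∀ i, MemLp (H i) 2 volume ∧
      ∫ x, H i x ^ 2 ≤ C * (1 / R ^ 2 * (∫ x in closedBall c (3 * R / 2), ‖∇ t x‖ ^ (2 * α))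
        + bvNorm f (ball c (2 * R)) * size R m N ^ (2 * α - 3)) ∧
      ∀ φ, IsTest (ball c R) φ → ∫ x, ‖∇ t x‖ ^ α * pd i φ x = - ∫ x, H i x * φ x := by
  obtain ⟨C, hC, key⟩ := estimate hα
  refine ⟨C, hC, fun {c R m N f u} h => ?_⟩
  obtain ⟨t, ht, htu, hE⟩ := key h
  refine ⟨t, ht, htu, ?_⟩
  have hS0 : 0 ≤ size R m N ^ (2 * α - 3) := Real.rpow_nonneg h.size_pos.le _
  have hb0 := bvNorm_nonneg h.bv
  choose H h1 h2 h3 using fun i => exists_weak_pd (U := ball c R)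
    (locallyIntegrable_iff.2 fun K hK => ht.integrableOn_rpow (by linarith) hK) (by positivity)
    (hE i)
  exact ⟨H, fun i => ⟨h1 i, h2 i, h3 i⟩⟩

end BallSol

theorem integrable_mul_of_locallyIntegrableOn {Ω : Set E2} {w ψ : E2 → ℝ}
    (hw : LocallyIntegrableOn w Ω) (hψ : Continuous ψ) (hc : HasCompactSupport ψ)
    (hs : tsupport ψ ⊆ Ω) : Integrable fun x => w x * ψ x := by
  refine (integrableOn_iff_integrable_of_support_subset fun x hx => ?_).1
    ((hw.integrableOn_compact_subset hs hc).mul_continuousOn hψ.continuousOn hc)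
  exact subset_tsupport _ (right_ne_zero_of_mul hx)

theorem IsTest.mul {U V : Set E2} {φ χ : E2 → ℝ} (h : IsTest U φ) (hχ : ContDiff ℝ (⊤ : ℕ∞) χ)
    (hV : tsupport φ ∩ tsupport χ ⊆ V) : IsTest V fun x => φ x * χ x :=
  ⟨h.1.mul hχ, h.2.mul_right, (subset_inter (tsupport_mul_subset_left)
    (tsupport_mul_subset_right)).trans hV⟩

/-- A local weak derivative identity on small balls holds for all test functions. -/
theorem weak_pd_of_local {Ω : Set E2} {w G : E2 → ℝ} {i : Fin 2}
    (hw : LocallyIntegrableOn w Ω) (hG : LocallyIntegrableOn G Ω)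
    (hloc : ∀ c ∈ Ω, ∃ r > 0, ∀ φ, IsTest (ball c r) φ → ∫ x, w x * pd i φ x = -∫ x, G x * φ x)
    {φ : E2 → ℝ} (hφ : IsTest Ω φ) : ∫ x, w x * pd i φ x = -∫ x, G x * φ x := by
  choose! r hr hid using hloc
  have hw' : ∀ {ψ}, IsTest Ω ψ → Integrable fun x => w x * pd i ψ x := fun h =>
    integrable_mul_of_locallyIntegrableOn hw (h.pd_continuous i) (h.pd_cpt i)
      ((tsupport_pd_subset _ i).trans h.supp)
  have hG' : ∀ {ψ}, IsTest Ω ψ → Integrable fun x => G x * ψ x := fun h =>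
    integrable_mul_of_locallyIntegrableOn hG h.smooth.continuous h.cpt h.supp
  have key : ∀ s : Finset E2, (∀ k ∈ s, k ∈ Ω) → ∀ ψ, IsTest Ω ψ →
      (∀ x, ψ x ≠ 0 → ∃ k ∈ s, x ∈ closedBall k (r k / 2)) →
      ∫ x, w x * pd i ψ x = -∫ x, G x * ψ x := by
    classical
    intro s
    induction s using Finset.induction_on with
    | empty =>
      intro _ ψ _ h0
      have := funext fun x => by
        by_contra hx
        simpa using h0 x hx
      simp [this, pd]
    | insert k s hk ih =>
      intro hs ψ hψ hcov
      have hkΩ := hs k (Finset.mem_insert_self k s)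
      have hrk := hr k hkΩ
      let χ : ContDiffBump k := ⟨r k / 2, 3 * r k / 4, by linarith, by linarith⟩
      have hχ : ContDiff ℝ (⊤ : ℕ∞) χ := χ.contDiff
      have h1b := hψ.mul hχ fun x hx => by
        have := hx.2
        rw [χ.tsupport_eq] at this
        exact closedBall_subset_ball (by linarith : 3 * r k / 4 < r k) this
      have h1 := hψ.mul hχ fun x hx => hψ.supp hx.1
      have h2 : IsTest Ω fun x => ψ x * (1 - χ x) :=
        hψ.mul (contDiff_const.sub hχ) fun x hx => hψ.supp hx.1
      have e2 := ih (fun j hj => hs j (Finset.mem_insert_of_mem hj)) _ h2 fun x hx => by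
        obtain ⟨j, hj, hxj⟩ := hcov x (left_ne_zero_of_mul hx)
        rcases Finset.mem_insert.1 hj with rfl | hj
        · exact absurd (by rw [χ.one_of_mem_closedBall hxj, sub_self, mul_zero]) hx
        · exact ⟨j, hj, hxj⟩
      have ep x : w x * pd i ψ x = w x * pd i (fun x => ψ x * χ x) x
          + w x * pd i (fun x => ψ x * (1 - χ x)) x := by
        rw [← mul_add, pd, pd, pd, ← add_apply, ← fderiv_fun_add
          ((h1.smooth.differentiable (by simp)) x) ((h2.smooth.differentiable (by simp)) x)]
        congr 4
        ext y; ring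
      have eg x : G x * ψ x = G x * (ψ x * χ x) + G x * (ψ x * (1 - χ x)) := by ring
      simp_rw [ep, eg]
      rw [integral_add (hw' h1) (hw' h2), integral_add (hG' h1) (hG' h2), hid k hkΩ _ h1b, e2,
        neg_add]
  obtain ⟨s, hc⟩ := hφ.cpt.elim_nhds_subcover' (fun k _ => closedBall k (r k / 2))
    fun k hk => closedBall_mem_nhds k (half_pos (hr k (hφ.supp hk)))
  classical
  refine key (s.image (↑)) (fun k hk => ?_) φ hφ fun x hx => ?_
  · obtain ⟨a, _, rfl⟩ := Finset.mem_image.1 hk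
    exact hφ.supp a.2
  · obtain ⟨a, ha, hxa⟩ := mem_iUnion₂.1 (hc (subset_tsupport _ hx))
    exact ⟨a, Finset.mem_image_of_mem _ ha, hxa⟩

/-- Weak derivatives given on balls glue to a weak gradient. -/
theorem exists_weakGrad_of_local {Ω : Set E2} (hΩ : IsOpen Ω) {w : E2 → ℝ} {E : E2 → ℝ → ℝ}
    (hwi : LocallyIntegrableOn w Ω)
    (h : ∀ c R, 0 < R → closedBall c (2 * R) ⊆ Ω → ∃ H : Fin 2 → E2 → ℝ, ∀ i,
      MemLp (H i) 2 volume ∧ ∫ x, H i x ^ 2 ≤ E c R ∧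
      ∀ φ, IsTest (ball c R) φ → ∫ x, w x * pd i φ x = -∫ x, H i x * φ x) :
    ∃ G, HasWeakGradOn w G Ω ∧ MemLpLocOn G 2 Ω ∧ ∀ c R, 0 < R → closedBall c (2 * R) ⊆ Ω →
      ∫⁻ x in ball c R, ENNReal.ofReal (‖G x‖ ^ 2) ≤ ENNReal.ofReal (2 * E c R) := by
  choose! H hL hE hid using h
  have hrad : ∀ y ∈ Ω, ∃ r > 0, closedBall y (2 * r) ⊆ Ω := fun y hy => by
    obtain ⟨ε, h0, hε⟩ := nhds_basis_closedBall.mem_iff.1 (hΩ.mem_nhds hy)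
    exact ⟨ε / 2, half_pos h0, by rwa [mul_div_cancel₀ _ two_ne_zero]⟩
  choose! r hr hrΩ using hrad
  have hsub : ∀ {c : E2} {R : ℝ}, 0 < R → closedBall c (2 * R) ⊆ Ω → ball c R ⊆ Ω := fun h0 h =>
    (ball_subset_closedBall.trans (closedBall_subset_closedBall (by linarith))).trans h
  have huniq : ∀ c R, 0 < R → closedBall c (2 * R) ⊆ Ω → ∀ c' R', 0 < R' →
      closedBall c' (2 * R') ⊆ Ω → ∀ i, ∀ᵐ x, x ∈ ball c R ∩ ball c' R' →
        H c R i x - H c' R' i x = 0 := by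
    intro c R h0 hs c' R' h0' hs' i
    have l1 := (hL c R h0 hs i).locallyIntegrable one_le_two
    have l2 := (hL c' R' h0' hs' i).locallyIntegrable one_le_two
    refine (isOpen_ball.inter isOpen_ball).ae_eq_zero_of_integral_contDiff_smul_eq_zero
      ((l1.sub l2).locallyIntegrableOn _) fun φ h1 h2 h3 => ?_
    have ht : IsTest (ball c R ∩ ball c' R') φ := ⟨h1, h2, h3⟩
    have e1 := hid c R h0 hs i φ (ht.mono inter_subset_left)
    have e2 := hid c' R' h0' hs' i φ (ht.mono inter_subset_right)
    have i1 := integrable_mul_of_locallyIntegrableOn (l1.locallyIntegrableOn univ) h1.continuous h2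
      (subset_univ _)
    have i2 := integrable_mul_of_locallyIntegrableOn (l2.locallyIntegrableOn univ) h1.continuous h2
      (subset_univ _)
    rw [show (fun x => φ x • (H c R i x - H c' R' i x))
      = fun x => H c R i x * φ x - H c' R' i x * φ x from funext fun x => by
        rw [smul_eq_mul]; ring, integral_sub i1 i2]
    linarith
  obtain ⟨S, hSΩ, hSc, hScov⟩ := TopologicalSpace.countable_cover_nhdsWithin
    (f := fun y => ball y (r y)) fun y hy => mem_nhdsWithin_of_mem_nhds (ball_mem_nhds y (hr y hy))
  have hk : ∀ x ∈ Ω, ∃ k ∈ S, x ∈ ball k (r k) := fun x hx => by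
    simpa using hScov hx
  choose! k hkS hkx using hk
  let G : E2 → E2 := fun x => WithLp.toLp 2 fun i => H (k x) (r (k x)) i x
  have hGH : ∀ c R, 0 < R → closedBall c (2 * R) ⊆ Ω →
      ∀ᵐ x, x ∈ ball c R → ∀ i, G x i = H c R i x := by
    intro c R h0 hs
    have := (ae_ball_iff hSc).2 fun j hj => ae_all_iff.2 fun i =>
      huniq c R h0 hs j (r j) (hr j (hSΩ hj)) (hrΩ j (hSΩ hj)) i
    filter_upwards [this] with x hx hxb i
    have hxΩ := hsub h0 hs hxb
    have := hx (k x) (hkS x hxΩ) i ⟨hxb, hkx x hxΩ⟩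
    exact (sub_eq_zero.1 this).symm
  have hnsq x : ‖G x‖ ^ 2 = G x 0 ^ 2 + G x 1 ^ 2 := by
    simp [EuclideanSpace.norm_sq_eq, Fin.sum_univ_two]
  have hGL := fun c R h0 hs i =>
    ((hL c R h0 hs i).restrict _).ae_eq ((ae_restrict_iff' measurableSet_ball).2 (by
      filter_upwards [hGH c R h0 hs] with x hx hxb using (hx hxb i).symm))
  have hsqint : ∀ c R, 0 < R → closedBall c (2 * R) ⊆ Ω →
      IntegrableOn (fun x => ‖G x‖ ^ 2) (ball c R) := fun c R h0 hs => by
    simp_rw [hnsq]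
    exact (hGL c R h0 hs 0).integrable_sq.add (hGL c R h0 hs 1).integrable_sq
  have hlocal : ∀ {v : E2 → ℝ}, (∀ c R, 0 < R → closedBall c (2 * R) ⊆ Ω →
      IntegrableOn v (ball c R)) → LocallyIntegrableOn v Ω := fun hv y hy =>
    ⟨ball y (r y), mem_nhdsWithin_of_mem_nhds (ball_mem_nhds y (hr y hy)),
      hv y (r y) (hr y hy) (hrΩ y hy)⟩
  have hGi := fun i => hlocal fun c R h0 hs => by
    have : IsFiniteMeasure (volume.restrict (ball c R)) := ⟨by
      rw [Measure.restrict_apply_univ]; exact measure_ball_lt_top⟩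
    exact (hGL c R h0 hs i).integrable one_le_two
  refine ⟨G, ⟨hwi, hlocal fun c R h0 hs => ?_, fun φ h1 h2 h3 i => ?_⟩, fun K hK hKc => ?_,
    fun c R h0 hs => ?_⟩
  · have : IsFiniteMeasure (volume.restrict (ball c R)) := ⟨by
      rw [Measure.restrict_apply_univ]; exact measure_ball_lt_top⟩
    refine ((memLp_two_iff_integrable_sq ?_).2 (hsqint c R h0 hs)).integrable one_le_two
    have := (hsqint c R h0 hs).aestronglyMeasurable.aemeasurable.sqrt
    simp_rw [Real.sqrt_sq (norm_nonneg _)] at this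
    exact this.aestronglyMeasurable
  · rw [setIntegral_eq_integral_of_forall_compl_eq_zero fun x hx => by
        rw [pd_eq_zero_off (fun hc => hx (h3 hc)), mul_zero],
      setIntegral_eq_integral_of_forall_compl_eq_zero fun x hx => by
        rw [image_eq_zero_of_notMem_tsupport (fun hc => hx (h3 hc)), mul_zero]]
    refine weak_pd_of_local hwi (hGi i) (fun c hc => ⟨r c, hr c hc, fun ψ hψ => ?_⟩) ⟨h1, h2, h3⟩
    rw [hid c (r c) (hr c hc) (hrΩ c hc) i ψ hψ]
    congr 1
    refine integral_congr_ae ?_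
    filter_upwards [hGH c (r c) (hr c hc) (hrΩ c hc)] with x hx
    by_cases hxb : x ∈ ball c (r c)
    · rw [hx hxb i]
    · rw [image_eq_zero_of_notMem_tsupport (fun hc => hxb (hψ.supp hc)), mul_zero, mul_zero]
  · exact_mod_cast (hlocal hsqint).integrableOn_compact_subset hK hKc
  · rw [← ofReal_integral_eq_lintegral_ofReal (hsqint c R h0 hs)
      (.of_forall fun x => sq_nonneg _)]
    refine ENNReal.ofReal_le_ofReal ?_
    have e i : ∫ x in ball c R, G x i ^ 2 ≤ E c R := by
      refine le_trans (le_of_eq_of_le (setIntegral_congr_ae measurableSet_ball ?_)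
        (setIntegral_le_integral (hL c R h0 hs i).integrable_sq
          (.of_forall fun x => sq_nonneg _))) (hE c R h0 hs i)
      filter_upwards [hGH c R h0 hs] with x hx hxb
      rw [hx hxb i]
    simp_rw [hnsq]
    rw [integral_add (hGL c R h0 hs 0).integrable_sq (hGL c R h0 hs 1).integrable_sq]
    linarith [e 0, e 1]

theorem bddAbove_abs_image {h : E2 → ℝ} {s : Set E2} (hs : IsCompact s) (hh : ContinuousOn h s) :
    BddAbove ((fun y => |h y|) '' s) :=
  (hs.image_of_continuousOn hh.abs).bddAbove

theorem BallSol.of_domain {Ω : Set E2} {f u : E2 → ℝ} (hbv : BVloc f Ω) (hf : ContinuousOn f Ω)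
    (hf0 : ∀ x ∈ Ω, 0 < f x) (hu : ContinuousOn u Ω) (hsub : ViscSub Ω f u) (hsup : ViscSup Ω f u)
    {c : E2} {R : ℝ} (h0 : 0 < R) (hs : closedBall c (2 * R) ⊆ Ω) :
    BallSol c R (supAbsOn u (closedBall c (2 * R))) (supAbsOn f (closedBall c (2 * R))) f u where
  pos := h0
  f_cont := hf.mono hs
  f_pos x hx := hf0 x (hs hx)
  f_le x hx := (le_abs_self _).trans
    (le_csSup (bddAbove_abs_image (isCompact_closedBall _ _) (hf.mono hs)) (mem_image_of_mem _ hx))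
  u_cont := hu.mono hs
  u_le x hx :=
    le_csSup (bddAbove_abs_image (isCompact_closedBall _ _) (hu.mono hs)) (mem_image_of_mem _ hx)
  sub := hsub.mono (ball_subset_closedBall.trans hs) fun _ _ => le_rfl
  sup x hx := hsup x (hs (ball_subset_closedBall hx))
  bv := by
    have hc : closure (ball c (2 * R)) ⊆ closedBall c (2 * R) := closure_ball_subset_closedBall
    exact hbv _ isOpen_ball ((isCompact_closedBall _ _).of_isClosed_subset isClosed_closure hc)
      (hc.trans hs)

theorem exists_weakGrad_of_pos {α : ℝ} (hα : 3 / 2 < α) : ∃ C : ℝ, 0 < C ∧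
    ∀ Ω : Set E2, IsOpen Ω → ∀ f u : E2 → ℝ, BVloc f Ω → ContinuousOn f Ω → (∀ x ∈ Ω, 0 < f x) →
      ContinuousOn u Ω → ViscSub Ω f u → ViscSup Ω f u →
      ∀ g : E2 → E2, (∀ᵐ x ∂(volume : Measure E2), x ∈ Ω → HasGradientAt u (g x) x) →
      ∃ G : E2 → E2, HasWeakGradOn (fun x => ‖g x‖ ^ α) G Ω ∧ MemLpLocOn G 2 Ω ∧
        ∀ (x : E2) (R : ℝ), 0 < R → closedBall x (2 * R) ⊆ Ω →
          (∫⁻ y in ball x R, ENNReal.ofReal (‖G y‖ ^ 2)) ≤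
            ENNReal.ofReal (C / R ^ 2) *
                (∫⁻ y in ball x (2 * R), ENNReal.ofReal (‖g y‖ ^ (2 * α)))
              + ENNReal.ofReal (C * bvNorm f (ball x (2 * R)) *
                  ((1 / R) * supAbsOn u (closedBall x (2 * R))
                    + (R * supAbsOn f (closedBall x (2 * R))) ^ ((1 : ℝ) / 3))
                    ^ (2 * α - 3)) := by
  obtain ⟨C, hC, hweak⟩ := BallSol.exists_weak hα
  refine ⟨2 * C, by positivity, fun Ω hΩ f u hbv hf hf0 hu hsub hsup g hg => ?_⟩
  have hsol : ∀ {c R}, 0 < R → closedBall c (2 * R) ⊆ Ω → _ := fun h0 hs =>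
    BallSol.of_domain hbv hf hf0 hu hsub hsup h0 hs
  have hgrad : ∀ {c : E2} {R : ℝ}, 0 < R → closedBall c (2 * R) ⊆ Ω → ∀ {t : E2 → ℝ},
      (∀ x ∈ closedBall c (15 * R / 8), t x = u x) →
      ∀ᵐ x, x ∈ ball c (15 * R / 8) → ‖g x‖ = ‖∇ t x‖ := fun h0 hs t ht => by
    filter_upwards [hg] with x hx hxb
    have he : t =ᶠ[𝓝 x] u := by
      filter_upwards [isOpen_ball.mem_nhds hxb] with y hy using ht y (ball_subset_closedBall hy)
    rw [((hx ((fun h0 hs => (ball_subset_closedBall.trans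
      (closedBall_subset_closedBall (by linarith))).trans hs) h0 hs hxb)).congr_of_eventuallyEq
      he).gradient]
  have hgi : ∀ {c : E2} {R : ℝ}, 0 < R → closedBall c (2 * R) ⊆ Ω → ∀ {s : ℝ}, 0 ≤ s →
      IntegrableOn (fun x => ‖g x‖ ^ s) (closedBall c (3 * R / 2)) := fun {c R} h0 hs s hs0 => by
    obtain ⟨t, ht, htu, -⟩ := hweak (hsol h0 hs)
    refine (ht.integrableOn_rpow hs0 (isCompact_closedBall c (3 * R / 2))).congr_fun_ae ?_
    filter_upwards [ae_restrict_of_ae (hgrad h0 hs htu), ae_restrict_mem measurableSet_closedBall]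
      with x hx hxb
    rw [hx (closedBall_subset_ball (by linarith) hxb)]
  have hloc : LocallyIntegrableOn (fun x => ‖g x‖ ^ α) Ω := fun y hy => by
    obtain ⟨ε, h0, hε⟩ := nhds_basis_closedBall.mem_iff.1 (hΩ.mem_nhds hy)
    exact ⟨closedBall y (3 * (ε / 2) / 2),
      mem_nhdsWithin_of_mem_nhds (closedBall_mem_nhds y (by linarith)),
      hgi (half_pos h0) (by rwa [mul_div_cancel₀ _ two_ne_zero]) (by linarith)⟩
  obtain ⟨G, hG, hG2, hGE⟩ := exists_weakGrad_of_local hΩ hloc (E := fun c R =>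
    C * (1 / R ^ 2 * (∫ x in closedBall c (3 * R / 2), ‖g x‖ ^ (2 * α)) +
      bvNorm f (ball c (2 * R)) * size R (supAbsOn u (closedBall c (2 * R)))
        (supAbsOn f (closedBall c (2 * R))) ^ (2 * α - 3))) fun c R h0 hs => by
    obtain ⟨t, ht, htu, H, hH⟩ := hweak (hsol h0 hs)
    refine ⟨H, fun i => ⟨(hH i).1, ?_, fun φ hφ => ?_⟩⟩
    · have e : ∫ x in closedBall c (3 * R / 2), ‖g x‖ ^ (2 * α)
          = ∫ x in closedBall c (3 * R / 2), ‖∇ t x‖ ^ (2 * α) := by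
        refine setIntegral_congr_ae measurableSet_closedBall ?_
        filter_upwards [hgrad h0 hs htu] with x hx hxb
        rw [hx (closedBall_subset_ball (by linarith) hxb)]
      rw [e]
      exact (hH i).2.1
    · rw [← (hH i).2.2 φ hφ]
      refine integral_congr_ae ?_
      filter_upwards [hgrad h0 hs htu] with x hx
      by_cases hxb : x ∈ tsupport φ
      · rw [hx (ball_subset_ball (by linarith) (hφ.supp hxb))]
      · rw [pd_eq_zero_off hxb, mul_zero, mul_zero]
  refine ⟨G, hG, hG2, fun c R h0 hs => (hGE c R h0 hs).trans ?_⟩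
  have hS := hsol h0 hs
  have hb : 0 ≤ bvNorm f (ball c (2 * R)) * size R (supAbsOn u (closedBall c (2 * R)))
      (supAbsOn f (closedBall c (2 * R))) ^ (2 * α - 3) :=
    mul_nonneg (bvNorm_nonneg hS.bv) (Real.rpow_nonneg hS.size_pos.le _)
  have hIle : ENNReal.ofReal (∫ x in closedBall c (3 * R / 2), ‖g x‖ ^ (2 * α))
      ≤ ∫⁻ y in ball c (2 * R), ENNReal.ofReal (‖g y‖ ^ (2 * α)) := by
    rw [ofReal_integral_eq_lintegral_ofReal (hgi h0 hs (by linarith))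
      (.of_forall fun x => Real.rpow_nonneg (norm_nonneg _) _)]
    exact lintegral_mono_set (closedBall_subset_ball (by linarith))
  refine le_trans (le_of_eq ?_) (add_le_add_left (mul_le_mul_right hIle _) _)
  rw [← ENNReal.ofReal_mul (by positivity), ← ENNReal.ofReal_add (by positivity) ?_]
  · congr 1
    rw [size]
    ring_nf
  · rw [mul_assoc]
    refine mul_nonneg (by positivity) ?_
    rwa [size, div_eq_inv_mul, ← one_div] at hb

theorem bvPairings_neg (f : E2 → ℝ) (U : Set E2) : bvPairings
  (fun x => -f x) U = bvPairings f U := by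
  have key : ∀ f : E2 → ℝ, bvPairings f U ⊆ bvPairings (fun x => -f x) U := by
    rintro f _ ⟨Φ, h1, h2, h3, h4, rfl⟩
    refine ⟨fun x => -Φ x, h1.neg, h2.neg, ?_, fun x => by rw [norm_neg]; exact h4 x, ?_⟩
    · rwa [tsupport, show (fun x => -Φ x) = -Φ from rfl, Function.support_neg]
    · refine integral_congr_ae (.of_forall fun x => ?_)
      simp [divg, pd_neg]
      ring
  refine (Subset.antisymm (key f) ?_).symm
  simpa using key fun x => -f x

theorem supAbsOn_neg (h : E2 → ℝ) (s : Set E2) : supAbsOn (fun x => -h x) s = supAbsOn h s := by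
  simp [supAbsOn]

theorem pos_or_neg_of_isPreconnected {Ω : Set E2} (hΩ : IsPreconnected Ω) {f : E2 → ℝ}
    (hf : ContinuousOn f Ω) (h0 : ∀ x ∈ Ω, 0 < |f x|) :
    (∀ x ∈ Ω, 0 < f x) ∨ ∀ x ∈ Ω, 0 < -f x := by
  by_contra! h
  obtain ⟨⟨a, ha, hfa⟩, b, hb, hfb⟩ := h
  obtain ⟨x, hx, hfx⟩ := hΩ.intermediate_value ha hb hf ⟨hfa, by linarith⟩
  exact absurd (h0 x hx) (by simp [hfx])

end

/-- For a viscosity solution `u` of `-Δ_∞ u = f` on a bounded domain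
`Ω ⊆ ℝ²` with `f ∈ BV_loc(Ω) ∩ C⁰(Ω)`, `|f| > 0`, and any `α > 3/2`, the function
`|Du|^α` lies in `W^{1,2}_loc(Ω)` and its weak gradient satisfies the quantitative
local `L²` bound on balls. -/
theorem statement0 (α : ℝ) (hα : 3 / 2 < α) :
    ∃ C : ℝ, 0 < C ∧
      ∀ (Ω : Set E2), IsOpen Ω → Bornology.IsBounded Ω → IsConnected Ω →
      ∀ f u : E2 → ℝ,
        BVloc f Ω → ContinuousOn f Ω → (∀ x ∈ Ω, 0 < |f x|) →
        ContinuousOn u Ω → IsViscositySol Ω f u →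
      ∀ g : E2 → E2, (∀ᵐ x ∂(volume : Measure E2), x ∈ Ω → HasGradientAt u (g x) x) →
      ∃ G : E2 → E2,
        HasWeakGradOn (fun x => ‖g x‖ ^ α) G Ω ∧ MemLpLocOn G 2 Ω ∧
        ∀ (x : E2) (R : ℝ), 0 < R → closedBall x (2 * R) ⊆ Ω →
          (∫⁻ y in ball x R, ENNReal.ofReal (‖G y‖ ^ 2)) ≤
            ENNReal.ofReal (C / R ^ 2) *
                (∫⁻ y in ball x (2 * R), ENNReal.ofReal (‖g y‖ ^ (2 * α)))
              + ENNReal.ofReal (C * bvNorm f (ball x (2 * R)) *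
                  ((1 / R) * supAbsOn u (closedBall x (2 * R))
                    + (R * supAbsOn f (closedBall x (2 * R))) ^ ((1 : ℝ) / 3))
                    ^ (2 * α - 3)) := by
  obtain ⟨C, hC, h⟩ := exists_weakGrad_of_pos hα
  refine ⟨C, hC, fun Ω hΩ _ hconn f u hbv hf hf0 hu hsol g hg => ?_⟩
  rcases pos_or_neg_of_isPreconnected hconn.isPreconnected hf hf0 with hp | hn
  · exact h Ω hΩ f u hbv hf hp hu hsol.vsub hsol.vsup g hg
  · have hbv' : BVloc (fun x => -f x) Ω := fun U h1 h2 h3 => by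
      rw [bvPairings_neg]
      exact hbv U h1 h2 h3
    have := h Ω hΩ (fun x => -f x) (fun x => -u x) hbv' hf.neg hn hu.neg hsol.vsup.neg
      hsol.vsub.neg (fun x => -g x) (hg.mono fun x hx hxΩ => (hx hxΩ).neg')
    simpa only [norm_neg, bvNorm, bvPairings_neg, supAbsOn_neg] using this
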